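/- Let T be a triangle with second Neumann eigenvalue μ₂(T), let e be a side of T, and let ψ : ℝ² → ℝ be a function, not identically zero on T, that is continuous on T, smooth on T minus the vertices, satisfies −(∂ₓ² + ∂_y²)ψ = λ·ψ on the interior of T for some λ ∈ ℝ, and whose normal derivative vanishes at every non-vertex point of e (Neumann condition along e). If there is an injective continuous path γ : [0,1] → T with γ(0) ∈ e, γ(1) ∈ e, γ(0) ≠ γ(1), and ψ(γ(t)) = 0 for all t ∈ [0,1], then λ > μ₂(T). -/

import Mathlib

open Set

noncomputable section

abbrev E2 : Type := EuclideanSpace ℝ (Fin 2)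

/-- The closed triangle: convex hull of the three vertices. -/
def Tri (v₁ v₂ v₃ : E2) : Set E2 := convexHull ℝ {v₁, v₂, v₃}

/-- The vertex set of the triangle. -/
def Vtx (v₁ v₂ v₃ : E2) : Set E2 := {v₁, v₂, v₃}

/-- The triangle minus its vertices. -/
def TriDom (v₁ v₂ v₃ : E2) : Set E2 := Tri v₁ v₂ v₃ \ Vtx v₁ v₂ v₃

/-- Second (mixed) directional derivative of `u` at `p`: first in direction `v`, then `w`. -/
def mixedDeriv (u : E2 → ℝ) (p v w : E2) : ℝ :=
  fderiv ℝ (fun y => fderiv ℝ u y v) p w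

/-- The (geometers') Laplacian `−(∂ₓ² + ∂_y²) u` at `p`. -/
def negLap (u : E2 → ℝ) (p : E2) : ℝ :=
  -(mixedDeriv u p (EuclideanSpace.single 0 1) (EuclideanSpace.single 0 1)
    + mixedDeriv u p (EuclideanSpace.single 1 1) (EuclideanSpace.single 1 1))

/-- `u` satisfies Neumann conditions along the segment `[a,b]`: at every non-endpoint
point of the segment, the derivative of `u` (within `S`) annihilates every vector
orthogonal to the direction of the side; equivalently the normal derivative vanishes. -/
def NeumannOn (S : Set E2) (a b : E2) (u : E2 → ℝ) : Prop :=
  ∀ p ∈ segment ℝ a b, p ≠ a → p ≠ b →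
    ∀ w : E2, @inner ℝ _ _ w (b - a) = 0 → fderivWithin ℝ u S p w = 0

/-- `u` is a Neumann eigenfunction of the triangle with vertices `v₁ v₂ v₃`,
with eigenvalue `μ > 0`. -/
structure IsNeumannEigenfun (v₁ v₂ v₃ : E2) (μ : ℝ) (u : E2 → ℝ) : Prop where
  pos : 0 < μ
  nonconst : ¬ ∃ c : ℝ, ∀ z ∈ Tri v₁ v₂ v₃, u z = c
  cont : ContinuousOn u (Tri v₁ v₂ v₃)
  smooth : ContDiffOn ℝ (⊤ : ℕ∞) u (TriDom v₁ v₂ v₃)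
  eqn : ∀ p ∈ interior (Tri v₁ v₂ v₃), negLap u p = μ * u p
  neumann₁₂ : NeumannOn (TriDom v₁ v₂ v₃) v₁ v₂ u
  neumann₂₃ : NeumannOn (TriDom v₁ v₂ v₃) v₂ v₃ u
  neumann₃₁ : NeumannOn (TriDom v₁ v₂ v₃) v₃ v₁ u

/-- `u` is a second Neumann eigenfunction: a Neumann eigenfunction whose eigenvalue is
the least `μ > 0` admitting a Neumann eigenfunction. -/
def IsSecondNeumannEigenfun (v₁ v₂ v₃ : E2) (u : E2 → ℝ) : Prop :=
  ∃ μ : ℝ, IsNeumannEigenfun v₁ v₂ v₃ μ u ∧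
    ∀ (μ' : ℝ) (u' : E2 → ℝ), IsNeumannEigenfun v₁ v₂ v₃ μ' u' → μ ≤ μ'

/-- `p` is a critical point of `u`: a non-vertex point of the triangle at which the
derivative (within the triangle minus vertices) vanishes. -/
def IsCritPt (v₁ v₂ v₃ : E2) (u : E2 → ℝ) (p : E2) : Prop :=
  p ∈ TriDom v₁ v₂ v₃ ∧ fderivWithin ℝ u (TriDom v₁ v₂ v₃) p = 0

/-- `(a, b)` is (an ordering of) a side of the triangle `v₁ v₂ v₃`. -/
def IsSide (v₁ v₂ v₃ a b : E2) : Prop :=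
  (a = v₁ ∧ b = v₂) ∨ (a = v₂ ∧ b = v₃) ∨ (a = v₃ ∧ b = v₁)

/-- Reflection of `z` across the line through `a` and `b`. -/
def lineReflect (a b z : E2) : E2 :=
  (2 : ℝ) • (a + ((@inner ℝ _ _ (z - a) (b - a)) / (@inner ℝ _ _ (b - a) (b - a))) • (b - a)) - z

/-- Determinant of the Hessian of `w` at `p` (in the standard coordinates). -/
def hessDet (w : E2 → ℝ) (p : E2) : ℝ :=
  mixedDeriv w p (EuclideanSpace.single 0 1) (EuclideanSpace.single 0 1) *
      mixedDeriv w p (EuclideanSpace.single 1 1) (EuclideanSpace.single 1 1) -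
    mixedDeriv w p (EuclideanSpace.single 0 1) (EuclideanSpace.single 1 1) *
      mixedDeriv w p (EuclideanSpace.single 1 1) (EuclideanSpace.single 0 1)

/-- The Hessian at `p` of the extension of `u` by reflection across the side `[a,b]`
satisfies the predicate `P`: there is a smooth local extension `w` of `u` near `p`,
invariant under the reflection across the line through `a, b`, with `P (hessDet w p)`. -/
def ReflHessAt (v₁ v₂ v₃ a b : E2) (u : E2 → ℝ) (p : E2) (P : ℝ → Prop) : Prop :=
  ∃ (U : Set E2) (w : E2 → ℝ), IsOpen U ∧ p ∈ U ∧ ContDiffOn ℝ (⊤ : ℕ∞) w U ∧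
    (∀ z ∈ U ∩ Tri v₁ v₂ v₃, w z = u z) ∧
    (∀ z ∈ U, lineReflect a b z ∈ U → w (lineReflect a b z) = w z) ∧
    P (hessDet w p)

/-- `p` is an isolated local extremum of `u` on the triangle: the connected component
of the level set `{z ∈ T : u z = u p}` containing `p` is `{p}`. -/
def IsIsolatedExtremum (v₁ v₂ v₃ : E2) (u : E2 → ℝ) (p : E2) : Prop :=
  connectedComponentIn {z ∈ Tri v₁ v₂ v₃ | u z = u p} p = {p}

noncomputable section

/-! ### Frames and coordinates -/

/-- An orthonormal frame, in coordinates. -/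
def OF (τ n : E2) : Prop :=
  τ 0 ^ 2 + τ 1 ^ 2 = 1 ∧ n 0 ^ 2 + n 1 ^ 2 = 1 ∧ τ 0 * n 0 + τ 1 * n 1 = 0

abbrev e0 : E2 := EuclideanSpace.single 0 1
abbrev e1 : E2 := EuclideanSpace.single 1 1

lemma OF_std : OF e0 e1 := by simp [OF]

lemma OF.rows {τ n : E2} (h : OF τ n) :
    τ 0 ^ 2 + n 0 ^ 2 = 1 ∧ τ 1 ^ 2 + n 1 ^ 2 = 1 ∧ τ 0 * τ 1 + n 0 * n 1 = 0 := by
  obtain ⟨h1, h2, h3⟩ := h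
  have key : τ 0 ^ 2 = n 1 ^ 2 := by
    have a1 : τ 0 ^ 2 * n 0 ^ 2 = τ 1 ^ 2 * n 1 ^ 2 := by
      have : τ 0 * n 0 = -(τ 1 * n 1) := by linarith
      calc τ 0 ^ 2 * n 0 ^ 2 = (τ 0 * n 0) ^ 2 := by ring
        _ = _ := by rw [this]; ring
    have a2 : n 0 ^ 2 = 1 - n 1 ^ 2 := by linarith
    have a3 : τ 1 ^ 2 = 1 - τ 0 ^ 2 := by linarith
    rw [a2, a3] at a1; linarith
  refine ⟨by linarith, by linarith, ?_⟩
  rcases eq_or_ne (τ 0) 0 with h0 | h0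
  · have n1 : n 1 = 0 := by
      have : n 1 ^ 2 = 0 := by rw [← key, h0]; ring
      exact pow_eq_zero_iff (two_ne_zero) |>.1 this
    rw [h0, n1]; ring
  · have : τ 0 * (τ 0 * τ 1 + n 0 * n 1) = 0 := by
      have e : τ 0 * n 0 = - (τ 1 * n 1) := by linarith
      calc τ 0 * (τ 0 * τ 1 + n 0 * n 1) = τ 0 ^ 2 * τ 1 + (τ 0 * n 0) * n 1 := by ring
        _ = 0 := by rw [e, key]; ring
    exact (mul_eq_zero.1 this).resolve_left h0

/-- The affine coordinates map of a frame. -/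
def fr (o τ n : E2) (q : ℝ × ℝ) : E2 := o + q.1 • τ + q.2 • n

/-- inner product in coordinates -/
def dt (u v : E2) : ℝ := u 0 * v 0 + u 1 * v 1

lemma inner_eq_dt (u v : E2) : @inner ℝ _ _ u v = dt u v := by
  simp [PiLp.inner_apply, Fin.sum_univ_two, dt]; ring

lemma fr_apply (o τ n : E2) (q : ℝ × ℝ) (i : Fin 2) :
    fr o τ n q i = o i + q.1 * τ i + q.2 * n i := by
  simp [fr]

lemma ext2 {p q : E2} (h0 : p 0 = q 0) (h1 : p 1 = q 1) : p = q := by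
  ext i; fin_cases i <;> assumption

/-- inverse of the coordinates map. -/
def frinv (o τ n : E2) (p : E2) : ℝ × ℝ := (dt (p - o) τ, dt (p - o) n)

lemma frinv_fr {o τ n : E2} (h : OF τ n) (q : ℝ × ℝ) : frinv o τ n (fr o τ n q) = q := by
  obtain ⟨h1, h2, h3⟩ := h
  ext
  · simp only [frinv, dt, fr_apply, PiLp.sub_apply]
    linear_combination q.1 * h1 + q.2 * h3
  · simp only [frinv, dt, fr_apply, PiLp.sub_apply]
    linear_combination q.2 * h2 + q.1 * h3

lemma fr_frinv {o τ n : E2} (h : OF τ n) (p : E2) : fr o τ n (frinv o τ n p) = p := by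
  obtain ⟨h1, h2, h3⟩ := h.rows
  apply ext2
  · simp only [frinv, dt, fr_apply, PiLp.sub_apply]
    linear_combination (p 0 - o 0) * h1 + (p 1 - o 1) * h3
  · simp only [frinv, dt, fr_apply, PiLp.sub_apply]
    linear_combination (p 1 - o 1) * h2 + (p 0 - o 0) * h3

lemma dt_continuous (v : E2) : Continuous (fun p : E2 => dt p v) := by
  unfold dt; fun_prop

lemma fr_contDiff (o τ n : E2) : ContDiff ℝ (⊤ : ℕ∞) (fr o τ n) := by
  unfold fr; fun_prop

lemma fr_continuous (o τ n : E2) : Continuous (fr o τ n) := (fr_contDiff o τ n).continuous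

lemma frinv_continuous (o τ n : E2) : Continuous (frinv o τ n) := by
  unfold frinv dt; fun_prop

/-- the coordinates map as a homeomorphism -/
def frH (o τ n : E2) (h : OF τ n) : ℝ × ℝ ≃ₜ E2 where
  toFun := fr o τ n
  invFun := frinv o τ n
  left_inv := frinv_fr h
  right_inv := fr_frinv h
  continuous_toFun := fr_continuous o τ n
  continuous_invFun := frinv_continuous o τ n

lemma fr_emb {o τ n : E2} (h : OF τ n) : MeasurableEmbedding (fr o τ n) :=
  (frH o τ n h).measurableEmbedding

lemma fr_hasFDerivAt (o τ n : E2) (q : ℝ × ℝ) :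
    HasFDerivAt (fr o τ n) ((ContinuousLinearMap.fst ℝ ℝ ℝ).smulRight τ +
      (ContinuousLinearMap.snd ℝ ℝ ℝ).smulRight n) q := by
  unfold fr
  have := (((hasFDerivAt_const (𝕜 := ℝ) o q).add
    ((hasFDerivAt_fst (𝕜 := ℝ) (p := q)).smul_const τ)).add
    ((hasFDerivAt_snd (𝕜 := ℝ) (p := q)).smul_const n))
  rw [zero_add] at this
  exact this

lemma fr_measurePreserving {o τ n : E2} (h : OF τ n) :
    MeasureTheory.MeasurePreserving (fr o τ n) MeasureTheory.volume MeasureTheory.volume := by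
  have hon : Orthonormal ℝ ![τ, n] := by
    rw [orthonormal_iff_ite]
    obtain ⟨h1, h2, h3⟩ := h
    intro i j
    fin_cases i <;> fin_cases j <;> simp only [inner_eq_dt, dt] <;> simp <;> linarith
  have hsp : ⊤ ≤ Submodule.span ℝ (Set.range ![τ, n]) := by
    intro p _
    have : p = (dt p τ) • τ + (dt p n) • n := by
      have := fr_frinv (o := 0) h p
      rw [← this]; simp [fr, frinv]
      have e1 : dt (dt p τ • τ + dt p n • n) τ = dt p τ := by
        obtain ⟨h1, h2, h3⟩ := h
        simp only [dt, PiLp.add_apply, PiLp.smul_apply, smul_eq_mul]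
        linear_combination (p 0 * τ 0 + p 1 * τ 1) * h1 + (p 0 * n 0 + p 1 * n 1) * h3
      have e2 : dt (dt p τ • τ + dt p n • n) n = dt p n := by
        obtain ⟨h1, h2, h3⟩ := h
        simp only [dt, PiLp.add_apply, PiLp.smul_apply, smul_eq_mul]
        linear_combination (p 0 * n 0 + p 1 * n 1) * h2 + (p 0 * τ 0 + p 1 * τ 1) * h3
      rw [e1, e2]
    rw [this]
    refine Submodule.add_mem _ (Submodule.smul_mem _ _ (Submodule.subset_span ⟨0, rfl⟩))
      (Submodule.smul_mem _ _ (Submodule.subset_span ⟨1, rfl⟩))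
  let b := OrthonormalBasis.mk hon hsp
  have m1 := b.measurePreserving_repr_symm
  have m2 := PiLp.volume_preserving_toLp (Fin 2)
  have m3 := (MeasureTheory.volume_preserving_finTwoArrow ℝ).symm
  have m4 := MeasureTheory.measurePreserving_add_left (MeasureTheory.volume : MeasureTheory.Measure E2) o
  have := m4.comp (m1.comp (m2.comp m3))
  convert this using 1
  funext q
  simp only [Function.comp_apply]
  rw [← b.sum_repr_symm]
  simp [fr, Fin.sum_univ_two, b, add_assoc]

lemma integral_fr {o τ n : E2} (h : OF τ n) (g : E2 → ℝ) :
    ∫ q, g (fr o τ n q) = ∫ p, g p :=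
  (fr_measurePreserving h).integral_comp (fr_emb h) g

lemma setIntegral_fr {o τ n : E2} (h : OF τ n) (g : E2 → ℝ) (s : Set E2) :
    ∫ q in fr o τ n ⁻¹' s, g (fr o τ n q) = ∫ p in s, g p :=
  (fr_measurePreserving h).setIntegral_preimage_emb (fr_emb h) g s

/-! ### Gradient product and Laplacian -/

/-- first directional derivative -/
abbrev pd (u : E2 → ℝ) (v p : E2) : ℝ := fderiv ℝ u p v

/-- gradient product -/
def gd (f g : E2 → ℝ) (p : E2) : ℝ :=
  fderiv ℝ f p e0 * fderiv ℝ g p e0 + fderiv ℝ f p e1 * fderiv ℝ g p e1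

def lap (u : E2 → ℝ) (p : E2) : ℝ := mixedDeriv u p e0 e0 + mixedDeriv u p e1 e1

lemma negLap_eq (u : E2 → ℝ) (p : E2) : negLap u p = - lap u p := rfl

lemma vec_decomp (v : E2) : v = v 0 • e0 + v 1 • e1 := by
  apply ext2 <;> simp

lemma lin_decomp (L : E2 →L[ℝ] ℝ) (v : E2) : L v = v 0 * L e0 + v 1 * L e1 := by
  conv_lhs => rw [vec_decomp v]
  simp

lemma gd_frame {τ n : E2} (h : OF τ n) (f g : E2 → ℝ) (p : E2) :
    gd f g p = fderiv ℝ f p τ * fderiv ℝ g p τ + fderiv ℝ f p n * fderiv ℝ g p n := by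
  rw [lin_decomp _ τ, lin_decomp _ n, lin_decomp (fderiv ℝ g p) τ, lin_decomp (fderiv ℝ g p) n, gd]
  obtain ⟨h1, h2, h3⟩ := h.rows
  set A := fderiv ℝ f p e0
  set B := fderiv ℝ f p e1
  set C := fderiv ℝ g p e0
  set D := fderiv ℝ g p e1
  linear_combination (-(A * C)) * h1 - (B * D) * h2 - (A * D + B * C) * h3

lemma mixed_lin1 {u : E2 → ℝ} {p : E2} (hu : ContDiffAt ℝ 2 u p) (v w : E2) :
    mixedDeriv u p v w = fderiv ℝ (fderiv ℝ u) p w v := by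
  have hd : DifferentiableAt ℝ (fderiv ℝ u) p :=
    (hu.fderiv_right (m := 1) (by norm_num)).differentiableAt (by norm_num)
  unfold mixedDeriv
  have := (hd.hasFDerivAt.clm_apply (hasFDerivAt_const v p)).fderiv
  rw [this]; simp

lemma lap_frame {τ n : E2} (h : OF τ n) {u : E2 → ℝ} {p : E2} (hu : ContDiffAt ℝ 2 u p) :
    lap u p = mixedDeriv u p τ τ + mixedDeriv u p n n := by
  unfold lap
  simp only [mixed_lin1 hu]
  set B := fderiv ℝ (fderiv ℝ u) p
  have hB : ∀ v w : E2, B v w = v 0 * (w 0 * B e0 e0 + w 1 * B e0 e1)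
      + v 1 * (w 0 * B e1 e0 + w 1 * B e1 e1) := by
    intro v w
    conv_lhs => rw [vec_decomp v]
    simp only [map_add, map_smul, add_apply, smul_apply,
      smul_eq_mul]
    rw [lin_decomp (B e0) w, lin_decomp (B e1) w]
  rw [hB τ τ, hB n n]
  obtain ⟨h1, h2, h3⟩ := h.rows
  linear_combination (-(B e0 e0)) * h1 - (B e1 e1) * h2 - (B e0 e1 + B e1 e0) * h3

/-! ### Triangles -/

def cr (u v : E2) : ℝ := u 0 * v 1 - u 1 * v 0

/-- barycentric coordinate relative to `c`, vanishing on the line `ab`. -/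
def bar (a b c p : E2) : ℝ := cr (b - a) (p - a) / cr (b - a) (c - a)

lemma cr_cyc (a b c : E2) : cr (c - b) (a - b) = cr (b - a) (c - a) := by
  simp [cr]; ring

lemma bar_sum {a b c : E2} (h : cr (b - a) (c - a) ≠ 0) (p : E2) :
    bar b c a p + bar c a b p + bar a b c p = 1 := by
  unfold bar
  rw [cr_cyc a b c, cr_cyc b c a, cr_cyc a b c, ← add_div, ← add_div, div_eq_one_iff_eq h]
  simp [cr]; ring

lemma bar_comb {a b c : E2} (h : cr (b - a) (c - a) ≠ 0) (p : E2) :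
    p = bar b c a p • a + bar c a b p • b + bar a b c p • c := by
  have e1 := cr_cyc a b c
  have e2 := cr_cyc b c a
  unfold bar
  rw [e1, e2, e1]
  apply ext2
  · simp only [PiLp.add_apply, PiLp.smul_apply, smul_eq_mul]
    field_simp
    simp [cr]; ring
  · simp only [PiLp.add_apply, PiLp.smul_apply, smul_eq_mul]
    field_simp
    simp [cr]; ring

lemma bar_affine (a b c p q : E2) (s t : ℝ) (hst : s + t = 1) :
    bar a b c (s • p + t • q) = s * bar a b c p + t * bar a b c q := by
  unfold bar
  rw [mul_div_assoc', mul_div_assoc', ← add_div]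
  congr 1
  simp [cr]
  linear_combination (-(a 0 * (b 1 - a 1) - a 1 * (b 0 - a 0))) * hst

lemma bar_continuous (a b c : E2) : Continuous (bar a b c) := by
  unfold bar cr; fun_prop

lemma bar_contDiff (a b c : E2) : ContDiff ℝ (⊤ : ℕ∞) (bar a b c) := by
  unfold bar cr
  fun_prop

lemma bar_self {a b c : E2} (h : cr (b - a) (c - a) ≠ 0) : bar a b c c = 1 := by
  unfold bar; exact div_self h

lemma bar_left (a b c : E2) : bar a b c a = 0 := by simp [bar, cr]

lemma bar_right (a b c : E2) : bar a b c b = 0 := by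
  simp [bar, cr]; left; ring

lemma Tri_perm (a b c : E2) : Tri b c a = Tri a b c := by
  unfold Tri; congr 1; ext x; simp; tauto

lemma Vtx_perm (a b c : E2) : Vtx b c a = Vtx a b c := by
  unfold Vtx; ext x; simp; tauto

lemma TriDom_perm (a b c : E2) : TriDom b c a = TriDom a b c := by
  unfold TriDom; rw [Tri_perm, Vtx_perm]

lemma cr_perm {a b c : E2} (h : cr (b - a) (c - a) ≠ 0) : cr (c - b) (a - b) ≠ 0 := by
  rw [cr_cyc]; exact h

lemma mem_Tri {a b c : E2} (h : cr (b - a) (c - a) ≠ 0) (p : E2) :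
    p ∈ Tri a b c ↔ 0 ≤ bar b c a p ∧ 0 ≤ bar c a b p ∧ 0 ≤ bar a b c p := by
  constructor
  · intro hp
    have hc : Convex ℝ {p : E2 | 0 ≤ bar b c a p ∧ 0 ≤ bar c a b p ∧ 0 ≤ bar a b c p} := by
      rintro x ⟨hx1, hx2, hx3⟩ y ⟨hy1, hy2, hy3⟩ s t hs ht hst
      refine ⟨?_, ?_, ?_⟩ <;> rw [bar_affine _ _ _ _ _ _ _ hst] <;> positivity
    refine convexHull_min ?_ hc hp
    have h2 := cr_perm h
    have h3 := cr_perm h2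
    rintro x (rfl | rfl | rfl) <;>
      simp [bar_left, bar_right, bar_self h, bar_self h2, bar_self h3]
  · rintro ⟨h1, h2, h3⟩
    rw [bar_comb h p]
    have hs := bar_sum h p
    have hcv := convex_convexHull ℝ ({a, b, c} : Set E2)
    have := hcv.sum_mem (t := Finset.univ) (w := ![bar b c a p, bar c a b p, bar a b c p])
      (z := ![a, b, c]) (by intro i _; fin_cases i <;> simpa)
      (by simpa [Fin.sum_univ_three] using hs)
      (by intro i _; fin_cases i <;> apply subset_convexHull <;> simp)
    unfold Tri
    simpa [Fin.sum_univ_three] using this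

lemma Tri_convex (a b c : E2) : Convex ℝ (Tri a b c) := convex_convexHull _ _

lemma Tri_compact (a b c : E2) : IsCompact (Tri a b c) :=
  Set.Finite.isCompact_convexHull ℝ (Set.toFinite _)

/-- moving along a direction changes `bar` linearly -/
lemma bar_add (a b c p v : E2) (s : ℝ) :
    bar a b c (p + s • v) = bar a b c p + s * (cr (b - a) v / cr (b - a) (c - a)) := by
  unfold bar
  rw [mul_div_assoc', ← add_div]; congr 1
  simp [cr]; ring

lemma mem_interior_Tri {a b c : E2} (h : cr (b - a) (c - a) ≠ 0) (p : E2) :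
    p ∈ interior (Tri a b c) ↔ 0 < bar b c a p ∧ 0 < bar c a b p ∧ 0 < bar a b c p := by
  constructor
  · intro hp
    have aux : ∀ x y z : E2, cr (y - x) (z - x) ≠ 0 → Tri x y z = Tri a b c → 0 < bar x y z p := by
      intro x y z hxyz hT
      rw [← hT] at hp
      by_contra hneg
      have h0 : bar x y z p = 0 :=
        le_antisymm (not_lt.1 hneg) ((mem_Tri hxyz p).1 (interior_subset hp)).2.2
      have hev : ∀ᶠ s : ℝ in nhds 0, p + s • (x - z) ∈ Tri x y z := by
        have hcont : ContinuousAt (fun s : ℝ => p + s • (x - z)) 0 := by fun_prop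
        apply hcont.eventually
        simpa using mem_interior_iff_mem_nhds.1 hp
      obtain ⟨ε, hε, hball⟩ := Metric.eventually_nhds_iff.1 hev
      have := hball (y := ε / 2) (by simp [abs_of_pos hε]; linarith)
      have h3 := ((mem_Tri hxyz _).1 this).2.2
      rw [bar_add, h0] at h3
      have : cr (y - x) (x - z) / cr (y - x) (z - x) = -1 := by
        rw [div_eq_iff hxyz]; simp [cr]; ring
      rw [this] at h3; linarith
    have h2 := cr_perm h
    have h3 := cr_perm h2
    exact ⟨aux b c a h2 (Tri_perm a b c), aux c a b h3 ((Tri_perm b c a).trans (Tri_perm a b c)),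
      aux a b c h rfl⟩
  · rintro ⟨h1, h2, h3⟩
    rw [mem_interior]
    refine ⟨{p | 0 < bar b c a p ∧ 0 < bar c a b p ∧ 0 < bar a b c p}, ?_, ?_, ⟨h1, h2, h3⟩⟩
    · rintro x ⟨hx1, hx2, hx3⟩
      exact (mem_Tri h x).2 ⟨hx1.le, hx2.le, hx3.le⟩
    · exact (isOpen_lt continuous_const (bar_continuous _ _ _)).inter
        ((isOpen_lt continuous_const (bar_continuous _ _ _)).inter
        (isOpen_lt continuous_const (bar_continuous _ _ _)))

lemma cr_ne_of_affineIndependent {a b c : E2} (h : AffineIndependent ℝ ![a, b, c]) :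
    cr (b - a) (c - a) ≠ 0 := by
  intro h0
  rw [affineIndependent_iff_linearIndependent_vsub ℝ _ (0 : Fin 3)] at h
  have h2 : LinearIndependent ℝ ![b - a, c - a] := by
    have := h.comp (fun i : Fin 2 => (⟨i.succ, Fin.succ_ne_zero i⟩ : {x : Fin 3 // x ≠ 0}))
      (fun i j hij => by simpa using hij)
    have e : ((fun i : {x : Fin 3 // x ≠ 0} => ![a, b, c] ↑i -ᵥ ![a, b, c] 0) ∘
      fun i : Fin 2 => (⟨i.succ, Fin.succ_ne_zero i⟩ : {x : Fin 3 // x ≠ 0})) = ![b - a, c - a] := by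
      funext i; fin_cases i <;> simp
    rw [← e]; exact this
  rw [LinearIndependent.pair_iff] at h2
  unfold cr at h0
  have hA := h2 ((c - a) 0) (-(b - a) 0) (by
    apply ext2 <;> simp at h0 ⊢ <;> linarith)
  have hB := h2 ((c - a) 1) (-(b - a) 1) (by
    apply ext2 <;> simp at h0 ⊢ <;> linarith)
  have hz : b - a = 0 := by
    apply ext2
    · have := hA.2
      simp at this ⊢; linarith
    · have := hB.2
      simp at this ⊢; linarith
  have := h2 1 0 (by rw [hz]; simp)
  simp at this

lemma side_frame {a b c : E2} (h : cr (b - a) (c - a) ≠ 0) :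
    ∃ (τ n : E2) (L κ : ℝ), OF τ n ∧ 0 < L ∧ b = a + L • τ ∧ 0 < κ ∧
      ∀ q : ℝ × ℝ, bar a b c (fr a τ n q) = κ * q.2 := by
  set L := Real.sqrt ((b - a) 0 ^ 2 + (b - a) 1 ^ 2) with hL
  have hpos : 0 < (b - a) 0 ^ 2 + (b - a) 1 ^ 2 := by
    by_contra hneg
    have h0 : (b - a) 0 = 0 := by nlinarith [sq_nonneg ((b - a) 0), sq_nonneg ((b - a) 1)]
    have h1 : (b - a) 1 = 0 := by nlinarith [sq_nonneg ((b - a) 0), sq_nonneg ((b - a) 1)]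
    apply h; unfold cr; rw [h0, h1]; ring
  have hLpos : 0 < L := Real.sqrt_pos.2 hpos
  have hL2 : L ^ 2 = (b - a) 0 ^ 2 + (b - a) 1 ^ 2 := Real.sq_sqrt hpos.le
  set τ : E2 := L⁻¹ • (b - a) with hτ
  have hbτ : b - a = L • τ := by rw [hτ, smul_smul, mul_inv_cancel₀ hLpos.ne', one_smul]
  have t1 : τ 0 ^ 2 + τ 1 ^ 2 = 1 := by
    have : L ^ 2 * (τ 0 ^ 2 + τ 1 ^ 2) = L ^ 2 := by
      conv_rhs => rw [hL2, hbτ]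
      simp; ring
    have h2 : L ^ 2 ≠ 0 := by positivity
    exact mul_left_cancel₀ h2 (by linarith)
  obtain ⟨s, hs, hs2⟩ : ∃ s : ℝ, s ^ 2 = 1 ∧ 0 < s * L / cr (b - a) (c - a) := by
    rcases lt_or_gt_of_ne h with hneg | hp
    · refine ⟨-1, by norm_num, ?_⟩
      exact div_pos_of_neg_of_neg (by linarith) hneg
    · exact ⟨1, by norm_num, by positivity⟩
  let n : E2 := !₂[-s * τ 1, s * τ 0]
  have n0 : n 0 = -s * τ 1 := by simp [n]
  have n1 : n 1 = s * τ 0 := by simp [n]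
  refine ⟨τ, n, L, s * L / cr (b - a) (c - a), ⟨t1, ?_, ?_⟩, hLpos, ?_, hs2, ?_⟩
  · rw [n0, n1]; linear_combination s ^ 2 * t1 + hs
  · rw [n0, n1]; ring
  · rw [← hbτ]; abel
  · intro q
    unfold bar
    have : cr (b - a) (fr a τ n q - a) = s * L * q.2 := by
      rw [hbτ]; unfold cr
      simp only [PiLp.sub_apply, fr_apply, PiLp.smul_apply, smul_eq_mul, n0, n1]
      linear_combination (L * q.2 * s) * t1
    rw [this]; ring
end

noncomputable section

/-! ### A crossing lemma for planar paths -/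

lemma sin_trap {f : ℝ → ℝ} (hf : Continuous f) {c : ℝ} (h0 : f 0 ∈ Icc c (c + Real.pi))
    (hs : ∀ t, 0 ≤ Real.sin (f t - c)) {t : ℝ} : f t ∈ Icc c (c + Real.pi) := by
  have hpi := Real.pi_pos
  by_contra hn
  have hI : ∀ y ∈ uIcc (f 0) (f t), 0 ≤ Real.sin (y - c) := by
    intro y hy
    obtain ⟨s, _, rfl⟩ := intermediate_value_uIcc (a := 0) (b := t) hf.continuousOn hy
    exact hs s
  rw [mem_Icc, not_and_or, not_le, not_le] at hn
  rcases hn with hn | hn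
  · set y := max (f t) (c - Real.pi / 2)
    have hy : y < c := max_lt hn (by linarith)
    have h1 := hI y (by
      rw [mem_uIcc]; right
      exact ⟨le_max_left _ _, by linarith [h0.1]⟩)
    have h2 : Real.sin (y - c) < 0 := Real.sin_neg_of_neg_of_neg_pi_lt (by linarith)
      (by have := le_max_right (f t) (c - Real.pi / 2); linarith)
    linarith
  · set y := min (f t) (c + Real.pi + Real.pi / 2)
    have hy : c + Real.pi < y := lt_min hn (by linarith)
    have h1 := hI y (by
      rw [mem_uIcc]; left
      exact ⟨by linarith [h0.2], min_le_left _ _⟩)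
    have h2 : Real.sin (y - c - Real.pi) > 0 := Real.sin_pos_of_pos_of_lt_pi (by linarith)
      (by have := min_le_right (f t) (c + Real.pi + Real.pi / 2); linarith)
    rw [Real.sin_sub_pi] at h2
    linarith

lemma cos_trap {f : ℝ → ℝ} (hf : Continuous f) {ω : ℝ}
    (hs : ∀ t, 0 ≤ Real.cos (f t - ω)) (s t : ℝ) : f s - f t ≤ Real.pi := by
  have hpi := Real.pi_pos
  by_contra hn
  push Not at hn
  -- choose k
  have hI : ∀ y ∈ uIcc (f s) (f t), 0 ≤ Real.cos (y - ω) := by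
    intro y hy
    obtain ⟨r, _, rfl⟩ := intermediate_value_uIcc (a := s) (b := t) hf.continuousOn hy
    exact hs r
  -- set the integer
  have key : ∀ y, f t ≤ y → y ≤ f s → 0 ≤ Real.cos (y - ω) := fun y h1 h2 =>
    hI y (by rw [mem_uIcc]; right; exact ⟨h1, h2⟩)
  have h1 := key (f t) le_rfl (by linarith)
  have h2 := key (f t + Real.pi) (by linarith) (by linarith)
  have h3 : Real.cos (f t + Real.pi - ω) = - Real.cos (f t - ω) := by
    rw [← Real.cos_add_pi]; congr 1; ring
  have h4 : Real.cos (f t - ω) = 0 := by linarith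
  -- small perturbation
  set δ := min (Real.pi / 2) (f s - f t - Real.pi)
  have hδ : 0 < δ := lt_min (by linarith) (by linarith)
  have hδ1 : δ ≤ Real.pi / 2 := min_le_left _ _
  have hδ2 : δ ≤ f s - f t - Real.pi := min_le_right _ _
  have h5 := key (f t + δ) (by linarith) (by linarith)
  have h6 := key (f t + δ + Real.pi) (by linarith) (by linarith)
  have h7 : Real.cos (f t + δ + Real.pi - ω) = - Real.cos (f t + δ - ω) := by
    rw [← Real.cos_add_pi]; congr 1; ring
  have h8 : Real.cos (f t + δ - ω) = 0 := by linarith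
  have h9 : Real.cos (f t + δ - ω) = Real.cos (f t - ω) * Real.cos δ - Real.sin (f t - ω) * Real.sin δ := by
    rw [← Real.cos_add]; congr 1; ring
  rw [h4, h8] at h9
  have h10 : Real.sin (f t - ω) ≠ 0 := by
    intro h0; have := Real.sin_sq_add_cos_sq (f t - ω); rw [h0, h4] at this; norm_num at this
  have h11 : 0 < Real.sin δ := Real.sin_pos_of_pos_of_lt_pi hδ (by linarith)
  have : Real.sin (f t - ω) * Real.sin δ ≠ 0 := mul_ne_zero h10 h11.ne'
  apply this; linarith

lemma exists_log_lift {F : ℝ × ℝ → ℂ} (hF : Continuous F) (h0 : ∀ q, F q ≠ 0) (l0 : ℂ)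
    (hl : Complex.exp l0 = F 0) :
    ∃ L : ℝ × ℝ → ℂ, Continuous L ∧ L 0 = l0 ∧ ∀ q, Complex.exp (L q) = F q := by
  let f : C(ℝ × ℝ, {z : ℂ // z ≠ 0}) := ⟨fun q => ⟨F q, h0 q⟩, by fun_prop⟩
  obtain ⟨L, ⟨h1, h2⟩, -⟩ := Complex.isCoveringMap_exp.existsUnique_continuousMap_lifts f 0 l0
    (by apply Subtype.ext; exact hl)
  refine ⟨L, L.continuous, h1, fun q => ?_⟩
  exact congrArg Subtype.val (congrFun h2 q)

theorem crossing {g k : ℝ → ℂ} (hg : Continuous g) (hk : Continuous k)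
    (hgi : ∀ t, 0 ≤ (g t).im) (hki : ∀ t, 0 ≤ (k t).im)
    (g0 : (g 0).im = 0) (g1 : (g 1).im = 0) (k0 : (k 0).im = 0)
    (h01 : (g 0).re < (k 0).re) (h02 : (k 0).re < (g 1).re)
    (m1 m2 : ℝ) (hm : m1 ≠ 0 ∨ m2 ≠ 0)
    (hs : ∀ σ, 0 ≤ m1 * (g σ - k 1).re + m2 * (g σ - k 1).im)
    (hne : ∀ σ t, g σ ≠ k t) :
    (k 1).im = 0 ∧ (g 0).re < (k 1).re ∧ (k 1).re < (g 1).re := by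
  have hpi := Real.pi_pos
  obtain ⟨L, hLc, hL0, hL⟩ := exists_log_lift (F := fun q => g q.1 - k q.2) (by fun_prop)
    (fun q => sub_ne_zero.2 (hne _ _)) (Real.log ((k 0).re - (g 0).re) + Real.pi * Complex.I) (by
      rw [Complex.exp_add, Complex.exp_pi_mul_I, ← Complex.ofReal_exp, Real.exp_log (by linarith)]
      apply Complex.ext <;> simp [g0, k0])
  have hre : ∀ q, (g q.1 - k q.2).re = Real.exp (L q).re * Real.cos (L q).im := by
    intro q; rw [← hL q, Complex.exp_re]
  have him : ∀ q, (g q.1 - k q.2).im = Real.exp (L q).re * Real.sin (L q).im := by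
    intro q; rw [← hL q, Complex.exp_im]
  have hsgn : ∀ q, 0 ≤ (g q.1 - k q.2).im → 0 ≤ Real.sin (L q).im := by
    intro q hq; rw [him] at hq
    exact nonneg_of_mul_nonneg_right hq (Real.exp_pos _)
  have hsgn' : ∀ q, (g q.1 - k q.2).im ≤ 0 → Real.sin (L q).im ≤ 0 := by
    intro q hq; rw [him] at hq
    exact nonpos_of_mul_nonpos_right hq (Real.exp_pos _)
  set A : ℝ × ℝ → ℝ := fun q => (L q).im with hA
  have hAc : Continuous A := by fun_prop
  have hA00 : A (0, 0) = Real.pi := by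
    have : ((0, 0) : ℝ × ℝ) = 0 := rfl
    simp only [hA, this, hL0]; simp
  -- left edge
  have e1 : A (0, 1) ∈ Icc Real.pi (Real.pi + Real.pi) := by
    apply sin_trap (f := fun t => A (0, t)) (by fun_prop) (by simp only [hA00]; constructor <;> linarith)
    intro t
    rw [Real.sin_sub_pi]
    have := hsgn' (0, t) (by simp [g0, hki t])
    simp only [hA]; linarith
  have e2 : A (1, 0) ∈ Icc 0 (0 + Real.pi) := by
    apply sin_trap (f := fun t => A (t, 0)) (by fun_prop) (by simp only [hA00]; constructor <;> linarith)
    intro t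
    rw [sub_zero]
    exact hsgn (t, 0) (by simp [k0, hgi t])
  have hA10 : A (1, 0) = 0 := by
    have h1 : Real.sin (A (1, 0)) = 0 := by
      have := him (1, 0)
      simp only [Complex.sub_im, g1, k0, sub_zero] at this
      exact (mul_eq_zero.1 this.symm).resolve_left (Real.exp_pos _).ne'
    have h2 : 0 < Real.cos (A (1, 0)) := by
      have := hre (1, 0)
      have h3 : 0 < (g 1 - k 0).re := by simp; linarith
      rw [this] at h3
      exact pos_of_mul_pos_right h3 (Real.exp_pos _).le
    rcases e2.1.eq_or_lt with h | h
    · exact h.symm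
    · exfalso
      rcases lt_or_eq_of_le e2.2 with h3 | h3
      · exact (Real.sin_pos_of_pos_of_lt_pi h (by linarith)).ne' h1
      · rw [h3, zero_add, Real.cos_pi] at h2; linarith
  have e3 : A (1, 1) ∈ Icc (-Real.pi) (-Real.pi + Real.pi) := by
    apply sin_trap (f := fun t => A (1, t)) (by fun_prop) (by simp only [hA10]; constructor <;> linarith)
    intro t
    rw [sub_neg_eq_add, Real.sin_add_pi]
    have := hsgn' (1, t) (by simp [g1, hki t])
    simp only [hA]; linarith
  have e4 : A (0, 1) - A (1, 1) ≤ Real.pi := by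
    set m : ℂ := ⟨m1, m2⟩
    have hm0 : m ≠ 0 := by
      intro h; have h1 := congrArg Complex.re h; have h2 := congrArg Complex.im h
      simp [m] at h1 h2; rcases hm with h | h <;> contradiction
    apply cos_trap (f := fun t => A (t, 1)) (by fun_prop) (ω := m.arg) ?_ 0 1
    intro t
    have h1 := hs t
    rw [hre (t, 1), him (t, 1)] at h1
    have h3 : m1 = ‖m‖ * Real.cos m.arg := by rw [Complex.norm_mul_cos_arg]
    have h4 : m2 = ‖m‖ * Real.sin m.arg := by rw [Complex.norm_mul_sin_arg]
    rw [h3, h4] at h1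
    rw [Real.cos_sub]
    have h5 : 0 < ‖m‖ * Real.exp (L (t, 1)).re := mul_pos (norm_pos_iff.2 hm0) (Real.exp_pos _)
    refine nonneg_of_mul_nonneg_right (b := _) ?_ h5
    simp only [hA]; linarith
  have f1 : A (0, 1) = Real.pi := by linarith [e1.1, e3.2]
  have f2 : A (1, 1) = 0 := by linarith [e1.1, e3.2]
  have r1 := hre (0, 1)
  have r2 := hre (1, 1)
  have r3 := him (1, 1)
  change _ = _ * Real.cos (A (0, 1)) at r1
  change _ = _ * Real.cos (A (1, 1)) at r2
  change _ = _ * Real.sin (A (1, 1)) at r3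
  rw [f1, Real.cos_pi] at r1
  rw [f2, Real.cos_zero] at r2
  rw [f2, Real.sin_zero] at r3
  have p1 := Real.exp_pos (L (0, 1)).re
  have p2 := Real.exp_pos (L (1, 1)).re
  simp only [Complex.sub_re, Complex.sub_im] at r1 r2 r3
  refine ⟨by linarith, by linarith, by linarith⟩
end

noncomputable section

lemma crossing_aux {a b c : E2} (h : cr (b - a) (c - a) ≠ 0) {τ n : E2} {κ : ℝ} (hof : OF τ n)
    (hκ : 0 < κ) (hbar : ∀ q : ℝ × ℝ, bar a b c (fr a τ n q) = κ * q.2) {γ β : ℝ → E2}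
    (hγc : ContinuousOn γ (Icc 0 1)) (hβc : ContinuousOn β (Icc 0 1))
    (hγT : ∀ t ∈ Icc (0:ℝ) 1, γ t ∈ Tri a b c) (hβT : ∀ t ∈ Icc (0:ℝ) 1, β t ∈ Tri a b c)
    (hγ0 : bar a b c (γ 0) = 0) (hγ1 : bar a b c (γ 1) = 0)
    (hβ0 : bar a b c (β 0) = 0)
    (h1 : dt (γ 0 - a) τ < dt (β 0 - a) τ) (h2 : dt (β 0 - a) τ < dt (γ 1 - a) τ)
    (hβ1 : bar b c a (β 1) = 0 ∨ bar c a b (β 1) = 0) :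
    ∃ s ∈ Icc (0:ℝ) 1, ∃ t ∈ Icc (0:ℝ) 1, γ s = β t := by
  by_contra hcon
  push Not at hcon
  have hy : ∀ p, bar a b c p = κ * dt (p - a) n := by
    intro p; conv_lhs => rw [← fr_frinv (o := a) hof p]
    rw [hbar]; rfl
  set pr : ℝ → ℝ := fun t => (projIcc (0:ℝ) 1 zero_le_one t : ℝ) with hpr
  have hprc : Continuous pr := continuous_subtype_val.comp continuous_projIcc
  have hprm : ∀ t, pr t ∈ Icc (0:ℝ) 1 := fun t => (projIcc (0:ℝ) 1 zero_le_one t).2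
  have pr0 : pr 0 = 0 := by simp [hpr]
  have pr1 : pr 1 = 1 := by simp [hpr]
  let Z : E2 → ℂ := fun p => ⟨dt (p - a) τ, dt (p - a) n⟩
  have hZc : Continuous Z := by
    have : Z = fun p => ((dt (p - a) τ : ℝ) : ℂ) + (dt (p - a) n : ℝ) * Complex.I := by
      funext p; apply Complex.ext <;> simp [Z]
    rw [this]; unfold dt; fun_prop
  have hgc : Continuous (fun t => γ (pr t)) := by
    rw [← continuousOn_univ]
    exact hγc.comp hprc.continuousOn (fun t _ => hprm t)
  have hkc : Continuous (fun t => β (pr t)) := by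
    rw [← continuousOn_univ]
    exact hβc.comp hprc.continuousOn (fun t _ => hprm t)
  have him : ∀ p, (Z p).im = bar a b c p / κ := by
    intro p; rw [hy]; simp only [Z]; field_simp
  have hre : ∀ p, (Z p).re = dt (p - a) τ := fun p => rfl
  have hTpos : ∀ p ∈ Tri a b c, 0 ≤ bar b c a p ∧ 0 ≤ bar c a b p ∧ 0 ≤ bar a b c p :=
    fun p => (mem_Tri h p).1
  -- generic side
  have main : ∀ x y z : E2, cr (y - x) (z - x) ≠ 0 → (∀ p ∈ Tri a b c, 0 ≤ bar x y z p) →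
      bar x y z (β 1) = 0 → (bar x y z a ≠ bar x y z b) → False := by
    intro x y z hxyz hpos hz hab
    have hlin : ∀ p q : E2, bar x y z p - bar x y z q =
        (cr (y - x) τ / cr (y - x) (z - x)) * (Z p - Z q).re +
        (cr (y - x) n / cr (y - x) (z - x)) * (Z p - Z q).im := by
      intro p q
      have ex : ∀ p, bar x y z p = bar x y z a + (dt (p - a) τ) * (cr (y - x) τ / cr (y - x) (z - x))
          + (dt (p - a) n) * (cr (y - x) n / cr (y - x) (z - x)) := by
        intro p
        conv_lhs => rw [← fr_frinv (o := a) hof p]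
        unfold fr
        rw [bar_add, bar_add]; rfl
      rw [ex p, ex q]
      simp only [Complex.sub_re, Complex.sub_im, Z]; ring
    have hm1 : cr (y - x) τ / cr (y - x) (z - x) ≠ 0 := by
      intro h0
      apply hab
      have := hlin a b
      rw [h0] at this
      simp only [Complex.sub_im, him, bar_left, bar_right] at this
      simp at this; linarith
    have res := crossing (hZc.comp hgc) (hZc.comp hkc)
      (fun t => by rw [Function.comp, him]; exact div_nonneg (hTpos _ (hγT _ (hprm t))).2.2 hκ.le)
      (fun t => by rw [Function.comp, him]; exact div_nonneg (hTpos _ (hβT _ (hprm t))).2.2 hκ.le)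
      (by rw [Function.comp, him, pr0, hγ0, zero_div])
      (by rw [Function.comp, him, pr1, hγ1, zero_div])
      (by rw [Function.comp, him, pr0, hβ0, zero_div])
      (by simp only [Function.comp, hre, pr0]; exact h1)
      (by simp only [Function.comp, hre, pr0, pr1]; exact h2)
      _ _ (Or.inl hm1)
      (fun s => by
        simp only [Function.comp]
        rw [← hlin, pr1, hz, sub_zero]; exact hpos _ (hγT _ (hprm s)))
      (fun s t hst => by
        apply hcon _ (hprm s) _ (hprm t)
        have e1 := congrArg Complex.re hst
        have e2 := congrArg Complex.im hst
        simp only [Function.comp, Z] at e1 e2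
        rw [← fr_frinv (o := a) hof (γ (pr s)), ← fr_frinv (o := a) hof (β (pr t))]
        unfold frinv; rw [e1, e2])
    obtain ⟨r1, r2, r3⟩ := res
    simp only [Function.comp, pr0, pr1] at r1 r2 r3
    have q1 := hlin (γ 0) (β 1)
    have q2 := hlin (γ 1) (β 1)
    have i0 : (Z (γ 0)).im = 0 := by rw [him, hγ0, zero_div]
    have i1 : (Z (γ 1)).im = 0 := by rw [him, hγ1, zero_div]
    rw [hz] at q1 q2
    simp only [Complex.sub_re, Complex.sub_im, i0, i1, r1, sub_self, mul_zero, add_zero, sub_zero] at q1 q2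
    have w1 := hpos _ (hγT 0 (by simp))
    have w2 := hpos _ (hγT 1 (by simp))
    rw [q1] at w1; rw [q2] at w2
    rcases lt_or_gt_of_ne hm1 with hlt | hgt
    · nlinarith
    · nlinarith
  have h2' := cr_perm h
  have h3' := cr_perm h2'
  rcases hβ1 with hb | hb
  · exact main b c a h2' (fun p hp => (hTpos p hp).1) hb (by rw [bar_self h2', bar_left]; norm_num)
  · exact main c a b h3' (fun p hp => (hTpos p hp).2.1) hb (by rw [bar_self h3', bar_right]; norm_num)

theorem crossing_tri {a b c : E2} (h : cr (b - a) (c - a) ≠ 0) {γ β : ℝ → E2}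
    (hγc : ContinuousOn γ (Icc 0 1)) (hβc : ContinuousOn β (Icc 0 1))
    (hγT : ∀ t ∈ Icc (0:ℝ) 1, γ t ∈ Tri a b c) (hβT : ∀ t ∈ Icc (0:ℝ) 1, β t ∈ Tri a b c)
    (hγ0 : bar a b c (γ 0) = 0) (hγ1 : bar a b c (γ 1) = 0)
    (hβ0 : β 0 ∈ openSegment ℝ (γ 0) (γ 1)) (hne : γ 0 ≠ γ 1)
    (hβ1 : bar b c a (β 1) = 0 ∨ bar c a b (β 1) = 0) :
    ∃ s ∈ Icc (0:ℝ) 1, ∃ t ∈ Icc (0:ℝ) 1, γ s = β t := by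
  obtain ⟨τ, n, L, κ, hof, hL, hb, hκ, hbar⟩ := side_frame h
  obtain ⟨s, t, hs, ht, hst, hβe⟩ := hβ0
  have hβ0' : bar a b c (β 0) = 0 := by
    rw [← hβe, bar_affine _ _ _ _ _ _ _ hst, hγ0, hγ1]; simp
  have hy : ∀ p, bar a b c p = κ * dt (p - a) n := by
    intro p; conv_lhs => rw [← fr_frinv (o := a) hof p]
    rw [hbar]; rfl
  have hτ : dt (β 0 - a) τ = s * dt (γ 0 - a) τ + t * dt (γ 1 - a) τ := by
    rw [← hβe]; simp only [dt, PiLp.sub_apply, PiLp.add_apply, PiLp.smul_apply, smul_eq_mul]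
    linear_combination (a 0 * τ 0 + a 1 * τ 1) * hst
  have hd : dt (γ 0 - a) τ ≠ dt (γ 1 - a) τ := by
    intro he
    apply hne
    have z0 : dt (γ 0 - a) n = 0 := by
      have := hy (γ 0); rw [hγ0] at this; exact (mul_eq_zero.1 this.symm).resolve_left hκ.ne'
    have z1 : dt (γ 1 - a) n = 0 := by
      have := hy (γ 1); rw [hγ1] at this; exact (mul_eq_zero.1 this.symm).resolve_left hκ.ne'
    rw [← fr_frinv (o := a) hof (γ 0), ← fr_frinv (o := a) hof (γ 1)]
    unfold frinv; rw [he, z0, z1]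
  have hs' : s = 1 - t := by linarith
  rcases lt_or_gt_of_ne hd with hlt | hgt
  · have k1 := mul_pos ht (sub_pos.2 hlt)
    have k2 := mul_pos hs (sub_pos.2 hlt)
    rw [hs'] at k2
    refine crossing_aux h hof hκ hbar hγc hβc hγT hβT hγ0 hγ1 hβ0' ?_ ?_ hβ1 <;> rw [hτ, hs'] <;> linarith
  · have k1 := mul_pos ht (sub_pos.2 hgt)
    have k2 := mul_pos hs (sub_pos.2 hgt)
    rw [hs'] at k2
    have hm : ∀ x ∈ Icc (0:ℝ) 1, 1 - x ∈ Icc (0:ℝ) 1 := by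
      intro x hx; constructor <;> linarith [hx.1, hx.2]
    obtain ⟨x, hx, y, hy, hxy⟩ := crossing_aux h hof hκ hbar (γ := fun x => γ (1 - x)) (β := β)
      (hγc.comp (by fun_prop) hm) hβc (fun x hx => hγT _ (hm x hx)) hβT (by simpa using hγ1)
      (by simpa using hγ0) hβ0'
      (by rw [hτ, hs']; simp only [sub_zero]; linarith) (by rw [hτ, hs']; simp only [sub_self]; linarith) hβ1
    exact ⟨1 - x, hm x hx, y, hy, hxy⟩
end

noncomputable section

/-! ### Divergence theorem on a triangle -/

open MeasureTheory in
/-- affine change of variables -/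
lemma integral_affine {a v w : E2} (h : cr v w ≠ 0) (g : E2 → ℝ) :
    ∫ p, g p = |cr v w| * ∫ q : ℝ × ℝ, g (fr a v w q) := by
  let M : ℝ × ℝ →ₗ[ℝ] ℝ × ℝ :=
    { toFun := fun q => (q.1 * v 0 + q.2 * w 0, q.1 * v 1 + q.2 * w 1)
      map_add' := by intro x y; ext <;> simp <;> ring
      map_smul' := by intro x y; ext <;> simp <;> ring }
  have hdet : LinearMap.det M = cr v w := by
    rw [← LinearMap.det_toMatrix (Module.Basis.finTwoProd ℝ), Matrix.det_fin_two]
    simp [LinearMap.toMatrix_apply, M, cr]; ring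
  have hd : LinearMap.det M ≠ 0 := by rw [hdet]; exact h
  have hmap := Measure.map_linearMap_addHaar_eq_smul_addHaar (volume : Measure (ℝ × ℝ)) hd
  let Me := LinearEquiv.ofIsUnitDet (f := M) (v := Module.Basis.finTwoProd ℝ)
    (v' := Module.Basis.finTwoProd ℝ) (by rw [LinearMap.det_toMatrix]; exact hd.isUnit)
  have hemb : MeasurableEmbedding M := Me.toContinuousLinearEquiv.toHomeomorph.measurableEmbedding
  have e : ∀ q, fr a v w q = fr a e0 e1 (M q) := by
    intro q; apply ext2 <;> simp [fr_apply, M] <;> ring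
  simp only [e]
  rw [← integral_fr (o := a) OF_std g, ← hemb.integral_map (fun q => g (fr a e0 e1 q)), hmap,
    integral_smul_measure, hdet, ENNReal.toReal_ofReal (abs_nonneg _), abs_inv, smul_eq_mul,
    ← mul_assoc, mul_inv_cancel₀ (abs_ne_zero.2 h), one_mul]

open MeasureTheory in
lemma integrable_affine {a v w : E2} (h : cr v w ≠ 0) {g : E2 → ℝ} (hg : Integrable g) :
    Integrable (fun q : ℝ × ℝ => g (fr a v w q)) := by
  let M : ℝ × ℝ →ₗ[ℝ] ℝ × ℝ :=
    { toFun := fun q => (q.1 * v 0 + q.2 * w 0, q.1 * v 1 + q.2 * w 1)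
      map_add' := by intro x y; ext <;> simp <;> ring
      map_smul' := by intro x y; ext <;> simp <;> ring }
  have hdet : LinearMap.det M = cr v w := by
    rw [← LinearMap.det_toMatrix (Module.Basis.finTwoProd ℝ), Matrix.det_fin_two]
    simp [LinearMap.toMatrix_apply, M, cr]; ring
  have hd : LinearMap.det M ≠ 0 := by rw [hdet]; exact h
  have hmap := Measure.map_linearMap_addHaar_eq_smul_addHaar (volume : Measure (ℝ × ℝ)) hd
  let Me := LinearEquiv.ofIsUnitDet (f := M) (v := Module.Basis.finTwoProd ℝ)
    (v' := Module.Basis.finTwoProd ℝ) (by rw [LinearMap.det_toMatrix]; exact hd.isUnit)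
  have hemb : MeasurableEmbedding M := Me.toContinuousLinearEquiv.toHomeomorph.measurableEmbedding
  have e : ∀ q, fr a v w q = fr a e0 e1 (M q) := by
    intro q; apply ext2 <;> simp [fr_apply, M] <;> ring
  simp only [e]
  have h1 : Integrable (fun q => g (fr a e0 e1 q)) :=
    ((fr_measurePreserving (o := a) OF_std).integrable_comp_emb (fr_emb OF_std)).2 hg
  have := (hemb.integrable_map_iff (μ := volume) (g := fun q => g (fr a e0 e1 q))).1
    (by rw [hmap]; exact h1.smul_measure ENNReal.ofReal_ne_top)
  exact this

lemma bar_fr1 {a b c : E2} (h : cr (b - a) (c - a) ≠ 0) (q : ℝ × ℝ) :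
    bar a b c (fr a (b - a) (c - a) q) = q.2 := by
  unfold bar; rw [div_eq_iff h]; simp [cr, fr_apply]; ring
lemma bar_fr2 {a b c : E2} (h : cr (b - a) (c - a) ≠ 0) (q : ℝ × ℝ) :
    bar c a b (fr a (b - a) (c - a) q) = q.1 := by
  have h3 := cr_perm (cr_perm h)
  unfold bar; rw [div_eq_iff h3]; simp [cr, fr_apply]; ring
lemma bar_fr3 {a b c : E2} (h : cr (b - a) (c - a) ≠ 0) (q : ℝ × ℝ) :
    bar b c a (fr a (b - a) (c - a) q) = 1 - q.1 - q.2 := by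
  have := bar_sum h (fr a (b - a) (c - a) q)
  rw [bar_fr1 h, bar_fr2 h] at this; linarith

open MeasureTheory in
lemma tri_slice {a b c : E2} (h : cr (b - a) (c - a) ≠ 0) {X : E2 → ℝ}
    (hc : ContinuousOn X (Tri a b c)) (hd : DifferentiableOn ℝ X (interior (Tri a b c)))
    (hi : IntegrableOn (fun p => fderiv ℝ X p (b - a)) (interior (Tri a b c))) :
    ∫ p in interior (Tri a b c), fderiv ℝ X p (b - a) = |cr (b - a) (c - a)| *
      ∫ t in (0:ℝ)..1, (X (b + t • (c - b)) - X (a + t • (c - a))) := by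
  set IT := interior (Tri a b c) with hIT
  have hIo : IsOpen IT := isOpen_interior
  set A := fr a (b - a) (c - a) with hA
  have hmem : ∀ q : ℝ × ℝ, A q ∈ IT ↔ (0 < q.1 ∧ q.1 < 1 - q.2) ∧ 0 < q.2 := by
    intro q
    rw [hIT, mem_interior_Tri h, hA, bar_fr1 h, bar_fr2 h, bar_fr3 h]
    constructor
    · rintro ⟨h1, h2, h3⟩; exact ⟨⟨h2, by linarith⟩, h3⟩
    · rintro ⟨⟨h1, h2⟩, h3⟩; exact ⟨by linarith, h1, h3⟩
  have hmemT : ∀ q : ℝ × ℝ, 0 ≤ q.1 → q.1 ≤ 1 - q.2 → 0 ≤ q.2 → A q ∈ Tri a b c := by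
    intro q h1 h2 h3
    rw [mem_Tri h, hA, bar_fr1 h, bar_fr2 h, bar_fr3 h]
    exact ⟨by linarith, h1, h3⟩
  rw [← integral_indicator hIo.measurableSet, integral_affine (a := a) h]
  have hintg := integrable_affine (a := a) h (hi.integrable_indicator hIo.measurableSet)
  congr 1
  rw [Measure.volume_eq_prod, integral_prod_symm _ hintg]
  rw [intervalIntegral.integral_of_le zero_le_one, ← integral_indicator measurableSet_Ioc]
  apply integral_congr_ae
  have hne : ∀ᵐ t : ℝ, t ≠ 1 := by simp [ae_iff, measure_singleton]
  filter_upwards [hintg.prod_left_ae, hne] with t ht ht1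
  replace ht : Integrable (fun s => indicator IT (fun p => fderiv ℝ X p (b - a)) (A (s, t))) := ht
  change ∫ s, indicator IT (fun p => fderiv ℝ X p (b - a)) (A (s, t)) = _
  by_cases htm : t ∈ Ioc (0:ℝ) 1
  · rw [indicator_of_mem htm]
    have ht1' : t < 1 := lt_of_le_of_ne htm.2 ht1
    have e1 : ∀ s : ℝ, (indicator IT (fun p => fderiv ℝ X p (b - a)) (A (s, t))) =
        indicator (Ioo 0 (1 - t)) (fun s => fderiv ℝ X (A (s, t)) (b - a)) s := by
      intro s
      by_cases hs : s ∈ Ioo 0 (1 - t)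
      · rw [indicator_of_mem hs, indicator_of_mem]
        rw [hmem]; exact ⟨hs, htm.1⟩
      · rw [indicator_of_notMem hs, indicator_of_notMem]
        rw [hmem]; exact fun hh => hs hh.1
    simp only [e1] at ht ⊢
    rw [integral_indicator measurableSet_Ioo, ← integral_Ioc_eq_integral_Ioo,
      ← intervalIntegral.integral_of_le (by linarith)]
    have ht' : IntegrableOn (fun s => fderiv ℝ X (A (s, t)) (b - a)) (Ioo 0 (1 - t)) :=
      (integrable_indicator_iff measurableSet_Ioo).1 ht
    have hder : ∀ s : ℝ, HasDerivAt (fun s => A (s, t)) (b - a) s := by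
      intro s
      have := (((hasDerivAt_id s).smul_const (b - a)).const_add a).add_const (t • (c - a))
      simpa [hA, fr] using this
    rw [intervalIntegral.integral_eq_sub_of_hasDerivAt_of_le (f := fun s => X (A (s, t)))
      (by linarith) _ _ _]
    · congr 2
      · rw [hA]; apply ext2 <;> simp [fr_apply] <;> ring
      · rw [hA]; apply ext2 <;> simp [fr_apply]
    · refine hc.comp ?_ ?_
      · exact (continuous_iff_continuousAt.2 fun s => (hder s).continuousAt).continuousOn
      · intro s hs; exact hmemT _ hs.1 hs.2 htm.1.le
    · intro s hs
      have hm : A (s, t) ∈ IT := (hmem _).2 ⟨hs, htm.1⟩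
      have := ((hd.differentiableAt (hIo.mem_nhds hm)).hasFDerivAt).comp_hasDerivAt s (hder s)
      exact this
    · rw [intervalIntegrable_iff_integrableOn_Ioo_of_le (by linarith)]
      exact ht'
  · rw [indicator_of_notMem htm]
    have : ∀ s : ℝ, (indicator IT (fun p => fderiv ℝ X p (b - a)) (A (s, t))) = 0 := by
      intro s
      apply indicator_of_notMem
      rw [hmem]
      rintro ⟨⟨h1, h2⟩, h3⟩
      apply htm; simp at h1 h2 h3 ⊢; constructor <;> linarith
    simp only [this, integral_zero]

/-- flux through the segment `ab` -/
def fl (a b : E2) (X0 X1 : E2 → ℝ) : ℝ :=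
  ∫ t in (0:ℝ)..1, (X0 (a + t • (b - a)) * (b - a) 1 - X1 (a + t • (b - a)) * (b - a) 0)

lemma seg_in_Tri {a b c : E2} {t : ℝ} (ht : t ∈ Icc (0:ℝ) 1) : a + t • (b - a) ∈ Tri a b c := by
  have : a + t • (b - a) = (1 - t) • a + t • b := by
    apply ext2 <;> simp <;> ring
  rw [this]
  exact Tri_convex a b c (subset_convexHull _ _ (by simp)) (subset_convexHull _ _ (by simp))
    (by linarith [ht.2]) ht.1 (by ring)

lemma seg_ii {a b c : E2} {X : E2 → ℝ} (hc : ContinuousOn X (Tri a b c)) :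
    IntervalIntegrable (fun t : ℝ => X (a + t • (b - a))) MeasureTheory.volume 0 1 := by
  apply ContinuousOn.intervalIntegrable
  rw [uIcc_of_le zero_le_one]
  exact hc.comp (by fun_prop) fun t ht => seg_in_Tri ht

lemma seg_flip (a b : E2) (X : E2 → ℝ) :
    ∫ t in (0:ℝ)..1, X (a + t • (b - a)) = ∫ t in (0:ℝ)..1, X (b + t • (a - b)) := by
  have := intervalIntegral.integral_comp_sub_left (fun t : ℝ => X (a + t • (b - a))) (a := 0) (b := 1) 1
  simp only [sub_self, sub_zero] at this
  rw [← this]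
  congr 1; funext t; congr 1
  apply ext2 <;> simp <;> ring

open MeasureTheory in
theorem div_tri {a b c : E2} (h : cr (b - a) (c - a) ≠ 0) {X0 X1 : E2 → ℝ}
    (hc0 : ContinuousOn X0 (Tri a b c)) (hc1 : ContinuousOn X1 (Tri a b c))
    (hd0 : DifferentiableOn ℝ X0 (interior (Tri a b c)))
    (hd1 : DifferentiableOn ℝ X1 (interior (Tri a b c)))
    (hi0 : ∀ v, IntegrableOn (fun p => fderiv ℝ X0 p v) (interior (Tri a b c)))
    (hi1 : ∀ v, IntegrableOn (fun p => fderiv ℝ X1 p v) (interior (Tri a b c))) :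
    cr (b - a) (c - a) * ∫ p in interior (Tri a b c), (fderiv ℝ X0 p e0 + fderiv ℝ X1 p e1) =
      |cr (b - a) (c - a)| * (fl a b X0 X1 + fl b c X0 X1 + fl c a X0 X1) := by
  have hP : Tri c a b = Tri a b c := (Tri_perm b c a).trans (Tri_perm a b c)
  have hP2 : Tri b c a = Tri a b c := Tri_perm a b c
  have key : ∀ X : E2 → ℝ, ContinuousOn X (Tri a b c) → DifferentiableOn ℝ X (interior (Tri a b c)) →
      (∀ v, IntegrableOn (fun p => fderiv ℝ X p v) (interior (Tri a b c))) →
      (∫ p in interior (Tri a b c), fderiv ℝ X p (b - a)) = |cr (b - a) (c - a)| *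
        ((∫ t in (0:ℝ)..1, X (b + t • (c - b))) - ∫ t in (0:ℝ)..1, X (c + t • (a - c))) ∧
      (∫ p in interior (Tri a b c), fderiv ℝ X p (c - a)) = |cr (b - a) (c - a)| *
        ((∫ t in (0:ℝ)..1, X (b + t • (c - b))) - ∫ t in (0:ℝ)..1, X (a + t • (b - a))) := by
    intro X hc hd hi
    have i1 := seg_ii hc
    have i2 : IntervalIntegrable (fun t : ℝ => X (b + t • (c - b))) volume 0 1 :=
      seg_ii (c := a) (by rw [hP2]; exact hc)
    have i3 : IntervalIntegrable (fun t : ℝ => X (a + t • (c - a))) volume 0 1 :=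
      seg_ii (c := b) (by
        have : Tri a c b = Tri a b c := by unfold Tri; congr 1; ext x; simp; tauto
        rw [this]; exact hc)
    have i4 : IntervalIntegrable (fun t : ℝ => X (c + t • (b - c))) volume 0 1 :=
      seg_ii (c := a) (by
        have : Tri c b a = Tri a b c := by unfold Tri; congr 1; ext x; simp; tauto
        rw [this]; exact hc)
    constructor
    · rw [tri_slice h hc hd (hi _), intervalIntegral.integral_sub i2 i3, seg_flip c a]
    · have h3 := cr_perm (cr_perm h)
      have := tri_slice h3 (X := X) (by rw [hP]; exact hc) (by rw [hP]; exact hd)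
        (by rw [hP]; exact hi _)
      rw [hP, intervalIntegral.integral_sub i1 i4, cr_cyc b c a, cr_cyc a b c] at this
      have e : ∀ p, fderiv ℝ X p (c - a) = - fderiv ℝ X p (a - c) := by
        intro p; rw [← map_neg]; congr 1; abel
      simp only [e]
      rw [integral_neg, this, seg_flip b c]; ring
  obtain ⟨k1, k2⟩ := key X0 hc0 hd0 hi0
  obtain ⟨k3, k4⟩ := key X1 hc1 hd1 hi1
  have flx : ∀ x y z : E2, Tri x y z = Tri a b c → fl x y X0 X1 =
      (∫ t in (0:ℝ)..1, X0 (x + t • (y - x))) * (y - x) 1 -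
      (∫ t in (0:ℝ)..1, X1 (x + t • (y - x))) * (y - x) 0 := by
    intro x y z hz
    unfold fl
    rw [intervalIntegral.integral_sub, intervalIntegral.integral_mul_const,
      intervalIntegral.integral_mul_const]
    · exact (seg_ii (c := z) (by rw [hz]; exact hc0)).mul_const _
    · exact (seg_ii (c := z) (by rw [hz]; exact hc1)).mul_const _
  rw [flx a b c rfl, flx b c a hP2, flx c a b hP]
  have e : ∀ p, cr (b - a) (c - a) * (fderiv ℝ X0 p e0 + fderiv ℝ X1 p e1) =
      ((c - a) 1 * fderiv ℝ X0 p (b - a) - (b - a) 1 * fderiv ℝ X0 p (c - a)) +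
      ((b - a) 0 * fderiv ℝ X1 p (c - a) - (c - a) 0 * fderiv ℝ X1 p (b - a)) := by
    intro p
    rw [lin_decomp _ (b - a), lin_decomp _ (c - a), lin_decomp (fderiv ℝ X1 p) (b - a),
      lin_decomp (fderiv ℝ X1 p) (c - a)]
    unfold cr; ring
  rw [← integral_const_mul]
  simp only [e]
  rw [integral_add, integral_sub, integral_sub, integral_const_mul, integral_const_mul,
    integral_const_mul, integral_const_mul, k1, k2, k3, k4]
  · simp only [PiLp.sub_apply]; ring
  · exact (hi1 _).const_mul _
  · exact (hi1 _).const_mul _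
  · exact (hi0 _).const_mul _
  · exact (hi0 _).const_mul _
  · exact ((hi0 _).const_mul _).sub ((hi0 _).const_mul _)
  · exact ((hi1 _).const_mul _).sub ((hi1 _).const_mul _)
end

noncomputable section

/-! ### Polar coordinates: circular means of solutions -/

open MeasureTheory in
lemma deriv_param {g g' : ℝ → ℝ → ℝ} {R : ℝ}
    (h1 : ContinuousOn (fun q : ℝ × ℝ => g q.1 q.2) (Ioo (-R) R ×ˢ univ))
    (h2 : ContinuousOn (fun q : ℝ × ℝ => g' q.1 q.2) (Ioo (-R) R ×ˢ univ))
    (hd : ∀ r ∈ Ioo (-R) R, ∀ θ, HasDerivAt (fun r => g r θ) (g' r θ) r) :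
    ∀ r ∈ Ioo (-R) R, HasDerivAt (fun r => ∫ θ in (0:ℝ)..(2 * Real.pi), g r θ)
      (∫ θ in (0:ℝ)..(2 * Real.pi), g' r θ) r := by
  intro r hr
  obtain ⟨ε, hε, hball⟩ := Metric.isOpen_iff.1 (isOpen_Ioo (a := -R) (b := R)) r hr
  have hsub : Icc (r - ε / 2) (r + ε / 2) ⊆ Ioo (-R) R := by
    intro y hy
    apply hball
    rw [Metric.mem_ball, Real.dist_eq, abs_lt]
    constructor <;> linarith [hy.1, hy.2]
  have hK : IsCompact (Icc (r - ε / 2) (r + ε / 2) ×ˢ Icc (0:ℝ) (2 * Real.pi)) :=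
    isCompact_Icc.prod isCompact_Icc
  obtain ⟨C, hC⟩ := hK.exists_bound_of_continuousOn (h2.mono (prod_mono hsub (subset_univ _)))
  have sl : ∀ (k : ℝ → ℝ → ℝ), ContinuousOn (fun q : ℝ × ℝ => k q.1 q.2) (Ioo (-R) R ×ˢ univ) →
      ∀ s ∈ Ioo (-R) R, Continuous (k s) := by
    intro k hk s hs
    rw [← continuousOn_univ]
    exact hk.comp (f := fun θ : ℝ => (s, θ)) (by fun_prop) (fun θ _ => ⟨hs, mem_univ _⟩)
  have hpi : (0:ℝ) ≤ 2 * Real.pi := by positivity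
  refine (intervalIntegral.hasDerivAt_integral_of_dominated_loc_of_deriv_le
    (s := Icc (r - ε / 2) (r + ε / 2)) (bound := fun _ => C) (F := g) (F' := g')
    (Icc_mem_nhds (by linarith) (by linarith)) ?_ ?_ ?_ ?_ ?_ ?_).2
  · filter_upwards [isOpen_Ioo.mem_nhds hr] with s hs
    exact (sl g h1 s hs).aestronglyMeasurable
  · exact (sl g h1 r hr).intervalIntegrable _ _
  · exact (sl g' h2 r hr).aestronglyMeasurable
  · refine ae_of_all _ fun θ hθ s hs => ?_
    rw [uIoc_of_le hpi] at hθ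
    exact hC (s, θ) ⟨hs, hθ.1.le, hθ.2⟩
  · exact intervalIntegrable_const
  · exact ae_of_all _ fun θ _ s hs => hd s (hsub hs) θ

lemma ode_uniq {N N1 N2 : ℝ → ℝ} {R s ν m : ℝ} (hs0 : 0 ≤ s)
    (hN : ∀ r ∈ Ioo (-R) R, HasDerivAt N (N1 r) r) (hN1 : ∀ r ∈ Ioo (-R) R, HasDerivAt N1 (N2 r) r)
    (hode : ∀ r ∈ Ioo s R, r ^ 2 * N2 r + r * N1 r + (ν * r ^ 2 - m) * N r = 0)
    (h0 : N s = 0) (h1 : N1 s = 0) (hm : 0 < s ∨ m = 0) :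
    ∀ r ∈ Ico s R, N r = 0 := by
  intro r hr
  have hsR : s < R := lt_of_le_of_lt hr.1 hr.2
  obtain ⟨K, hK⟩ : ∃ K, ∀ x ∈ Ioo s R, |1 - ν + m / x ^ 2| ≤ K := by
    refine ⟨|1 - ν| + |m| / s ^ 2, fun x hx => (abs_add_le _ _).trans ?_⟩
    gcongr
    rcases hm with hm | hm
    · rw [abs_div, abs_of_nonneg (sq_nonneg x)]
      gcongr
      exact hx.1.le
    · rw [hm]; simp
  set E : ℝ → ℝ := fun x => (N1 x ^ 2 + N x ^ 2) * Real.exp (-K * x)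
  have hin : ∀ x ∈ Ico s R, x ∈ Ioo (-R) R := fun x hx => ⟨by linarith [hx.1], hx.2⟩
  have hE : ∀ x ∈ Ico s R, HasDerivAt E ((2 * N1 x * N2 x + 2 * N x * N1 x) * Real.exp (-K * x) +
      (N1 x ^ 2 + N x ^ 2) * (Real.exp (-K * x) * -K)) x := by
    intro x hx
    have d1 := ((hN1 x (hin x hx)).pow 2).add ((hN x (hin x hx)).pow 2)
    have d2 : HasDerivAt (fun x => Real.exp (-K * x)) (Real.exp (-K * x) * -K) x := by
      simpa using ((hasDerivAt_id x).const_mul (-K)).exp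
    convert! d1.mul d2 using 1
    simp
  have hanti : AntitoneOn E (Ico s R) := by
    apply antitoneOn_of_deriv_nonpos (convex_Ico s R)
    · exact fun x hx => (hE x hx).continuousAt.continuousWithinAt
    · intro x hx; rw [interior_Ico] at hx
      exact (hE x ⟨hx.1.le, hx.2⟩).differentiableAt.differentiableWithinAt
    · intro x hx; rw [interior_Ico] at hx
      rw [(hE x ⟨hx.1.le, hx.2⟩).deriv]
      have hx0 : 0 < x := lt_of_le_of_lt hs0 hx.1
      have ho := hode x hx
      have hN2 : N2 x = - (N1 x / x) - (ν - m / x ^ 2) * N x := by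
        field_simp
        linarith
      have hk := hK x hx
      have e : (2 * N1 x * N2 x + 2 * N x * N1 x) ≤ K * (N1 x ^ 2 + N x ^ 2) := by
        rw [hN2]
        have t1 : 0 ≤ N1 x ^ 2 / x := by positivity
        have t2 : 2 * ((1 - ν + m / x ^ 2) * (N x * N1 x)) ≤ K * (N1 x ^ 2 + N x ^ 2) := by
          have a1 : (1 - ν + m / x ^ 2) * (N x * N1 x) ≤ K * |N x * N1 x| := by
            calc _ ≤ |(1 - ν + m / x ^ 2) * (N x * N1 x)| := le_abs_self _
              _ = |1 - ν + m / x ^ 2| * |N x * N1 x| := abs_mul _ _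
              _ ≤ _ := by gcongr
          have a2 : 2 * |N x * N1 x| ≤ N1 x ^ 2 + N x ^ 2 := by
            rw [abs_mul]
            nlinarith [sq_nonneg (|N x| - |N1 x|), sq_abs (N x), sq_abs (N1 x)]
          have a3 : 0 ≤ K := (abs_nonneg _).trans hk
          nlinarith
        have t3 : 2 * N1 x * (-(N1 x / x) - (ν - m / x ^ 2) * N x) + 2 * N x * N1 x =
          - 2 * (N1 x ^ 2 / x) + 2 * ((1 - ν + m / x ^ 2) * (N x * N1 x)) := by ring
        rw [t3]; linarith
      have hp := Real.exp_pos (-K * x)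
      nlinarith
  have hEr := hanti ⟨le_rfl, hsR⟩ hr hr.1
  have : E s = 0 := by simp [E, h0, h1]
  rw [this] at hEr
  have hp := Real.exp_pos (-K * r)
  have : N1 r ^ 2 + N r ^ 2 ≤ 0 := by
    by_contra hc
    push Not at hc
    have := mul_pos hc hp
    exact absurd hEr (not_le.2 this)
  have : N r ^ 2 = 0 := le_antisymm (by nlinarith [sq_nonneg (N1 r)]) (sq_nonneg _)
  exact pow_eq_zero_iff two_ne_zero |>.1 this

/-- unit direction -/
def dr (θ : ℝ) : E2 := Real.cos θ • e0 + Real.sin θ • e1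
/-- its derivative -/
def dr' (θ : ℝ) : E2 := (-Real.sin θ) • e0 + Real.cos θ • e1

lemma dr_hasDerivAt (θ : ℝ) : HasDerivAt dr (dr' θ) θ :=
  ((Real.hasDerivAt_cos θ).smul_const e0).add ((Real.hasDerivAt_sin θ).smul_const e1)
lemma dr'_hasDerivAt (θ : ℝ) : HasDerivAt dr' (-dr θ) θ := by
  have := ((Real.hasDerivAt_sin θ).neg.smul_const e0).add ((Real.hasDerivAt_cos θ).smul_const e1)
  convert! this using 1
  unfold dr; module
lemma dr_cont : Continuous dr := continuous_iff_continuousAt.2 fun θ => (dr_hasDerivAt θ).continuousAt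
lemma dr'_cont : Continuous dr' := continuous_iff_continuousAt.2 fun θ => (dr'_hasDerivAt θ).continuousAt
lemma dr_OF (θ : ℝ) : OF (dr θ) (dr' θ) := by
  have := Real.sin_sq_add_cos_sq θ
  refine ⟨?_, ?_, ?_⟩ <;> simp [dr, dr'] <;> linarith
lemma dr_norm (θ : ℝ) : ‖dr θ‖ = 1 := by
  have h := (dr_OF θ).1
  rw [EuclideanSpace.norm_eq, Real.sqrt_eq_one]
  simpa [Fin.sum_univ_two] using h

variable {v : E2 → ℝ} {x : E2} {R ν : ℝ}

lemma polar_mem {r : ℝ} (hr : r ∈ Ioo (-R) R) (θ : ℝ) : x + r • dr θ ∈ Metric.ball x R := by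
  rw [Metric.mem_ball, dist_eq_norm, add_sub_cancel_left, norm_smul, dr_norm, mul_one, Real.norm_eq_abs, abs_lt]
  exact hr

lemma chain_clm {D : E2 → E2 →L[ℝ] ℝ} {A : E2 →L[ℝ] E2 →L[ℝ] ℝ} {γ e : ℝ → E2} {γ' e' : E2} {s : ℝ}
    (h : HasFDerivAt D A (γ s)) (hγ : HasDerivAt γ γ' s) (he : HasDerivAt e e' s) :
    HasDerivAt (fun s => D (γ s) (e s)) (A γ' (e s) + D (γ s) e') s :=
  (h.comp_hasDerivAt s hγ).clm_apply he

lemma chain_clm0 {D : E2 → E2 →L[ℝ] ℝ} {A : E2 →L[ℝ] E2 →L[ℝ] ℝ} {γ : ℝ → E2} {γ' : E2} {s : ℝ} (e : E2)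
    (h : HasFDerivAt D A (γ s)) (hγ : HasDerivAt γ γ' s) :
    HasDerivAt (fun s => D (γ s) e) (A γ' e) s := by
  have := chain_clm h hγ (hasDerivAt_const s e)
  rw [map_zero, add_zero] at this
  exact this

set_option maxHeartbeats 1000000 in
/-- The angular Fourier coefficients of a solution satisfy the Bessel equation. -/
lemma polar_ode (hv : ContDiffOn ℝ 2 v (Metric.ball x R))
    (hlap : ∀ p ∈ Metric.ball x R, lap v p = -ν * v p)
    {c c' : ℝ → ℝ} {m : ℝ} (hc : ∀ θ, HasDerivAt c (c' θ) θ) (hc' : ∀ θ, HasDerivAt c' (-m * c θ) θ)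
    (hp : c (2 * Real.pi) = c 0) (hp' : c' (2 * Real.pi) = c' 0) :
    ∃ N1 N2 : ℝ → ℝ, (∀ r ∈ Ioo (-R) R,
        HasDerivAt (fun r => ∫ θ in (0:ℝ)..(2 * Real.pi), v (x + r • dr θ) * c θ) (N1 r) r) ∧
      (∀ r ∈ Ioo (-R) R, HasDerivAt N1 (N2 r) r) ∧
      (∀ r ∈ Ioo (-R) R, r ^ 2 * N2 r + r * N1 r +
        (ν * r ^ 2 - m) * (∫ θ in (0:ℝ)..(2 * Real.pi), v (x + r • dr θ) * c θ) = 0) ∧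
      N1 0 = ∫ θ in (0:ℝ)..(2 * Real.pi), fderiv ℝ v x (dr θ) * c θ := by
  set B := Metric.ball x R
  have hBo : IsOpen B := Metric.isOpen_ball
  have hcc : Continuous c := continuous_iff_continuousAt.2 fun θ => (hc θ).continuousAt
  have hcc' : Continuous c' := continuous_iff_continuousAt.2 fun θ => (hc' θ).continuousAt
  have hv1 : ContDiffOn ℝ 1 (fderiv ℝ v) B := hv.fderiv_of_isOpen hBo (by norm_num)
  have hv2 : ContinuousOn (fderiv ℝ (fderiv ℝ v)) B := hv1.continuousOn_fderiv_of_isOpen hBo (by norm_num)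
  have hvd : ∀ p ∈ B, HasFDerivAt v (fderiv ℝ v p) p := fun p hp =>
    ((hv.differentiableOn (by norm_num)).differentiableAt (hBo.mem_nhds hp)).hasFDerivAt
  have hvd1 : ∀ p ∈ B, HasFDerivAt (fderiv ℝ v) (fderiv ℝ (fderiv ℝ v) p) p := fun p hp =>
    ((hv1.differentiableOn (by norm_num)).differentiableAt (hBo.mem_nhds hp)).hasFDerivAt
  have hP : ContinuousOn (fun q : ℝ × ℝ => x + q.1 • dr q.2) (Ioo (-R) R ×ˢ univ) := by
    have := dr_cont
    exact Continuous.continuousOn (by fun_prop)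
  have hPm : MapsTo (fun q : ℝ × ℝ => x + q.1 • dr q.2) (Ioo (-R) R ×ˢ univ) B :=
    fun q hq => polar_mem hq.1 _
  have cdr : ContinuousOn (fun q : ℝ × ℝ => dr q.2) (Ioo (-R) R ×ˢ univ) :=
    (dr_cont.comp continuous_snd).continuousOn
  have ccc : ContinuousOn (fun q : ℝ × ℝ => c q.2) (Ioo (-R) R ×ˢ univ) :=
    (hcc.comp continuous_snd).continuousOn
  have g0 : ContinuousOn (fun q : ℝ × ℝ => v (x + q.1 • dr q.2) * c q.2) (Ioo (-R) R ×ˢ univ) :=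
    (hv.continuousOn.comp hP hPm).mul ccc
  have g1 : ContinuousOn (fun q : ℝ × ℝ => fderiv ℝ v (x + q.1 • dr q.2) (dr q.2) * c q.2)
      (Ioo (-R) R ×ˢ univ) :=
    ((hv1.continuousOn.comp hP hPm).clm_apply cdr).mul ccc
  have g2 : ContinuousOn (fun q : ℝ × ℝ =>
      fderiv ℝ (fderiv ℝ v) (x + q.1 • dr q.2) (dr q.2) (dr q.2) * c q.2) (Ioo (-R) R ×ˢ univ) :=
    (((hv2.comp hP hPm).clm_apply cdr).clm_apply cdr).mul ccc
  have hrd : ∀ θ r : ℝ, HasDerivAt (fun r : ℝ => x + r • dr θ) (dr θ) r := by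
    intro θ r
    simpa using ((hasDerivAt_id r).smul_const (dr θ)).const_add x
  have hθd : ∀ r θ : ℝ, HasDerivAt (fun θ : ℝ => x + r • dr θ) (r • dr' θ) θ := by
    intro r θ
    exact ((dr_hasDerivAt θ).const_smul r).const_add x
  refine ⟨fun r => ∫ θ in (0:ℝ)..(2 * Real.pi), fderiv ℝ v (x + r • dr θ) (dr θ) * c θ,
    fun r => ∫ θ in (0:ℝ)..(2 * Real.pi), fderiv ℝ (fderiv ℝ v) (x + r • dr θ) (dr θ) (dr θ) * c θ,
    ?_, ?_, ?_, ?_⟩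
  · refine deriv_param g0 g1 fun r hr θ => ?_
    exact (((hvd _ (polar_mem hr θ)).comp_hasDerivAt r (hrd θ r)).mul_const (c θ))
  · refine deriv_param (g := fun r θ => fderiv ℝ v (x + r • dr θ) (dr θ) * c θ)
      (g' := fun r θ => fderiv ℝ (fderiv ℝ v) (x + r • dr θ) (dr θ) (dr θ) * c θ) g1 g2 fun r hr θ => ?_
    have hd : HasFDerivAt (fderiv ℝ v) (fderiv ℝ (fderiv ℝ v) (x + r • dr θ))
      ((fun r : ℝ => x + r • dr θ) r) := hvd1 _ (polar_mem hr θ)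
    have := (chain_clm0 (dr θ) hd (hrd θ r)).mul_const (c θ)
    exact this
  · intro r hr
    -- slices
    have sl : ∀ {k : ℝ × ℝ → ℝ}, ContinuousOn k (Ioo (-R) R ×ˢ univ) →
        Continuous (fun θ => k (r, θ)) := by
      intro k hk
      rw [← continuousOn_univ]
      exact hk.comp (f := fun θ : ℝ => (r, θ)) (by fun_prop) (fun θ _ => ⟨hr, mem_univ _⟩)
    have i0 := sl g0
    have i1 := sl g1
    have i2 := sl g2
    simp only at i0 i1 i2
    set P : ℝ → E2 := fun θ => x + r • dr θ with hPdef
    have hPB : ∀ θ, P θ ∈ B := fun θ => polar_mem hr θ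
    -- antiderivative of the angular part
    set W : ℝ → ℝ := fun θ => r * fderiv ℝ v (P θ) (dr' θ) * c θ - v (P θ) * c' θ with hW
    have hWd : ∀ θ, HasDerivAt W
        (r ^ 2 * (lap v (P θ) - fderiv ℝ (fderiv ℝ v) (P θ) (dr θ) (dr θ)) * c θ
          - r * (fderiv ℝ v (P θ) (dr θ)) * c θ + m * (v (P θ) * c θ)) θ := by
      intro θ
      have hd : HasFDerivAt (fderiv ℝ v) (fderiv ℝ (fderiv ℝ v) (P θ)) (P θ) := hvd1 _ (hPB θ)
      have d1 := chain_clm (γ := P) hd (hθd r θ) (dr'_hasDerivAt θ)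
      have d2 := (hvd _ (hPB θ)).comp_hasDerivAt θ (hθd r θ)
      have := ((d1.const_mul r).mul (hc θ)).sub (d2.mul (hc' θ))
      convert! this using 1
      have hl : lap v (P θ) - fderiv ℝ (fderiv ℝ v) (P θ) (dr θ) (dr θ) =
          fderiv ℝ (fderiv ℝ v) (P θ) (dr' θ) (dr' θ) := by
        have hcd : ContDiffAt ℝ 2 v (P θ) := hv.contDiffAt (hBo.mem_nhds (hPB θ))
        rw [lap_frame (dr_OF θ) hcd, mixed_lin1 hcd, mixed_lin1 hcd]; ring
      rw [hl]
      simp only [Function.comp, map_smul, map_neg, smul_eq_mul, smul_apply]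
      ring
    have hintg : Continuous (fun θ => r ^ 2 * (lap v (P θ) - fderiv ℝ (fderiv ℝ v) (P θ) (dr θ) (dr θ)) * c θ
          - r * (fderiv ℝ v (P θ) (dr θ)) * c θ + m * (v (P θ) * c θ)) := by
      have : (fun θ => r ^ 2 * (lap v (P θ) - fderiv ℝ (fderiv ℝ v) (P θ) (dr θ) (dr θ)) * c θ
          - r * (fderiv ℝ v (P θ) (dr θ)) * c θ + m * (v (P θ) * c θ)) =
          fun θ => r ^ 2 * (-ν) * (v (P θ) * c θ) - r ^ 2 * (fderiv ℝ (fderiv ℝ v) (P θ) (dr θ) (dr θ) * c θ)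
           - r * (fderiv ℝ v (P θ) (dr θ) * c θ) + m * (v (P θ) * c θ) := by
        funext θ; rw [hlap _ (hPB θ)]; ring
      rw [this]; fun_prop
    have hFTC := intervalIntegral.integral_eq_sub_of_hasDerivAt (a := 0) (b := 2 * Real.pi)
      (fun θ _ => hWd θ) (hintg.intervalIntegrable _ _)
    have hdr : dr (2 * Real.pi) = dr 0 := by simp [dr]
    have hdr' : dr' (2 * Real.pi) = dr' 0 := by simp [dr']
    have hWe : W (2 * Real.pi) - W 0 = 0 := by
      simp only [hW, hPdef, hdr, hdr', hp, hp']; ring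
    rw [hWe] at hFTC
    have : (fun θ => r ^ 2 * (lap v (P θ) - fderiv ℝ (fderiv ℝ v) (P θ) (dr θ) (dr θ)) * c θ
          - r * (fderiv ℝ v (P θ) (dr θ)) * c θ + m * (v (P θ) * c θ)) =
          fun θ => (m - ν * r ^ 2) * (v (P θ) * c θ) - (r ^ 2 * (fderiv ℝ (fderiv ℝ v) (P θ) (dr θ) (dr θ) * c θ)
           + r * (fderiv ℝ v (P θ) (dr θ) * c θ)) := by
        funext θ; rw [hlap _ (hPB θ)]; ring
    rw [this, intervalIntegral.integral_sub, intervalIntegral.integral_add,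
      intervalIntegral.integral_const_mul, intervalIntegral.integral_const_mul,
      intervalIntegral.integral_const_mul] at hFTC
    · linarith
    all_goals apply Continuous.intervalIntegrable; fun_prop
  · simp

/-- Circular means of a solution vanishing at the centre vanish. -/
lemma circ_mean_zero (hv : ContDiffOn ℝ 2 v (Metric.ball x R))
    (hlap : ∀ p ∈ Metric.ball x R, lap v p = -ν * v p) (h0 : v x = 0) :
    ∀ r ∈ Ico 0 R, ∫ θ in (0:ℝ)..(2 * Real.pi), v (x + r • dr θ) = 0 := by
  obtain ⟨N1, N2, h1, h2, h3, h4⟩ := polar_ode hv hlap (c := fun _ => 1) (c' := fun _ => 0) (m := 0)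
    (fun θ => hasDerivAt_const _ _) (fun θ => by simpa using hasDerivAt_const θ (0:ℝ)) rfl rfl
  simp only [mul_one] at h1 h2 h3 h4
  have hN10 : N1 0 = 0 := by
    rw [h4]
    have : ∀ θ, fderiv ℝ v x (dr θ) = Real.cos θ * fderiv ℝ v x e0 + Real.sin θ * fderiv ℝ v x e1 := by
      intro θ; simp [dr]
    simp only [this]
    rw [intervalIntegral.integral_add, intervalIntegral.integral_mul_const,
      intervalIntegral.integral_mul_const, integral_cos, integral_sin]
    · simp
    all_goals apply Continuous.intervalIntegrable; fun_prop
  exact ode_uniq (m := 0) (ν := ν) le_rfl h1 h2 (fun r hr => h3 r ⟨by linarith [hr.1, hr.2], hr.2⟩)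
    (by simp [h0]) hN10 (Or.inr rfl)

/-- If a solution vanishes near the centre, all its angular Fourier coefficients vanish. -/
lemma circ_coeff_zero (hv : ContDiffOn ℝ 2 v (Metric.ball x R))
    (hlap : ∀ p ∈ Metric.ball x R, lap v p = -ν * v p) {ε : ℝ} (hε : 0 < ε)
    (h0 : ∀ p ∈ Metric.ball x ε, v p = 0)
    {c c' : ℝ → ℝ} {m : ℝ} (hc : ∀ θ, HasDerivAt c (c' θ) θ) (hc' : ∀ θ, HasDerivAt c' (-m * c θ) θ)
    (hp : c (2 * Real.pi) = c 0) (hp' : c' (2 * Real.pi) = c' 0) :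
    ∀ r ∈ Ico 0 R, ∫ θ in (0:ℝ)..(2 * Real.pi), v (x + r • dr θ) * c θ = 0 := by
  obtain ⟨N1, N2, h1, h2, h3, h4⟩ := polar_ode hv hlap hc hc' hp hp'
  intro r hr
  have hz : ∀ r ∈ Ioo (-ε) ε, (∫ θ in (0:ℝ)..(2 * Real.pi), v (x + r • dr θ) * c θ) = 0 := by
    intro r hr
    have : ∀ θ, v (x + r • dr θ) = 0 := fun θ => h0 _ (polar_mem hr θ)
    simp [this]
  by_cases hrε : r < ε / 2
  · exact hz r ⟨by linarith [hr.1], by linarith⟩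
  push Not at hrε
  have hmem : ε / 2 ∈ Ioo (-R) R := ⟨by linarith [hr.2], by linarith [hr.2]⟩
  refine ode_uniq (m := m) (ν := ν) (s := ε / 2) (by linarith) h1 h2
    (fun r hr => h3 r ⟨by linarith [hr.1, hr.2], hr.2⟩) (hz _ ⟨by linarith, by linarith⟩) ?_
    (Or.inl (by linarith)) r ⟨hrε, hr.2⟩
  refine (h1 _ hmem).unique ?_
  refine (hasDerivAt_const (ε / 2) (0:ℝ)).congr_of_eventuallyEq ?_
  filter_upwards [isOpen_Ioo.mem_nhds (show ε / 2 ∈ Ioo (-ε) ε from ⟨by linarith, by linarith⟩)] with s hs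
  exact hz s hs
end

noncomputable section

/-! ### Mean value property and unique continuation on balls -/

lemma two_le_top : (2 : WithTop ℕ∞) ≤ ((⊤ : ℕ∞) : WithTop ℕ∞) := by
  have : ((2 : ℕ∞) : WithTop ℕ∞) ≤ ((⊤ : ℕ∞) : WithTop ℕ∞) := WithTop.coe_le_coe.2 le_top
  exact this

lemma lap_ridge {C C1 C2 : ℝ → ℝ} (h1 : ∀ t, HasDerivAt C (C1 t) t) (h2 : ∀ t, HasDerivAt C1 (C2 t) t)
    (τ : E2) (t0 : ℝ) :
    (∀ p w, fderiv ℝ (fun p : E2 => C (dt p τ + t0)) p w = C1 (dt p τ + t0) * dt w τ) ∧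
    (∀ p, lap (fun p : E2 => C (dt p τ + t0)) p = C2 (dt p τ + t0) * dt τ τ) := by
  have hd : ∀ p : E2, HasFDerivAt (fun p : E2 => dt p τ + t0) (innerSL ℝ τ) p := by
    intro p
    have : (fun p : E2 => dt p τ + t0) = fun p => innerSL ℝ τ p + t0 := by
      funext p; rw [innerSL_apply_apply, real_inner_comm, inner_eq_dt]
    rw [this]
    exact (innerSL ℝ τ).hasFDerivAt.add_const _
  have gen : ∀ {C C1 : ℝ → ℝ}, (∀ t, HasDerivAt C (C1 t) t) → ∀ p w,
      fderiv ℝ (fun p : E2 => C (dt p τ + t0)) p w = C1 (dt p τ + t0) * dt w τ := by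
    intro C C1 h p w
    have := ((h (dt p τ + t0)).comp_hasFDerivAt p (hd p)).fderiv
    simp only [Function.comp_def] at this
    rw [this]
    simp only [smul_apply, innerSL_apply_apply, smul_eq_mul]
    rw [real_inner_comm, inner_eq_dt]
  refine ⟨gen h1, fun p => ?_⟩
  have hm : ∀ v, mixedDeriv (fun p : E2 => C (dt p τ + t0)) p v v = C2 (dt p τ + t0) * dt v τ * dt v τ := by
    intro v
    unfold mixedDeriv
    have : (fun y => fderiv ℝ (fun p : E2 => C (dt p τ + t0)) y v) =
      fun y => (fun t => C1 t * dt v τ) (dt y τ + t0) := by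
      funext y; exact gen h1 y v
    rw [this, gen (C1 := fun t => C2 t * dt v τ) (fun t => (h2 t).mul_const _)]
  unfold lap
  rw [hm, hm]
  simp [dt]; ring

lemma exists_CC (ν : ℝ) : ∃ C C1 : ℝ → ℝ, ContDiff ℝ (⊤ : ℕ∞) C ∧ (∀ t, HasDerivAt C (C1 t) t) ∧
    (∀ t, HasDerivAt C1 (-ν * C t) t) ∧ C 0 = 1 := by
  rcases le_total 0 ν with h | h
  · have hs := Real.mul_self_sqrt h
    set k := Real.sqrt ν
    refine ⟨fun t => Real.cos (k * t), fun t => -Real.sin (k * t) * k, by fun_prop, ?_, ?_, by simp⟩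
    · intro t
      simpa using (((hasDerivAt_id t).const_mul k)).cos
    · intro t
      have := ((((hasDerivAt_id t).const_mul k)).sin.neg.mul_const k)
      convert! this using 1
      simp only [id, mul_one]; rw [← hs]; ring
  · have hs := Real.mul_self_sqrt (show 0 ≤ -ν by linarith)
    set k := Real.sqrt (-ν)
    refine ⟨fun t => Real.cosh (k * t), fun t => Real.sinh (k * t) * k, by fun_prop, ?_, ?_, by simp⟩
    · intro t
      simpa using (((hasDerivAt_id t).const_mul k)).cosh
    · intro t
      have := ((((hasDerivAt_id t).const_mul k)).sinh.mul_const k)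
      convert! this using 1
      simp only [id, mul_one]; rw [← hs]; ring

/-- radial bump of radius `R` -/
def bmp (R : ℝ) (y : E2) : ℝ := Real.smoothTransition (1 - dt y y / R ^ 2)

lemma dt_self (y : E2) : dt y y = ‖y‖ ^ 2 := by
  rw [← inner_eq_dt, real_inner_self_eq_norm_sq]

lemma bmp_contDiff (R : ℝ) : ContDiff ℝ (⊤ : ℕ∞) (bmp R) := by
  unfold bmp
  apply Real.smoothTransition.contDiff.comp
  unfold dt
  fun_prop

lemma bmp_zero {R : ℝ} (hR : 0 < R) {y : E2} (hy : R ≤ ‖y‖) : bmp R y = 0 := by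
  apply Real.smoothTransition.zero_of_nonpos
  rw [dt_self]
  have : 1 ≤ ‖y‖ ^ 2 / R ^ 2 := by
    rw [le_div_iff₀ (by positivity)]; rw [one_mul]; gcongr
  linarith

lemma bmp_pos {R : ℝ} (hR : 0 < R) {y : E2} (hy : ‖y‖ < R) : 0 < bmp R y := by
  apply Real.smoothTransition.pos_of_pos
  rw [dt_self]
  have : ‖y‖ ^ 2 / R ^ 2 < 1 := by
    rw [div_lt_one (by positivity)]; gcongr
  linarith

lemma bmp_nonneg (R : ℝ) (y : E2) : 0 ≤ bmp R y := Real.smoothTransition.nonneg _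
lemma bmp_le_one (R : ℝ) (y : E2) : bmp R y ≤ 1 := Real.smoothTransition.le_one _

lemma bmp_polar (R r θ : ℝ) : bmp R (r • dr θ) = Real.smoothTransition (1 - r ^ 2 / R ^ 2) := by
  unfold bmp; rw [dt_self, norm_smul, dr_norm]; simp

lemma bmp_support {R : ℝ} (hR : 0 < R) : HasCompactSupport (bmp R) := by
  apply HasCompactSupport.of_support_subset_isCompact (isCompact_closedBall (0 : E2) R)
  intro y hy
  rw [mem_closedBall_zero_iff]
  by_contra hc
  push Not at hc
  exact hy (bmp_zero hR hc.le)

open MeasureTheory in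
lemma polar_zero {G : E2 → ℝ} {x : E2} {R : ℝ} (hG : Continuous G) (h0 : ∀ y, R ≤ ‖y - x‖ → G y = 0)
    (hm : ∀ r ∈ Ico 0 R, ∫ θ in (0:ℝ)..(2 * Real.pi), G (x + r • dr θ) = 0) : ∫ y, G y = 0 := by
  rw [← integral_fr (o := x) OF_std G, ← integral_comp_polarCoord_symm]
  have hF : ∀ p : ℝ × ℝ, p.1 • G (fr x e0 e1 (polarCoord.symm p)) = p.1 * G (x + p.1 • dr p.2) := by
    intro p
    rw [smul_eq_mul]; congr 2
    simp only [fr, polarCoord_symm_apply, dr, smul_add, smul_smul, add_assoc]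
  simp only [hF]
  have hc : Continuous (fun p : ℝ × ℝ => p.1 * G (x + p.1 • dr p.2)) := by
    have := dr_cont
    fun_prop
  have hz : ∀ r θ : ℝ, 0 < r → R ≤ r → G (x + r • dr θ) = 0 := by
    intro r θ hr hRr
    apply h0
    rw [add_sub_cancel_left, norm_smul, dr_norm, mul_one, Real.norm_eq_abs, abs_of_pos hr]
    exact hRr
  have hintg : IntegrableOn (fun p : ℝ × ℝ => p.1 * G (x + p.1 • dr p.2)) (Ioi 0 ×ˢ Ioo (-Real.pi) Real.pi) := by
    have h1 : IntegrableOn (fun p : ℝ × ℝ => p.1 * G (x + p.1 • dr p.2)) (Icc 0 R ×ˢ Icc (-Real.pi) Real.pi) :=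
      hc.continuousOn.integrableOn_compact (isCompact_Icc.prod isCompact_Icc)
    refine h1.of_forall_sdiff_eq_zero (measurableSet_Ioi.prod measurableSet_Ioo) ?_
    rintro ⟨r, θ⟩ ⟨⟨hr, hθ⟩, hn⟩
    simp only [mem_Ioi] at hr
    have : R ≤ r := by
      by_contra hc
      push Not at hc
      exact hn ⟨⟨hr.le, hc.le⟩, hθ.1.le, hθ.2.le⟩
    simp [hz r θ hr this]
  have ht : polarCoord.target = Ioi (0:ℝ) ×ˢ Ioo (-Real.pi) Real.pi := rfl
  rw [ht, Measure.volume_eq_prod, setIntegral_prod _ hintg]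
  rw [setIntegral_congr_fun (g := fun _ => 0) measurableSet_Ioi]
  · simp
  · intro r hr
    simp only [mem_Ioi] at hr
    simp only
    by_cases hRr : R ≤ r
    · simp [hz r _ hr hRr]
    · push Not at hRr
      rw [integral_const_mul, ← integral_Ioc_eq_integral_Ioo, ← intervalIntegral.integral_of_le (by linarith [Real.pi_pos])]
      have hper : Function.Periodic (fun θ => G (x + r • dr θ)) (2 * Real.pi) := by
        intro θ; simp [dr]
      have := hper.intervalIntegral_add_eq (-Real.pi) 0
      rw [show -Real.pi + 2 * Real.pi = Real.pi by ring, zero_add, hm r ⟨hr.le, hRr⟩] at this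
      rw [this, mul_zero]

/-- continuity of a product cut off by a bump -/
lemma cutoff_cont {v : E2 → ℝ} {x : E2} {R R' : ℝ} (hR : 0 < R) (hRR : R < R')
    (hv : ContinuousOn v (Metric.ball x R')) : Continuous (fun y => v y * bmp R (y - x)) := by
  have hb := (bmp_contDiff R).continuous
  rw [continuous_iff_continuousAt]
  intro y
  by_cases hy : y ∈ Metric.ball x R'
  · exact (hv.continuousAt (Metric.isOpen_ball.mem_nhds hy)).mul (by fun_prop)
  · have : (fun y => v y * bmp R (y - x)) =ᶠ[nhds y] fun _ => 0 := by
      have hopen : IsOpen {z : E2 | R < ‖z - x‖} := isOpen_lt continuous_const (by fun_prop)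
      have hmem : y ∈ {z : E2 | R < ‖z - x‖} := by
        rw [Metric.mem_ball, dist_eq_norm] at hy
        simp only [mem_ofPred_eq]; linarith
      filter_upwards [hopen.mem_nhds hmem] with z hz
      rw [bmp_zero hR (le_of_lt hz), mul_zero]
    exact this.continuousAt

open MeasureTheory in
/-- Mean value property. -/
lemma mvp {C C1 : ℝ → ℝ} {ν : ℝ} (hC : ContDiff ℝ (⊤ : ℕ∞) C) (h1 : ∀ t, HasDerivAt C (C1 t) t)
    (h2 : ∀ t, HasDerivAt C1 (-ν * C t) t) (hC0 : C 0 = 1)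
    {v : E2 → ℝ} {x : E2} {R R' : ℝ} (hR : 0 < R) (hRR : R < R')
    (hv : ContDiffOn ℝ 2 v (Metric.ball x R')) (hlap : ∀ p ∈ Metric.ball x R', lap v p = -ν * v p) :
    ∫ y, v y * bmp R (y - x) = v x * ∫ y : E2, bmp R y * C (y 0) := by
  set V : E2 → ℝ := fun p => C (dt p e0 + (-(x 0))) with hV
  have hVe : ∀ p, V p = C (p 0 - x 0) := by intro p; simp [hV, dt, sub_eq_add_neg]
  have hVs : ContDiff ℝ (⊤ : ℕ∞) V := by
    apply hC.comp; unfold dt; fun_prop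
  have hlV : ∀ p, lap V p = -ν * V p := by
    intro p
    rw [(lap_ridge h1 h2 e0 (-(x 0))).2 p]; simp [dt, hV]
  set g : E2 → ℝ := fun p => v p - v x * V p with hg
  have hgs : ContDiffOn ℝ 2 g (Metric.ball x R') :=
    hv.sub ((contDiff_const.mul (hVs.of_le two_le_top)).contDiffOn)
  have hgl : ∀ p ∈ Metric.ball x R', lap g p = -ν * g p := by
    intro p hp
    have a1 : ContDiffAt ℝ 2 v p := hv.contDiffAt (Metric.isOpen_ball.mem_nhds hp)
    have a2 : ContDiffAt ℝ 2 V p := (hVs.of_le two_le_top).contDiffAt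
    have key : ∀ w, mixedDeriv g p w w = mixedDeriv v p w w - v x * mixedDeriv V p w w := by
      intro w
      unfold mixedDeriv
      have hev : (fun y => fderiv ℝ g y w) =ᶠ[nhds p] fun y => fderiv ℝ v y w - v x * fderiv ℝ V y w := by
        filter_upwards [Metric.isOpen_ball.mem_nhds hp] with y hy
        have b1 : DifferentiableAt ℝ v y :=
          (hv.contDiffAt (Metric.isOpen_ball.mem_nhds hy)).differentiableAt (by norm_num)
        have b2 : DifferentiableAt ℝ V y := hVs.differentiable (by simp) y
        have := (b1.hasFDerivAt.sub (b2.hasFDerivAt.const_mul (v x))).fderiv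
        rw [show g = v - fun y => v x * V y from rfl, this]
        simp
      rw [hev.fderiv_eq]
      have c1 : DifferentiableAt ℝ (fun y => fderiv ℝ v y w) p :=
        ((a1.fderiv_right (m := 1) (by norm_num)).differentiableAt (by norm_num)).clm_apply (differentiableAt_const w)
      have c2 : DifferentiableAt ℝ (fun y => fderiv ℝ V y w) p :=
        ((a2.fderiv_right (m := 1) (by norm_num)).differentiableAt (by norm_num)).clm_apply (differentiableAt_const w)
      have := (c1.hasFDerivAt.sub (c2.hasFDerivAt.const_mul (v x))).fderiv
      rw [show (fun y => fderiv ℝ v y w - v x * fderiv ℝ V y w) =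
        (fun y => fderiv ℝ v y w) - fun y => v x * fderiv ℝ V y w from rfl, this]
      simp
    have l1 := hlap p hp
    have l2 := hlV p
    unfold lap at l1 l2 ⊢
    rw [key, key]
    simp only [hg]
    linear_combination l1 - v x * l2
  have hg0 : g x = 0 := by simp [hg, hVe, hC0]
  have hz := circ_mean_zero hgs hgl hg0
  have hGc := cutoff_cont hR hRR hgs.continuousOn
  have hzero : ∫ y, g y * bmp R (y - x) = 0 := by
    refine polar_zero (x := x) (R := R) hGc (fun y hy => by rw [bmp_zero hR hy, mul_zero]) ?_
    intro r hr
    have : ∀ θ, g (x + r • dr θ) * bmp R (x + r • dr θ - x) =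
      g (x + r • dr θ) * Real.smoothTransition (1 - r ^ 2 / R ^ 2) := by
      intro θ; rw [add_sub_cancel_left, bmp_polar]
    simp only [this]
    rw [intervalIntegral.integral_mul_const, hz r ⟨hr.1, by linarith [hr.2]⟩, zero_mul]
  have cs : ∀ {w : E2 → ℝ}, Continuous (fun y => w y * bmp R (y - x)) →
      Integrable (fun y => w y * bmp R (y - x)) := by
    intro w hw
    apply hw.integrable_of_hasCompactSupport
    apply HasCompactSupport.of_support_subset_isCompact (isCompact_closedBall x R)
    intro y hy
    rw [Metric.mem_closedBall, dist_eq_norm]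
    by_contra hc
    push Not at hc
    exact hy (by simp only [bmp_zero hR hc.le, mul_zero])
  have i1 := cs (cutoff_cont hR hRR hv.continuousOn)
  have i2 := cs (cutoff_cont (v := V) hR hRR hVs.continuous.continuousOn)
  have : ∀ y, g y * bmp R (y - x) = v y * bmp R (y - x) - v x * (V y * bmp R (y - x)) := by
    intro y; simp only [hg]; ring
  simp only [this] at hzero
  rw [integral_sub i1 (i2.const_mul _), integral_const_mul, sub_eq_zero] at hzero
  rw [hzero]
  congr 1
  rw [← integral_add_right_eq_self _ x]
  congr 1
  funext y
  rw [hVe]; simp [mul_comm]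

lemma four_zero {h : ℝ → ℝ} (hc : Continuous h) (hp : Function.Periodic h (2 * Real.pi))
    (h1 : ∀ n : ℤ, ∫ θ in (0:ℝ)..(2 * Real.pi), h θ * Real.cos (n * θ) = 0)
    (h2 : ∀ n : ℤ, ∫ θ in (0:ℝ)..(2 * Real.pi), h θ * Real.sin (n * θ) = 0) : ∀ θ, h θ = 0 := by
  have : Fact (0 < 2 * Real.pi) := ⟨by positivity⟩
  have hp' : Function.Periodic (fun θ => (h θ : ℂ)) (2 * Real.pi) := fun θ => by simp only; rw [hp θ]
  have hcl : Continuous (hp'.lift : AddCircle (2 * Real.pi) → ℂ) := by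
    refine continuous_coinduced_dom.2 ?_
    exact Complex.continuous_ofReal.comp hc
  set f : C(AddCircle (2 * Real.pi), ℂ) := ⟨hp'.lift, hcl⟩
  have hf : ∀ n, fourierCoeff f n = 0 := by
    intro n
    rw [fourierCoeff_eq_intervalIntegral _ _ 0, zero_add]
    have : ∀ θ : ℝ, (fourier (-n) (θ : AddCircle (2 * Real.pi)) : ℂ) • f θ =
      ((h θ * Real.cos (n * θ) : ℝ) : ℂ) - ((h θ * Real.sin (n * θ) : ℝ) : ℂ) * Complex.I := by
      intro θ
      have hfθ : f (θ : AddCircle (2 * Real.pi)) = (h θ : ℂ) := rfl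
      rw [hfθ, fourier_coe_apply]
      have : (2 * (Real.pi:ℂ) * Complex.I * ((-n : ℤ) : ℂ) * (θ:ℂ) / ((2 * Real.pi : ℝ) : ℂ)) =
        ((-(n * θ) : ℝ) : ℂ) * Complex.I := by
        have hpi : (Real.pi : ℂ) ≠ 0 := by exact_mod_cast Real.pi_ne_zero
        push_cast
        field_simp
      rw [this, Complex.exp_mul_I, ← Complex.ofReal_cos, ← Complex.ofReal_sin, Real.cos_neg, Real.sin_neg]
      push_cast
      rw [smul_eq_mul]; ring
    simp only [this]
    rw [intervalIntegral.integral_sub, intervalIntegral.integral_mul_const, intervalIntegral.integral_ofReal,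
      intervalIntegral.integral_ofReal, h1, h2]
    · simp
    all_goals apply Continuous.intervalIntegrable; fun_prop
  have hs := hasSum_fourier_series_of_summable (f := f) (by
    have : fourierCoeff f = fun _ => 0 := funext hf
    rw [this]; exact summable_zero)
  simp only [hf, zero_smul] at hs
  have := hs.unique hasSum_zero
  intro θ
  have e : f (θ : AddCircle (2 * Real.pi)) = 0 := by rw [this]; rfl
  have e2 : (h θ : ℂ) = 0 := e
  exact_mod_cast e2

/-- Unique continuation in a ball. -/
lemma uc_ball {v : E2 → ℝ} {x : E2} {R ν ε : ℝ} (hv : ContDiffOn ℝ 2 v (Metric.ball x R))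
    (hlap : ∀ p ∈ Metric.ball x R, lap v p = -ν * v p) (hε : 0 < ε)
    (h0 : ∀ p ∈ Metric.ball x ε, v p = 0) : ∀ p ∈ Metric.ball x R, v p = 0 := by
  have hz : ∀ r ∈ Ico 0 R, ∀ θ, v (x + r • dr θ) = 0 := by
    intro r hr
    have hr' : r ∈ Ioo (-R) R := ⟨by linarith [hr.1, hr.2], hr.2⟩
    apply four_zero
    · rw [← continuousOn_univ]
      have := dr_cont
      exact hv.continuousOn.comp (f := fun θ => x + r • dr θ) (by fun_prop) (fun θ _ => polar_mem hr' θ)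
    · intro θ; simp [dr]
    · intro n
      refine circ_coeff_zero hv hlap hε h0 (c := fun θ => Real.cos (n * θ)) (c' := fun θ => -Real.sin (n * θ) * n)
        (m := n ^ 2) ?_ ?_ ?_ ?_ r hr
      · intro θ; simpa using ((hasDerivAt_id θ).const_mul (n:ℝ)).cos
      · intro θ
        convert! ((hasDerivAt_id θ).const_mul (n:ℝ)).sin.neg.mul_const (n:ℝ) using 1
        simp only [id]; ring
      · simp
      · have := Real.sin_int_mul_pi (2 * n)
        have e : Real.sin (n * (2 * Real.pi)) = 0 := by rw [← this]; push_cast; ring_nf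
        simp only [mul_zero, Real.sin_zero, e]
    · intro n
      refine circ_coeff_zero hv hlap hε h0 (c := fun θ => Real.sin (n * θ)) (c' := fun θ => Real.cos (n * θ) * n)
        (m := n ^ 2) ?_ ?_ ?_ ?_ r hr
      · intro θ; simpa using ((hasDerivAt_id θ).const_mul (n:ℝ)).sin
      · intro θ
        convert! ((hasDerivAt_id θ).const_mul (n:ℝ)).cos.mul_const (n:ℝ) using 1
        simp only [id]; ring
      · have := Real.sin_int_mul_pi (2 * n)
        simp only [mul_zero, Real.sin_zero]
        rw [← this]; push_cast; ring_nf
      · simp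
  intro p hp
  set z : ℂ := ⟨(p - x) 0, (p - x) 1⟩
  have hzn : ‖z‖ = ‖p - x‖ := by
    rw [EuclideanSpace.norm_eq, Complex.norm_def, Complex.normSq_apply]
    simp [z, Fin.sum_univ_two, sq]
  have hpz : p = x + ‖z‖ • dr (Complex.arg z) := by
    have a := Complex.norm_mul_cos_arg z
    have b := Complex.norm_mul_sin_arg z
    apply ext2
    · simp [dr, z]
    · simp [dr, z]
  rw [hpz]
  refine hz _ ⟨norm_nonneg _, ?_⟩ _
  rw [hzn, ← dist_eq_norm]; exact hp
end

noncomputable section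

/-! ### Weyl's lemma -/
open MeasureTheory Filter Topology

def cv (w ρ : E2 → ℝ) (x : E2) : ℝ := ∫ y, w y * ρ (x - y)

lemma cv_eq (w ρ : E2 → ℝ) :
    cv w ρ = convolution w ρ (ContinuousLinearMap.lsmul ℝ ℝ) volume := by
  funext x; rw [convolution_lsmul]; rfl

lemma cv_smooth {w ρ : E2 → ℝ} (hw : LocallyIntegrable w) (hρ : ContDiff ℝ (⊤ : ℕ∞) ρ) (hc : HasCompactSupport ρ) :
    ContDiff ℝ (⊤ : ℕ∞) (cv w ρ) := by
  rw [cv_eq]; exact hc.contDiff_convolution_right _ hw hρ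

lemma cv_fderiv {w ρ : E2 → ℝ} (hw : LocallyIntegrable w) (hρ : ContDiff ℝ (⊤ : ℕ∞) ρ) (hc : HasCompactSupport ρ)
    (x v : E2) : fderiv ℝ (cv w ρ) x v = cv w (fun y => fderiv ℝ ρ y v) x := by
  have h1 : ContDiff ℝ 1 ρ := hρ.of_le (by exact_mod_cast le_top)
  rw [cv_eq, (hc.hasFDerivAt_convolution_right _ hw h1 x).fderiv, convolution_precompR_apply _ hw
    (hc.fderiv ℝ) (h1.continuous_fderiv (by norm_num)), cv_eq]

lemma dir_smooth {ρ : E2 → ℝ} (hρ : ContDiff ℝ (⊤ : ℕ∞) ρ) (v : E2) :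
    ContDiff ℝ (⊤ : ℕ∞) (fun y => fderiv ℝ ρ y v) :=
  (hρ.fderiv_right (m := (⊤ : ℕ∞)) (by exact_mod_cast le_rfl)).clm_apply contDiff_const

lemma dir_supp {ρ : E2 → ℝ} (hc : HasCompactSupport ρ) (v : E2) :
    HasCompactSupport (fun y => fderiv ℝ ρ y v) := hc.fderiv_apply ℝ v

lemma lap_smooth {ρ : E2 → ℝ} (hρ : ContDiff ℝ (⊤ : ℕ∞) ρ) : ContDiff ℝ (⊤ : ℕ∞) (lap ρ) := by
  have := fun v => dir_smooth (dir_smooth hρ v) v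
  exact (this e0).add (this e1)

lemma lap_supp {ρ : E2 → ℝ} (hρ : HasCompactSupport ρ) : HasCompactSupport (lap ρ) := by
  have := fun v => dir_supp (dir_supp hρ v) v
  exact (this e0).add (this e1)

lemma cv_integrable {w ρ : E2 → ℝ} (hw : LocallyIntegrable w) (hρ : Continuous ρ) (hc : HasCompactSupport ρ)
    (x : E2) : Integrable (fun y => w y * ρ (x - y)) := by
  have := hc.convolutionExists_right (ContinuousLinearMap.lsmul ℝ ℝ) hw hρ x
  exact this

lemma cv_lap {w ρ : E2 → ℝ} (hw : LocallyIntegrable w) (hρ : ContDiff ℝ (⊤ : ℕ∞) ρ) (hc : HasCompactSupport ρ)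
    (x : E2) : lap (cv w ρ) x = cv w (lap ρ) x := by
  have key : ∀ v, mixedDeriv (cv w ρ) x v v = cv w (fun y => mixedDeriv ρ y v v) x := by
    intro v
    unfold mixedDeriv
    rw [show (fun y => fderiv ℝ (cv w ρ) y v) = cv w (fun y => fderiv ℝ ρ y v) from
      funext fun y => cv_fderiv hw hρ hc y v]
    exact cv_fderiv hw (dir_smooth hρ v) (dir_supp hc v) x v
  unfold lap
  rw [key, key]
  unfold cv
  rw [← integral_add]
  · congr 1; funext y; ring
  · exact cv_integrable hw (dir_smooth (dir_smooth hρ e0) e0).continuous (dir_supp (dir_supp hc e0) e0) x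
  · exact cv_integrable hw (dir_smooth (dir_smooth hρ e1) e1).continuous (dir_supp (dir_supp hc e1) e1) x

lemma fderiv_refl {ρ : E2 → ℝ} (hρ : ContDiff ℝ (⊤ : ℕ∞) ρ) (x y v : E2) :
    fderiv ℝ (fun y => ρ (x - y)) y v = - fderiv ℝ ρ (x - y) v := by
  have h1 : HasFDerivAt ρ (fderiv ℝ ρ (x - y)) (x - y) := (hρ.differentiable (by simp) _).hasFDerivAt
  have h2 : HasFDerivAt (fun y => x - y) (-ContinuousLinearMap.id ℝ E2) y := (hasFDerivAt_id y).const_sub x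
  have := (h1.comp y h2).fderiv
  simp only [Function.comp_def] at this
  rw [this]; simp

lemma lap_refl {ρ : E2 → ℝ} (hρ : ContDiff ℝ (⊤ : ℕ∞) ρ) (x y : E2) :
    lap (fun y => ρ (x - y)) y = lap ρ (x - y) := by
  have key : ∀ v, mixedDeriv (fun y => ρ (x - y)) y v v = mixedDeriv ρ (x - y) v v := by
    intro v
    unfold mixedDeriv
    rw [show (fun z => fderiv ℝ (fun y => ρ (x - y)) z v) = fun z => - (fun u => fderiv ℝ ρ u v) (x - z) from
      funext fun z => fderiv_refl hρ x z v]
    have := fderiv_refl (dir_smooth hρ v) x y v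
    rw [fderiv_fun_neg]
    simp only [neg_apply]
    rw [this]; simp
  unfold lap; rw [key, key]

/-- distributional solutions -/
def WeakSol (Ω : Set E2) (w : E2 → ℝ) (ν : ℝ) : Prop :=
  ∀ h : E2 → ℝ, ContDiff ℝ (⊤ : ℕ∞) h → HasCompactSupport h → tsupport h ⊆ Ω →
    ∫ y, w y * (lap h y + ν * h y) = 0

lemma moll_sol {Ω : Set E2} {w ρ : E2 → ℝ} {ν ε : ℝ} (hw : LocallyIntegrable w) (hs : WeakSol Ω w ν)
    (hρ : ContDiff ℝ (⊤ : ℕ∞) ρ) (hc : HasCompactSupport ρ) (hρε : tsupport ρ ⊆ Metric.closedBall 0 ε)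
    {x : E2} (hx : Metric.closedBall x ε ⊆ Ω) : lap (cv w ρ) x = -ν * cv w ρ x := by
  have hh : ContDiff ℝ (⊤ : ℕ∞) (fun y => ρ (x - y)) := hρ.comp (by fun_prop)
  have hsub : tsupport (fun y => ρ (x - y)) ⊆ Metric.closedBall x ε := by
    apply closure_minimal _ Metric.isClosed_closedBall
    intro y hy
    have : x - y ∈ tsupport ρ := subset_tsupport _ hy
    have := hρε this
    rw [mem_closedBall_zero_iff] at this
    rwa [Metric.mem_closedBall, dist_comm, dist_eq_norm]
  have hcs : HasCompactSupport (fun y => ρ (x - y)) :=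
    HasCompactSupport.of_support_subset_isCompact (isCompact_closedBall x ε) ((subset_tsupport _).trans hsub)
  have h := hs _ hh hcs (hsub.trans hx)
  rw [cv_lap hw hρ hc]
  have i1 := cv_integrable hw (lap_smooth hρ).continuous (lap_supp hc) x
  have i2 := cv_integrable hw hρ.continuous hc x
  have e : ∀ y, w y * (lap (fun y => ρ (x - y)) y + ν * ρ (x - y)) =
      w y * lap ρ (x - y) + ν * (w y * ρ (x - y)) := by
    intro y; rw [lap_refl hρ]; ring
  simp only [e] at h
  rw [integral_add i1 (i2.const_mul _), integral_const_mul] at h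
  unfold cv
  linarith

lemma kappa_pos {C : ℝ → ℝ} (hC : Continuous C) (hC0 : C 0 = 1) :
    ∃ R0 > 0, ∀ R, 0 < R → R ≤ R0 → 0 < ∫ y : E2, bmp R y * C (y 0) := by
  have : ∀ᶠ t in 𝓝 (0:ℝ), 0 < C t := hC.continuousAt.eventually (lt_mem_nhds (by rw [hC0]; norm_num))
  obtain ⟨R0, hR0, hb⟩ := Metric.eventually_nhds_iff.1 this
  refine ⟨R0, hR0, fun R hR hRR => ?_⟩
  have hcont : Continuous (fun y : E2 => bmp R y * C (y 0)) := by
    have := (bmp_contDiff R).continuous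
    fun_prop
  apply hcont.integral_pos_of_hasCompactSupport_nonneg_nonzero (x := 0)
  · exact (bmp_support hR).mul_right
  · intro y
    by_cases hy : R ≤ ‖y‖
    · simp [bmp_zero hR hy]
    · push Not at hy
      apply mul_nonneg (bmp_nonneg _ _)
      apply le_of_lt
      apply hb
      rw [dist_zero_right]
      exact lt_of_le_of_lt (PiLp.norm_apply_le y 0) (by linarith)
  · have := bmp_pos hR (y := 0) (by simpa using hR)
    simp [hC0, this.ne']

lemma bmp_even (R : ℝ) (y : E2) : bmp R (-y) = bmp R y := by
  unfold bmp; simp [dt]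

lemma weyl_local {Ω : Set E2} {w : E2 → ℝ} {ν : ℝ} (hΩ : IsOpen Ω) (hw : Integrable w) (hs : WeakSol Ω w ν)
    {x0 : E2} (hx0 : x0 ∈ Ω) : ∃ r > 0, ∃ g : E2 → ℝ, ContDiff ℝ (⊤ : ℕ∞) g ∧ Metric.ball x0 r ⊆ Ω ∧
      ∀ᵐ x, x ∈ Metric.ball x0 r → w x = g x := by
  obtain ⟨C, C1, hC, h1, h2, hC0⟩ := exists_CC ν
  obtain ⟨R0, hR0, hκ⟩ := kappa_pos hC.continuous hC0
  obtain ⟨δ, hδ, hball⟩ := Metric.isOpen_iff.1 hΩ x0 hx0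
  set R := min R0 (δ / 4) with hR
  have hRp : 0 < R := lt_min hR0 (by linarith)
  have hRδ : R ≤ δ / 4 := min_le_right _ _
  have hκp := hκ R hRp (min_le_left _ _)
  set κ := ∫ y : E2, bmp R y * C (y 0) with hκd
  have hwl : LocallyIntegrable w := hw.locallyIntegrable
  refine ⟨R, hRp, fun x => κ⁻¹ * cv w (bmp R) x, contDiff_const.mul (cv_smooth hwl (bmp_contDiff R) (bmp_support hRp)),
    (Metric.ball_subset_ball (by linarith)).trans hball, ?_⟩
  set φ : ℕ → ContDiffBump (0 : E2) := fun i => ⟨R / (2 * (i + 2)), R / (i + 2), by positivity, by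
    rw [div_lt_div_iff₀ (by positivity) (by positivity)]; nlinarith [hRp, (Nat.cast_nonneg i : (0:ℝ) ≤ i)]⟩ with hφ
  have hout : Tendsto (fun i => (φ i).rOut) atTop (𝓝 0) := by
    simp only [hφ]
    apply Tendsto.const_div_atTop
    exact tendsto_atTop_add_const_right _ _ tendsto_natCast_atTop_atTop
  have hout2 : ∀ i, (φ i).rOut ≤ R := by
    intro i; simp only [hφ]
    apply div_le_self hRp.le
    linarith [(Nat.cast_nonneg i : (0:ℝ) ≤ i)]
  have hae := ContDiffBump.ae_convolution_tendsto_right_of_locallyIntegrable (μ := volume) (K := 2) hout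
    (Eventually.of_forall fun i => by simp only [hφ]; apply le_of_eq; field_simp) hwl
  filter_upwards [hae] with x hx hxB
  set ρ : ℕ → E2 → ℝ := fun i => (φ i).normed volume with hρ
  have hρs : ∀ i, ContDiff ℝ (⊤ : ℕ∞) (ρ i) := fun i => (φ i).contDiff_normed
  have hρc : ∀ i, HasCompactSupport (ρ i) := fun i => (φ i).hasCompactSupport_normed
  have hρt : ∀ i, tsupport (ρ i) ⊆ Metric.closedBall 0 R := by
    intro i; simp only [hρ]; rw [(φ i).tsupport_normed_eq]
    exact Metric.closedBall_subset_closedBall (hout2 i)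
  have hcve : ∀ i z, convolution (ρ i) w (ContinuousLinearMap.lsmul ℝ ℝ) volume z = cv w (ρ i) z := by
    intro i z; rw [convolution_lsmul_swap]; unfold cv
    congr 1; funext t; rw [smul_eq_mul, mul_comm]
  have hsol : ∀ i, ∀ p ∈ Metric.ball x (2 * R), lap (cv w (ρ i)) p = -ν * cv w (ρ i) p := by
    intro i p hp
    refine moll_sol hwl hs (hρs i) (hρc i) (hρt i) ?_
    intro y hy
    apply hball
    rw [Metric.mem_ball] at hp hxB ⊢
    rw [Metric.mem_closedBall] at hy
    linarith [dist_triangle y p x0, dist_triangle p x x0]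
  have hm : ∀ i, ∫ y, cv w (ρ i) y * bmp R (y - x) = cv w (ρ i) x * κ := fun i =>
    mvp hC h1 h2 hC0 hRp (show R < 2 * R by linarith)
      ((cv_smooth hwl (hρs i) (hρc i)).of_le two_le_top).contDiffOn (hsol i)
  -- rewrite the left side by Fubini
  set b : E2 → ℝ := fun y => bmp R (y - x) with hb
  have hbc : Continuous b := (bmp_contDiff R).continuous.comp (by fun_prop)
  have hbs : HasCompactSupport b := by
    apply HasCompactSupport.of_support_subset_isCompact (isCompact_closedBall x R)
    intro y hy
    rw [Metric.mem_closedBall, dist_eq_norm]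
    by_contra hc
    push Not at hc
    exact hy (bmp_zero hRp hc.le)
  have hbi : Integrable b := hbc.integrable_of_hasCompactSupport hbs
  have hfub : ∀ i, ∫ y, cv w (ρ i) y * b y = ∫ z, w z * convolution (ρ i) b (ContinuousLinearMap.lsmul ℝ ℝ) volume z := by
    intro i
    obtain ⟨M, hM⟩ := (hρs i).continuous.bounded_above_of_compact_support (hρc i)
    have hintg : Integrable (Function.uncurry fun (y z : E2) => w z * ρ i (y - z) * b y) (volume.prod volume) := by
      have hd : Integrable (fun p : E2 × E2 => b p.1 * w p.2) (volume.prod volume) := hbi.mul_prod hw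
      refine (hd.norm.const_mul M).mono' ?_ ?_
      · have e1 : AEStronglyMeasurable (fun p : E2 × E2 => w p.2) (volume.prod volume) := hw.aestronglyMeasurable.comp_snd
        have e2 : Continuous (fun p : E2 × E2 => ρ i (p.1 - p.2)) := (hρs i).continuous.comp (by fun_prop)
        have e3 : Continuous (fun p : E2 × E2 => b p.1) := by fun_prop
        exact (e1.mul e2.aestronglyMeasurable).mul e3.aestronglyMeasurable
      · refine Eventually.of_forall fun p => ?_
        simp only [Function.uncurry, norm_mul]
        calc _ ≤ ‖w p.2‖ * M * ‖b p.1‖ := by gcongr; exact hM _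
          _ = _ := by ring
    have := integral_integral_swap hintg
    calc _ = ∫ y, ∫ z, w z * ρ i (y - z) * b y := by
          congr 1; funext y; unfold cv; rw [integral_mul_const]
      _ = ∫ z, ∫ y, w z * ρ i (y - z) * b y := this
      _ = _ := by
          congr 1; funext z
          simp only [mul_assoc]
          rw [integral_const_mul, convolution_lsmul_swap]
          congr 2; funext y
          rw [smul_eq_mul, ← neg_sub z y]
          simp only [hρ]
          rw [ContDiffBump.normed_neg]
  have hlim : Tendsto (fun i => ∫ z, w z * convolution (ρ i) b (ContinuousLinearMap.lsmul ℝ ℝ) volume z) atTop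
      (𝓝 (∫ z, w z * b z)) := by
    apply tendsto_integral_of_dominated_convergence (fun z => ‖w z‖)
    · intro i
      apply hw.aestronglyMeasurable.mul
      have := (hρc i).contDiff_convolution_left (ContinuousLinearMap.lsmul ℝ ℝ) (n := 0) ((hρs i).of_le (by simp))
        (hbi.locallyIntegrable (μ := volume))
      exact this.continuous.aestronglyMeasurable
    · exact hw.norm
    · intro i
      refine Eventually.of_forall fun z => ?_
      rw [norm_mul]
      apply mul_le_of_le_one_right (norm_nonneg _)
      rw [convolution_lsmul]
      calc _ ≤ ∫ t, ρ i t := by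
            apply norm_integral_le_of_norm_le (φ i).integrable_normed
            refine Eventually.of_forall fun t => ?_
            rw [norm_smul]
            have n1 : ‖ρ i t‖ = ρ i t := by rw [Real.norm_eq_abs, abs_of_nonneg]; exact (φ i).nonneg_normed t
            rw [n1]
            apply mul_le_of_le_one_right ((φ i).nonneg_normed t)
            rw [Real.norm_eq_abs, abs_of_nonneg (bmp_nonneg _ _)]
            exact bmp_le_one _ _
        _ = 1 := (φ i).integral_normed
    · refine Eventually.of_forall fun z => ?_
      exact (ContDiffBump.convolution_tendsto_right_of_continuous hout hbc z).const_mul (w z)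
  have hlim2 : Tendsto (fun i => cv w (ρ i) x * κ) atTop (𝓝 (w x * κ)) := by
    apply Tendsto.mul_const
    exact hx.congr fun i => hcve i x
  have heq : w x * κ = ∫ z, w z * b z := by
    apply tendsto_nhds_unique hlim2
    refine hlim.congr fun i => ?_
    rw [← hfub, hm]
  have : cv w (bmp R) x = ∫ z, w z * b z := by
    unfold cv; congr 1; funext z; simp only [hb]; rw [← neg_sub z x, bmp_even]
  rw [this, ← heq]
  field_simp

lemma int_cs {f g : E2 → ℝ} (hf : Continuous f) (hg : Continuous g) (hc : HasCompactSupport g) :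
    Integrable (fun x => f x * g x) :=
  (hf.mul hg).integrable_of_hasCompactSupport hc.mul_left

lemma green_cs {g h : E2 → ℝ} (hg : ContDiff ℝ (⊤ : ℕ∞) g) (hh : ContDiff ℝ (⊤ : ℕ∞) h) (hc : HasCompactSupport h) :
    ∫ y, g y * lap h y = ∫ y, lap g y * h y := by
  have key : ∀ v, ∫ y, g y * mixedDeriv h y v v = ∫ y, mixedDeriv g y v v * h y := by
    intro v
    have d := dir_smooth hh v
    have d2 := dir_smooth d v
    have dg := dir_smooth hg v
    have dg2 := dir_smooth dg v
    have s1 := dir_supp hc v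
    have s2 := dir_supp s1 v
    unfold mixedDeriv
    rw [integral_mul_fderiv_eq_neg_fderiv_mul_of_integrable (int_cs dg.continuous d.continuous s1)
      (int_cs hg.continuous d2.continuous s2) (int_cs hg.continuous d.continuous s1)
      (fun x _ => hg.differentiable (by simp) x) (fun x _ => d.differentiable (by simp) x),
      integral_mul_fderiv_eq_neg_fderiv_mul_of_integrable (int_cs dg2.continuous hh.continuous hc)
      (int_cs dg.continuous d.continuous s1) (int_cs dg.continuous hh.continuous hc)
      (fun x _ => dg.differentiable (by simp) x) (fun x _ => hh.differentiable (by simp) x), neg_neg]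
  have cm : ∀ {u : E2 → ℝ}, ContDiff ℝ (⊤ : ℕ∞) u → ∀ v, Continuous (fun y => mixedDeriv u y v v) :=
    fun hu v => (dir_smooth (dir_smooth hu v) v).continuous
  have sm : ∀ v, HasCompactSupport (fun y => mixedDeriv h y v v) := fun v => dir_supp (dir_supp hc v) v
  unfold lap
  simp only [mul_add, add_mul]
  rw [integral_add (int_cs hg.continuous (cm hh e0) (sm e0)) (int_cs hg.continuous (cm hh e1) (sm e1)),
    integral_add (int_cs (cm hg e0) hh.continuous hc) (int_cs (cm hg e1) hh.continuous hc), key, key]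

lemma lap_congr {f g : E2 → ℝ} {p : E2} (h : f =ᶠ[𝓝 p] g) : lap f p = lap g p := by
  have key : ∀ v, mixedDeriv f p v v = mixedDeriv g p v v := by
    intro v
    unfold mixedDeriv
    have : (fun y => fderiv ℝ f y v) =ᶠ[𝓝 p] fun y => fderiv ℝ g y v := by
      filter_upwards [h.eventuallyEq_nhds] with y hy
      rw [hy.fderiv_eq]
    rw [this.fderiv_eq]
  unfold lap; rw [key, key]

/-- Weyl's lemma. -/
lemma weyl {Ω : Set E2} {w : E2 → ℝ} {ν : ℝ} (hΩ : IsOpen Ω) (hw : Integrable w) (hs : WeakSol Ω w ν) :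
    ∃ g : E2 → ℝ, ContDiffOn ℝ (⊤ : ℕ∞) g Ω ∧ (∀ p ∈ Ω, lap g p = -ν * g p) ∧ ∀ᵐ x, x ∈ Ω → w x = g x := by
  choose! r hr g hg hsub hae using fun x (hx : x ∈ Ω) => weyl_local hΩ hw hs hx
  -- each local representative solves the equation
  have hloc : ∀ x ∈ Ω, ∀ p ∈ Metric.ball x (r x), lap (g x) p = -ν * g x p := by
    intro x hx
    have hcont : Continuous (fun y => lap (g x) y + ν * g x y) :=
      (lap_smooth (hg x hx)).continuous.add (continuous_const.mul (hg x hx).continuous)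
    have h0 : ∀ᵐ p, p ∈ Metric.ball x (r x) → lap (g x) p + ν * g x p = 0 := by
      apply Metric.isOpen_ball.ae_eq_zero_of_integral_contDiff_smul_eq_zero
      · exact hcont.locallyIntegrable.locallyIntegrableOn _
      · intro h hh hc hsupp
        have e1 := hs h hh hc (hsupp.trans (hsub x hx))
        have e2 : ∫ y, w y * (lap h y + ν * h y) = ∫ y, g x y * (lap h y + ν * h y) := by
          apply integral_congr_ae
          filter_upwards [hae x hx] with y hy
          by_cases hyb : y ∈ tsupport h
          · rw [hy (hsupp hyb)]
          · have hz : h =ᶠ[𝓝 y] fun _ => 0 := by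
              filter_upwards [(isClosed_tsupport h).isOpen_compl.mem_nhds hyb] with z hz
              exact image_eq_zero_of_notMem_tsupport hz
            rw [lap_congr hz, hz.eq_of_nhds]
            simp [lap, mixedDeriv]
        rw [e2] at e1
        simp only [mul_add] at e1
        have i2 : Integrable (fun y => g x y * (ν * h y)) :=
          int_cs (g := fun y => ν * h y) (hg x hx).continuous (continuous_const.mul hh.continuous) (hc.mul_left)
        rw [integral_add (int_cs (hg x hx).continuous (lap_smooth hh).continuous (lap_supp hc))
          i2,
          green_cs (hg x hx) hh hc, ← integral_add (int_cs (lap_smooth (hg x hx)).continuous hh.continuous hc)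
          i2] at e1
        rw [← e1]
        congr 1; funext y; rw [smul_eq_mul]; ring
    have h1 := Measure.eqOn_open_of_ae_eq (μ := (volume : Measure E2)) (f := fun y => lap (g x) y + ν * g x y)
      (g := fun _ => 0) (U := Metric.ball x (r x))
      ((ae_restrict_iff' Metric.isOpen_ball.measurableSet).2 h0) Metric.isOpen_ball hcont.continuousOn continuousOn_const
    intro p hp
    have := h1 hp
    simp only at this
    linarith
  -- compatibility
  have hcomp : ∀ x ∈ Ω, ∀ p ∈ Metric.ball x (r x), g p p = g x p := by
    intro x hx p hp
    have hpΩ := hsub x hx hp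
    have hU : IsOpen (Metric.ball x (r x) ∩ Metric.ball p (r p)) := Metric.isOpen_ball.inter Metric.isOpen_ball
    refine Measure.eqOn_open_of_ae_eq (μ := (volume : Measure E2)) (f := g p) (g := g x)
      (U := Metric.ball x (r x) ∩ Metric.ball p (r p)) ((ae_restrict_iff' hU.measurableSet).2 ?_) hU
      (hg p hpΩ).continuous.continuousOn (hg x hx).continuous.continuousOn ⟨hp, Metric.mem_ball_self (hr p hpΩ)⟩
    filter_upwards [hae x hx, hae p hpΩ] with z h1 h2 hz
    rw [← h1 hz.1, ← h2 hz.2]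
  have hev : ∀ x ∈ Ω, (fun y => g y y) =ᶠ[𝓝 x] g x := by
    intro x hx
    filter_upwards [Metric.isOpen_ball.mem_nhds (Metric.mem_ball_self (hr x hx))] with y hy
    exact hcomp x hx y hy
  refine ⟨fun y => g y y, ?_, ?_, ?_⟩
  · intro x hx
    exact ((hg x hx).contDiffAt.congr_of_eventuallyEq (hev x hx)).contDiffWithinAt
  · intro p hp
    rw [lap_congr (hev p hp)]
    exact hloc p hp p (Metric.mem_ball_self (hr p hp))
  · rw [ae_iff]
    apply measure_null_of_locally_null
    intro x hx
    have hxΩ : x ∈ Ω := by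
      by_contra hc
      exact hx fun h => absurd h hc
    refine ⟨Metric.ball x (r x) ∩ {y | ¬ (y ∈ Ω → w y = g y y)}, ?_, ?_⟩
    · exact inter_mem (mem_nhdsWithin_of_mem_nhds (Metric.isOpen_ball.mem_nhds (Metric.mem_ball_self (hr x hxΩ))))
        self_mem_nhdsWithin
    · refine measure_mono_null ?_ (ae_iff.1 (hae x hxΩ))
      rintro y ⟨hy, hn⟩ hn2
      apply hn
      intro _
      rw [hn2 hy, hcomp x hxΩ y hy]
end

noncomputable section
open MeasureTheory Filter Topology

/-! ### The class of test functions and the Poincare inequality on convex sets -/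

structure Cl (a b c : E2) (f : E2 → ℝ) : Prop where
  cont : ContinuousOn f (Tri a b c)
  c1 : ContDiffOn ℝ 1 f (interior (Tri a b c))
  bd : ∃ M : ℝ, ∀ p ∈ interior (Tri a b c), ‖fderiv ℝ f p‖ ≤ M

lemma IT_fin (a b c : E2) : volume (interior (Tri a b c)) < ⊤ :=
  lt_of_le_of_lt (measure_mono interior_subset) (Tri_compact a b c).measure_lt_top

lemma intOn_bdd {a b c : E2} {g : E2 → ℝ} (hg : ContinuousOn g (interior (Tri a b c)))
    (hb : ∃ M : ℝ, ∀ p ∈ interior (Tri a b c), ‖g p‖ ≤ M) : IntegrableOn g (interior (Tri a b c)) := by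
  obtain ⟨M, hM⟩ := hb
  have hfin : IsFiniteMeasure (volume.restrict (interior (Tri a b c))) := ⟨by simpa using IT_fin a b c⟩
  exact Integrable.of_bound (hg.aestronglyMeasurable isOpen_interior.measurableSet) M
    ((ae_restrict_iff' isOpen_interior.measurableSet).2 (Eventually.of_forall hM))

lemma int_lin3 {α : Type*} [MeasurableSpace α] {μ : Measure α} {f g h : α → ℝ} (hf : Integrable f μ) (hg : Integrable g μ)
    (hh : Integrable h μ) (r s t : ℝ) :
    Integrable (fun x => r * f x + s * g x + t * h x) μ ∧
    ∫ x, (r * f x + s * g x + t * h x) ∂μ = r * ∫ x, f x ∂μ + s * ∫ x, g x ∂μ + t * ∫ x, h x ∂μ := by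
  have h1 : Integrable (fun x => r * f x + s * g x) μ := (hf.const_mul r).add (hg.const_mul s)
  refine ⟨h1.add (hh.const_mul t), ?_⟩
  rw [integral_add h1 (hh.const_mul t), integral_add (hf.const_mul r) (hg.const_mul s),
    integral_const_mul, integral_const_mul, integral_const_mul]

lemma ii_lin3 {f g h : ℝ → ℝ} {x y : ℝ} (hf : ContinuousOn f (uIcc x y)) (hg : ContinuousOn g (uIcc x y))
    (hh : ContinuousOn h (uIcc x y)) (r s t : ℝ) :
    ∫ z in x..y, (r * f z + s * g z + t * h z) =
      r * (∫ z in x..y, f z) + s * (∫ z in x..y, g z) + t * ∫ z in x..y, h z := by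
  have i1 := hf.intervalIntegrable (μ := volume)
  have i2 := hg.intervalIntegrable (μ := volume)
  have i3 := hh.intervalIntegrable (μ := volume)
  rw [intervalIntegral.integral_add ((i1.const_mul r).add (i2.const_mul s)) (i3.const_mul t),
    intervalIntegral.integral_add (i1.const_mul r) (i2.const_mul s),
    intervalIntegral.integral_const_mul, intervalIntegral.integral_const_mul,
    intervalIntegral.integral_const_mul]

lemma intOn_cont {a b c : E2} {g : E2 → ℝ} (hg : ContinuousOn g (Tri a b c)) :
    IntegrableOn g (interior (Tri a b c)) :=
  (hg.integrableOn_compact (Tri_compact a b c)).mono_set interior_subset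

lemma pd_cont {a b c : E2} {f : E2 → ℝ} (hf : ContDiffOn ℝ 1 f (interior (Tri a b c))) (w : E2) :
    ContinuousOn (fun p => fderiv ℝ f p w) (interior (Tri a b c)) :=
  (hf.continuousOn_fderiv_of_isOpen isOpen_interior le_rfl).clm_apply continuousOn_const

lemma Cl.pd_bd {a b c : E2} {f : E2 → ℝ} (hf : Cl a b c f) (w : E2) :
    ∃ M : ℝ, ∀ p ∈ interior (Tri a b c), ‖fderiv ℝ f p w‖ ≤ M := by
  obtain ⟨M, hM⟩ := hf.bd
  exact ⟨M * ‖w‖, fun p hp => (ContinuousLinearMap.le_opNorm _ _).trans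
    (mul_le_mul_of_nonneg_right (hM p hp) (norm_nonneg _))⟩

lemma gd_cont {a b c : E2} {f g : E2 → ℝ} (hf : ContDiffOn ℝ 1 f (interior (Tri a b c)))
    (hg : ContDiffOn ℝ 1 g (interior (Tri a b c))) : ContinuousOn (gd f g) (interior (Tri a b c)) :=
  ((pd_cont hf e0).mul (pd_cont hg e0)).add ((pd_cont hf e1).mul (pd_cont hg e1))

lemma Cl.gd_int {a b c : E2} {f g : E2 → ℝ} (hf : Cl a b c f) (hg : Cl a b c g) :
    IntegrableOn (gd f g) (interior (Tri a b c)) := by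
  refine intOn_bdd (gd_cont hf.c1 hg.c1) ?_
  obtain ⟨M0, h0⟩ := hf.pd_bd e0
  obtain ⟨M1, h1⟩ := hf.pd_bd e1
  obtain ⟨N0, k0⟩ := hg.pd_bd e0
  obtain ⟨N1, k1⟩ := hg.pd_bd e1
  refine ⟨M0 * N0 + M1 * N1, fun p hp => ?_⟩
  refine (norm_add_le _ _).trans (add_le_add ?_ ?_) <;> rw [norm_mul]
  · exact mul_le_mul (h0 p hp) (k0 p hp) (norm_nonneg _) ((norm_nonneg _).trans (h0 p hp))
  · exact mul_le_mul (h1 p hp) (k1 p hp) (norm_nonneg _) ((norm_nonneg _).trans (h1 p hp))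

lemma Cl.mul_int {a b c : E2} {f g : E2 → ℝ} (hf : Cl a b c f) (hg : Cl a b c g) :
    IntegrableOn (fun p => f p * g p) (interior (Tri a b c)) := intOn_cont (hf.cont.mul hg.cont)

lemma Cl.int {a b c : E2} {f : E2 → ℝ} (hf : Cl a b c f) :
    IntegrableOn f (interior (Tri a b c)) := intOn_cont hf.cont

lemma gd_self_ge (f : E2 → ℝ) (p w : E2) : (fderiv ℝ f p w) ^ 2 ≤ gd f f p * ‖w‖ ^ 2 := by
  rw [lin_decomp, ← dt_self]
  unfold gd dt
  nlinarith [sq_nonneg (w 0 * fderiv ℝ f p e1 - w 1 * fderiv ℝ f p e0)]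

lemma gd_self_nonneg (f : E2 → ℝ) (p : E2) : 0 ≤ gd f f p := by
  unfold gd; nlinarith [mul_self_nonneg (fderiv ℝ f p e0), mul_self_nonneg (fderiv ℝ f p e1)]

lemma seg_ineq {a b c : E2} {f : E2 → ℝ} (hf : ContDiffOn ℝ 1 f (interior (Tri a b c))) {K : Set E2}
    (hK : Convex ℝ K) (hKT : K ⊆ interior (Tri a b c)) {x y : E2} (hx : x ∈ K) (hy : y ∈ K) {d : ℝ}
    (hd : ‖x - y‖ ≤ d) :
    ENNReal.ofReal ((f x - f y) ^ 2) ≤ ENNReal.ofReal (d ^ 2) *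
      ∫⁻ t in Icc (0:ℝ) 1, K.indicator (fun p => ENNReal.ofReal (gd f f p)) (y + t • (x - y)) := by
  have hin : ∀ t ∈ Icc (0:ℝ) 1, y + t • (x - y) ∈ K := fun t ht => by
    exact hK.add_smul_sub_mem hy hx ht
  set φ : ℝ → ℝ := fun t => fderiv ℝ f (y + t • (x - y)) (x - y) with hφ
  have hφc : ContinuousOn φ (Icc 0 1) := by
    have := (pd_cont hf (x - y)).comp (f := fun t : ℝ => y + t • (x - y)) (s := Icc 0 1)
      (by fun_prop) (fun t ht => hKT (hin t ht))
    exact this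
  have hφu : ContinuousOn φ (uIcc 0 1) := by rwa [uIcc_of_le zero_le_one]
  have hftc : ∫ t in (0:ℝ)..1, φ t = f x - f y := by
    have h := intervalIntegral.integral_eq_sub_of_hasDerivAt (a := 0) (b := 1)
      (f := fun t : ℝ => f (y + t • (x - y))) (f' := φ) (fun t ht => by
        rw [uIcc_of_le zero_le_one] at ht
        have hd := ((hf.differentiableOn (by norm_num)).differentiableAt
          (isOpen_interior.mem_nhds (hKT (hin t ht)))).hasFDerivAt
        have h2 : HasDerivAt (fun t : ℝ => y + t • (x - y)) (x - y) t := by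
          simpa using ((hasDerivAt_id t).smul_const (x - y)).const_add y
        exact hd.comp_hasDerivAt t h2) hφu.intervalIntegrable
    rw [h]; simp
  have hcs : (f x - f y) ^ 2 ≤ ∫ t in (0:ℝ)..1, φ t ^ 2 := by
    have h0 : 0 ≤ ∫ t in (0:ℝ)..1, (φ t - (f x - f y)) ^ 2 :=
      intervalIntegral.integral_nonneg zero_le_one fun t _ => sq_nonneg _
    have h1 : ∫ t in (0:ℝ)..1, (φ t - (f x - f y)) ^ 2 =
        (∫ t in (0:ℝ)..1, φ t ^ 2) - (f x - f y) ^ 2 := by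
      have : (fun t => (φ t - (f x - f y)) ^ 2) =
          fun t => 1 * φ t ^ 2 + (-(2 * (f x - f y))) * φ t + (f x - f y) ^ 2 * 1 := by funext t; ring
      rw [this, ii_lin3 (f := fun t => φ t ^ 2) (h := fun _ => 1) (hφu.pow 2) hφu continuousOn_const, hftc]
      simp; ring
    linarith
  have hd0 : 0 ≤ d := (norm_nonneg _).trans hd
  have hle : ∫ t in (0:ℝ)..1, φ t ^ 2 ≤ ∫ t in (0:ℝ)..1, d ^ 2 * gd f f (y + t • (x - y)) := by
    have hgc : ContinuousOn (fun t : ℝ => gd f f (y + t • (x - y))) (uIcc 0 1) := by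
      rw [uIcc_of_le zero_le_one]
      exact (gd_cont hf hf).comp (by fun_prop) (fun t ht => hKT (hin t ht))
    refine intervalIntegral.integral_mono_on zero_le_one (hφu.pow 2).intervalIntegrable
      (continuousOn_const.mul hgc).intervalIntegrable fun t _ => ?_
    refine (gd_self_ge _ _ _).trans ?_
    rw [mul_comm]
    exact mul_le_mul_of_nonneg_right (by gcongr) (gd_self_nonneg _ _)
  refine (ENNReal.ofReal_le_ofReal (hcs.trans hle)).trans (le_of_eq ?_)
  rw [intervalIntegral.integral_const_mul, ENNReal.ofReal_mul (by positivity),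
    intervalIntegral.integral_of_le zero_le_one, ← integral_Icc_eq_integral_Ioc]
  congr 1
  rw [ofReal_integral_eq_lintegral_ofReal]
  · refine setLIntegral_congr_fun measurableSet_Icc fun t ht => ?_
    simp [indicator_of_mem (hin t ht)]
  · exact ((gd_cont hf hf).comp (by fun_prop) (fun t ht => hKT (hin t ht))).integrableOn_compact isCompact_Icc
  · exact Eventually.of_forall fun t => gd_self_nonneg _ _

/-- lintegral of a dilate -/
lemma lint_dil {F : E2 → ENNReal} (hF : Measurable F) (y : E2) {t : ℝ} (ht : 1 / 2 ≤ t) :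
    ∫⁻ x, F (y + t • (x - y)) ≤ 4 * ∫⁻ x, F x := by
  have ht0 : 0 < t := by linarith
  have h1 : ∫⁻ x, F (y + t • (x - y)) = ∫⁻ x, F (y + t • x) :=
    lintegral_sub_right_eq_self (fun x => F (y + t • x)) y
  have h2 : ∫⁻ x, F (y + t • x) = ENNReal.ofReal |(t ^ 2)⁻¹| * ∫⁻ x, F (y + x) := by
    have := Measure.map_addHaar_smul (volume : Measure E2) ht0.ne'
    have h3 : ∫⁻ x, F (y + x) ∂(Measure.map (fun x => t • x) volume) = ∫⁻ x, F (y + t • x) :=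
      lintegral_map (hF.comp (measurable_const_add y)) (measurable_const_smul t)
    rw [← h3]
    erw [this]
    rw [lintegral_smul_measure]
    simp
  rw [h1, h2, lintegral_add_left_eq_self]
  gcongr
  rw [abs_of_pos (by positivity)]
  have : (t ^ 2)⁻¹ ≤ 4 := by
    rw [inv_le_comm₀ (by positivity) (by norm_num)]; nlinarith
  calc ENNReal.ofReal (t ^ 2)⁻¹ ≤ ENNReal.ofReal 4 := ENNReal.ofReal_le_ofReal this
    _ = 4 := by simp

lemma dbl_ineq {F : E2 → ENNReal} (hF : Measurable F) (K : Set E2) :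
    ∫⁻ x in K, ∫⁻ y in K, ∫⁻ t in Icc (0:ℝ) 1, F (y + t • (x - y)) ≤
      4 * volume K * ∫⁻ x, F x := by
  have hm1 : Measurable fun q : (E2 × E2) × ℝ => F (q.1.2 + q.2 • (q.1.1 - q.1.2)) :=
    hF.comp (by fun_prop)
  have half : ∀ (s : Set ℝ), MeasurableSet s → (∀ t ∈ s, 1 / 2 ≤ t) →
      ∫⁻ y in K, ∫⁻ x in K, ∫⁻ t in s, F (y + t • (x - y)) ≤ volume s * (4 * volume K * ∫⁻ x, F x) := by
    intro s hsm hs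
    calc ∫⁻ y in K, ∫⁻ x in K, ∫⁻ t in s, F (y + t • (x - y))
        ≤ ∫⁻ y in K, volume s * (4 * ∫⁻ x, F x) := by
          refine lintegral_mono fun y => ?_
          rw [lintegral_lintegral_swap]
          · calc _ ≤ ∫⁻ t in s, (4 * ∫⁻ x, F x) := by
                  refine setLIntegral_mono measurable_const fun t ht => ?_
                  exact (setLIntegral_le_lintegral _ _).trans (lint_dil hF y (hs t ht))
              _ = _ := by rw [setLIntegral_const, mul_comm]
          · exact (hF.comp (by fun_prop : Measurable fun q : E2 × ℝ => y + q.2 • (q.1 - y))).aemeasurable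
      _ = _ := by rw [setLIntegral_const]; ring
  have hsplit : ∀ x y : E2, ∫⁻ t in Icc (0:ℝ) 1, F (y + t • (x - y)) =
      (∫⁻ t in Icc (1/2:ℝ) 1, F (x + t • (y - x))) + ∫⁻ t in Ioc (1/2:ℝ) 1, F (y + t • (x - y)) := by
    intro x y
    have hu : Icc (0:ℝ) 1 = Icc 0 (1/2) ∪ Ioc (1/2) 1 := by
      rw [Icc_union_Ioc_eq_Icc] <;> norm_num
    rw [hu, lintegral_union measurableSet_Ioc]
    · congr 1
      have h := (Measure.measurePreserving_sub_left (volume : Measure ℝ) 1).setLIntegral_comp_preimage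
        (measurableSet_Icc (a := (0:ℝ)) (b := 1/2))
        (f := fun t => F (y + t • (x - y))) (hF.comp (by fun_prop))
      rw [← h]
      have : (fun t : ℝ => 1 - t) ⁻¹' Icc 0 (1/2) = Icc (1/2) 1 := by
        ext t; simp only [mem_preimage, mem_Icc]; constructor <;> rintro ⟨h1, h2⟩ <;> constructor <;> linarith
      rw [this]
      refine lintegral_congr fun t => ?_
      congr 1; ext i; simp; ring
    · rw [Set.disjoint_left]; intro t h1 h2; exact absurd h2.1 (not_lt.2 h1.2)
  have hmA : Measurable fun q : E2 × E2 => ∫⁻ t in Icc (1/2:ℝ) 1, F (q.1 + t • (q.2 - q.1)) :=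
    Measurable.lintegral_prod_right' (f := fun q : (E2 × E2) × ℝ => F (q.1.1 + q.2 • (q.1.2 - q.1.1)))
      (hF.comp (by fun_prop))
  have hmB : Measurable fun q : E2 × E2 => ∫⁻ t in Ioc (1/2:ℝ) 1, F (q.2 + t • (q.1 - q.2)) :=
    Measurable.lintegral_prod_right' (f := fun q : (E2 × E2) × ℝ => F (q.1.2 + q.2 • (q.1.1 - q.1.2)))
      (hF.comp (by fun_prop))
  calc _ = ∫⁻ x in K, ((∫⁻ y in K, ∫⁻ t in Icc (1/2:ℝ) 1, F (x + t • (y - x))) +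
        ∫⁻ y in K, ∫⁻ t in Ioc (1/2:ℝ) 1, F (y + t • (x - y))) := by
        refine lintegral_congr fun x => ?_
        rw [lintegral_congr fun y => hsplit x y]
        exact lintegral_add_left (hmA.comp measurable_prodMk_left) _
    _ = (∫⁻ x in K, ∫⁻ y in K, ∫⁻ t in Icc (1/2:ℝ) 1, F (x + t • (y - x))) +
        ∫⁻ x in K, ∫⁻ y in K, ∫⁻ t in Ioc (1/2:ℝ) 1, F (y + t • (x - y)) := by
        exact lintegral_add_left hmA.lintegral_prod_right' _
    _ = (∫⁻ x in K, ∫⁻ y in K, ∫⁻ t in Icc (1/2:ℝ) 1, F (x + t • (y - x))) +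
        ∫⁻ y in K, ∫⁻ x in K, ∫⁻ t in Ioc (1/2:ℝ) 1, F (y + t • (x - y)) := by
        congr 1
        exact lintegral_lintegral_swap hmB.aemeasurable
    _ ≤ volume (Icc (1/2:ℝ) 1) * (4 * volume K * ∫⁻ x, F x) +
        volume (Ioc (1/2:ℝ) 1) * (4 * volume K * ∫⁻ x, F x) :=
        add_le_add (half _ measurableSet_Icc fun t ht => ht.1) (half _ measurableSet_Ioc fun t ht => ht.1.le)
    _ = _ := by
        rw [Real.volume_Icc, Real.volume_Ioc, ← add_mul, ← ENNReal.ofReal_add (by norm_num) (by norm_num)]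
        norm_num

theorem poincare {a b c : E2} {f : E2 → ℝ} (hf : Cl a b c f) {K : Set E2} (hK : Convex ℝ K)
    (hKm : MeasurableSet K) (hKT : K ⊆ interior (Tri a b c)) {d : ℝ}
    (hd : ∀ x ∈ K, ∀ y ∈ K, ‖x - y‖ ≤ d) :
    volume.real K * ∫ p in K, f p ^ 2 ≤
      (∫ p in K, f p) ^ 2 + 2 * d ^ 2 * volume.real K * ∫ p in K, gd f f p := by
  have hfin : volume K < ⊤ := lt_of_le_of_lt (measure_mono hKT) (IT_fin a b c)
  have hfm : IsFiniteMeasure (volume.restrict K) := ⟨by simpa using hfin⟩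
  have hi1 : IntegrableOn f K := hf.int.mono_set hKT
  have hi2 : IntegrableOn (fun p => f p ^ 2) K := (intOn_cont (hf.cont.pow 2)).mono_set hKT
  have hi3 : IntegrableOn (gd f f) K := (hf.gd_int hf).mono_set hKT
  set F : E2 → ENNReal := K.indicator (fun p => ENNReal.ofReal (gd f f p)) with hF
  have hFm : Measurable F := by
    have h1 : ContinuousOn (fun p => ENNReal.ofReal (gd f f p)) K :=
      ENNReal.continuous_ofReal.comp_continuousOn ((gd_cont hf.c1 hf.c1).mono hKT)
    classical
    have := h1.measurable_piecewise (g := fun _ => 0) continuousOn_const hKm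
    convert! this using 1
  have hFi : ∫⁻ x, F x = ENNReal.ofReal (∫ p in K, gd f f p) := by
    rw [hF, lintegral_indicator hKm, ofReal_integral_eq_lintegral_ofReal hi3]
    exact Eventually.of_forall fun t => gd_self_nonneg _ _
  have inner : ∀ x, ∫ y in K, (f x - f y) ^ 2 =
      volume.real K * f x ^ 2 - 2 * f x * (∫ p in K, f p) + ∫ p in K, f p ^ 2 := by
    intro x
    have : (fun y => (f x - f y) ^ 2) = fun y => f x ^ 2 * 1 + (- (2 * f x)) * f y + 1 * f y ^ 2 := by
      funext y; ring
    rw [this, (int_lin3 (integrable_const _) hi1 hi2 _ _ _).2, setIntegral_const]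
    simp; ring
  have hiin : ∀ x, IntegrableOn (fun y => (f x - f y) ^ 2) K := by
    intro x
    have : (fun y => (f x - f y) ^ 2) = fun y => f x ^ 2 * 1 + (- (2 * f x)) * f y + 1 * f y ^ 2 := by
      funext y; ring
    rw [this]
    exact (int_lin3 (integrable_const _) hi1 hi2 _ _ _).1
  have outerI : IntegrableOn (fun x => ∫ y in K, (f x - f y) ^ 2) K := by
    simp only [inner]
    refine ((hi2.const_mul _).sub ?_).add (integrable_const _)
    simp only [mul_assoc]
    exact (hi1.mul_const _).const_mul 2
  have outer : ∫ x in K, ∫ y in K, (f x - f y) ^ 2 =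
      2 * (volume.real K * (∫ p in K, f p ^ 2) - (∫ p in K, f p) ^ 2) := by
    simp only [inner]
    have e : (fun x => volume.real K * f x ^ 2 - 2 * f x * (∫ p in K, f p) + ∫ p in K, f p ^ 2) =
      fun x => volume.real K * f x ^ 2 + (-(2 * ∫ p in K, f p)) * f x + (∫ p in K, f p ^ 2) * 1 := by
      funext x; ring
    rw [e, (int_lin3 hi2 hi1 (integrable_const _) _ _ _).2, setIntegral_const]
    simp; ring
  have hmain : ENNReal.ofReal (∫ x in K, ∫ y in K, (f x - f y) ^ 2) ≤
      ENNReal.ofReal (d ^ 2) * (4 * volume K * ENNReal.ofReal (∫ p in K, gd f f p)) := by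
    rw [ofReal_integral_eq_lintegral_ofReal outerI
      (Eventually.of_forall fun x => integral_nonneg fun y => sq_nonneg _)]
    rw [← hFi]
    refine le_trans ?_ (mul_le_mul_right (dbl_ineq hFm K) _)
    rw [← lintegral_const_mul']
    · refine setLIntegral_mono' hKm fun x hx => ?_
      rw [ofReal_integral_eq_lintegral_ofReal (hiin x) (Eventually.of_forall fun y => sq_nonneg _),
        ← lintegral_const_mul']
      · exact setLIntegral_mono' hKm fun y hy => seg_ineq hf.c1 hK hKT hx hy (hd x hx y hy)
      · simp
    · simp
  have hgn : 0 ≤ ∫ p in K, gd f f p := integral_nonneg fun p => gd_self_nonneg _ _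
  have h4 : ENNReal.ofReal (d ^ 2) * (4 * volume K * ENNReal.ofReal (∫ p in K, gd f f p)) =
      ENNReal.ofReal (d ^ 2 * (4 * volume.real K * ∫ p in K, gd f f p)) := by
    rw [ENNReal.ofReal_mul (by positivity), ENNReal.ofReal_mul (by positivity),
      ENNReal.ofReal_mul (by positivity), ofReal_measureReal hfin.ne]
    simp
  rw [h4, ENNReal.ofReal_le_ofReal_iff (by positivity), outer] at hmain
  linarith

end

noncomputable section
open MeasureTheory Filter Topology

/-! ### Quadratic forms -/

def AA (a b c : E2) (f g : E2 → ℝ) : ℝ := ∫ p in interior (Tri a b c), gd f g p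
def BB (a b c : E2) (f g : E2 → ℝ) : ℝ := ∫ p in interior (Tri a b c), f p * g p
def MM (a b c : E2) (f : E2 → ℝ) : ℝ := ∫ p in interior (Tri a b c), f p

lemma Cl.diffAt {a b c : E2} {f : E2 → ℝ} (hf : Cl a b c f) {p : E2} (hp : p ∈ interior (Tri a b c)) :
    DifferentiableAt ℝ f p :=
  (hf.c1.differentiableOn (by norm_num)).differentiableAt (isOpen_interior.mem_nhds hp)

lemma fderiv_lin {f g : E2 → ℝ} {p : E2} (hf : DifferentiableAt ℝ f p) (hg : DifferentiableAt ℝ g p) (s t : ℝ) :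
    fderiv ℝ (fun p => s * f p + t * g p) p = s • fderiv ℝ f p + t • fderiv ℝ g p :=
  ((hf.hasFDerivAt.const_mul s).add (hg.hasFDerivAt.const_mul t)).fderiv

lemma Cl.lin {a b c : E2} {f g : E2 → ℝ} (hf : Cl a b c f) (hg : Cl a b c g) (s t : ℝ) :
    Cl a b c (fun p => s * f p + t * g p) := by
  refine ⟨(continuousOn_const.mul hf.cont).add (continuousOn_const.mul hg.cont),
    (contDiffOn_const.mul hf.c1).add (contDiffOn_const.mul hg.c1), ?_⟩
  obtain ⟨M, hM⟩ := hf.bd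
  obtain ⟨N, hN⟩ := hg.bd
  refine ⟨|s| * M + |t| * N, fun p hp => ?_⟩
  rw [fderiv_lin (hf.diffAt hp) (hg.diffAt hp)]
  refine (norm_add_le _ _).trans (add_le_add ?_ ?_) <;> rw [norm_smul, Real.norm_eq_abs]
  · exact mul_le_mul_of_nonneg_left (hM p hp) (abs_nonneg _)
  · exact mul_le_mul_of_nonneg_left (hN p hp) (abs_nonneg _)

lemma gd_lin {f g : E2 → ℝ} {p : E2} (hf : DifferentiableAt ℝ f p) (hg : DifferentiableAt ℝ g p) (s t : ℝ) :
    gd (fun p => s * f p + t * g p) (fun p => s * f p + t * g p) p =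
      s ^ 2 * gd f f p + 2 * s * t * gd f g p + t ^ 2 * gd g g p := by
  unfold gd
  rw [fderiv_lin hf hg]
  simp only [_root_.add_apply, _root_.smul_apply, smul_eq_mul]
  ring

lemma AA_lin {a b c : E2} {f g : E2 → ℝ} (hf : Cl a b c f) (hg : Cl a b c g) (s t : ℝ) :
    AA a b c (fun p => s * f p + t * g p) (fun p => s * f p + t * g p) =
      s ^ 2 * AA a b c f f + 2 * s * t * AA a b c f g + t ^ 2 * AA a b c g g := by
  unfold AA
  rw [← (int_lin3 (hf.gd_int hf) (hf.gd_int hg) (hg.gd_int hg) _ _ _).2]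
  exact setIntegral_congr_fun isOpen_interior.measurableSet fun p hp => gd_lin (hf.diffAt hp) (hg.diffAt hp) s t

lemma BB_lin' {a b c : E2} {f g : E2 → ℝ} (hf : IntegrableOn (fun p => f p * f p) (interior (Tri a b c)))
    (hfg : IntegrableOn (fun p => f p * g p) (interior (Tri a b c)))
    (hg : IntegrableOn (fun p => g p * g p) (interior (Tri a b c))) (s t : ℝ) :
    BB a b c (fun p => s * f p + t * g p) (fun p => s * f p + t * g p) =
      s ^ 2 * BB a b c f f + 2 * s * t * BB a b c f g + t ^ 2 * BB a b c g g := by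
  unfold BB
  rw [← (int_lin3 hf hfg hg _ _ _).2]
  congr 1; funext p; ring

lemma BB_lin {a b c : E2} {f g : E2 → ℝ} (hf : Cl a b c f) (hg : Cl a b c g) (s t : ℝ) :
    BB a b c (fun p => s * f p + t * g p) (fun p => s * f p + t * g p) =
      s ^ 2 * BB a b c f f + 2 * s * t * BB a b c f g + t ^ 2 * BB a b c g g :=
  BB_lin' (hf.mul_int hf) (hf.mul_int hg) (hg.mul_int hg) s t

lemma MM_lin {a b c : E2} {f g : E2 → ℝ} (hf : IntegrableOn f (interior (Tri a b c)))
    (hg : IntegrableOn g (interior (Tri a b c))) (s t : ℝ) :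
    MM a b c (fun p => s * f p + t * g p) = s * MM a b c f + t * MM a b c g := by
  unfold MM
  rw [integral_add (hf.const_mul s) (hg.const_mul t), integral_const_mul, integral_const_mul]

lemma AA_nonneg (a b c : E2) (f : E2 → ℝ) : 0 ≤ AA a b c f f := integral_nonneg fun p => gd_self_nonneg _ _
lemma BB_nonneg (a b c : E2) (f : E2 → ℝ) : 0 ≤ BB a b c f f := integral_nonneg fun p => mul_self_nonneg _

/-! ### Cells and compactness -/

def cell (a b c : E2) (N : ℕ) (k : ℤ × ℤ) : Set E2 :=
  interior (Tri a b c) ∩ {p | ⌊((N:ℝ) + 1) * p 0⌋ = k.1 ∧ ⌊((N:ℝ) + 1) * p 1⌋ = k.2}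

lemma cell_sub (a b c : E2) (N : ℕ) (k : ℤ × ℤ) : cell a b c N k ⊆ interior (Tri a b c) := inter_subset_left

lemma cell_meas (a b c : E2) (N : ℕ) (k : ℤ × ℤ) : MeasurableSet (cell a b c N k) := by
  refine isOpen_interior.measurableSet.inter (MeasurableSet.inter ?_ ?_)
  · exact (Int.measurable_floor.comp (by fun_prop : Measurable fun p : E2 => ((N:ℝ) + 1) * p 0))
      (measurableSet_singleton k.1)
  · exact (Int.measurable_floor.comp (by fun_prop : Measurable fun p : E2 => ((N:ℝ) + 1) * p 1))
      (measurableSet_singleton k.2)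

lemma cell_convex (a b c : E2) (N : ℕ) (k : ℤ × ℤ) : Convex ℝ (cell a b c N k) := by
  refine (Tri_convex a b c).interior.inter ?_
  intro p hp q hq s t hs ht hst
  simp only [Set.mem_ofPred_eq, Int.floor_eq_iff] at hp hq ⊢
  obtain ⟨⟨h1, h2⟩, h3, h4⟩ := hp
  obtain ⟨⟨k1, k2⟩, k3, k4⟩ := hq
  have e : s = 1 - t := by linarith
  have key : ∀ {x y m : ℝ}, m ≤ x → x < m + 1 → m ≤ y → y < m + 1 → m ≤ s * x + t * y ∧ s * x + t * y < m + 1 := by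
    intro x y m hx hx' hy hy'
    constructor
    · have h1 : m = s * m + t * m := by rw [← add_mul, hst, one_mul]
      rw [h1]; gcongr
    · rcases hs.eq_or_lt with h0 | h0
      · have : t = 1 := by linarith
        simp [← h0, this, hy']
      · have h1 : m + 1 = s * (m + 1) + t * (m + 1) := by rw [← add_mul, hst, one_mul]
        rw [h1]
        exact add_lt_add_of_lt_of_le (mul_lt_mul_of_pos_left hx' h0) (mul_le_mul_of_nonneg_left hy'.le ht)
  have a1 := key h1 h2 k1 k2
  have a2 := key h3 h4 k3 k4
  have ee : ∀ i, ((N:ℝ) + 1) * (s • p + t • q) i = s * (((N:ℝ) + 1) * p i) + t * (((N:ℝ) + 1) * q i) := by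
    intro i; simp; ring
  rw [ee, ee]
  exact ⟨a1, a2⟩

lemma cell_diam {a b c : E2} {N : ℕ} {k : ℤ × ℤ} {x y : E2} (hx : x ∈ cell a b c N k) (hy : y ∈ cell a b c N k) :
    ‖x - y‖ ≤ 2 / ((N:ℝ) + 1) := by
  obtain ⟨-, h1, h2⟩ := hx
  obtain ⟨-, k1, k2⟩ := hy
  rw [Int.floor_eq_iff] at h1 h2 k1 k2
  have hN : (0:ℝ) < (N:ℝ) + 1 := by positivity
  have e0 : |((N:ℝ) + 1) * (x 0 - y 0)| ≤ 1 := by rw [abs_le]; constructor <;> linarith [h1.1, h1.2, k1.1, k1.2]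
  have e1 : |((N:ℝ) + 1) * (x 1 - y 1)| ≤ 1 := by rw [abs_le]; constructor <;> linarith [h2.1, h2.2, k2.1, k2.2]
  have s0 := sq_le_one_iff_abs_le_one _ |>.2 e0
  have s1 := sq_le_one_iff_abs_le_one _ |>.2 e1
  have : (‖x - y‖ * ((N:ℝ) + 1)) ^ 2 ≤ 2 ^ 2 := by
    rw [mul_pow, ← dt_self]; simp only [dt, PiLp.sub_apply]; nlinarith
  rw [le_div_iff₀ hN]
  exact (sq_le_sq₀ (by positivity) (by norm_num)).1 this

lemma cell_cover (a b c : E2) (N : ℕ) : ∃ s : Finset (ℤ × ℤ),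
    interior (Tri a b c) = ⋃ k ∈ s, cell a b c N k := by
  obtain ⟨R, hR⟩ := (Tri_compact a b c).isBounded.exists_norm_le
  set B : ℤ := ⌈((N:ℝ) + 1) * R⌉ + 1 with hB
  refine ⟨Finset.Icc (-B) B ×ˢ Finset.Icc (-B) B, ?_⟩
  ext p
  simp only [mem_iUnion]
  constructor
  · intro hp
    refine ⟨(⌊((N:ℝ) + 1) * p 0⌋, ⌊((N:ℝ) + 1) * p 1⌋), ?_, hp, rfl, rfl⟩
    have hpn : ‖p‖ ≤ R := hR p (interior_subset hp)
    have key : ∀ i, ⌊((N:ℝ) + 1) * p i⌋ ∈ Finset.Icc (-B) B := by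
      intro i
      have h1 : |p i| ≤ R := (PiLp.norm_apply_le p i).trans hpn
      have h2 : |((N:ℝ) + 1) * p i| ≤ ((N:ℝ) + 1) * R := by
        rw [abs_mul, abs_of_pos (by positivity)]; gcongr
      have h3 := abs_le.1 h2
      have h4 := Int.le_ceil (((N:ℝ) + 1) * R)
      rw [Finset.mem_Icc]
      constructor
      · rw [Int.le_floor, hB]; push_cast; linarith
      · have : (⌊((N:ℝ) + 1) * p i⌋ : ℝ) ≤ (B:ℝ) := by
          rw [hB]; push_cast; linarith [Int.floor_le (((N:ℝ) + 1) * p i)]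
        exact_mod_cast this
    exact Finset.mem_product.2 ⟨key 0, key 1⟩
  · rintro ⟨k, -, hp⟩; exact hp.1

lemma cell_disj (a b c : E2) (N : ℕ) (s : Set (ℤ × ℤ)) : s.PairwiseDisjoint (cell a b c N) := by
  intro k _ l _ hkl
  refine Set.disjoint_left.2 fun p hp hq => hkl ?_
  exact Prod.ext (hp.2.1.symm.trans hq.2.1) (hp.2.2.symm.trans hq.2.2)

lemma cell_sum {a b c : E2} {N : ℕ} {s : Finset (ℤ × ℤ)}
    (hs : interior (Tri a b c) = ⋃ k ∈ s, cell a b c N k) {g : E2 → ℝ}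
    (hg : IntegrableOn g (interior (Tri a b c))) :
    ∫ p in interior (Tri a b c), g p = ∑ k ∈ s, ∫ p in cell a b c N k, g p := by
  conv_lhs => rw [hs]
  exact integral_biUnion_finset s (fun k _ => cell_meas a b c N k) (cell_disj a b c N s)
    (fun k _ => hg.mono_set inter_subset_left)

lemma poincare_cells {a b c : E2} {N : ℕ} {s : Finset (ℤ × ℤ)}
    (hs : interior (Tri a b c) = ⋃ k ∈ s, cell a b c N k) {f : E2 → ℝ} (hf : Cl a b c f) :
    BB a b c f f ≤ ∑ k ∈ s, (volume.real (cell a b c N k))⁻¹ * (∫ p in cell a b c N k, f p) ^ 2 +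
      8 / ((N:ℝ) + 1) ^ 2 * AA a b c f f := by
  unfold AA BB
  rw [cell_sum hs (hf.mul_int hf), cell_sum hs (hf.gd_int hf), Finset.mul_sum, ← Finset.sum_add_distrib]
  refine Finset.sum_le_sum fun k _ => ?_
  have hP := poincare hf (cell_convex a b c N k) (cell_meas a b c N k) inter_subset_left
    (d := 2 / ((N:ℝ) + 1)) (fun x hx y hy => cell_diam hx hy)
  have hgn : 0 ≤ ∫ p in cell a b c N k, gd f f p := integral_nonneg fun p => gd_self_nonneg _ _
  rcases (measureReal_nonneg : 0 ≤ volume.real (cell a b c N k)).eq_or_lt with h0 | h0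
  · have hz : volume (cell a b c N k) = 0 := by
      have := h0.symm
      rwa [measureReal_eq_zero_iff (lt_of_le_of_lt (measure_mono (cell_sub a b c N k)) (IT_fin a b c)).ne] at this
    rw [Measure.restrict_eq_zero.2 hz]; simp
  · have hsq : ∫ p in cell a b c N k, f p * f p = ∫ p in cell a b c N k, f p ^ 2 := by
      congr 1; funext p; ring
    rw [hsq]
    have e : 8 / ((N:ℝ) + 1) ^ 2 = 2 * (2 / ((N:ℝ) + 1)) ^ 2 := by rw [div_pow]; ring
    rw [e, ← mul_le_mul_iff_right₀ h0]
    refine hP.trans (le_of_eq ?_)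
    field_simp

lemma BB_sub_le {a b c : E2} {f g : E2 → ℝ} (hf : Cl a b c f) (hg : Cl a b c g) :
    AA a b c (fun p => 1 * f p + (-1) * g p) (fun p => 1 * f p + (-1) * g p) ≤ 2 * AA a b c f f + 2 * AA a b c g g := by
  have h1 := AA_lin hf hg 1 1
  have h2 := AA_lin hf hg 1 (-1)
  have h3 := AA_nonneg a b c (fun p => 1 * f p + 1 * g p)
  rw [h1] at h3
  rw [h2]
  linarith

lemma cs_mean {a b c : E2} {f : E2 → ℝ} (hf : Cl a b c f) {K : Set E2}
    (hKT : K ⊆ interior (Tri a b c)) :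
    |∫ p in K, f p| ≤ volume.real (interior (Tri a b c)) + BB a b c f f := by
  have h1 : |∫ p in K, f p| ≤ ∫ p in K, |f p| := abs_integral_le_integral_abs
  have h2 : ∫ p in K, |f p| ≤ ∫ p in interior (Tri a b c), |f p| :=
    setIntegral_mono_set hf.int.abs (Eventually.of_forall fun p => abs_nonneg _) (LE.le.eventuallyLE hKT)
  have hc : IntegrableOn (fun _ : E2 => (1:ℝ)) (interior (Tri a b c)) := integrableOn_const (IT_fin a b c).ne
  have h3 : ∫ p in interior (Tri a b c), |f p| ≤ ∫ p in interior (Tri a b c), (1 + f p * f p) :=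
    setIntegral_mono hf.int.abs (hc.add (hf.mul_int hf)) fun p => by
      show |f p| ≤ 1 + f p * f p
      rcases abs_cases (f p) with h | h <;> nlinarith [sq_nonneg (f p - 1), sq_nonneg (f p + 1)]
  have h4 : ∫ p in interior (Tri a b c), (1 + f p * f p) = volume.real (interior (Tri a b c)) + BB a b c f f := by
    rw [integral_add hc (hf.mul_int hf)]; simp [BB]
  linarith

theorem rellich {a b c : E2} {f : ℕ → E2 → ℝ} (hf : ∀ n, Cl a b c (f n)) {M B : ℝ} (hA : ∀ n, AA a b c (f n) (f n) ≤ M)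
    (hB : ∀ n, BB a b c (f n) (f n) ≤ B) : ∃ φ : ℕ → ℕ, StrictMono φ ∧ ∀ ε > 0, ∃ N, ∀ k ≥ N, ∀ l ≥ N,
      BB a b c (fun p => 1 * f (φ k) p + (-1) * f (φ l) p) (fun p => 1 * f (φ k) p + (-1) * f (φ l) p) ≤ ε := by
  set C := volume.real (interior (Tri a b c)) + B with hC
  set α : ℕ → (ℕ × (ℤ × ℤ)) → ℝ := fun n q => ∫ p in cell a b c q.1 q.2, f n p with hα
  have hmem : ∀ n, α n ∈ Set.pi univ (fun _ : ℕ × (ℤ × ℤ) => Icc (-C) C) := by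
    intro n q _
    rw [mem_Icc, ← abs_le]
    exact (cs_mean (hf n) inter_subset_left).trans (by rw [hC]; linarith [hB n])
  obtain ⟨α0, -, φ, hφ, hlim⟩ := (isCompact_univ_pi fun _ : ℕ × (ℤ × ℤ) => isCompact_Icc (a := -C) (b := C)).tendsto_subseq hmem
  refine ⟨φ, hφ, fun ε hε => ?_⟩
  rw [tendsto_pi_nhds] at hlim
  have hM : 0 ≤ M := (AA_nonneg a b c (f 0)).trans (hA 0)
  obtain ⟨N, hN⟩ : ∃ N : ℕ, 8 / ((N:ℝ) + 1) ^ 2 * (4 * M) ≤ ε / 2 := by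
    obtain ⟨N, hN⟩ := exists_nat_gt (64 * M / ε)
    refine ⟨N, ?_⟩
    rw [div_lt_iff₀ hε] at hN
    rw [div_mul_eq_mul_div, div_le_iff₀ (by positivity)]
    have h0 : (0:ℝ) ≤ N := Nat.cast_nonneg N
    nlinarith [mul_nonneg h0 h0, mul_nonneg hε.le h0, mul_nonneg (mul_nonneg hε.le h0) h0]
  obtain ⟨s, hs⟩ := cell_cover a b c N
  have hsum : Tendsto (fun q : ℕ × ℕ => ∑ k ∈ s, (volume.real (cell a b c N k))⁻¹ *
      ((α ∘ φ) q.1 (N, k) - (α ∘ φ) q.2 (N, k)) ^ 2) (atTop ×ˢ atTop) (𝓝 0) := by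
    have : ∀ k ∈ s, Tendsto (fun q : ℕ × ℕ => (volume.real (cell a b c N k))⁻¹ *
      ((α ∘ φ) q.1 (N, k) - (α ∘ φ) q.2 (N, k)) ^ 2) (atTop ×ˢ atTop) (𝓝 0) := by
      intro k _
      have h1 := ((hlim (N, k)).comp (tendsto_fst (f := (atTop : Filter ℕ)) (g := (atTop : Filter ℕ)))).sub
        ((hlim (N, k)).comp (tendsto_snd (f := (atTop : Filter ℕ)) (g := (atTop : Filter ℕ))))
      have h2 := (h1.pow 2).const_mul (volume.real (cell a b c N k))⁻¹
      simpa using h2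
    simpa using tendsto_finsetSum s this
  have hev := hsum.eventually (gt_mem_nhds (half_pos hε))
  rw [prod_atTop_atTop_eq, eventually_atTop] at hev
  obtain ⟨⟨N1, N2⟩, hev⟩ := hev
  refine ⟨max N1 N2, fun k hk l hl => ?_⟩
  have h1 := hev (k, l) ⟨(le_max_left _ _).trans hk, (le_max_right _ _).trans hl⟩
  refine (poincare_cells hs ((hf (φ k)).lin (hf (φ l)) 1 (-1))).trans ?_
  have h2 : 8 / ((N:ℝ) + 1) ^ 2 * AA a b c (fun p => 1 * f (φ k) p + (-1) * f (φ l) p)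
      (fun p => 1 * f (φ k) p + (-1) * f (φ l) p) ≤ ε / 2 := by
    refine le_trans (mul_le_mul_of_nonneg_left ?_ (by positivity)) hN
    exact (BB_sub_le (hf _) (hf _)).trans (by linarith [hA (φ k), hA (φ l)])
  have h3 : ∀ j, ∫ p in cell a b c N j, (1 * f (φ k) p + (-1) * f (φ l) p) =
      (α ∘ φ) k (N, j) - (α ∘ φ) l (N, j) := by
    intro j
    have i1 := (hf (φ k)).int.mono_set (cell_sub a b c N j)
    have i2 := (hf (φ l)).int.mono_set (cell_sub a b c N j)
    rw [integral_add (i1.const_mul _) (i2.const_mul _), integral_const_mul, integral_const_mul]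
    simp [hα]; ring
  simp only [h3]
  linarith

end

noncomputable section
open MeasureTheory Filter Topology

/-! ### L2 tools -/

lemma cs_int {α : Type*} [MeasurableSpace α] {μ : Measure α} {g w : α → ℝ} (hg : MemLp g 2 μ) (hw : MemLp w 2 μ) :
    (∫ x, g x * w x ∂μ) ^ 2 ≤ (∫ x, g x * g x ∂μ) * ∫ x, w x * w x ∂μ := by
  have key : ∀ t : ℝ, 0 ≤ (∫ x, g x * g x ∂μ) * (t * t) + (2 * ∫ x, g x * w x ∂μ) * t + ∫ x, w x * w x ∂μ := by
    intro t
    have h1 := (int_lin3 (hg.integrable_mul hg) (hg.integrable_mul hw) (hw.integrable_mul hw) (t * t) (2 * t) 1).2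
    simp only [Pi.mul_apply] at h1
    have h2 : 0 ≤ ∫ x, (t * t * (g x * g x) + 2 * t * (g x * w x) + 1 * (w x * w x)) ∂μ :=
      integral_nonneg fun x => by
        show 0 ≤ t * t * (g x * g x) + 2 * t * (g x * w x) + 1 * (w x * w x)
        nlinarith [sq_nonneg (t * g x + w x)]
    rw [h1] at h2; linarith
  have := discrim_le_zero key
  unfold discrim at this
  nlinarith

lemma L2conv {α : Type*} [MeasurableSpace α] {μ : Measure α} {f : ℕ → α → ℝ} {u : α → ℝ} (hf : ∀ k, MemLp (f k) 2 μ)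
    (hu : MemLp u 2 μ) (h0 : Tendsto (fun k => ∫ x, (f k x - u x) * (f k x - u x) ∂μ) atTop (𝓝 0)) :
    (∀ g, MemLp g 2 μ → Tendsto (fun k => ∫ x, g x * f k x ∂μ) atTop (𝓝 (∫ x, g x * u x ∂μ))) ∧
    Tendsto (fun k => ∫ x, f k x * f k x ∂μ) atTop (𝓝 (∫ x, u x * u x ∂μ)) := by
  have hd : ∀ k, MemLp (fun x => f k x - u x) 2 μ := fun k => (hf k).sub hu
  have key : ∀ g, MemLp g 2 μ → Tendsto (fun k => ∫ x, g x * (f k x - u x) ∂μ) atTop (𝓝 0) := by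
    intro g hg
    have h1 : Tendsto (fun k => (∫ x, g x * g x ∂μ) * ∫ x, (f k x - u x) * (f k x - u x) ∂μ) atTop (𝓝 0) := by
      simpa using h0.const_mul (∫ x, g x * g x ∂μ)
    have h2 : Tendsto (fun k => (∫ x, g x * (f k x - u x) ∂μ) ^ 2) atTop (𝓝 0) :=
      squeeze_zero (fun k => sq_nonneg _) (fun k => cs_int hg (hd k)) h1
    have h3 := h2.sqrt
    simp only [Real.sqrt_sq_eq_abs, Real.sqrt_zero] at h3
    exact (tendsto_zero_iff_abs_tendsto_zero _).2 h3
  constructor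
  · intro g hg
    have h1 : ∀ k, ∫ x, g x * f k x ∂μ = (∫ x, g x * (f k x - u x) ∂μ) + ∫ x, g x * u x ∂μ := by
      intro k
      have i1 : Integrable (fun x => g x * (f k x - u x)) μ := hg.integrable_mul (hd k)
      have i2 : Integrable (fun x => g x * u x) μ := hg.integrable_mul hu
      rw [← integral_add i1 i2]
      congr 1; funext x; ring
    simp only [h1]
    simpa using (key g hg).add_const (∫ x, g x * u x ∂μ)
  · have h1 : ∀ k, ∫ x, f k x * f k x ∂μ = 1 * (∫ x, (f k x - u x) * (f k x - u x) ∂μ) +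
        2 * (∫ x, u x * (f k x - u x) ∂μ) + 1 * ∫ x, u x * u x ∂μ := by
      intro k
      have := (int_lin3 ((hd k).integrable_mul (hd k)) (hu.integrable_mul (hd k)) (hu.integrable_mul hu) 1 2 1).2
      simp only [Pi.mul_apply] at this
      rw [← this]
      congr 1; funext x; ring
    simp only [h1]
    simpa using ((h0.const_mul 1).add ((key u hu).const_mul 2)).add_const (1 * ∫ x, u x * u x ∂μ)

lemma L2complete {α : Type*} [MeasurableSpace α] {μ : Measure α} {f : ℕ → α → ℝ} (hf : ∀ k, MemLp (f k) 2 μ)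
    (hc : ∀ ε > 0, ∃ N, ∀ k ≥ N, ∀ l ≥ N, ∫ x, (f k x - f l x) * (f k x - f l x) ∂μ ≤ ε) :
    ∃ u, MemLp u 2 μ ∧ Tendsto (fun k => ∫ x, (f k x - u x) * (f k x - u x) ∂μ) atTop (𝓝 0) := by
  have nsq : ∀ {g : α → ℝ} (G : Lp ℝ 2 μ), G =ᵐ[μ] g → ‖G‖ ^ 2 = ∫ x, g x * g x ∂μ := by
    intro g G hG
    rw [← real_inner_self_eq_norm_sq, L2.inner_def]
    refine integral_congr_ae ?_
    filter_upwards [hG] with x hx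
    simp [hx, sq]
  set F : ℕ → Lp ℝ 2 μ := fun k => (hf k).toLp (f k) with hF
  have hFc : ∀ k, F k =ᵐ[μ] f k := fun k => (hf k).coeFn_toLp
  have hcau : CauchySeq F := by
    rw [Metric.cauchySeq_iff]
    intro ε hε
    obtain ⟨N, hN⟩ := hc (ε ^ 2 / 2) (by positivity)
    refine ⟨N, fun k hk l hl => ?_⟩
    rw [dist_eq_norm]
    have h1 := nsq (g := fun x => f k x - f l x) (F k - F l) (by
      filter_upwards [Lp.coeFn_sub (F k) (F l), hFc k, hFc l] with x h1 h2 h3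
      rw [h1, Pi.sub_apply, h2, h3])
    have h2 := hN k hk l hl
    rw [← h1] at h2
    exact lt_of_pow_lt_pow_left₀ 2 hε.le (by nlinarith [sq_nonneg ε, pow_pos hε 2])
  obtain ⟨U, hU⟩ := cauchySeq_tendsto_of_complete hcau
  refine ⟨U, Lp.memLp U, ?_⟩
  have h1 : ∀ k, ∫ x, (f k x - U x) * (f k x - U x) ∂μ = ‖F k - U‖ ^ 2 := by
    intro k
    refine (nsq (g := fun x => f k x - U x) (F k - U) ?_).symm
    filter_upwards [Lp.coeFn_sub (F k) U, hFc k] with x h1 h2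
    rw [h1, Pi.sub_apply, h2]
  simp only [h1]
  have := (tendsto_iff_norm_sub_tendsto_zero.1 hU).pow 2
  simpa using this

lemma memLp_bdd {α : Type*} [MeasurableSpace α] {μ : Measure α} [IsFiniteMeasure μ] {f : α → ℝ} (hm : AEStronglyMeasurable f μ) (M : ℝ)
    (hb : ∀ᵐ x ∂μ, ‖f x‖ ≤ M) : MemLp f 2 μ := MemLp.of_bound hm M hb

instance fin_IT (a b c : E2) : IsFiniteMeasure (volume.restrict (interior (Tri a b c))) := ⟨by simpa using IT_fin a b c⟩

lemma memLp_cont {a b c : E2} {g : E2 → ℝ} (hg : ContinuousOn g (Tri a b c)) :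
    MemLp g 2 (volume.restrict (interior (Tri a b c))) := by
  obtain ⟨M, hM⟩ := (Tri_compact a b c).exists_bound_of_continuousOn hg
  exact memLp_bdd ((hg.mono interior_subset).aestronglyMeasurable isOpen_interior.measurableSet) M
    ((ae_restrict_iff' isOpen_interior.measurableSet).2 (Eventually.of_forall fun p hp => hM p (interior_subset hp)))

lemma Cl_smooth (a b c : E2) {h : E2 → ℝ} (hh : ContDiff ℝ 1 h) : Cl a b c h := by
  refine ⟨hh.continuous.continuousOn, hh.contDiffOn, ?_⟩
  obtain ⟨M, hM⟩ := (Tri_compact a b c).exists_bound_of_continuousOn (hh.continuous_fderiv (by norm_num)).continuousOn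
  exact ⟨M, fun p hp => hM p (interior_subset hp)⟩

lemma fderiv_mul_dir {f g : E2 → ℝ} {p : E2} (hf : DifferentiableAt ℝ f p) (hg : DifferentiableAt ℝ g p) (w : E2) :
    fderiv ℝ (fun p => f p * g p) p w = f p * fderiv ℝ g p w + g p * fderiv ℝ f p w := by
  have := (hf.hasFDerivAt.mul hg.hasFDerivAt).fderiv
  change fderiv ℝ (fun p => f p * g p) p = _ at this
  rw [this]; simp

/-- Green's identity on the triangle -/
lemma green_tri {a b c : E2} (hcr : cr (b - a) (c - a) ≠ 0) {f h : E2 → ℝ} (hf : Cl a b c f) (hh : ContDiff ℝ 2 h) :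
    cr (b - a) (c - a) * (AA a b c f h + ∫ p in interior (Tri a b c), f p * lap h p) =
      |cr (b - a) (c - a)| * (fl a b (fun p => f p * fderiv ℝ h p e0) (fun p => f p * fderiv ℝ h p e1) +
        fl b c (fun p => f p * fderiv ℝ h p e0) (fun p => f p * fderiv ℝ h p e1) +
        fl c a (fun p => f p * fderiv ℝ h p e0) (fun p => f p * fderiv ℝ h p e1)) := by
  have hd : ∀ w, ContDiff ℝ 1 (fun p => fderiv ℝ h p w) := fun w =>
    (hh.fderiv_right (m := 1) (by norm_num)).clm_apply contDiff_const
  have hl : Continuous (lap h) := by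
    have : ∀ w, Continuous fun p => mixedDeriv h p w w := fun w =>
      ((hd w).continuous_fderiv (by norm_num)).clm_apply continuous_const
    exact (this e0).add (this e1)
  have hda : ∀ w p, DifferentiableAt ℝ (fun p => fderiv ℝ h p w) p := fun w p =>
    ((hd w).differentiable (by norm_num)) p
  have hX : ∀ w, Cl a b c (fun p => f p * fderiv ℝ h p w) := by
    intro w
    refine ⟨hf.cont.mul (hd w).continuous.continuousOn, hf.c1.mul (hd w).contDiffOn, ?_⟩
    obtain ⟨M, hM⟩ := hf.bd
    obtain ⟨F, hF⟩ := (Tri_compact a b c).exists_bound_of_continuousOn hf.cont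
    obtain ⟨N, hN⟩ := (Cl_smooth a b c (hd w)).bd
    obtain ⟨H, hH⟩ := (Tri_compact a b c).exists_bound_of_continuousOn (hd w).continuous.continuousOn
    refine ⟨F * N + H * M, fun p hp => ?_⟩
    have := ((hf.diffAt hp).hasFDerivAt.mul (hda w p).hasFDerivAt).fderiv
    change fderiv ℝ (fun p => f p * fderiv ℝ h p w) p = _ at this
    rw [this]
    refine (norm_add_le _ _).trans (add_le_add ?_ ?_) <;> rw [norm_smul]
    · exact mul_le_mul (hF p (interior_subset hp)) (hN p hp) (norm_nonneg _) ((norm_nonneg _).trans (hF p (interior_subset hp)))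
    · exact mul_le_mul (hH p (interior_subset hp)) (hM p hp) (norm_nonneg _) ((norm_nonneg _).trans (hH p (interior_subset hp)))
  have key := div_tri hcr (X0 := fun p => f p * fderiv ℝ h p e0) (X1 := fun p => f p * fderiv ℝ h p e1)
    (hX e0).cont (hX e1).cont (fun p hp => ((hX e0).diffAt hp).differentiableWithinAt)
    (fun p hp => ((hX e1).diffAt hp).differentiableWithinAt)
    (fun v => intOn_bdd (pd_cont (hX e0).c1 v) ((hX e0).pd_bd v))
    (fun v => intOn_bdd (pd_cont (hX e1).c1 v) ((hX e1).pd_bd v))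
  rw [← key]
  congr 1
  unfold AA
  have i2 : IntegrableOn (fun p => f p * lap h p) (interior (Tri a b c)) := intOn_cont (hf.cont.mul hl.continuousOn)
  rw [← integral_add (hf.gd_int (Cl_smooth a b c (hh.of_le (by norm_num)))) i2]
  refine setIntegral_congr_fun isOpen_interior.measurableSet fun p hp => ?_
  show gd f h p + f p * lap h p = fderiv ℝ (fun p => f p * fderiv ℝ h p e0) p e0 + fderiv ℝ (fun p => f p * fderiv ℝ h p e1) p e1
  rw [fderiv_mul_dir (hf.diffAt hp) (hda e0 p), fderiv_mul_dir (hf.diffAt hp) (hda e1 p)]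
  unfold gd lap mixedDeriv
  ring

/-- zero flux of `h` through the segment `a b` -/
def ZF (a b : E2) (h : E2 → ℝ) : Prop :=
  ∀ t ∈ Icc (0:ℝ) 1, fderiv ℝ h (a + t • (b - a)) e0 * (b - a) 1 - fderiv ℝ h (a + t • (b - a)) e1 * (b - a) 0 = 0

lemma fl_zero {a b : E2} {f h : E2 → ℝ} (hz : ZF a b h) :
    fl a b (fun p => f p * fderiv ℝ h p e0) (fun p => f p * fderiv ℝ h p e1) = 0 := by
  unfold fl
  rw [intervalIntegral.integral_congr (g := fun _ => (0:ℝ))]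
  · simp
  · intro t ht
    rw [uIcc_of_le zero_le_one] at ht
    have := hz t ht
    show f _ * fderiv ℝ h _ e0 * (b - a) 1 - f _ * fderiv ℝ h _ e1 * (b - a) 0 = 0
    linear_combination f (a + t • (b - a)) * this

lemma green_zf {a b c : E2} (hcr : cr (b - a) (c - a) ≠ 0) {f h : E2 → ℝ} (hf : Cl a b c f) (hh : ContDiff ℝ 2 h)
    (h1 : ZF a b h) (h2 : ZF b c h) (h3 : ZF c a h) :
    AA a b c f h = - ∫ p in interior (Tri a b c), f p * lap h p := by
  have := green_tri hcr hf hh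
  rw [fl_zero h1, fl_zero h2, fl_zero h3] at this
  simp only [add_zero, mul_zero, mul_eq_zero, hcr, false_or] at this
  linarith

lemma IT_nonempty {a b c : E2} (hcr : cr (b - a) (c - a) ≠ 0) : (interior (Tri a b c)).Nonempty := by
  refine ⟨fr a (b - a) (c - a) (1/3, 1/3), ?_⟩
  rw [mem_interior_Tri hcr, bar_fr1 hcr, bar_fr2 hcr, bar_fr3 hcr]
  norm_num

lemma BB_zero {a b c : E2} {f : E2 → ℝ} (hf : ContinuousOn f (interior (Tri a b c)))
    (hi : IntegrableOn (fun p => f p * f p) (interior (Tri a b c))) (h0 : BB a b c f f = 0) :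
    ∀ p ∈ interior (Tri a b c), f p = 0 := by
  unfold BB at h0
  rw [integral_eq_zero_iff_of_nonneg (fun p => mul_self_nonneg _) hi] at h0
  have := Measure.eqOn_open_of_ae_eq h0 isOpen_interior (hf.mul hf) continuousOn_const
  intro p hp
  have := this hp
  simpa using this

lemma MM_const (a b c : E2) (m : ℝ) : MM a b c (fun _ => m) = volume.real (interior (Tri a b c)) * m := by
  simp [MM]

lemma vol_pos {a b c : E2} (hcr : cr (b - a) (c - a) ≠ 0) : 0 < volume.real (interior (Tri a b c)) := by
  rw [measureReal_def, ENNReal.toReal_pos_iff]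
  exact ⟨isOpen_interior.measure_pos _ (IT_nonempty hcr), IT_fin a b c⟩

end

noncomputable section
open MeasureTheory Filter Topology

structure Mini (a b c : E2) (ν : ℝ) (u : E2 → ℝ) : Prop where
  pos : 0 < ν
  ineq : ∀ f, Cl a b c f → MM a b c f = 0 → ν * BB a b c f f ≤ AA a b c f f
  mem : MemLp u 2 (volume.restrict (interior (Tri a b c)))
  mean : MM a b c u = 0
  norm : BB a b c u u = 1
  weak : ∀ h : E2 → ℝ, ContDiff ℝ 2 h → ZF a b h → ZF b c h → ZF c a h →
    ∫ p in interior (Tri a b c), u p * (lap h p + ν * h p) = 0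
  tail : ∀ ε > 0, ∃ δ > 0, ∀ K : Set E2, Convex ℝ K → MeasurableSet K → K ⊆ interior (Tri a b c) →
    volume.real K ≤ δ → ∀ d : ℝ, (∀ x ∈ K, ∀ y ∈ K, ‖x - y‖ ≤ d) →
    volume.real K * ∫ p in K, u p * u p ≤ (∫ p in K, u p) ^ 2 + d ^ 2 * volume.real K * ε

lemma one_Cl (a b c : E2) : Cl a b c (fun _ => (1:ℝ)) := Cl_smooth a b c contDiff_const

lemma AA_one (a b c : E2) (f : E2 → ℝ) : AA a b c f (fun _ => (1:ℝ)) = 0 := by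
  unfold AA gd; simp

/-- any element of the class can be centred -/
lemma center {a b c : E2} (hcr : cr (b - a) (c - a) ≠ 0) {f : E2 → ℝ} (hf : Cl a b c f) :
    ∃ m : ℝ, Cl a b c (fun p => 1 * f p + m * 1) ∧ MM a b c (fun p => 1 * f p + m * 1) = 0 := by
  refine ⟨- MM a b c f / volume.real (interior (Tri a b c)), hf.lin (one_Cl a b c) 1 _, ?_⟩
  rw [MM_lin hf.int (one_Cl a b c).int, MM_const]
  field_simp [(vol_pos hcr).ne']
  ring

lemma exists_unit {a b c : E2} (hcr : cr (b - a) (c - a) ≠ 0) :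
    ∃ f, Cl a b c f ∧ MM a b c f = 0 ∧ BB a b c f f = 1 := by
  have hx : Cl a b c (fun p => p 0) := Cl_smooth a b c (by fun_prop)
  obtain ⟨m, hm, h0⟩ := center hcr hx
  set g : E2 → ℝ := fun p => 1 * p 0 + m * 1 with hg
  have hB : 0 < BB a b c g g := by
    refine lt_of_le_of_ne (BB_nonneg a b c g) fun h => ?_
    have hz := BB_zero (hm.cont.mono interior_subset) (hm.mul_int hm) h.symm
    obtain ⟨p, hp⟩ := IT_nonempty hcr
    have hopen : ∀ᶠ t in 𝓝 (0:ℝ), p + t • e0 ∈ interior (Tri a b c) := by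
      have hc : Continuous fun t : ℝ => p + t • e0 := by fun_prop
      exact hc.continuousAt.eventually (isOpen_interior.mem_nhds (by simpa using hp))
    obtain ⟨ε, hε, hb⟩ := Metric.eventually_nhds_iff.1 hopen
    have h1 := hz _ (hb (y := ε / 2) (by rw [Real.dist_eq, sub_zero, abs_of_pos (half_pos hε)]; linarith))
    have h2 := hz p hp
    simp [hg] at h1 h2
    linarith
  set s := (Real.sqrt (BB a b c g g))⁻¹ with hs
  refine ⟨fun p => s * g p + 0 * g p, hm.lin hm s 0, ?_, ?_⟩
  · rw [MM_lin hm.int hm.int, h0]; simp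
  · rw [BB_lin hm hm, hs, inv_pow, Real.sq_sqrt hB.le]
    field_simp; ring

lemma AA_lower {a b c : E2} (hcr : cr (b - a) (c - a) ≠ 0) : ∃ δ > 0, ∀ f, Cl a b c f → MM a b c f = 0 →
    δ * BB a b c f f ≤ AA a b c f f := by
  obtain ⟨R, hR⟩ := (Tri_compact a b c).isBounded.exists_norm_le
  have hR0 : 0 ≤ R := by
    obtain ⟨p, hp⟩ := IT_nonempty hcr
    exact (norm_nonneg p).trans (hR p (interior_subset hp))
  refine ⟨(2 * (2 * R + 1) ^ 2)⁻¹, by positivity, fun f hf h0 => ?_⟩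
  have hP := poincare hf (Tri_convex a b c).interior isOpen_interior.measurableSet le_rfl (d := 2 * R + 1)
    (fun x hx y hy => (norm_sub_le x y).trans (by linarith [hR x (interior_subset hx), hR y (interior_subset hy)]))
  have hv := vol_pos hcr
  have e1 : ∫ p in interior (Tri a b c), f p ^ 2 = BB a b c f f := by
    unfold BB; congr 1; funext p; ring
  have e2 : ∫ p in interior (Tri a b c), f p = 0 := h0
  rw [e1, e2] at hP
  change _ ≤ _ + _ * AA a b c f f at hP
  rw [inv_mul_le_iff₀ (by positivity)]
  have : volume.real (interior (Tri a b c)) * BB a b c f f ≤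
    volume.real (interior (Tri a b c)) * (2 * (2 * R + 1) ^ 2 * AA a b c f f) := by linarith
  exact le_of_mul_le_mul_left this hv

theorem exists_mini {a b c : E2} (hcr : cr (b - a) (c - a) ≠ 0) : ∃ ν u, Mini a b c ν u := by
  set S : Set ℝ := {r | ∃ f, Cl a b c f ∧ MM a b c f = 0 ∧ BB a b c f f = 1 ∧ r = AA a b c f f} with hS
  obtain ⟨δ, hδ, hlow⟩ := AA_lower hcr
  have hne : S.Nonempty := by
    obtain ⟨f, h1, h2, h3⟩ := exists_unit hcr
    exact ⟨_, f, h1, h2, h3, rfl⟩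
  have hbd : ∀ r ∈ S, δ ≤ r := by
    rintro r ⟨f, h1, h2, h3, rfl⟩
    have := hlow f h1 h2
    rwa [h3, mul_one] at this
  have hbdd : BddBelow S := ⟨δ, hbd⟩
  set ν := sInf S with hν
  have hνδ : δ ≤ ν := le_csInf hne hbd
  have hν0 : 0 < ν := hδ.trans_le hνδ
  have ineq : ∀ f, Cl a b c f → MM a b c f = 0 → ν * BB a b c f f ≤ AA a b c f f := by
    intro f hf h0
    rcases (BB_nonneg a b c f).eq_or_lt with hB | hB
    · rw [← hB, mul_zero]; exact AA_nonneg a b c f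
    · set s := (Real.sqrt (BB a b c f f))⁻¹ with hs
      have hs2 : s ^ 2 = (BB a b c f f)⁻¹ := by rw [hs, inv_pow, Real.sq_sqrt hB.le]
      have : ν ≤ AA a b c (fun p => s * f p + 0 * f p) (fun p => s * f p + 0 * f p) := by
        refine csInf_le hbdd ⟨_, hf.lin hf s 0, ?_, ?_, rfl⟩
        · rw [MM_lin hf.int hf.int, h0]; simp
        · rw [BB_lin hf hf, hs2]; field_simp; ring
      rw [AA_lin hf hf, hs2] at this
      have h2 : ν ≤ (BB a b c f f)⁻¹ * AA a b c f f := by linarith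
      rw [inv_mul_eq_div, le_div_iff₀ hB] at h2
      exact h2
  have hseq : ∀ n : ℕ, ∃ f, Cl a b c f ∧ MM a b c f = 0 ∧ BB a b c f f = 1 ∧ AA a b c f f < ν + 1 / ((n:ℝ) + 1) := by
    intro n
    obtain ⟨r, ⟨f, h1, h2, h3, rfl⟩, hr⟩ := exists_lt_of_csInf_lt hne (show sInf S < ν + 1 / ((n:ℝ) + 1) by
      have : (0:ℝ) < 1 / ((n:ℝ) + 1) := by positivity
      linarith)
    exact ⟨f, h1, h2, h3, hr⟩
  choose f0 hf0 hM0 hB0 hA0 using hseq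
  obtain ⟨φ, hφ, hcau⟩ := rellich hf0 (M := ν + 1) (B := 1) (fun n => (hA0 n).le.trans (by
    have : 1 / ((n:ℝ) + 1) ≤ 1 := by
      rw [div_le_one (by positivity)]; linarith [(Nat.cast_nonneg n : (0:ℝ) ≤ n)]
    linarith)) (fun n => (hB0 n).le)
  set f : ℕ → E2 → ℝ := fun k => f0 (φ k) with hf_def
  have hf : ∀ k, Cl a b c (f k) := fun k => hf0 _
  have hM : ∀ k, MM a b c (f k) = 0 := fun k => hM0 _
  have hB : ∀ k, BB a b c (f k) (f k) = 1 := fun k => hB0 _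
  have hA : ∀ k, AA a b c (f k) (f k) ≤ ν + 1 / ((k:ℝ) + 1) := fun k => (hA0 _).le.trans (by
    have : (k:ℝ) ≤ φ k := by exact_mod_cast hφ.le_apply
    gcongr)
  have hAl : ∀ k, ν ≤ AA a b c (f k) (f k) := fun k => by
    have := ineq _ (hf k) (hM k)
    rwa [hB, mul_one] at this
  have hmem : ∀ k, MemLp (f k) 2 (volume.restrict (interior (Tri a b c))) := fun k => memLp_cont (hf k).cont
  obtain ⟨u, hu, hlim⟩ := L2complete hmem (fun ε hε => by
    obtain ⟨N, hN⟩ := hcau ε hε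
    refine ⟨N, fun k hk l hl => ?_⟩
    refine le_trans (le_of_eq ?_) (hN k hk l hl)
    unfold BB
    congr 1; funext p; ring)
  obtain ⟨hw, hn⟩ := L2conv hmem hu hlim
  have hone : MemLp (fun _ : E2 => (1:ℝ)) 2 (volume.restrict (interior (Tri a b c))) := memLp_cont continuousOn_const
  -- Cauchy property of gradients
  have hAc : ∀ ε > 0, ∃ N, ∀ k ≥ N, ∀ l ≥ N, AA a b c (fun p => 1 * f k p + (-1) * f l p)
      (fun p => 1 * f k p + (-1) * f l p) ≤ ε := by
    intro ε hε
    obtain ⟨N1, hN1⟩ := hcau (ε / (2 * ν)) (by positivity)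
    obtain ⟨N2, hN2⟩ := exists_nat_gt (8 / ε)
    refine ⟨max N1 N2, fun k hk l hl => ?_⟩
    have h1 := hN1 k (le_of_max_le_left hk) l (le_of_max_le_left hl)
    have e1 := BB_lin (hf k) (hf l) 1 (-1)
    have e2 := BB_lin (hf k) (hf l) 1 1
    have e3 := AA_lin (hf k) (hf l) 1 (-1)
    have e4 := AA_lin (hf k) (hf l) 1 1
    have h2 := ineq _ ((hf k).lin (hf l) 1 1) (by rw [MM_lin (hf k).int (hf l).int, hM, hM]; simp)
    have hs : ∀ j ≥ max N1 N2, 1 / ((j:ℝ) + 1) ≤ ε / 8 := by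
      intro j hj
      have h3 : (N2:ℝ) ≤ j := by exact_mod_cast le_of_max_le_right hj
      rw [div_le_div_iff₀ (by positivity) (by norm_num)]
      rw [div_lt_iff₀ hε] at hN2
      nlinarith
    have h3 := hA k
    have h4 := hA l
    have h5 := hs k hk
    have h6 := hs l hl
    rw [hB, hB] at e1 e2
    change BB a b c (fun p => 1 * f k p + (-1) * f l p) (fun p => 1 * f k p + (-1) * f l p) ≤ ε / (2 * ν) at h1
    rw [e1] at h1
    rw [e2, e4] at h2
    rw [e3]
    have h7 : ν * (1 ^ 2 * 1 + 2 * 1 * (-1) * BB a b c (f k) (f l) + (-1) ^ 2 * 1) ≤ ε / 2 := by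
      calc _ ≤ ν * (ε / (2 * ν)) := mul_le_mul_of_nonneg_left h1 hν0.le
        _ = ε / 2 := by field_simp
    nlinarith
  refine ⟨ν, u, hν0, ineq, hu, ?_, ?_, ?_, ?_⟩
  · have h1 := hw _ hone
    have h2 : (fun k => ∫ x in interior (Tri a b c), 1 * f k x) = fun k => (0:ℝ) := by
      funext k; have := hM k; unfold MM at this; simpa using this
    rw [h2] at h1
    have := tendsto_nhds_unique h1 tendsto_const_nhds
    unfold MM; simpa using this
  · have h2 : (fun k => ∫ x in interior (Tri a b c), f k x * f k x) = fun k => (1:ℝ) := by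
      funext k; exact hB k
    rw [h2] at hn
    exact tendsto_nhds_unique hn tendsto_const_nhds
  · intro h hh z1 z2 z3
    have hhC : Cl a b c h := Cl_smooth a b c (hh.of_le (by norm_num))
    obtain ⟨m, hm, hm0⟩ := center hcr hhC
    set g : E2 → ℝ := fun p => 1 * h p + m * 1 with hg
    have hl : Continuous (lap h) := by
      have hd : ∀ w, ContDiff ℝ 1 (fun p => fderiv ℝ h p w) := fun w =>
        (hh.fderiv_right (m := 1) (by norm_num)).clm_apply contDiff_const
      have : ∀ w, Continuous fun p => mixedDeriv h p w w := fun w =>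
        ((hd w).continuous_fderiv (by norm_num)).clm_apply continuous_const
      exact (this e0).add (this e1)
    have hgg : MemLp (fun p => lap h p + ν * h p) 2 (volume.restrict (interior (Tri a b c))) :=
      memLp_cont (hl.add (continuous_const.mul hh.continuous)).continuousOn
    have h1 := hw _ hgg
    -- the form
    set q : ℕ → ℝ := fun k => ∫ x in interior (Tri a b c), (lap h x + ν * h x) * f k x with hq
    set Qg := AA a b c g g - ν * BB a b c g g with hQg
    have hgd : ∀ k, AA a b c (f k) g = AA a b c (f k) h := by
      intro k
      unfold AA
      refine setIntegral_congr_fun isOpen_interior.measurableSet fun p hp => ?_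
      unfold gd
      rw [hg, fderiv_lin (hhC.diffAt hp) ((one_Cl a b c).diffAt hp)]
      simp
    have hbb : ∀ k, BB a b c (f k) g = BB a b c (f k) h := by
      intro k
      have e : BB a b c (f k) g = ∫ p in interior (Tri a b c), (1 * (f k p * h p) + m * f k p + 0 * f k p) := by
        unfold BB; congr 1; funext p; rw [hg]; ring
      rw [e, (int_lin3 ((hf k).mul_int hhC) (hf k).int (hf k).int _ _ _).2]
      have := hM k
      unfold MM at this
      rw [this]; simp [BB]
    have hqk : ∀ k, AA a b c (f k) g - ν * BB a b c (f k) g = - q k := by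
      intro k
      rw [hgd, hbb, green_zf hcr (hf k) hh z1 z2 z3]
      have i1 : IntegrableOn (fun p => f k p * lap h p) (interior (Tri a b c)) := intOn_cont ((hf k).cont.mul hl.continuousOn)
      have := (int_lin3 i1 ((hf k).mul_int hhC) (hf k).int 1 ν 0).2
      have e : q k = ∫ p in interior (Tri a b c), (1 * (f k p * lap h p) + ν * (f k p * h p) + 0 * f k p) := by
        rw [hq]; simp only; congr 1; funext p; ring
      rw [e, this]; unfold BB; ring
    have hsq : ∀ k : ℕ, (q k) ^ 2 ≤ 1 / ((k:ℝ) + 1) * Qg := by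
      intro k
      have key : ∀ t : ℝ, 0 ≤ Qg * (t * t) + (2 * (- q k)) * t + (AA a b c (f k) (f k) - ν) := by
        intro t
        have h2 := ineq _ ((hf k).lin hm 1 t) (by rw [MM_lin (hf k).int hm.int, hM, hm0]; simp)
        rw [BB_lin (hf k) hm, AA_lin (hf k) hm, hB] at h2
        rw [← hqk, hQg]
        nlinarith
      have hd := discrim_le_zero key
      unfold discrim at hd
      have hQ0 : 0 ≤ Qg := by rw [hQg]; linarith [ineq _ hm hm0]
      have h3 := hA k
      nlinarith [mul_le_mul_of_nonneg_left (show AA a b c (f k) (f k) - ν ≤ 1 / ((k:ℝ) + 1) by linarith) hQ0]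
    have hq0 : Tendsto (fun k => (q k) ^ 2) atTop (𝓝 0) := by
      have : Tendsto (fun k : ℕ => 1 / ((k:ℝ) + 1) * Qg) atTop (𝓝 0) := by
        simpa using tendsto_one_div_add_atTop_nhds_zero_nat.mul_const Qg
      exact squeeze_zero (fun k => sq_nonneg _) hsq this
    have h4 := tendsto_nhds_unique (h1.pow 2) hq0
    have h5 : ∫ x in interior (Tri a b c), (lap h x + ν * h x) * u x = 0 := by
      exact pow_eq_zero_iff (two_ne_zero) |>.1 h4
    rw [← h5]; congr 1; funext p; ring
  · intro ε hε
    obtain ⟨N, hN⟩ := hAc (ε / 8) (by positivity)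
    obtain ⟨G0, hG0⟩ := (hf N).pd_bd e0
    obtain ⟨G1, hG1⟩ := (hf N).pd_bd e1
    set G := G0 ^ 2 + G1 ^ 2 with hG
    have hGp : ∀ p ∈ interior (Tri a b c), gd (f N) (f N) p ≤ G := by
      intro p hp
      have h1 := hG0 p hp
      have h2 := hG1 p hp
      rw [Real.norm_eq_abs] at h1 h2
      unfold gd
      have h3 := sq_le_sq' (abs_le.1 h1).1 (abs_le.1 h1).2
      have h4 := sq_le_sq' (abs_le.1 h2).1 (abs_le.1 h2).2
      nlinarith
    have hGn : 0 ≤ G := by positivity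
    refine ⟨ε / (8 * (G + 1)), by positivity, fun K hK hKm hKT hKd d hd => ?_⟩
    have hle : volume.restrict K ≤ volume.restrict (interior (Tri a b c)) := Measure.restrict_mono hKT le_rfl
    have hmK : ∀ k, MemLp (f k) 2 (volume.restrict K) := fun k => (hmem k).mono_measure hle
    have huK : MemLp u 2 (volume.restrict K) := hu.mono_measure hle
    have hlimK : Tendsto (fun k => ∫ x in K, (f k x - u x) * (f k x - u x)) atTop (𝓝 0) := by
      refine squeeze_zero (fun k => integral_nonneg fun x => mul_self_nonneg _) (fun k => ?_) hlim
      have hdk : MemLp (fun x => f k x - u x) 2 (volume.restrict (interior (Tri a b c))) := (hmem k).sub hu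
      exact setIntegral_mono_set (hdk.integrable_mul hdk) (Eventually.of_forall fun x => mul_self_nonneg _)
        (LE.le.eventuallyLE hKT)
    obtain ⟨hwK, hnK⟩ := L2conv hmK huK hlimK
    have h1 := hwK _ (hone.mono_measure hle)
    simp only [one_mul] at h1
    have hgrad : ∀ k ≥ N, ∫ p in K, gd (f k) (f k) p ≤ ε / 2 := by
      intro k hk
      have i0 := ((hf N).gd_int (hf N)).mono_set hKT
      have i1 := (((hf k).lin (hf N) 1 (-1)).gd_int ((hf k).lin (hf N) 1 (-1)))
      have s1 : ∫ p in K, gd (f k) (f k) p ≤ ∫ p in K, (2 * gd (fun p => 1 * f k p + (-1) * f N p) (fun p => 1 * f k p + (-1) * f N p) p + 2 * gd (f N) (f N) p + 0 * gd (f N) (f N) p) := by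
        refine setIntegral_mono_on (((hf k).gd_int (hf k)).mono_set hKT) (int_lin3 (i1.mono_set hKT) i0 i0 _ _ _).1 hKm fun p hp => ?_
        rw [gd_lin ((hf k).diffAt (hKT hp)) ((hf N).diffAt (hKT hp))]
        unfold gd
        nlinarith [sq_nonneg (fderiv ℝ (f k) p e0 - 2 * fderiv ℝ (f N) p e0), sq_nonneg (fderiv ℝ (f k) p e1 - 2 * fderiv ℝ (f N) p e1)]
      rw [(int_lin3 (i1.mono_set hKT) i0 i0 _ _ _).2] at s1
      have s2 : ∫ p in K, gd (fun p => 1 * f k p + (-1) * f N p) (fun p => 1 * f k p + (-1) * f N p) p ≤ ε / 8 :=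
        le_trans (setIntegral_mono_set i1 (Eventually.of_forall fun x => gd_self_nonneg _ _) (LE.le.eventuallyLE hKT)) (hN k hk N le_rfl)
      have s3 : ∫ p in K, gd (f N) (f N) p ≤ volume.real K * G := by
        have : ∫ p in K, gd (f N) (f N) p ≤ ∫ p in K, G :=
          setIntegral_mono_on i0 (integrableOn_const (lt_of_le_of_lt (measure_mono hKT) (IT_fin a b c)).ne) hKm fun p hp => hGp p (hKT hp)
        simpa using this
      have s4 : volume.real K * G ≤ ε / 8 := by
        calc volume.real K * G ≤ ε / (8 * (G + 1)) * G := mul_le_mul_of_nonneg_right hKd hGn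
          _ ≤ ε / 8 := by
            rw [div_mul_eq_mul_div, div_le_div_iff₀ (by positivity) (by norm_num)]; nlinarith
      linarith
    have hfin : ∀ k ≥ N, volume.real K * ∫ p in K, f k p * f k p ≤ (∫ p in K, f k p) ^ 2 + d ^ 2 * volume.real K * ε := by
      intro k hk
      have h2 := poincare (hf k) hK hKm hKT hd
      have e : ∫ p in K, f k p ^ 2 = ∫ p in K, f k p * f k p := by congr 1; funext p; ring
      rw [e] at h2
      have h3 : 2 * d ^ 2 * volume.real K * ∫ p in K, gd (f k) (f k) p ≤ 2 * d ^ 2 * volume.real K * (ε / 2) :=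
        mul_le_mul_of_nonneg_left (hgrad k hk) (by positivity)
      linarith
    exact le_of_tendsto_of_tendsto (hnK.const_mul _) ((h1.pow 2).add_const _) ((eventually_ge_atTop N).mono hfin)

end

noncomputable section
open MeasureTheory Filter Topology

/-- Reflection across the line through `a` with unit normal `n`. -/
def rf (a n p : E2) : E2 := p - (2 * dt (p - a) n) • n

lemma rf_apply (a n p : E2) (i : Fin 2) : rf a n p i = p i - 2 * dt (p - a) n * n i := by
  simp [rf]

lemma OF_neg {τ n : E2} (h : OF τ n) : OF τ (-n) := by
  obtain ⟨h1, h2, h3⟩ := h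
  refine ⟨h1, by simpa using h2, ?_⟩
  simp; linarith

lemma rf_fr {a τ n : E2} (h : OF τ n) (q : ℝ × ℝ) : rf a n (fr a τ n q) = fr a τ (-n) q := by
  obtain ⟨h1, h2, h3⟩ := h
  have : dt (fr a τ n q - a) n = q.2 := by
    simp only [dt, PiLp.sub_apply, fr_apply]; linear_combination q.1 * h3 + q.2 * h2
  apply ext2 <;> rw [rf_apply, this, fr_apply, fr_apply] <;> simp <;> ring

lemma dt_rf {a τ n : E2} (h : OF τ n) (p : E2) : dt (rf a n p - a) n = - dt (p - a) n := by
  obtain ⟨h1, h2, h3⟩ := h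
  generalize hd : dt (p - a) n = d
  simp only [dt, PiLp.sub_apply, rf_apply] at *
  rw [hd]
  linear_combination hd - 2 * d * h2

lemma rf_rf {a τ n : E2} (h : OF τ n) (p : E2) : rf a n (rf a n p) = p := by
  have := dt_rf (a := a) h p
  apply ext2 <;> rw [rf_apply, this, rf_apply] <;> ring

lemma rf_cont (a n : E2) : Continuous (rf a n) := by
  unfold rf dt; fun_prop

lemma rf_contDiff (a n : E2) : ContDiff ℝ (⊤ : ℕ∞) (rf a n) := by
  unfold rf dt; fun_prop

lemma rf_eq {a τ n : E2} (h : OF τ n) : rf a n = fr a τ (-n) ∘ frinv a τ n := by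
  funext p
  rw [Function.comp_apply, ← rf_fr h, fr_frinv h]

lemma rf_integral {a τ n : E2} (h : OF τ n) (G : E2 → ℝ) : ∫ p, G (rf a n p) = ∫ p, G p := by
  rw [← integral_fr (o := a) h, ← integral_fr (o := a) (OF_neg h)]
  simp only [rf_fr h]

lemma rf_emb {a τ n : E2} (h : OF τ n) : MeasurableEmbedding (rf a n) :=
  (Homeomorph.mk ⟨rf a n, rf a n, rf_rf h, rf_rf h⟩ (rf_cont a n) (rf_cont a n)).measurableEmbedding

lemma rf_mp {a τ n : E2} (h : OF τ n) : MeasurePreserving (rf a n) volume volume := by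
  have h1 : MeasurePreserving (frinv a τ n) volume volume :=
    MeasurePreserving.symm (frH a τ n h).toMeasurableEquiv (fr_measurePreserving h)
  rw [rf_eq h]
  exact (fr_measurePreserving (OF_neg h)).comp h1

lemma rf_fderiv (a n p : E2) : HasFDerivAt (rf a n) (ContinuousLinearMap.id ℝ E2 -
    (2 • (n 0 • (EuclideanSpace.proj 0 : E2 →L[ℝ] ℝ) + n 1 • (EuclideanSpace.proj 1 : E2 →L[ℝ] ℝ))).smulRight n) p := by
  have h1 : HasFDerivAt (fun p : E2 => 2 * dt (p - a) n)
      (2 • (n 0 • (EuclideanSpace.proj 0 : E2 →L[ℝ] ℝ) + n 1 • (EuclideanSpace.proj 1 : E2 →L[ℝ] ℝ))) p := by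
    have : (fun p : E2 => 2 * dt (p - a) n) = fun p => (2 • (n 0 • (EuclideanSpace.proj 0 : E2 →L[ℝ] ℝ) +
        n 1 • (EuclideanSpace.proj 1 : E2 →L[ℝ] ℝ))) p + (-2 * dt a n) := by
      funext p; simp [dt]; ring
    rw [this]
    exact (ContinuousLinearMap.hasFDerivAt _).add_const _
  exact (hasFDerivAt_id p).sub (h1.smul_const n)

lemma rf_chain {h : E2 → ℝ} {a n p : E2} (hd : DifferentiableAt ℝ h (rf a n p)) (w : E2) :
    fderiv ℝ (fun p => h (rf a n p)) p w = fderiv ℝ h (rf a n p) (w - (2 * dt w n) • n) := by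
  have := (hd.hasFDerivAt.comp p (rf_fderiv a n p)).fderiv
  simp only [Function.comp_def] at this
  rw [this]
  simp only [ContinuousLinearMap.comp_apply, _root_.sub_apply, ContinuousLinearMap.id_apply,
    ContinuousLinearMap.smulRight_apply]
  congr 3
  simp [dt]; ring

lemma rf_lap {h : E2 → ℝ} (hh : ContDiff ℝ (⊤ : ℕ∞) h) {a τ n : E2} (ho : OF τ n) (p : E2) :
    lap (fun p => h (rf a n p)) p = lap h (rf a n p) := by
  have hd : ∀ q, DifferentiableAt ℝ h q := fun q => hh.differentiable (by simp) q
  have hc : ContDiff ℝ (⊤ : ℕ∞) (fun p => h (rf a n p)) := hh.comp (rf_contDiff a n)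
  rw [lap_frame ho (hc.of_le two_le_top).contDiffAt, lap_frame ho (hh.of_le two_le_top).contDiffAt]
  obtain ⟨h1, h2, h3⟩ := ho
  have t1 : τ - (2 * dt τ n) • n = τ := by simp [dt, h3]
  have t2 : n - (2 * dt n n) • n = -n := by
    have : dt n n = 1 := by simp only [dt]; linear_combination h2
    rw [this]; module
  unfold mixedDeriv
  congr 1
  · rw [show (fun y => fderiv ℝ (fun p => h (rf a n p)) y τ) = fun y => (fun z => fderiv ℝ h z τ) (rf a n y) from
      funext fun y => by rw [rf_chain (hd _), t1]]
    rw [rf_chain ((dir_smooth hh τ).differentiable (by simp) _), t1]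
  · rw [show (fun y => fderiv ℝ (fun p => h (rf a n p)) y n) = fun y => (fun z => fderiv ℝ h z (-n)) (rf a n y) from
      funext fun y => by rw [rf_chain (hd _), t2]]
    rw [rf_chain ((dir_smooth hh (-n)).differentiable (by simp) _), t2]
    simp only [map_neg, fderiv_fun_neg, _root_.neg_apply, neg_neg]

lemma rf_norm {a τ n : E2} (h : OF τ n) (p o : E2) (ho : rf a n o = o) : ‖rf a n p - o‖ = ‖p - o‖ := by
  have h2 := h.2.1
  have hq : ‖rf a n p - o‖ ^ 2 = ‖p - o‖ ^ 2 := by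
    rw [← dt_self, ← dt_self]
    have hz : dt (o - a) n = 0 := by
      have := dt_rf (a := a) h o
      rw [ho] at this; linarith
    simp only [dt, PiLp.sub_apply, rf_apply] at hz ⊢
    linear_combination (4 * ((p 0 - a 0) * n 0 + (p 1 - a 1) * n 1) ^ 2) * h2 + 4 * ((p 0 - a 0) * n 0 + (p 1 - a 1) * n 1) * hz
  exact (sq_eq_sq₀ (norm_nonneg _) (norm_nonneg _)).1 hq
end

noncomputable section
open MeasureTheory Filter Topology

structure SF (a b c τ n : E2) (L κ : ℝ) : Prop where
  hcr : cr (b - a) (c - a) ≠ 0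
  of : OF τ n
  hL : 0 < L
  hb : b = a + L • τ
  hκ : 0 < κ
  hbar : ∀ p, bar a b c p = κ * dt (p - a) n

lemma exists_SF {a b c : E2} (h : cr (b - a) (c - a) ≠ 0) : ∃ τ n L κ, SF a b c τ n L κ := by
  obtain ⟨τ, n, L, κ, h1, h2, h3, h4, h5⟩ := side_frame h
  refine ⟨τ, n, L, κ, h, h1, h2, h3, h4, fun p => ?_⟩
  have := h5 (frinv a τ n p)
  rwa [fr_frinv h1] at this

/-- Folding onto the half plane. -/
def fo (a n p : E2) : E2 := p + (|dt (p - a) n| - dt (p - a) n) • n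

lemma fo_cont (a n : E2) : Continuous (fo a n) := by
  unfold fo dt; fun_prop

lemma fo_pos {a n p : E2} (h : 0 ≤ dt (p - a) n) : fo a n p = p := by
  unfold fo; rw [abs_of_nonneg h]; simp

lemma fo_neg {a n p : E2} (h : dt (p - a) n ≤ 0) : fo a n p = rf a n p := by
  unfold fo rf; rw [abs_of_nonpos h]; module

lemma fo_rf {a τ n : E2} (h : OF τ n) (p : E2) : fo a n (rf a n p) = fo a n p := by
  rcases le_total 0 (dt (p - a) n) with h1 | h1
  · rw [fo_pos h1, fo_neg (by rw [dt_rf h]; linarith), rf_rf h]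
  · rw [fo_neg h1, fo_pos (by rw [dt_rf h]; linarith)]

/-- The doubled triangle. -/
def Om (a b c n : E2) : Set E2 := {p | 0 < bar b c a (fo a n p) ∧ 0 < bar c a b (fo a n p)}

lemma Om_open (a b c n : E2) : IsOpen (Om a b c n) :=
  (isOpen_lt continuous_const ((bar_continuous _ _ _).comp (fo_cont a n))).inter
    (isOpen_lt continuous_const ((bar_continuous _ _ _).comp (fo_cont a n)))

section
variable {a b c τ n : E2} {L κ : ℝ}

lemma SF.IT_pos (S : SF a b c τ n L κ) {p : E2} (hp : p ∈ interior (Tri a b c)) : 0 < dt (p - a) n := by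
  have := ((mem_interior_Tri S.hcr p).1 hp).2.2
  rw [S.hbar] at this
  exact pos_of_mul_pos_right (by linarith) S.hκ.le

lemma SF.Tri_nonneg (S : SF a b c τ n L κ) {p : E2} (hp : p ∈ Tri a b c) : 0 ≤ dt (p - a) n := by
  have := ((mem_Tri S.hcr p).1 hp).2.2
  rw [S.hbar] at this
  exact nonneg_of_mul_nonneg_right (by linarith) S.hκ

lemma SF.IT_Om (S : SF a b c τ n L κ) : interior (Tri a b c) ⊆ Om a b c n := by
  intro p hp
  have h := (mem_interior_Tri S.hcr p).1 hp
  simp only [Om, mem_ofPred_eq, fo_pos (S.IT_pos hp).le]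
  exact ⟨h.1, h.2.1⟩

lemma SF.rf_Om (S : SF a b c τ n L κ) {p : E2} : rf a n p ∈ Om a b c n ↔ p ∈ Om a b c n := by
  simp only [Om, mem_ofPred_eq, fo_rf S.of]

lemma SF.rf_IT (S : SF a b c τ n L κ) {p : E2} (hp : p ∈ interior (Tri a b c)) :
    rf a n p ∉ interior (Tri a b c) := by
  intro h
  have h1 := S.IT_pos hp
  have h2 := S.IT_pos h
  rw [dt_rf S.of] at h2; linarith

/-- points of the two other sides are not in the doubled triangle -/
lemma SF.not_Om (S : SF a b c τ n L κ) {p : E2} (hp : p ∈ Tri a b c) (h : bar b c a p = 0 ∨ bar c a b p = 0) :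
    p ∉ Om a b c n := by
  intro h'
  simp only [Om, mem_ofPred_eq, fo_pos (S.Tri_nonneg hp)] at h'
  rcases h with h | h <;> linarith [h'.1, h'.2]

/-- The doubled function. -/
def dbl (a b c n : E2) (u : E2 → ℝ) (p : E2) : ℝ :=
  (interior (Tri a b c)).indicator u p + (interior (Tri a b c)).indicator u (rf a n p)

lemma SF.dbl_rf (S : SF a b c τ n L κ) (u : E2 → ℝ) (p : E2) : dbl a b c n u (rf a n p) = dbl a b c n u p := by
  unfold dbl; rw [rf_rf S.of, add_comm]

lemma SF.dbl_IT (S : SF a b c τ n L κ) (u : E2 → ℝ) {p : E2} (hp : p ∈ interior (Tri a b c)) :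
    dbl a b c n u p = u p := by
  unfold dbl; rw [indicator_of_mem hp, indicator_of_notMem (S.rf_IT hp), add_zero]

lemma SF.dbl_int (S : SF a b c τ n L κ) {u : E2 → ℝ} (hu : IntegrableOn u (interior (Tri a b c))) :
    Integrable (dbl a b c n u) := by
  have h1 : Integrable ((interior (Tri a b c)).indicator u) := hu.integrable_indicator isOpen_interior.measurableSet
  exact h1.add ((rf_mp S.of).integrable_comp_of_integrable h1)

lemma SF.dbl_pair (S : SF a b c τ n L κ) {u : E2 → ℝ} (hu : IntegrableOn u (interior (Tri a b c))) {G : E2 → ℝ}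
    (hG : Continuous G) (M : ℝ) (hM : ∀ p, ‖G p‖ ≤ M) :
    ∫ p, dbl a b c n u p * G p = ∫ p in interior (Tri a b c), u p * (G p + G (rf a n p)) := by
  have h1 : Integrable ((interior (Tri a b c)).indicator u) := hu.integrable_indicator isOpen_interior.measurableSet
  have h2 : Integrable (fun p => (interior (Tri a b c)).indicator u (rf a n p)) :=
    (rf_mp S.of).integrable_comp_of_integrable h1
  have i1 : Integrable (fun p => (interior (Tri a b c)).indicator u p * G p) :=
    h1.mul_bdd (c := M) hG.aestronglyMeasurable (Eventually.of_forall hM)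
  have i2 : Integrable (fun p => (interior (Tri a b c)).indicator u (rf a n p) * G p) :=
    h2.mul_bdd (c := M) hG.aestronglyMeasurable (Eventually.of_forall hM)
  have i3 : Integrable (fun p => (interior (Tri a b c)).indicator u p * G (rf a n p)) :=
    h1.mul_bdd (c := M) (hG.comp (rf_cont a n)).aestronglyMeasurable (Eventually.of_forall fun p => hM _)
  have e1 : ∫ p, (interior (Tri a b c)).indicator u (rf a n p) * G p =
      ∫ p, (interior (Tri a b c)).indicator u p * G (rf a n p) := by
    rw [← rf_integral (a := a) S.of]
    simp only [rf_rf S.of]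
  unfold dbl
  simp only [add_mul]
  rw [integral_add i1 i2, e1, ← integral_add i1 i3, ← integral_indicator isOpen_interior.measurableSet]
  congr 1; funext p
  by_cases hp : p ∈ interior (Tri a b c)
  · simp [hp]; ring
  · simp [hp]

lemma SF.zf (S : SF a b c τ n L κ) {H : E2 → ℝ} (hH : ContDiff ℝ (⊤ : ℕ∞) H) (he : ∀ p, H (rf a n p) = H p) :
    ZF a b H := by
  intro t ht
  have hp : rf a n (a + t • (b - a)) = a + t • (b - a) := by
    have h3 := S.of.2.2
    unfold rf
    rw [S.hb]
    have : dt (a + t • (a + L • τ - a) - a) n = 0 := by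
      simp [dt]; linear_combination t * L * h3
    rw [this]; simp
  set p := a + t • (b - a) with hpd
  have hd : ∀ q, DifferentiableAt ℝ H q := fun q => hH.differentiable (by simp) q
  have h1 := rf_chain (a := a) (n := n) (hd (rf a n p)) n
  rw [show (fun p => H (rf a n p)) = H from funext he, hp] at h1
  obtain ⟨o1, o2, o3⟩ := S.of
  have t2 : n - (2 * dt n n) • n = -n := by
    have : dt n n = 1 := by simp only [dt]; linear_combination o2
    rw [this]; module
  rw [t2, map_neg] at h1
  have h0 : fderiv ℝ H p n = 0 := by linarith
  rw [lin_decomp] at h0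
  have hba : b - a = L • τ := by rw [S.hb]; abel
  rw [hba]
  simp only [PiLp.smul_apply, smul_eq_mul]
  -- τ = ± rotated n
  have hq : (τ 1 * n 1 + τ 0 * n 0) = 0 := by linarith
  have hτ : τ 1 = (τ 1 * n 0 - τ 0 * n 1) * n 0 ∧ τ 0 = -(τ 1 * n 0 - τ 0 * n 1) * n 1 := by
    constructor
    · linear_combination (-τ 1) * o2 + n 1 * hq
    · linear_combination (-τ 0) * o2 + n 0 * hq
  have g1 : fderiv ℝ H p e0 * τ 1 - fderiv ℝ H p e1 * τ 0 = 0 := by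
    linear_combination (fderiv ℝ H p e0) * hτ.1 - (fderiv ℝ H p e1) * hτ.2 + (τ 1 * n 0 - τ 0 * n 1) * h0
  linear_combination L * g1

lemma ZF_of_notMem {H : E2 → ℝ} (h : ∀ t ∈ Icc (0:ℝ) 1, a + t • (b - a) ∉ tsupport H) : ZF a b H := by
  intro t ht
  have := fderiv_of_notMem_tsupport (𝕜 := ℝ) (h t ht)
  rw [this]; simp
end
end

noncomputable section
open MeasureTheory Filter Topology

lemma Mini.intOn {a b c : E2} {ν : ℝ} {u : E2 → ℝ} (hu : Mini a b c ν u) : IntegrableOn u (interior (Tri a b c)) :=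
  hu.mem.integrable (by norm_num)

lemma seg_bar (a b c : E2) (t : ℝ) : bar a b c (a + t • (b - a)) = 0 := by
  rw [bar_add, bar_left, cr]; ring

lemma tsupport_add_rf {h : E2 → ℝ} {a τ n p : E2} (ho : OF τ n) (h1 : p ∉ tsupport h) (h2 : rf a n p ∉ tsupport h) :
    p ∉ tsupport (fun p => h p + h (rf a n p)) := by
  rw [notMem_tsupport_iff_eventuallyEq] at *
  have h3 : ∀ᶠ q in 𝓝 p, h (rf a n q) = 0 := (rf_cont a n).continuousAt.eventually h2
  filter_upwards [h1, h3] with q e1 e2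
  simp only [Pi.zero_apply] at *
  rw [e1, e2, add_zero]

lemma Mini.weakSol {a b c τ n : E2} {L κ ν : ℝ} {u : E2 → ℝ} (hu : Mini a b c ν u) (S : SF a b c τ n L κ) :
    WeakSol (Om a b c n) (dbl a b c n u) ν := by
  intro h hh hc hs
  have hl := lap_smooth hh
  have hG : Continuous (fun y => lap h y + ν * h y) := hl.continuous.add (continuous_const.mul hh.continuous)
  have hGc : HasCompactSupport (fun y => lap h y + ν * h y) := (lap_supp hc).add (hc.mul_left (f := fun _ => ν))
  obtain ⟨M, hM⟩ := hG.bounded_above_of_compact_support hGc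
  rw [S.dbl_pair hu.intOn hG M hM]
  set H : E2 → ℝ := fun p => h p + h (rf a n p) with hH
  have hr : ContDiff ℝ (⊤ : ℕ∞) (fun p => h (rf a n p)) := hh.comp (rf_contDiff a n)
  have hHs : ContDiff ℝ (⊤ : ℕ∞) H := hh.add hr
  have hlap : ∀ p, lap H p = lap h p + lap h (rf a n p) := by
    intro p
    rw [← rf_lap hh S.of]
    have key : ∀ v, mixedDeriv H p v v = mixedDeriv h p v v + mixedDeriv (fun p => h (rf a n p)) p v v := by
      intro v
      unfold mixedDeriv
      rw [show (fun y => fderiv ℝ H y v) = fun y => fderiv ℝ h y v + fderiv ℝ (fun p => h (rf a n p)) y v from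
        funext fun y => by rw [hH, fderiv_fun_add (hh.differentiable (by simp) _) (hr.differentiable (by simp) _)]; rfl]
      rw [fderiv_fun_add ((dir_smooth hh v).differentiable (by simp) _) ((dir_smooth hr v).differentiable (by simp) _)]
      rfl
    unfold lap; rw [key, key]; ring
  have hout : ∀ p ∈ Tri a b c, (bar b c a p = 0 ∨ bar c a b p = 0) → p ∉ tsupport H := by
    intro p hp hb
    have h1 := S.not_Om hp hb
    exact tsupport_add_rf S.of (fun h' => h1 (hs h')) (fun h' => h1 (S.rf_Om.1 (hs h')))
  have := hu.weak H (hHs.of_le two_le_top) (S.zf hHs fun p => by simp only [hH, rf_rf S.of]; ring)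
    (ZF_of_notMem fun t ht => hout _ (by rw [← Tri_perm]; exact seg_in_Tri ht) (Or.inl (seg_bar _ _ _ _)))
    (ZF_of_notMem fun t ht => hout _ (by rw [Tri_perm c a b]; exact seg_in_Tri ht) (Or.inr (seg_bar _ _ _ _)))
  rw [← this]
  congr 1; funext p; rw [hlap]; ring

lemma ae_eq_cont {Ω : Set E2} (hΩ : IsOpen Ω) {f g : E2 → ℝ} (hf : ContinuousOn f Ω) (hg : ContinuousOn g Ω)
    (h : ∀ᵐ p, p ∈ Ω → f p = g p) : ∀ p ∈ Ω, f p = g p := by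
  have h' : f =ᵐ[volume.restrict Ω] g := (ae_restrict_iff' hΩ.measurableSet).2 h
  have := MeasureTheory.Measure.eqOn_open_of_ae_eq h' hΩ hf hg
  exact this

/-- Regularity up to a side. -/
structure SideReg (a b c τ n : E2) (ν : ℝ) (u g : E2 → ℝ) : Prop where
  smooth : ContDiffOn ℝ (⊤ : ℕ∞) g (Om a b c n)
  eqn : ∀ p ∈ Om a b c n, lap g p = -ν * g p
  ae : ∀ᵐ p, p ∈ Om a b c n → dbl a b c n u p = g p
  even : ∀ p ∈ Om a b c n, g (rf a n p) = g p

lemma Mini.sideReg {a b c τ n : E2} {L κ ν : ℝ} {u : E2 → ℝ} (hu : Mini a b c ν u) (S : SF a b c τ n L κ) :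
    ∃ g, SideReg a b c τ n ν u g := by
  obtain ⟨g, h1, h2, h3⟩ := weyl (Om_open a b c n) (S.dbl_int hu.intOn) (hu.weakSol S)
  refine ⟨g, h1, h2, h3, ?_⟩
  refine ae_eq_cont (Om_open a b c n) ?_ h1.continuousOn ?_
  · exact h1.continuousOn.comp (rf_cont a n).continuousOn fun p hp => S.rf_Om.2 hp
  · have := (rf_mp (a := a) S.of).quasiMeasurePreserving.ae h3
    filter_upwards [this, h3] with p e1 e2 hp
    rw [← e1 (S.rf_Om.2 hp), S.dbl_rf, e2 hp]

lemma SideReg.ae_IT {a b c τ n : E2} {L κ ν : ℝ} {u g : E2 → ℝ} (h : SideReg a b c τ n ν u g) (S : SF a b c τ n L κ) :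
    ∀ᵐ p, p ∈ interior (Tri a b c) → u p = g p := by
  filter_upwards [h.ae] with p hp hI
  rw [← hp (S.IT_Om hI), S.dbl_IT u hI]

lemma SideReg.neumann {a b c τ n : E2} {L κ ν : ℝ} {u g : E2 → ℝ} (h : SideReg a b c τ n ν u g) (S : SF a b c τ n L κ)
    {p : E2} (hp : p ∈ Om a b c n) (h0 : dt (p - a) n = 0) : fderiv ℝ g p n = 0 := by
  have hfix : rf a n p = p := by unfold rf; rw [h0]; simp
  have hd : DifferentiableAt ℝ g (rf a n p) := by
    rw [hfix]
    exact (h.smooth.contDiffAt ((Om_open a b c n).mem_nhds hp)).differentiableAt (by simp)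
  have h1 := rf_chain hd n
  have he : (fun p => g (rf a n p)) =ᶠ[𝓝 p] g := by
    filter_upwards [(Om_open a b c n).mem_nhds hp] with q hq using h.even q hq
  rw [he.fderiv_eq, hfix] at h1
  have t2 : n - (2 * dt n n) • n = -n := by
    have : dt n n = 1 := by simp only [dt]; linear_combination S.of.2.1
    rw [this]; module
  rw [t2, map_neg] at h1
  linarith

/-- Mean value formula in terms of the original function. -/
lemma SideReg.mean {a b c τ n : E2} {L κ ν : ℝ} {u g : E2 → ℝ} (h : SideReg a b c τ n ν u g) (S : SF a b c τ n L κ)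
    (hu : IntegrableOn u (interior (Tri a b c)))
    {C C1 : ℝ → ℝ} (hC : ContDiff ℝ (⊤ : ℕ∞) C) (h1 : ∀ t, HasDerivAt C (C1 t) t)
    (h2 : ∀ t, HasDerivAt C1 (-ν * C t) t) (hC0 : C 0 = 1) {x : E2} {R R' : ℝ} (hR : 0 < R) (hRR : R < R')
    (hB : Metric.ball x R' ⊆ Om a b c n) :
    g x * ∫ y : E2, bmp R y * C (y 0) =
      ∫ p in interior (Tri a b c), u p * (bmp R (p - x) + bmp R (rf a n p - x)) := by
  rw [← mvp hC h1 h2 hC0 hR hRR ((h.smooth.mono hB).of_le two_le_top) (fun p hp => h.eqn p (hB hp))]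
  have hG : Continuous (fun y => bmp R (y - x)) := (bmp_contDiff R).continuous.comp (by fun_prop)
  rw [← S.dbl_pair hu hG 1 fun p => by
    rw [Real.norm_eq_abs, abs_of_nonneg (bmp_nonneg _ _)]; exact bmp_le_one _ _]
  apply integral_congr_ae
  filter_upwards [h.ae] with p hp
  by_cases hpB : p ∈ Metric.ball x R'
  · simp only [hp (hB hpB)]
  · have : bmp R (p - x) = 0 := by
      apply bmp_zero hR
      rw [Metric.mem_ball, dist_eq_norm] at hpB
      linarith
    simp only [this, mul_zero]

lemma line_null {a τ n : E2} (ho : OF τ n) : volume {p : E2 | dt (p - a) n = 0} = 0 := by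
  have h1 := (fr_measurePreserving (o := a) ho).measure_preimage_emb (fr_emb ho) {p : E2 | dt (p - a) n = 0}
  rw [← h1]
  have : fr a τ n ⁻¹' {p : E2 | dt (p - a) n = 0} = univ ×ˢ {(0:ℝ)} := by
    ext q
    have := congrArg Prod.snd (frinv_fr (o := a) ho q)
    simp only [frinv] at this
    simp [this]
  rw [this, Measure.volume_eq_prod, Measure.prod_prod]; simp

/-- Mass of the folded kernel. -/
lemma SF.mass {a b c τ n : E2} {L κ : ℝ} (S : SF a b c τ n L κ) {x : E2} {R : ℝ} (hR : 0 < R)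
    (hB : Metric.ball x R ⊆ Om a b c n) :
    ∫ p in interior (Tri a b c), (bmp R (p - x) + bmp R (rf a n p - x)) = ∫ y : E2, bmp R y := by
  have hG : Continuous (fun y => bmp R (y - x)) := (bmp_contDiff R).continuous.comp (by fun_prop)
  have h1 : IntegrableOn (fun _ : E2 => (1:ℝ)) (interior (Tri a b c)) := integrableOn_const (IT_fin a b c).ne
  have := S.dbl_pair h1 hG 1 fun p => by
    rw [Real.norm_eq_abs, abs_of_nonneg (bmp_nonneg _ _)]; exact bmp_le_one _ _
  simp only [one_mul] at this
  rw [← this, ← integral_sub_right_eq_self (fun y => bmp R y) x]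
  apply integral_congr_ae
  have hn : ∀ᵐ p : E2, dt (p - a) n ≠ 0 := by
    have := line_null (a := a) S.of
    exact measure_eq_zero_iff_ae_notMem.1 this
  filter_upwards [hn] with p hp
  by_cases hpB : p ∈ Metric.ball x R
  · have hO := hB hpB
    have hone : dbl a b c n (fun _ => 1) p = 1 := by
      rcases lt_or_gt_of_ne hp with h | h
      · have hm : rf a n p ∈ interior (Tri a b c) := by
          rw [mem_interior_Tri S.hcr]
          simp only [Om, mem_ofPred_eq, fo_neg h.le] at hO
          refine ⟨hO.1, hO.2, ?_⟩
          rw [S.hbar, dt_rf S.of]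
          exact mul_pos S.hκ (by linarith)
        rw [← S.dbl_rf, S.dbl_IT _ hm]
      · have hm : p ∈ interior (Tri a b c) := by
          rw [mem_interior_Tri S.hcr]
          simp only [Om, mem_ofPred_eq, fo_pos h.le] at hO
          refine ⟨hO.1, hO.2, ?_⟩
          rw [S.hbar]
          exact mul_pos S.hκ h
        rw [S.dbl_IT _ hm]
    rw [hone, one_mul]
  · have : bmp R (p - x) = 0 := by
      apply bmp_zero hR
      rw [Metric.mem_ball, dist_eq_norm] at hpB
      linarith
    simp only [this, mul_zero]
end

noncomputable section
open MeasureTheory Filter Topology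

/-- Profile of the annular weights. -/
def WW (s : ℝ) : ℝ := Real.smoothTransition (2 * s - 1)

lemma WW_contDiff : ContDiff ℝ (⊤ : ℕ∞) WW := Real.smoothTransition.contDiff.comp (by fun_prop)

lemma WW_zero {s : ℝ} (h : s ≤ 1 / 2) : WW s = 0 := Real.smoothTransition.zero_of_nonpos (by linarith)
lemma WW_one {s : ℝ} (h : 1 ≤ s) : WW s = 1 := Real.smoothTransition.one_of_one_le (by linarith)

def ww (s : ℝ) : ℝ := deriv WW s

lemma ww_contDiff : ContDiff ℝ (⊤ : ℕ∞) ww := (contDiff_infty_iff_deriv.1 WW_contDiff).2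

lemma WW_hasDeriv (s : ℝ) : HasDerivAt WW (ww s) s := (WW_contDiff.differentiable (by simp) s).hasDerivAt

lemma ww_zero {s : ℝ} (h : 1 < s) : ww s = 0 := by
  have : WW =ᶠ[𝓝 s] fun _ => 1 := by
    filter_upwards [lt_mem_nhds h] with t ht using WW_one ht.le
  unfold ww; rw [this.deriv_eq]; simp

lemma ww_zero' {s : ℝ} (h : s < 1 / 2) : ww s = 0 := by
  have : WW =ᶠ[𝓝 s] fun _ => 0 := by
    filter_upwards [gt_mem_nhds h] with t ht using WW_zero ht.le
  unfold ww; rw [this.deriv_eq]; simp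

lemma ww_bdd : ∃ A > 0, ∀ s, |ww s| ≤ A := by
  have hc : HasCompactSupport ww := by
    apply HasCompactSupport.intro (isCompact_Icc (a := (1/2:ℝ)) (b := 1))
    intro x hx
    by_cases h : x < 1 / 2
    · exact ww_zero' h
    · exact ww_zero (by by_contra h'; exact hx ⟨by linarith, by linarith⟩)
  obtain ⟨M, hM⟩ := ww_contDiff.continuous.bounded_above_of_compact_support hc
  exact ⟨max M 1, by positivity, fun s => (hM s).trans (le_max_left _ _)⟩

lemma ww_pos : ∃ s ∈ Ioo (1/2:ℝ) 1, ww s = 2 := by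
  obtain ⟨s, hs, h⟩ := exists_hasDerivAt_eq_slope WW ww (a := 1/2) (b := 1) (by norm_num)
    WW_contDiff.continuous.continuousOn (fun s _ => WW_hasDeriv s)
  refine ⟨s, hs, ?_⟩
  rw [h, WW_one le_rfl, WW_zero le_rfl]; norm_num

def F1 (s : ℝ) : ℝ := (WW s - WW (4 * s)) / (4 * s)

lemma F1_zero {s : ℝ} (h : s ≤ 1 / 8) : F1 s = 0 := by
  unfold F1; rw [WW_zero (by linarith), WW_zero (by linarith)]; simp

lemma F1_zero' {s : ℝ} (h : 1 ≤ s) : F1 s = 0 := by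
  unfold F1; rw [WW_one (by linarith), WW_one (by linarith)]; simp

lemma F1_contDiff : ContDiff ℝ (⊤ : ℕ∞) F1 := by
  rw [contDiff_iff_contDiffAt]
  intro s
  by_cases h : s < 1 / 8
  · have : F1 =ᶠ[𝓝 s] fun _ => 0 := by
      filter_upwards [gt_mem_nhds h] with t ht using F1_zero ht.le
    exact contDiffAt_const.congr_of_eventuallyEq this
  · unfold F1
    refine ContDiffAt.div ?_ (by fun_prop) (by intro h0; push Not at h; linarith)
    exact (WW_contDiff.sub (WW_contDiff.comp (by fun_prop))).contDiffAt

def F0 (s : ℝ) : ℝ := ∫ t in (1:ℝ)..s, F1 t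

lemma F0_deriv (s : ℝ) : HasDerivAt F0 (F1 s) s :=
  intervalIntegral.integral_hasDerivAt_right (F1_contDiff.continuous.intervalIntegrable _ _)
    (F1_contDiff.continuous.stronglyMeasurableAtFilter _ _) F1_contDiff.continuous.continuousAt

lemma F0_contDiff : ContDiff ℝ (⊤ : ℕ∞) F0 := by
  rw [contDiff_infty_iff_deriv]
  refine ⟨fun s => (F0_deriv s).differentiableAt, ?_⟩
  rw [show deriv F0 = F1 from funext fun s => (F0_deriv s).deriv]
  exact F1_contDiff

lemma F0_zero {s : ℝ} (h : 1 ≤ s) : F0 s = 0 := by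
  unfold F0
  rw [intervalIntegral.integral_congr (g := fun _ => 0), intervalIntegral.integral_zero]
  intro t ht
  rw [uIcc_of_le h] at ht
  exact F1_zero' ht.1

lemma F0_bdd : ∃ A > 0, ∀ s, 0 ≤ s → |F0 s| ≤ A := by
  obtain ⟨M, hM⟩ := isCompact_Icc.exists_bound_of_continuousOn (s := Icc (0:ℝ) 1) F0_contDiff.continuous.continuousOn
  refine ⟨max M 1, by positivity, fun s hs => ?_⟩
  rcases le_total s 1 with h | h
  · exact (hM s ⟨hs, h⟩).trans (le_max_left _ _)
  · rw [F0_zero h]; simp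

/-- `F1` solves the radial equation. -/
lemma F1_eq (s : ℝ) : s * deriv F1 s + F1 s = (ww s - 4 * ww (4 * s)) / 4 := by
  have h1 : HasDerivAt (fun s => s * F1 s) (1 * F1 s + s * deriv F1 s) s :=
    (hasDerivAt_id s).mul (F1_contDiff.differentiable (by simp) s).hasDerivAt
  have h2 : HasDerivAt (fun s => (WW s - WW (4 * s)) / 4) ((ww s - ww (4 * s) * 4) / 4) s := by
    have := (WW_hasDeriv (4 * s)).comp s ((hasDerivAt_id s).const_mul 4)
    simp only [mul_one] at this
    exact ((WW_hasDeriv s).sub this).div_const 4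
  have he : (fun s => s * F1 s) = fun s => (WW s - WW (4 * s)) / 4 := by
    funext s
    by_cases hs : s = 0
    · subst hs; simp
    · unfold F1; field_simp
  rw [he] at h1
  have := h1.unique h2
  linarith

/-- radial variable -/
def rq (a : E2) (k : ℝ) (p : E2) : ℝ := k * dt (p - a) (p - a)

lemma rq_contDiff (a : E2) (k : ℝ) : ContDiff ℝ (⊤ : ℕ∞) (rq a k) := by
  unfold rq dt; fun_prop

lemma rq_fderiv (a : E2) (k : ℝ) (p w : E2) : fderiv ℝ (rq a k) p w = 2 * k * dt (p - a) w := by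
  have h : ∀ i : Fin 2, HasFDerivAt (fun p : E2 => p i - a i) (EuclideanSpace.proj i : E2 →L[ℝ] ℝ) p := fun i =>
    (EuclideanSpace.proj i : E2 →L[ℝ] ℝ).hasFDerivAt.sub_const _
  have := (((h 0).mul (h 0)).add ((h 1).mul (h 1))).const_mul k
  have e : rq a k = fun p => k * ((p 0 - a 0) * (p 0 - a 0) + (p 1 - a 1) * (p 1 - a 1)) := by
    funext p; simp [rq, dt]
  rw [e]
  refine (congrArg (fun L : E2 →L[ℝ] ℝ => L w) this.fderiv).trans ?_
  simp [dt]; ring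

lemma rad_fderiv {F F' : ℝ → ℝ} (hF : ∀ s, HasDerivAt F (F' s) s) (a : E2) (k : ℝ) (p w : E2) :
    fderiv ℝ (fun p => F (rq a k p)) p w = F' (rq a k p) * (2 * k * dt (p - a) w) := by
  have h1 := ((rq_contDiff a k).differentiable (by simp) p).hasFDerivAt
  have := ((hF (rq a k p)).comp_hasFDerivAt p h1).fderiv
  simp only [Function.comp_def] at this
  rw [this, _root_.smul_apply, rq_fderiv, smul_eq_mul]

def hh (a : E2) (k : ℝ) (p : E2) : ℝ := F0 (rq a k p)

lemma hh_contDiff (a : E2) (k : ℝ) : ContDiff ℝ (⊤ : ℕ∞) (hh a k) := F0_contDiff.comp (rq_contDiff a k)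

lemma hh_lap (a : E2) (k : ℝ) (p : E2) : lap (hh a k) p = k * ww (rq a k p) - 4 * k * ww (rq a (4 * k) p) := by
  have key : ∀ i : Fin 2, mixedDeriv (hh a k) p (EuclideanSpace.single i 1) (EuclideanSpace.single i 1) =
      deriv F1 (rq a k p) * (2 * k * (p i - a i)) ^ 2 + F1 (rq a k p) * (2 * k) := by
    intro i
    have hdt : ∀ q : E2, dt q (EuclideanSpace.single i 1) = q i := by
      intro q; fin_cases i <;> simp [dt]
    unfold mixedDeriv
    rw [show (fun y => fderiv ℝ (hh a k) y (EuclideanSpace.single i 1)) = fun y => F1 (rq a k y) * (2 * k * (y i - a i)) from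
      funext fun y => by unfold hh; rw [rad_fderiv F0_deriv, hdt]; rfl]
    have d1 : DifferentiableAt ℝ (fun y => F1 (rq a k y)) p :=
      (F1_contDiff.comp (rq_contDiff a k)).differentiable (by simp) p
    have d2 : HasFDerivAt (fun y : E2 => 2 * k * (y i - a i)) ((2 * k) • (EuclideanSpace.proj i : E2 →L[ℝ] ℝ)) p :=
      ((EuclideanSpace.proj i : E2 →L[ℝ] ℝ).hasFDerivAt.sub_const _).const_mul _
    rw [fderiv_mul_dir d1 d2.differentiableAt, d2.fderiv,
      rad_fderiv (fun s => (F1_contDiff.differentiable (by simp) s).hasDerivAt), hdt]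
    simp; ring
  unfold lap
  rw [key 0, key 1]
  have e4 : rq a (4 * k) p = 4 * rq a k p := by unfold rq; ring
  rw [e4]
  have h := F1_eq (rq a k p)
  have hr : rq a k p = k * ((p 0 - a 0) ^ 2 + (p 1 - a 1) ^ 2) := by
    simp only [rq, dt, PiLp.sub_apply]; ring
  linear_combination 4 * k * h - 4 * k * deriv F1 (rq a k p) * hr

lemma hh_zf1 (a b : E2) (k : ℝ) : ZF a b (hh a k) := by
  intro t _
  unfold hh
  rw [rad_fderiv F0_deriv, rad_fderiv F0_deriv]
  simp [dt]; ring

lemma hh_zf2 (a c : E2) (k : ℝ) : ZF c a (hh a k) := by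
  intro t _
  unfold hh
  rw [rad_fderiv F0_deriv, rad_fderiv F0_deriv]
  simp [dt]; ring

lemma hh_zf3 {a b c : E2} {k : ℝ} (hf : ∀ t ∈ Icc (0:ℝ) 1, 1 ≤ rq a k (b + t • (c - b))) : ZF b c (hh a k) := by
  intro t ht
  unfold hh
  rw [rad_fderiv F0_deriv, rad_fderiv F0_deriv, F1_zero' (hf t ht)]
  simp
end

noncomputable section
open MeasureTheory Filter Topology

lemma cr_le (u v : E2) : |cr u v| ≤ ‖u‖ * ‖v‖ := by
  apply abs_le_of_sq_le_sq _ (by positivity)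
  rw [mul_pow, ← dt_self, ← dt_self]
  simp only [cr, dt]
  nlinarith [sq_nonneg (u 0 * v 0 + u 1 * v 1)]

lemma dt_le (u v : E2) : |dt u v| ≤ ‖u‖ * ‖v‖ := by
  apply abs_le_of_sq_le_sq _ (by positivity)
  rw [mul_pow, ← dt_self, ← dt_self]
  simp only [dt]
  nlinarith [sq_nonneg (u 0 * v 1 - u 1 * v 0)]

lemma bar_lip (a b c : E2) : ∃ Λ > 0, ∀ p q, |bar a b c p - bar a b c q| ≤ Λ * ‖p - q‖ := by
  refine ⟨‖b - a‖ / |cr (b - a) (c - a)| + 1, by positivity, fun p q => ?_⟩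
  have h := bar_add a b c q (p - q) 1
  rw [one_smul, add_sub_cancel, one_mul] at h
  rw [h, add_sub_cancel_left, abs_div]
  have := cr_le (b - a) (p - q)
  have h2 : |cr (b - a) (p - q)| / |cr (b - a) (c - a)| ≤ ‖b - a‖ * ‖p - q‖ / |cr (b - a) (c - a)| := by gcongr
  have h3 : ‖b - a‖ * ‖p - q‖ / |cr (b - a) (c - a)| = ‖b - a‖ / |cr (b - a) (c - a)| * ‖p - q‖ := by ring
  nlinarith [norm_nonneg (p - q)]

def wt (a : E2) (r : ℝ) (p : E2) : ℝ := (r ^ 2)⁻¹ * ww (rq a (r ^ 2)⁻¹ p)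

lemma wt_cont (a : E2) (r : ℝ) : Continuous (wt a r) :=
  continuous_const.mul (ww_contDiff.continuous.comp (rq_contDiff a _).continuous)

lemma wt_lap {a : E2} {r : ℝ} (p : E2) : lap (hh a (r ^ 2)⁻¹) p = wt a r p - wt a (r / 2) p := by
  rw [hh_lap]
  unfold wt
  have : ((r / 2) ^ 2)⁻¹ = 4 * (r ^ 2)⁻¹ := by rw [div_pow, inv_div]; ring
  rw [this]

lemma rq_norm (a : E2) (k : ℝ) (p : E2) : rq a k p = k * ‖p - a‖ ^ 2 := by
  unfold rq; rw [dt_self]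

lemma wt_zero {a : E2} {r : ℝ} (hr : 0 < r) {p : E2} (hp : r < ‖p - a‖) : wt a r p = 0 := by
  unfold wt
  rw [ww_zero, mul_zero]
  rw [rq_norm, inv_mul_eq_div, lt_div_iff₀ (by positivity), one_mul]
  gcongr

lemma hh_zero {a : E2} {r : ℝ} (hr : 0 < r) {p : E2} (hp : r ≤ ‖p - a‖) : hh a (r ^ 2)⁻¹ p = 0 := by
  unfold hh
  apply F0_zero
  rw [rq_norm, inv_mul_eq_div, le_div_iff₀ (by positivity), one_mul]
  gcongr

lemma far_side {a b c : E2} (hcr : cr (b - a) (c - a) ≠ 0) : ∃ ρ > 0, ∀ t ∈ Icc (0:ℝ) 1, ρ ≤ ‖b + t • (c - b) - a‖ := by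
  obtain ⟨Λ, hΛ, h⟩ := bar_lip b c a
  refine ⟨1 / Λ, by positivity, fun t _ => ?_⟩
  have := h a (b + t • (c - b))
  rw [bar_self (cr_perm hcr), seg_bar, sub_zero, abs_one, norm_sub_rev] at this
  rw [div_le_iff₀ hΛ]; linarith

lemma hh_zf {a b c : E2} {ρ r : ℝ} (hρ : ∀ t ∈ Icc (0:ℝ) 1, ρ ≤ ‖b + t • (c - b) - a‖) (hr : 0 < r) (hrρ : r ≤ ρ) :
    ZF a b (hh a (r ^ 2)⁻¹) ∧ ZF b c (hh a (r ^ 2)⁻¹) ∧ ZF c a (hh a (r ^ 2)⁻¹) := by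
  refine ⟨hh_zf1 _ _ _, hh_zf3 fun t ht => ?_, hh_zf2 _ _ _⟩
  have := hρ t ht
  rw [rq_norm, inv_mul_eq_div, le_div_iff₀ (by positivity), one_mul]
  gcongr; linarith

lemma ball_vol (a : E2) {r : ℝ} (hr : 0 ≤ r) : volume.real (Metric.ball a r) = r ^ 2 * volume.real (Metric.ball (0:E2) 1) := by
  rw [measureReal_def, Measure.addHaar_ball _ _ hr, ENNReal.toReal_mul, ENNReal.toReal_ofReal (by positivity)]
  simp [measureReal_def]

section
variable {a b c : E2} {ν : ℝ} {u : E2 → ℝ}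

lemma mass_dyadic (hcr : cr (b - a) (c - a) ≠ 0) {ρ r : ℝ} (hρ : ∀ t ∈ Icc (0:ℝ) 1, ρ ≤ ‖b + t • (c - b) - a‖)
    (hr : 0 < r) (hrρ : r ≤ ρ) : MM a b c (wt a r) = MM a b c (wt a (r / 2)) := by
  obtain ⟨z1, z2, z3⟩ := hh_zf (b := b) (c := c) hρ hr hrρ
  have := green_zf hcr (one_Cl a b c) ((hh_contDiff a _).of_le two_le_top) z1 z2 z3
  simp only [one_mul, wt_lap] at this
  have h0 : AA a b c (fun _ => (1:ℝ)) (hh a (r ^ 2)⁻¹) = 0 := by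
    unfold AA gd; simp
  rw [h0, integral_sub (intOn_cont (wt_cont a r).continuousOn) (intOn_cont (wt_cont a _).continuousOn)] at this
  unfold MM; linarith

lemma Mini.dyadic (hu : Mini a b c ν u) {ρ : ℝ} (hρ : ∀ t ∈ Icc (0:ℝ) 1, ρ ≤ ‖b + t • (c - b) - a‖) :
    ∃ C, ∀ r, 0 < r → r ≤ ρ → |BB a b c u (wt a r) - BB a b c u (wt a (r / 2))| ≤ C * r := by
  obtain ⟨A, hA, hF⟩ := F0_bdd
  refine ⟨ν * (A * Real.sqrt (volume.real (Metric.ball (0:E2) 1))), fun r hr hrρ => ?_⟩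
  obtain ⟨z1, z2, z3⟩ := hh_zf (b := b) (c := c) hρ hr hrρ
  have hc := hh_contDiff a (r ^ 2)⁻¹
  have hw := hu.weak _ (hc.of_le two_le_top) z1 z2 z3
  have hL : ∀ g : E2 → ℝ, Continuous g → Integrable (fun p => u p * g p) (volume.restrict (interior (Tri a b c))) := by
    intro g hg
    exact MemLp.integrable_mul hu.mem (memLp_cont hg.continuousOn)
  have e1 := int_lin3 (hL _ (wt_cont a r)) (hL _ (wt_cont a (r / 2))) (hL _ hc.continuous) 1 (-1) ν
  have e2 : ∫ p in interior (Tri a b c), u p * (lap (hh a (r ^ 2)⁻¹) p + ν * hh a (r ^ 2)⁻¹ p) =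
      ∫ p in interior (Tri a b c), (1 * (u p * wt a r p) + -1 * (u p * wt a (r / 2) p) + ν * (u p * hh a (r ^ 2)⁻¹ p)) := by
    congr 1; funext p; rw [wt_lap]; ring
  rw [e2, e1.2] at hw
  have hcs := cs_int (memLp_cont (a := a) (b := b) (c := c) hc.continuous.continuousOn) hu.mem
  have hn := hu.norm
  unfold BB at hn
  rw [hn, mul_one] at hcs
  have hb : ∫ p in interior (Tri a b c), hh a (r ^ 2)⁻¹ p * hh a (r ^ 2)⁻¹ p ≤ A ^ 2 * volume.real (Metric.ball a r) := by
    have hsup : ∀ p, hh a (r ^ 2)⁻¹ p * hh a (r ^ 2)⁻¹ p ≤ (Metric.ball a r).indicator (fun _ => A ^ 2) p := by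
      intro p
      by_cases hp : p ∈ Metric.ball a r
      · rw [indicator_of_mem hp]
        have := hF (rq a (r ^ 2)⁻¹ p) (by rw [rq_norm]; positivity)
        rw [← pow_two, ← sq_abs]
        unfold hh
        gcongr
      · rw [indicator_of_notMem hp, hh_zero hr]; simp
        rw [Metric.mem_ball, dist_eq_norm] at hp; linarith
    have hi : Integrable ((Metric.ball a r).indicator (fun _ : E2 => A ^ 2)) :=
      (integrable_indicator_iff Metric.isOpen_ball.measurableSet).2 (integrableOn_const Metric.isBounded_ball.measure_lt_top.ne)
    calc _ ≤ ∫ p in interior (Tri a b c), (Metric.ball a r).indicator (fun _ => A ^ 2) p :=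
          integral_mono (intOn_cont (hc.continuous.mul hc.continuous).continuousOn) hi.integrableOn hsup
      _ ≤ ∫ p, (Metric.ball a r).indicator (fun _ => A ^ 2) p :=
          setIntegral_le_integral hi (Eventually.of_forall fun p => indicator_nonneg (fun _ _ => by positivity) _)
      _ = _ := by
          rw [integral_indicator Metric.isOpen_ball.measurableSet, setIntegral_const, smul_eq_mul, mul_comm]
  rw [ball_vol a hr.le] at hb
  have hfin : |∫ p in interior (Tri a b c), u p * hh a (r ^ 2)⁻¹ p| ≤ A * Real.sqrt (volume.real (Metric.ball (0:E2) 1)) * r := by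
    apply abs_le_of_sq_le_sq _ (by positivity)
    rw [mul_pow, mul_pow, Real.sq_sqrt (by positivity)]
    simp only [mul_comm (u _)]
    linarith
  have : BB a b c u (wt a r) - BB a b c u (wt a (r / 2)) = -ν * ∫ p in interior (Tri a b c), u p * hh a (r ^ 2)⁻¹ p := by
    unfold BB; linarith
  rw [this, abs_mul, abs_neg, abs_of_pos hu.pos, mul_assoc]
  exact mul_le_mul_of_nonneg_left hfin hu.pos.le

lemma Mini.dyadic_lim (hu : Mini a b c ν u) {ρ : ℝ} (hρ0 : 0 < ρ) (hρ : ∀ t ∈ Icc (0:ℝ) 1, ρ ≤ ‖b + t • (c - b) - a‖) :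
    ∃ l, Tendsto (fun k : ℕ => BB a b c u (wt a (ρ * (1 / 2) ^ k))) atTop (𝓝 l) := by
  obtain ⟨C, hC⟩ := hu.dyadic hρ
  apply cauchySeq_tendsto_of_complete
  apply cauchySeq_of_le_geometric (1/2) (C * ρ) (by norm_num)
  intro k
  have h1 : (1/2:ℝ) ^ k ≤ 1 := pow_le_one₀ (by norm_num) (by norm_num)
  have := hC (ρ * (1/2) ^ k) (by positivity) (by nlinarith)
  rw [Real.dist_eq]
  rw [show ρ * (1 / 2) ^ k / 2 = ρ * (1 / 2) ^ (k + 1) by ring] at this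
  linarith

lemma mass_pos (hcr : cr (b - a) (c - a) ≠ 0) {ρ : ℝ} (hρ0 : 0 < ρ)
    (hρ : ∀ t ∈ Icc (0:ℝ) 1, ρ ≤ ‖b + t • (c - b) - a‖) :
    0 < MM a b c (wt a ρ) := by
  have hnn : ∀ p, 0 ≤ wt a ρ p := fun p => mul_nonneg (by positivity) (by
    unfold ww; exact Monotone.deriv_nonneg (Real.smoothTransition.monotone.comp fun x y h => by linarith))
  refine lt_of_le_of_ne (integral_nonneg hnn) fun h => ?_
  have hz := (setIntegral_eq_zero_iff_of_nonneg_ae (Eventually.of_forall hnn)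
    (intOn_cont (wt_cont a ρ).continuousOn)).1 h.symm
  have hz2 := ae_eq_cont (g := fun _ => (0:ℝ)) isOpen_interior (wt_cont a ρ).continuousOn continuousOn_const
    ((ae_restrict_iff' isOpen_interior.measurableSet).1 hz)
  obtain ⟨s, hs, hws⟩ := ww_pos
  -- direction to the midpoint of the opposite side
  set m := b + (1/2:ℝ) • (c - b) with hm
  have hma := hρ (1/2) ⟨by norm_num, by norm_num⟩
  have hma0 : 0 < ‖m - a‖ := lt_of_lt_of_le hρ0 hma
  set t := Real.sqrt s * ρ / ‖m - a‖ with ht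
  have hs0 : 0 < s := by linarith [hs.1]
  have hs1 : Real.sqrt s < 1 := by rw [Real.sqrt_lt' one_pos]; linarith [hs.2]
  have ht0 : 0 < t := by positivity
  have ht1 : t < 1 := by
    rw [ht, div_lt_one hma0]; nlinarith [Real.sqrt_nonneg s]
  have hp : a + t • (m - a) ∈ interior (Tri a b c) := by
    have hf : a + t • (m - a) = fr a (b - a) (c - a) (t / 2, t / 2) := by
      rw [hm]; unfold fr; module
    rw [mem_interior_Tri hcr, hf, bar_fr1 hcr, bar_fr2 hcr, bar_fr3 hcr]
    exact ⟨by linarith, by linarith, by linarith⟩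
  have := hz2 _ hp
  have hval : rq a (ρ ^ 2)⁻¹ (a + t • (m - a)) = s := by
    rw [rq_norm, add_sub_cancel_left, norm_smul, Real.norm_eq_abs, abs_of_pos ht0, ht]
    field_simp
    rw [Real.sq_sqrt hs0.le]
  unfold wt at this
  rw [hval, hws] at this
  have h2 : (ρ ^ 2)⁻¹ * 2 > 0 := by positivity
  linarith
end
end

noncomputable section
open MeasureTheory Filter Topology

/-- Neighbourhood of the vertex `a` in the triangle. -/
def Kr (a b c : E2) (r : ℝ) : Set E2 := interior (Tri a b c) ∩ Metric.ball a (2 * r)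

lemma Kr_vol_pos {a b c : E2} (hcr : cr (b - a) (c - a) ≠ 0) {r : ℝ} (hr : 0 < r) : 0 < volume.real (Kr a b c r) := by
  have hopen : IsOpen (Kr a b c r) := isOpen_interior.inter Metric.isOpen_ball
  have hne : (Kr a b c r).Nonempty := by
    have h1 : a ∈ closure (interior (Tri a b c)) := by
      have hc := (Tri_convex a b c).closure_interior_eq_closure_of_nonempty_interior (IT_nonempty hcr)
      rw [hc]
      exact subset_closure (subset_convexHull ℝ _ (by simp))
    obtain ⟨x, hx, hd⟩ := Metric.mem_closure_iff.1 h1 (2 * r) (by linarith)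
    exact ⟨x, hx, by rwa [Metric.mem_ball, dist_comm]⟩
  have := hopen.measure_pos volume hne
  exact ENNReal.toReal_pos this.ne' ((measure_mono inter_subset_left).trans_lt (IT_fin a b c)).ne

lemma Mini.osc {a b c : E2} {ν : ℝ} {u : E2 → ℝ} (hcr : cr (b - a) (c - a) ≠ 0) (hu : Mini a b c ν u) {η : ℝ} (hη : 0 < η) :
    ∃ r1 > 0, ∀ r, 0 < r → r ≤ r1 → ∃ m : ℝ, ∀ ω : E2 → ℝ, Continuous ω → (∀ p, |ω p| ≤ (r ^ 2)⁻¹) →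
      (∀ p, 2 * r ≤ ‖p - a‖ → ω p = 0) → |BB a b c u ω - m * MM a b c ω| ≤ η := by
  set V := volume.real (Metric.ball (0:E2) 1) with hV
  obtain ⟨δ, hδ, ht⟩ := hu.tail (η ^ 2 / (64 * (V + 1))) (by positivity)
  refine ⟨Real.sqrt (δ / (4 * (V + 1))), by positivity, fun r hr hr1 => ?_⟩
  have hV0 : 0 ≤ V := measureReal_nonneg
  set K := Kr a b c r with hK
  have hKm : MeasurableSet K := (isOpen_interior.inter Metric.isOpen_ball).measurableSet
  have hKT : K ⊆ interior (Tri a b c) := inter_subset_left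
  have hvol : volume.real K ≤ 4 * r ^ 2 * V := by
    have := measureReal_mono (μ := volume) (inter_subset_right : K ⊆ Metric.ball a (2 * r)) Metric.isBounded_ball.measure_lt_top.ne
    have this : volume.real K ≤ volume.real (Metric.ball a (2 * r)) := this
    rw [ball_vol a (by linarith), ← hV] at this
    nlinarith
  have hr2 : r ^ 2 ≤ δ / (4 * (V + 1)) := by
    rw [← Real.sqrt_le_sqrt_iff (by positivity), Real.sqrt_sq hr.le]; exact hr1
  rw [le_div_iff₀ (by positivity)] at hr2
  have hKδ : volume.real K ≤ δ := by nlinarith [sq_nonneg r]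
  have hd : ∀ x ∈ K, ∀ y ∈ K, ‖x - y‖ ≤ 4 * r := by
    intro x hx y hy
    have h1 := hx.2; have h2 := hy.2
    rw [Metric.mem_ball, dist_eq_norm] at h1 h2
    calc ‖x - y‖ = ‖(x - a) - (y - a)‖ := by congr 1; abel
      _ ≤ ‖x - a‖ + ‖y - a‖ := norm_sub_le _ _
      _ ≤ 4 * r := by linarith
  have htail := ht K ((Tri_convex a b c).interior.inter (convex_ball _ _)) hKm hKT hKδ (4 * r) hd
  have hKp := Kr_vol_pos hcr hr
  rw [← hK] at hKp
  set k := volume.real K with hk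
  set m := (∫ p in K, u p) / k with hm
  refine ⟨m, fun ω hω hb h0 => ?_⟩
  have huK : MemLp u 2 (volume.restrict K) := hu.mem.mono_measure (Measure.restrict_mono hKT le_rfl)
  haveI : IsFiniteMeasure (volume.restrict K) := ⟨by
    simpa using (measure_mono hKT).trans_lt (IT_fin a b c)⟩
  have hωK : MemLp ω 2 (volume.restrict K) :=
    memLp_bdd hω.aestronglyMeasurable.restrict (r ^ 2)⁻¹ (Eventually.of_forall hb)
  have hmK : MemLp (fun _ : E2 => m) 2 (volume.restrict K) := memLp_const m
  have hum : MemLp (fun p => u p - m) 2 (volume.restrict K) := huK.sub hmK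
  have hcs := cs_int hum hωK
  -- restrict integrals to K
  have hres : ∀ g : E2 → ℝ, ∫ p in interior (Tri a b c), g p * ω p = ∫ p in K, g p * ω p := by
    intro g
    apply setIntegral_eq_of_subset_of_forall_sdiff_eq_zero isOpen_interior.measurableSet hKT
    intro p hp
    have : ω p = 0 := h0 p (by
      by_contra hlt
      exact hp.2 ⟨hp.1, by rw [Metric.mem_ball, dist_eq_norm]; linarith⟩)
    rw [this, mul_zero]
  have i1 : Integrable (fun p => u p * ω p) (volume.restrict K) := MemLp.integrable_mul huK hωK
  have i2 : Integrable ω (volume.restrict K) := hωK.integrable (by norm_num)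
  have iu : Integrable u (volume.restrict K) := huK.integrable (by norm_num)
  have iuu : Integrable (fun p => u p * u p) (volume.restrict K) := MemLp.integrable_mul huK huK
  have i1c : Integrable (fun _ : E2 => (1:ℝ)) (volume.restrict K) := integrable_const _
  have e1 : BB a b c u ω - m * MM a b c ω = ∫ p in K, (u p - m) * ω p := by
    have h1 := hres u
    have h2 := hres (fun _ => 1)
    simp only [one_mul] at h2
    unfold BB MM
    rw [h1, h2]
    have := (int_lin3 i1 i2 i2 1 (-m) 0).2
    rw [show (fun p => (u p - m) * ω p) = fun p => 1 * (u p * ω p) + -m * ω p + 0 * ω p from funext fun p => by ring, this]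
    ring
  have e2 : ∫ p in K, (u p - m) * (u p - m) = (∫ p in K, u p * u p) - 2 * m * (∫ p in K, u p) + m ^ 2 * k := by
    have := (int_lin3 iuu iu i1c 1 (-2 * m) (m ^ 2)).2
    rw [show (fun p => (u p - m) * (u p - m)) = fun p => 1 * (u p * u p) + -2 * m * u p + m ^ 2 * 1 from
      funext fun p => by ring, this, setIntegral_const, smul_eq_mul]
    ring
  have hmk : ∫ p in K, u p = m * k := by rw [hm]; field_simp
  have e3 : ∫ p in K, (u p - m) * (u p - m) ≤ (4 * r) ^ 2 * (η ^ 2 / (64 * (V + 1))) := by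
    rw [e2, hmk]
    rw [hmk] at htail
    have : k * ((∫ p in K, u p * u p) - 2 * m * (m * k) + m ^ 2 * k) ≤ k * ((4 * r) ^ 2 * (η ^ 2 / (64 * (V + 1)))) := by
      nlinarith
    exact le_of_mul_le_mul_left this hKp
  have e4 : ∫ p in K, ω p * ω p ≤ ((r ^ 2)⁻¹) ^ 2 * k := by
    have : ∫ p in K, ω p * ω p ≤ ∫ p in K, ((r ^ 2)⁻¹) ^ 2 := by
      apply integral_mono (show Integrable (fun p => ω p * ω p) _ from MemLp.integrable_mul hωK hωK) (integrable_const _)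
      intro p
      show ω p * ω p ≤ ((r ^ 2)⁻¹) ^ 2
      nlinarith [hb p, abs_nonneg (ω p), sq_abs (ω p)]
    rw [setIntegral_const, smul_eq_mul] at this
    linarith
  rw [e1]
  apply abs_le_of_sq_le_sq _ hη.le
  have hnn : 0 ≤ ∫ p in K, (u p - m) * (u p - m) := integral_nonneg fun p => mul_self_nonneg _
  calc _ ≤ _ := hcs
    _ ≤ ((4 * r) ^ 2 * (η ^ 2 / (64 * (V + 1)))) * (((r ^ 2)⁻¹) ^ 2 * (4 * r ^ 2 * V)) := by
        apply mul_le_mul e3 (e4.trans _) (integral_nonneg fun p => mul_self_nonneg _) (by positivity)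
        gcongr
    _ = η ^ 2 * (V / (V + 1)) := by field_simp; norm_num
    _ ≤ η ^ 2 * 1 := by
        gcongr
        rw [div_le_one (by linarith)]; linarith
    _ = η ^ 2 := mul_one _

lemma SF.fo_dist {a b c τ n : E2} {L κ : ℝ} (S : SF a b c τ n L κ) {x : E2} (hx : x ∈ Tri a b c) (p : E2) :
    ‖fo a n p - x‖ ≤ 3 * ‖p - x‖ := by
  rcases le_total 0 (dt (p - a) n) with h | h
  · rw [fo_pos h]; linarith [norm_nonneg (p - x)]
  · rw [fo_neg h]
    have hx0 := S.Tri_nonneg hx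
    have hn : ‖n‖ = 1 := by
      have h1 : ‖n‖ ^ 2 = 1 := by rw [← dt_self, dt]; linear_combination S.of.2.1
      nlinarith [norm_nonneg n]
    have h1 := dt_le (p - x) n
    rw [hn, mul_one] at h1
    have h2 : dt (p - x) n = dt (p - a) n - dt (x - a) n := by simp [dt]; ring
    have h3 := neg_abs_le (dt (p - x) n)
    have h4 : |2 * dt (p - a) n| ≤ 2 * ‖p - x‖ := by
      rw [abs_of_nonpos (by linarith)]; linarith
    calc ‖rf a n p - x‖ = ‖(p - x) - (2 * dt (p - a) n) • n‖ := by unfold rf; congr 1; abel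
      _ ≤ ‖p - x‖ + ‖(2 * dt (p - a) n) • n‖ := norm_sub_le _ _
      _ ≤ 3 * ‖p - x‖ := by rw [norm_smul, hn, mul_one, Real.norm_eq_abs]; linarith

/-- Every point near the vertex has a comparable ball inside one of the doubled triangles. -/
lemma corner_ball {a b c τ n τ' n' : E2} {L κ L' κ' : ℝ} (S : SF a b c τ n L κ) (S' : SF c a b τ' n' L' κ') :
    ∃ θ ρ : ℝ, 0 < θ ∧ θ ≤ 1 / 4 ∧ 0 < ρ ∧ ∀ r, 0 < r → r ≤ ρ → ∀ x ∈ interior (Tri a b c), r / 2 < ‖x - a‖ → ‖x - a‖ ≤ r →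
      Metric.ball x (2 * θ * r) ⊆ Om a b c n ∨ Metric.ball x (2 * θ * r) ⊆ Om c a b n' := by
  obtain ⟨Λ1, hΛ1, h1⟩ := bar_lip b c a
  obtain ⟨Λ2, hΛ2, h2⟩ := bar_lip c a b
  obtain ⟨Λ3, hΛ3, h3⟩ := bar_lip a b c
  set Λ := Λ1 + Λ2 + Λ3 with hΛ
  set D := ‖b - a‖ + ‖c - a‖ + 1 with hD
  have hDp : 0 < D := by positivity
  have hΛp : 0 < Λ := by positivity
  set θ := min (1/4) (1 / (32 * D * Λ)) with hθ
  have hθ0 : 0 < θ := by positivity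
  have hθ4 : θ ≤ 1 / 4 := min_le_left _ _
  have hθΛ : θ * (32 * D * Λ) ≤ 1 := by
    rw [← le_div_iff₀ (by positivity)]; exact min_le_right _ _
  refine ⟨θ, 1 / (8 * Λ), hθ0, hθ4, by positivity, fun r hr hrρ x hx hx1 hx2 => ?_⟩
  rw [le_div_iff₀ (by positivity)] at hrρ
  have hxT := interior_subset hx
  have hxb := (mem_interior_Tri S.hcr x).1 hx
  -- size of the barycentric coordinates
  have hsum : ‖x - a‖ ≤ D * (bar c a b x + bar a b c x) := by
    have e : x - a = bar c a b x • (b - a) + bar a b c x • (c - a) := by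
      have hc := bar_comb S.hcr x
      have hs := bar_sum S.hcr x
      have : x - a = (bar b c a x • a + bar c a b x • b + bar a b c x • c) - (bar b c a x + bar c a b x + bar a b c x) • a := by
        rw [hs, one_smul, ← hc]
      rw [this]; module
    rw [e]
    refine (norm_add_le _ _).trans ?_
    rw [norm_smul, norm_smul, Real.norm_eq_abs, Real.norm_eq_abs, abs_of_pos hxb.2.1, abs_of_pos hxb.2.2]
    nlinarith [norm_nonneg (b - a), norm_nonneg (c - a), hxb.2.1, hxb.2.2]
  have near : ∀ q : E2, ‖q - x‖ ≤ 3 * (2 * θ * r) → 0 < bar b c a q := by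
    intro q hq
    have hqa : ‖q - a‖ ≤ 3 * r := by
      calc ‖q - a‖ = ‖(q - x) + (x - a)‖ := by congr 1; abel
        _ ≤ ‖q - x‖ + ‖x - a‖ := norm_add_le _ _
        _ ≤ 3 * r := by nlinarith
    have := h1 q a
    rw [bar_self (cr_perm S.hcr)] at this
    have h4 := neg_abs_le (bar b c a q - 1)
    have h5 : Λ1 * ‖q - a‖ ≤ Λ * (3 * r) := by
      apply mul_le_mul (by linarith) hqa (norm_nonneg _) hΛp.le
    nlinarith
  have big : ∀ (f : E2 → ℝ) (l : ℝ), 0 < l → l ≤ Λ → (∀ p q, |f p - f q| ≤ l * ‖p - q‖) → ‖x - a‖ ≤ 2 * D * f x →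
      ∀ q : E2, ‖q - x‖ < 3 * (2 * θ * r) → 0 < f q := by
    intro f l hl hlΛ hf hfx q hq
    have h4 := neg_abs_le (f q - f x)
    have h5 := hf q x
    have h6 : l * ‖q - x‖ ≤ Λ * (3 * (2 * θ * r)) := by
      apply mul_le_mul hlΛ hq.le (norm_nonneg _) hΛp.le
    have h7 : 2 * D * (Λ * (3 * (2 * θ * r))) < r / 2 := by
      have : 2 * D * (Λ * (3 * (2 * θ * r))) = (θ * (32 * D * Λ)) * r * (12 / 32) := by ring
      rw [this]; nlinarith
    have h8 : 2 * D * (f x - f q) < 2 * D * f x := by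
      have : f x - f q ≤ Λ * (3 * (2 * θ * r)) := by linarith
      have : 2 * D * (f x - f q) ≤ 2 * D * (Λ * (3 * (2 * θ * r))) := by gcongr
      linarith
    have := lt_of_mul_lt_mul_left h8 (by positivity)
    linarith
  have hxT' : x ∈ Tri c a b := by rw [← Tri_perm c a b]; exact hxT
  rcases le_total (bar a b c x) (bar c a b x) with hle | hle
  · left
    intro p hp
    rw [Metric.mem_ball, dist_eq_norm] at hp
    have hd := S.fo_dist hxT p
    exact ⟨near _ (by linarith), big _ Λ2 hΛ2 (by linarith) h2 (by nlinarith) _ (by linarith)⟩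
  · right
    intro p hp
    rw [Metric.mem_ball, dist_eq_norm] at hp
    have hd := S'.fo_dist hxT' p
    exact ⟨big _ Λ3 hΛ3 (by linarith) h3 (by nlinarith) _ (by linarith), near _ (by linarith)⟩
end

noncomputable section
open MeasureTheory Filter Topology

lemma bmp_int {R : ℝ} (hR : 0 < R) : Integrable (bmp R) volume :=
  (bmp_contDiff R).continuous.integrable_of_hasCompactSupport (bmp_support hR)

lemma bmp_scale {R : ℝ} (hR : 0 < R) : ∫ y, bmp R y = R ^ 2 * ∫ y, bmp 1 y := by
  have h := Measure.integral_comp_smul (volume : Measure E2) (bmp R) R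
  have e : (fun y : E2 => bmp R (R • y)) = bmp 1 := by
    funext y
    unfold bmp dt
    congr 2
    simp only [PiLp.smul_apply, smul_eq_mul]
    field_simp
  rw [e, finrank_euclideanSpace_fin, abs_of_pos (by positivity), smul_eq_mul] at h
  rw [h]; field_simp

lemma bmp_one_pos : 0 < ∫ y, bmp 1 y := by
  rw [integral_pos_iff_support_of_nonneg (fun y => bmp_nonneg 1 y) (bmp_int one_pos)]
  refine lt_of_lt_of_le (Metric.isOpen_ball.measure_pos volume ⟨(0:E2), Metric.mem_ball_self one_pos⟩) (measure_mono fun y hy => ?_)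
  rw [Metric.mem_ball, dist_zero_right] at hy
  exact (bmp_pos one_pos hy).ne'

lemma kappa_lim {C : ℝ → ℝ} (hC : Continuous C) (hC0 : C 0 = 1) {ε : ℝ} (hε : 0 < ε) :
    ∃ R0 > 0, ∀ R, 0 < R → R ≤ R0 → |(∫ y : E2, bmp R y * C (y 0)) - ∫ y, bmp R y| ≤ ε * ∫ y, bmp R y := by
  obtain ⟨δ, hδ, h⟩ := Metric.continuousAt_iff.1 hC.continuousAt ε hε
  refine ⟨δ, hδ, fun R hR hRδ => ?_⟩
  have hi : Integrable (fun y : E2 => bmp R y * C (y 0)) volume := by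
    apply Continuous.integrable_of_hasCompactSupport
    · exact (bmp_contDiff R).continuous.mul (hC.comp (by fun_prop))
    · exact (bmp_support hR).mul_right
  rw [← integral_sub hi (bmp_int hR), ← integral_const_mul, ← Real.norm_eq_abs]
  apply norm_integral_le_of_norm_le ((bmp_int hR).const_mul ε)
  refine Eventually.of_forall fun y => ?_
  rcases le_or_gt R ‖y‖ with hy | hy
  · rw [bmp_zero hR hy]; simp
  · have h1 : |y 0| ≤ ‖y‖ := by
      have := PiLp.norm_apply_le y 0
      rwa [Real.norm_eq_abs] at this
    have h2 := h (x := y 0) (by rw [Real.dist_eq, sub_zero]; linarith)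
    rw [hC0, Real.dist_eq] at h2
    rw [Real.norm_eq_abs, show bmp R y * C (y 0) - bmp R y = (C (y 0) - 1) * bmp R y by ring, abs_mul,
      abs_of_nonneg (bmp_nonneg R y)]
    exact mul_le_mul_of_nonneg_right h2.le (bmp_nonneg R y)

lemma side_avg {a b c τ n : E2} {L κ ν : ℝ} {u g : E2 → ℝ} (h : SideReg a b c τ n ν u g) (S : SF a b c τ n L κ)
    (hi : IntegrableOn u (interior (Tri a b c))) {C C1 : ℝ → ℝ} (hC : ContDiff ℝ (⊤ : ℕ∞) C)
    (h1 : ∀ t, HasDerivAt C (C1 t) t) (h2 : ∀ t, HasDerivAt C1 (-ν * C t) t) (hC0 : C 0 = 1)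
    {o : E2} (ho : rf a n o = o) {x : E2} {θ r : ℝ} (hθ : 0 < θ) (hθ1 : θ ≤ 1 / 4) (hr : 0 < r) (hx : ‖x - o‖ ≤ r)
    (hB : Metric.ball x (2 * θ * r) ⊆ Om a b c n) :
    ∃ ω : E2 → ℝ, Continuous ω ∧ (∀ p, |ω p| ≤ (r ^ 2)⁻¹) ∧ (∀ p, 2 * r ≤ ‖p - o‖ → ω p = 0) ∧
      ∫ p in interior (Tri a b c), ω p = (r ^ 2)⁻¹ / 2 * ∫ y, bmp (θ * r) y ∧
      ∫ p in interior (Tri a b c), u p * ω p = (r ^ 2)⁻¹ / 2 * (g x * ∫ y : E2, bmp (θ * r) y * C (y 0)) := by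
  have hR : 0 < θ * r := by positivity
  refine ⟨fun p => (r ^ 2)⁻¹ / 2 * (bmp (θ * r) (p - x) + bmp (θ * r) (rf a n p - x)), ?_, ?_, ?_, ?_, ?_⟩
  · have := (bmp_contDiff (θ * r)).continuous
    have h3 := rf_cont a n
    fun_prop
  · intro p
    have := bmp_nonneg (θ * r) (p - x)
    have := bmp_nonneg (θ * r) (rf a n p - x)
    have := bmp_le_one (θ * r) (p - x)
    have := bmp_le_one (θ * r) (rf a n p - x)
    have hp : 0 < (r ^ 2)⁻¹ := by positivity
    rw [abs_of_nonneg (by positivity)]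
    nlinarith
  · intro p hp
    have key : ∀ q : E2, 2 * r ≤ ‖q - o‖ → bmp (θ * r) (q - x) = 0 := by
      intro q hq
      apply bmp_zero hR
      have : ‖q - o‖ ≤ ‖q - x‖ + ‖x - o‖ := by
        rw [show q - o = (q - x) + (x - o) by abel]; exact norm_add_le _ _
      nlinarith
    show (r ^ 2)⁻¹ / 2 * (bmp (θ * r) (p - x) + bmp (θ * r) (rf a n p - x)) = 0
    rw [key p hp, key (rf a n p) (by rwa [rf_norm S.of p o ho])]
    ring
  · rw [integral_const_mul, S.mass hR (Subset.trans (Metric.ball_subset_ball (by nlinarith)) hB)]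
  · rw [h.mean S hi hC h1 h2 hC0 hR (by nlinarith) hB, ← integral_const_mul]
    congr 1
    funext p
    ring

lemma unq {g q l e1 e2 ε : ℝ} (h1 : |g * q - l| ≤ e1) (h2 : |q - 1| ≤ e2) (h3 : e2 ≤ 1 / 2) (h4 : e1 ≤ 1)
    (h5 : e1 + 2 * (|l| + 1) * e2 < ε) : |g - l| < ε := by
  have hq : 1 / 2 ≤ q := by have := abs_le.1 h2; linarith
  have hg : |g| * q ≤ |l| + 1 := by
    have : |g * q| ≤ |g * q - l| + |l| := by
      have := abs_add_le (g * q - l) l; simpa using this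
    rw [abs_mul, abs_of_pos (by linarith : 0 < q)] at this
    linarith
  have hg2 : |g| ≤ 2 * (|l| + 1) := by nlinarith [abs_nonneg g]
  calc |g - l| = |(g * q - l) + g * (1 - q)| := by congr 1; ring
    _ ≤ |g * q - l| + |g * (1 - q)| := abs_add_le _ _
    _ = |g * q - l| + |g| * |q - 1| := by rw [abs_mul, abs_sub_comm 1 q]
    _ ≤ e1 + 2 * (|l| + 1) * e2 := by
        have : 0 ≤ e2 := (abs_nonneg _).trans h2
        gcongr
    _ < ε := h5

lemma mass_const {a b c : E2} (hcr : cr (b - a) (c - a) ≠ 0) {ρ : ℝ} (hρ0 : 0 < ρ)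
    (hρ : ∀ t ∈ Icc (0:ℝ) 1, ρ ≤ ‖b + t • (c - b) - a‖) (k : ℕ) : MM a b c (wt a (ρ * (1 / 2) ^ k)) = MM a b c (wt a ρ) := by
  induction k with
  | zero => simp
  | succ k ih =>
    rw [← ih, mass_dyadic hcr hρ (r := ρ * (1 / 2) ^ k) (by positivity)]
    · congr 2; ring
    · have : ((1:ℝ) / 2) ^ k ≤ 1 := pow_le_one₀ (by norm_num) (by norm_num)
      nlinarith

lemma Cl.perm {a b c : E2} {f : E2 → ℝ} (h : Cl b c a f) : Cl a b c f := by
  obtain ⟨h1, h2, h3⟩ := h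
  rw [Tri_perm] at h1 h2 h3
  exact ⟨h1, h2, h3⟩

lemma AA_perm (a b c : E2) : AA b c a = AA a b c := by unfold AA; rw [Tri_perm]
lemma BB_perm (a b c : E2) : BB b c a = BB a b c := by unfold BB; rw [Tri_perm]
lemma MM_perm (a b c : E2) : MM b c a = MM a b c := by unfold MM; rw [Tri_perm]

lemma Mini.perm {a b c : E2} {ν : ℝ} {u : E2 → ℝ} (h : Mini a b c ν u) : Mini b c a ν u where
  pos := h.pos
  ineq f hf hm := by
    rw [AA_perm, BB_perm]; rw [MM_perm] at hm
    exact h.ineq f hf.perm hm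
  mem := by rw [Tri_perm]; exact h.mem
  mean := by rw [MM_perm]; exact h.mean
  norm := by rw [BB_perm]; exact h.norm
  weak k h1 h2 h3 h4 := by rw [Tri_perm]; exact h.weak k h1 h4 h2 h3
  tail := by rw [Tri_perm]; exact h.tail

lemma rf_self (a n : E2) : rf a n a = a := by
  simp [rf, dt]

lemma SF.rf_b {a b c τ n : E2} {L κ : ℝ} (S : SF a b c τ n L κ) : rf a n b = b := by
  have : dt (b - a) n = 0 := by
    rw [S.hb]
    simp only [dt, add_sub_cancel_left, PiLp.smul_apply, smul_eq_mul]
    linear_combination L * S.of.2.2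
  simp [rf, this]

set_option maxHeartbeats 1000000 in
lemma vertex_lim {a b c τ n τ' n' : E2} {L κ L' κ' ν : ℝ} {u g g' : E2 → ℝ} (hu : Mini a b c ν u)
    (S : SF a b c τ n L κ) (S' : SF c a b τ' n' L' κ') (h : SideReg a b c τ n ν u g) (h' : SideReg c a b τ' n' ν u g')
    (hgg : ∀ p ∈ interior (Tri a b c), g p = g' p) : ∃ l, Tendsto g (𝓝[interior (Tri a b c)] a) (𝓝 l) := by
  have hcr := S.hcr
  obtain ⟨ρ1, hρ1, hfar⟩ := far_side hcr
  obtain ⟨θ, ρ2, hθ, hθ1, hρ2, hcb⟩ := corner_ball S S'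
  obtain ⟨A, hA, hww⟩ := ww_bdd
  obtain ⟨C, C1, hC, hC1, hC2, hC0⟩ := exists_CC ν
  set ρ := min ρ1 ρ2 with hρ
  have hρ0 : 0 < ρ := lt_min hρ1 hρ2
  have hfar' : ∀ t ∈ Icc (0:ℝ) 1, ρ ≤ ‖b + t • (c - b) - a‖ := fun t ht => (min_le_left _ _).trans (hfar t ht)
  obtain ⟨l, hl⟩ := hu.dyadic_lim hρ0 hfar'
  set M0 := MM a b c (wt a ρ) with hM0
  have hM0p : 0 < M0 := mass_pos hcr hρ0 hfar'
  set I1 := ∫ y, bmp 1 y with hI1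
  have hI1p : 0 < I1 := bmp_one_pos
  refine ⟨l / M0, ?_⟩
  rw [Metric.tendsto_nhdsWithin_nhds]
  intro ε hε
  -- error budget
  set e1 := min 1 (ε / 4) with he1
  have he1p : 0 < e1 := lt_min one_pos (by linarith)
  set e2 := min (1 / 2) (ε / (8 * (|l / M0| + 1))) with he2
  have hlp : 0 < |l / M0| + 1 := by positivity
  have he2p : 0 < e2 := lt_min (by norm_num) (by positivity)
  have he2le : 2 * (|l / M0| + 1) * e2 ≤ ε / 4 := by
    calc 2 * (|l / M0| + 1) * e2 ≤ 2 * (|l / M0| + 1) * (ε / (8 * (|l / M0| + 1))) := by gcongr; exact min_le_right _ _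
      _ = ε / 4 := by field_simp; norm_num
  set c1 := 2 / (θ ^ 2 * I1) + A / M0 with hc1
  have hc1p : 0 < c1 := by positivity
  set η := e1 / (2 * c1) with hη
  have hηp : 0 < η := by positivity
  obtain ⟨r1, hr1, hosc⟩ := hu.osc hcr hηp
  obtain ⟨R0, hR0, hK⟩ := kappa_lim hC.continuous hC0 he2p
  obtain ⟨K0, hK0⟩ := (Metric.tendsto_atTop.1 hl) (M0 * e1 / 2) (by positivity)
  refine ⟨min (min (ρ * (1 / 2) ^ K0) (r1 / 2)) (R0 / 2), by positivity, fun {x} hx hxd => ?_⟩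
  rw [dist_eq_norm, lt_min_iff, lt_min_iff] at hxd
  obtain ⟨⟨hd1, hd2⟩, hd3⟩ := hxd
  have hxa : 0 < ‖x - a‖ := by
    rw [norm_pos_iff, sub_ne_zero]
    rintro rfl
    have h1 := ((mem_interior_Tri hcr _).1 hx).2.2
    rw [bar_left] at h1
    exact lt_irrefl _ h1
  have hp1 : ((1:ℝ) / 2) ^ K0 ≤ 1 := pow_le_one₀ (by norm_num) (by norm_num)
  obtain ⟨k, hk1, hk2⟩ := exists_nat_pow_near_of_lt_one (x := ‖x - a‖ / ρ) (y := 1 / 2) (by positivity)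
    (by rw [div_le_one hρ0]; nlinarith) (by norm_num) (by norm_num)
  rw [lt_div_iff₀ hρ0, pow_succ] at hk1
  rw [div_le_iff₀ hρ0] at hk2
  set r := ρ * (1 / 2) ^ k with hr
  have hrp : 0 < r := by positivity
  have hpk : ((1:ℝ) / 2) ^ k ≤ 1 := pow_le_one₀ (by norm_num) (by norm_num)
  have hrρ : r ≤ ρ := by nlinarith
  have hx1 : r / 2 < ‖x - a‖ := by linarith
  have hx2 : ‖x - a‖ ≤ r := by linarith
  have hkK : K0 ≤ k := by
    by_contra hlt
    push Not at hlt
    have : ((1:ℝ) / 2) ^ K0 ≤ (1 / 2) ^ (k + 1) := pow_le_pow_of_le_one (by norm_num) (by norm_num) hlt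
    rw [pow_succ] at this
    nlinarith
  obtain ⟨m, hm⟩ := hosc r hrp (by linarith)
  -- first weight
  have f1 := hm (fun p => A⁻¹ * wt a r p) ((wt_cont a r).const_mul _) (fun p => by
    rw [wt, ← mul_assoc, mul_comm A⁻¹, mul_assoc, abs_mul, abs_of_pos (by positivity : 0 < (r ^ 2)⁻¹), abs_mul,
      abs_of_pos (by positivity : 0 < A⁻¹)]
    have : A⁻¹ * |ww (rq a (r ^ 2)⁻¹ p)| ≤ 1 := by
      rw [inv_mul_le_iff₀ hA, mul_one]; exact hww _
    have hp : 0 < (r ^ 2)⁻¹ := by positivity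
    nlinarith) (fun p hp => by show A⁻¹ * wt a r p = 0; rw [wt_zero hrp (by linarith), mul_zero])
  have f1a : MM a b c (fun p => A⁻¹ * wt a r p) = A⁻¹ * M0 := by
    rw [hM0, ← mass_const hcr hρ0 hfar' k]; unfold MM; rw [integral_const_mul]
  have f1b : BB a b c u (fun p => A⁻¹ * wt a r p) = A⁻¹ * BB a b c u (wt a r) := by
    unfold BB; rw [← integral_const_mul]; congr 1; funext p; ring
  rw [f1a, f1b] at f1
  -- second weight
  have hperm : Tri c a b = Tri a b c := by rw [← Tri_perm c a b]
  have hω : ∃ ω : E2 → ℝ, Continuous ω ∧ (∀ p, |ω p| ≤ (r ^ 2)⁻¹) ∧ (∀ p, 2 * r ≤ ‖p - a‖ → ω p = 0) ∧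
      ∫ p in interior (Tri a b c), ω p = (r ^ 2)⁻¹ / 2 * ∫ y, bmp (θ * r) y ∧
      ∫ p in interior (Tri a b c), u p * ω p = (r ^ 2)⁻¹ / 2 * (g x * ∫ y : E2, bmp (θ * r) y * C (y 0)) := by
    rcases hcb r hrp (hrρ.trans (min_le_right _ _)) x hx hx1 hx2 with hB | hB
    · exact side_avg h S hu.intOn hC hC1 hC2 hC0 (rf_self a n) hθ hθ1 hrp hx2 hB
    · rw [hgg x hx]
      have := side_avg h' S' hu.perm.perm.intOn hC hC1 hC2 hC0 S'.rf_b hθ hθ1 hrp hx2 hB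
      rwa [hperm] at this
  obtain ⟨ω, w1, w2, w3, w4, w5⟩ := hω
  have f2 := hm ω w1 w2 w3
  have f2a : MM a b c ω = θ ^ 2 * I1 / 2 := by
    unfold MM; rw [w4, bmp_scale (by positivity), ← hI1]; field_simp
  set KR := ∫ y : E2, bmp (θ * r) y * C (y 0) with hKR
  have hIR : ∫ y, bmp (θ * r) y = (θ * r) ^ 2 * I1 := bmp_scale (by positivity)
  have hKe := hK (θ * r) (by positivity) (by nlinarith)
  rw [hIR, ← hKR] at hKe
  set q := KR / ((θ * r) ^ 2 * I1) with hq
  have hqI : KR = q * ((θ * r) ^ 2 * I1) := by rw [hq]; field_simp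
  have hq1 : |q - 1| ≤ e2 := by
    rw [hqI, show q * ((θ * r) ^ 2 * I1) - (θ * r) ^ 2 * I1 = (q - 1) * ((θ * r) ^ 2 * I1) by ring, abs_mul,
      abs_of_pos (by positivity : 0 < (θ * r) ^ 2 * I1)] at hKe
    exact le_of_mul_le_mul_right hKe (by positivity)
  have f2b : BB a b c u ω = (g x * q) * (θ ^ 2 * I1 / 2) := by
    unfold BB; rw [w5, hqI]; field_simp
  rw [f2a, f2b, ← sub_mul, abs_mul, abs_of_pos (by positivity : 0 < θ ^ 2 * I1 / 2)] at f2
  have g2 : |g x * q - m| ≤ η * (2 / (θ ^ 2 * I1)) := by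
    rw [← le_div_iff₀ (by positivity)] at f2
    refine f2.trans (le_of_eq ?_)
    field_simp
  have g1 : |BB a b c u (wt a r) / M0 - m| ≤ η * (A / M0) := by
    rw [show A⁻¹ * BB a b c u (wt a r) - m * (A⁻¹ * M0) = (BB a b c u (wt a r) / M0 - m) * (M0 / A) by field_simp,
      abs_mul, abs_of_pos (by positivity : 0 < M0 / A), ← le_div_iff₀ (by positivity)] at f1
    refine f1.trans (le_of_eq ?_)
    field_simp
  have g3 : |BB a b c u (wt a r) / M0 - l / M0| ≤ e1 / 2 := by
    have := hK0 k hkK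
    rw [Real.dist_eq] at this
    rw [← sub_div, abs_div, abs_of_pos hM0p, div_le_iff₀ hM0p]
    linarith
  have hηc : η * (2 / (θ ^ 2 * I1)) + η * (A / M0) = e1 / 2 := by
    rw [← mul_add, ← hc1, hη]; field_simp
  have hfin : |g x * q - l / M0| ≤ e1 := by
    rw [abs_le] at *
    constructor <;> linarith [g1.1, g1.2, g2.1, g2.2, g3.1, g3.2]
  rw [Real.dist_eq]
  exact unq hfin hq1 (min_le_left _ _) (min_le_left _ _) (by
    have : e1 ≤ ε / 4 := min_le_right _ _
    linarith)

end

noncomputable section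
open MeasureTheory Filter Topology

lemma Tri_mem_Om {a b c τ n p : E2} {L κ : ℝ} (S : SF a b c τ n L κ) (hp : p ∈ Tri a b c) (h1 : 0 < bar b c a p)
    (h2 : 0 < bar c a b p) : p ∈ Om a b c n := by
  simp only [Om, mem_ofPred_eq, fo_pos (S.Tri_nonneg hp)]
  exact ⟨h1, h2⟩

lemma Om_mem {a b c τ n p : E2} {L κ : ℝ} (S : SF a b c τ n L κ) (hp : p ∈ Tri a b c) (h : p ∈ Om a b c n) :
    0 < bar b c a p ∧ 0 < bar c a b p := by
  simp only [Om, mem_ofPred_eq, fo_pos (S.Tri_nonneg hp)] at h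
  exact h

lemma open_side {a b c p : E2} (hcr : cr (b - a) (c - a) ≠ 0) (hp : p ∈ segment ℝ a b) (h1 : p ≠ a) (h2 : p ≠ b) :
    p ∈ Tri a b c ∧ 0 < bar b c a p ∧ 0 < bar c a b p ∧ bar a b c p = 0 := by
  have h3 := mem_openSegment_of_ne_left_right h1.symm h2.symm hp
  rw [openSegment_eq_image'] at h3
  obtain ⟨t, ht, rfl⟩ := h3
  have e : a + t • (b - a) = fr a (b - a) (c - a) (t, 0) := by simp [fr]
  have b1 := bar_fr1 hcr (t, 0)
  have b2 := bar_fr2 hcr (t, 0)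
  have b3 := bar_fr3 hcr (t, 0)
  rw [← e] at b1 b2 b3
  simp only at b1 b2 b3
  rw [mem_Tri hcr]
  refine ⟨⟨?_, ?_, ?_⟩, ?_, ?_, ?_⟩ <;> simp only [b1, b2, b3] <;> linarith [ht.1, ht.2]

lemma vertex_of {a b c p : E2} (hcr : cr (b - a) (c - a) ≠ 0) (h1 : bar b c a p = 0) (h2 : bar c a b p = 0) : p = c := by
  have h3 := bar_sum hcr p
  have h4 := bar_comb hcr p
  rw [h1, h2] at h4 h3
  rw [h4, show bar a b c p = 1 by linarith]
  simp

lemma Tri_uniq {a b c : E2} (hcr : cr (b - a) (c - a) ≠ 0) : UniqueDiffOn ℝ (TriDom a b c) := by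
  have h1 : UniqueDiffOn ℝ (Tri a b c) := uniqueDiffOn_convex (Tri_convex a b c) (IT_nonempty hcr)
  have h2 : IsClosed (Vtx a b c) := ((Set.toFinite {a, b, c} : Set.Finite _)).isClosed
  exact h1.inter h2.isOpen_compl

lemma IT_sub_dom {a b c : E2} (hcr : cr (b - a) (c - a) ≠ 0) : interior (Tri a b c) ⊆ TriDom a b c := by
  intro p hp
  refine ⟨interior_subset hp, ?_⟩
  have h := (mem_interior_Tri hcr p).1 hp
  rintro (rfl | rfl | rfl)
  · rw [bar_left p b c] at h; exact lt_irrefl _ h.2.2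
  · rw [bar_right a p c] at h; exact lt_irrefl _ h.2.2
  · rw [bar_right b p a] at h; exact lt_irrefl _ h.1

lemma closure_IT {a b c : E2} (hcr : cr (b - a) (c - a) ≠ 0) : closure (interior (Tri a b c)) = Tri a b c := by
  rw [(Tri_convex a b c).closure_interior_eq_closure_of_nonempty_interior (IT_nonempty hcr)]
  exact (Tri_compact a b c).isClosed.closure_eq

lemma vec_frame {τ n : E2} (h : OF τ n) (w : E2) : w = dt w τ • τ + dt w n • n := by
  have := fr_frinv (o := 0) h w
  simp only [fr, frinv, sub_zero, zero_add] at this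
  exact this.symm

section
variable {a b c τ n : E2} {L κ ν : ℝ} {u g G U : E2 → ℝ}

lemma SideReg.diffAt (h : SideReg a b c τ n ν u g) {p : E2} (hp : p ∈ Om a b c n) : ContDiffAt ℝ (⊤ : ℕ∞) g p :=
  h.smooth.contDiffAt ((Om_open a b c n).mem_nhds hp)

lemma SideReg.tendsto (h : SideReg a b c τ n ν u g) (hG : ∀ p ∈ interior (Tri a b c), G p = g p) {p : E2}
    (hp : p ∈ Om a b c n) : Tendsto G (𝓝[interior (Tri a b c)] p) (𝓝 (g p)) := by
  have h1 : Tendsto g (𝓝[interior (Tri a b c)] p) (𝓝 (g p)) := (h.diffAt hp).continuousAt.continuousWithinAt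
  refine h1.congr' ?_
  filter_upwards [self_mem_nhdsWithin] with q hq
  exact (hG q hq).symm

lemma SideReg.lift_ev (hU : ∀ p ∈ Tri a b c, p ∈ Om a b c n → U p = g p) {p : E2}
    (hp : p ∈ Om a b c n) : U =ᶠ[𝓝[TriDom a b c] p] g := by
  filter_upwards [self_mem_nhdsWithin, mem_nhdsWithin_of_mem_nhds ((Om_open a b c n).mem_nhds hp)] with q h1 h2
  exact hU q h1.1 h2

lemma SideReg.lift_smooth (h : SideReg a b c τ n ν u g) (hU : ∀ p ∈ Tri a b c, p ∈ Om a b c n → U p = g p) {p : E2}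
    (hpT : p ∈ Tri a b c) (hp : p ∈ Om a b c n) : ContDiffWithinAt ℝ (⊤ : ℕ∞) U (TriDom a b c) p :=
  (h.diffAt hp).contDiffWithinAt.congr_of_eventuallyEq (SideReg.lift_ev hU hp) (hU p hpT hp)

lemma SideReg.lift_neumann (h : SideReg a b c τ n ν u g) (S : SF a b c τ n L κ)
    (hU : ∀ p ∈ Tri a b c, p ∈ Om a b c n → U p = g p) : NeumannOn (TriDom a b c) a b U := by
  intro p hp h1 h2 w hw
  obtain ⟨hT, h3, h4, h5⟩ := open_side S.hcr hp h1 h2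
  have hO := Tri_mem_Om S hT h3 h4
  have hpd : p ∈ TriDom a b c := by
    refine ⟨hT, ?_⟩
    rintro (rfl | rfl | rfl)
    · exact h1 rfl
    · exact h2 rfl
    · rw [bar_self S.hcr] at h5; exact one_ne_zero h5
  have hd : HasFDerivAt g (fderiv ℝ g p) p := ((h.diffAt hO).differentiableAt (by simp)).hasFDerivAt
  have h6 : HasFDerivWithinAt U (fderiv ℝ g p) (TriDom a b c) p :=
    hd.hasFDerivWithinAt.congr_of_eventuallyEq (SideReg.lift_ev hU hO) (hU p hT hO)
  rw [h6.fderivWithin (Tri_uniq S.hcr p hpd)]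
  have h7 : dt (p - a) n = 0 := by
    rw [S.hbar] at h5
    exact (mul_eq_zero.1 h5).resolve_left S.hκ.ne'
  have h8 := h.neumann S hO h7
  have h9 : dt w τ = 0 := by
    rw [inner_eq_dt, S.hb, add_sub_cancel_left] at hw
    have : L * dt w τ = 0 := by rw [← hw]; simp [dt]; ring
    exact (mul_eq_zero.1 this).resolve_left S.hL.ne'
  have h10 : w = dt w n • n := by
    have h11 := vec_frame S.of w
    rw [h9] at h11
    simpa using h11
  rw [h10, map_smul, h8, smul_zero]

end


lemma SideReg.agree {a b c τ n τ' n' : E2} {L κ L' κ' ν : ℝ} {u g g' : E2 → ℝ}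
    (S : SF a b c τ n L κ) (S' : SF b c a τ' n' L' κ') (h : SideReg a b c τ n ν u g) (h' : SideReg b c a τ' n' ν u g') :
    ∀ p ∈ interior (Tri a b c), g p = g' p := by
  have h1 := h.ae_IT S
  have h2 := h'.ae_IT S'
  have s2 := S'.IT_Om
  rw [Tri_perm] at h2 s2
  apply ae_eq_cont isOpen_interior (h.smooth.continuousOn.mono S.IT_Om) (h'.smooth.continuousOn.mono s2)
  filter_upwards [h1, h2] with p h3 h4 h5
  rw [← h3 h5, ← h4 h5]

/-- The variational minimizer has a classical representative. -/
lemma Mini.eigenfun {a b c : E2} {ν : ℝ} {u : E2 → ℝ} (hcr : cr (b - a) (c - a) ≠ 0) (hu : Mini a b c ν u) :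
    ∃ U, IsNeumannEigenfun a b c ν U := by
  obtain ⟨τ1, n1, L1, κ1, S1⟩ := exists_SF hcr
  obtain ⟨τ2, n2, L2, κ2, S2⟩ := exists_SF (cr_perm hcr)
  obtain ⟨τ3, n3, L3, κ3, S3⟩ := exists_SF (cr_perm (cr_perm hcr))
  obtain ⟨g1, r1⟩ := hu.sideReg S1
  obtain ⟨g2, r2⟩ := hu.perm.sideReg S2
  obtain ⟨g3, r3⟩ := hu.perm.perm.sideReg S3
  have p2 : Tri b c a = Tri a b c := Tri_perm a b c
  have p3 : Tri c a b = Tri a b c := (Tri_perm b c a).trans p2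
  have d2 : TriDom b c a = TriDom a b c := TriDom_perm a b c
  have d3 : TriDom c a b = TriDom a b c := (TriDom_perm b c a).trans d2
  have a12 := SideReg.agree S1 S2 r1 r2
  have a23 := SideReg.agree S2 S3 r2 r3
  rw [p2] at a23
  have a13 : ∀ p ∈ interior (Tri a b c), g1 p = g3 p := fun p hp => (a12 p hp).trans (a23 p hp)
  obtain ⟨la, hla⟩ := vertex_lim hu S1 S3 r1 r3 a13
  obtain ⟨lb, hlb⟩ := vertex_lim hu.perm S2 S1 r2 r1 (by rw [p2]; exact fun p hp => (a12 p hp).symm)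
  obtain ⟨lc, hlc⟩ := vertex_lim hu.perm.perm S3 S2 r3 r2 (by rw [p3]; exact fun p hp => (a23 p hp).symm)
  rw [p2] at hlb
  rw [p3] at hlc
  set I := interior (Tri a b c) with hI
  have tc : ∀ {g : E2 → ℝ} {x : E2} {l : ℝ}, (∀ p ∈ I, g1 p = g p) → Tendsto g (𝓝[I] x) (𝓝 l) → Tendsto g1 (𝓝[I] x) (𝓝 l) := by
    intro g x l hg ht
    refine ht.congr' ?_
    filter_upwards [self_mem_nhdsWithin] with q hq
    exact (hg q hq).symm
  have hlb' := tc a12 hlb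
  have hlc' := tc a13 hlc
  set U := extendFrom I g1 with hU
  have cl : closure I = Tri a b c := closure_IT hcr
  have t1 : ∀ p ∈ Om a b c n1, Tendsto g1 (𝓝[I] p) (𝓝 (g1 p)) := fun p hp => r1.tendsto (fun _ _ => rfl) hp
  have t2 : ∀ p ∈ Om b c a n2, Tendsto g1 (𝓝[I] p) (𝓝 (g2 p)) := fun p hp => by
    have := r2.tendsto (G := g1) (by rw [p2]; exact a12) hp
    rwa [p2] at this
  have t3 : ∀ p ∈ Om c a b n3, Tendsto g1 (𝓝[I] p) (𝓝 (g3 p)) := fun p hp => by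
    have := r3.tendsto (G := g1) (by rw [p3]; exact a13) hp
    rwa [p3] at this
  have U1 : ∀ p ∈ Tri a b c, p ∈ Om a b c n1 → U p = g1 p := fun p hp hO => extendFrom_eq (cl ▸ hp) (t1 p hO)
  have U2 : ∀ p ∈ Tri b c a, p ∈ Om b c a n2 → U p = g2 p := fun p hp hO => extendFrom_eq (by rw [cl, ← p2]; exact hp) (t2 p hO)
  have U3 : ∀ p ∈ Tri c a b, p ∈ Om c a b n3 → U p = g3 p := fun p hp hO => extendFrom_eq (by rw [cl, ← p3]; exact hp) (t3 p hO)
  have cover : ∀ p ∈ Tri a b c, (p = a ∨ p = b ∨ p = c) ∨ p ∈ Om a b c n1 ∨ p ∈ Om b c a n2 ∨ p ∈ Om c a b n3 := by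
    intro p hp
    have hb := (mem_Tri hcr p).1 hp
    rcases hb.1.eq_or_lt with h1 | h1
    · rcases hb.2.1.eq_or_lt with h2 | h2
      · left; right; right; exact vertex_of hcr h1.symm h2.symm
      · rcases hb.2.2.eq_or_lt with h3 | h3
        · left; right; left; exact vertex_of (cr_perm (cr_perm hcr)) h3.symm h1.symm
        · right; right; left; exact Tri_mem_Om S2 (by rwa [p2]) h2 h3
    · rcases hb.2.1.eq_or_lt with h2 | h2
      · rcases hb.2.2.eq_or_lt with h3 | h3
        · left; left; exact vertex_of (cr_perm hcr) h2.symm h3.symm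
        · right; right; right; exact Tri_mem_Om S3 (by rwa [p3]) h3 h1
      · right; left; exact Tri_mem_Om S1 hp h1 h2
  have Uc : ContinuousOn U (Tri a b c) := by
    apply continuousOn_extendFrom (by rw [cl])
    intro p hp
    rcases cover p hp with (rfl | rfl | rfl) | h | h | h
    · exact ⟨_, hla⟩
    · exact ⟨_, hlb'⟩
    · exact ⟨_, hlc'⟩
    · exact ⟨_, t1 p h⟩
    · exact ⟨_, t2 p h⟩
    · exact ⟨_, t3 p h⟩
  have hUg : ∀ p ∈ I, U p = g1 p := fun p hp => U1 p (interior_subset hp) (S1.IT_Om hp)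
  have hae : ∀ᵐ p ∂(volume.restrict I), u p = U p := by
    rw [ae_restrict_iff' isOpen_interior.measurableSet]
    filter_upwards [r1.ae_IT S1] with p hp hpI
    rw [hp hpI, hUg p hpI]
  refine ⟨U, hu.pos, ?_, Uc, ?_, ?_, r1.lift_neumann S1 U1, ?_, ?_⟩
  · rintro ⟨m, hm⟩
    have h1 : MM a b c u = MM a b c (fun _ => m) := by
      apply integral_congr_ae
      filter_upwards [hae, ae_restrict_mem isOpen_interior.measurableSet] with p hp hpI
      rw [hp, hm p (interior_subset hpI)]
    have h2 : BB a b c u u = BB a b c (fun _ => m) (fun _ => m) := by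
      apply integral_congr_ae
      filter_upwards [hae, ae_restrict_mem isOpen_interior.measurableSet] with p hp hpI
      rw [hp, hm p (interior_subset hpI)]
    rw [hu.mean, MM_const] at h1
    have hm0 : m = 0 := (mul_eq_zero.1 h1.symm).resolve_left (vol_pos hcr).ne'
    rw [hu.norm, hm0] at h2
    simp [BB] at h2
  · intro p hp
    rcases cover p hp.1 with h | h | h | h
    · exact absurd (by simpa [Vtx] using h) hp.2
    · exact r1.lift_smooth U1 hp.1 h
    · have := r2.lift_smooth U2 (by rw [p2]; exact hp.1) h
      rwa [d2] at this
    · have := r3.lift_smooth U3 (by rw [p3]; exact hp.1) h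
      rwa [d3] at this
  · intro p hp
    have hev : U =ᶠ[𝓝 p] g1 := by
      filter_upwards [isOpen_interior.mem_nhds hp] with q hq
      exact hUg q hq
    rw [negLap_eq, lap_congr hev, r1.eqn p (S1.IT_Om hp), hUg p hp]
    ring
  · have := r2.lift_neumann S2 U2
    rwa [d2] at this
  · have := r3.lift_neumann S3 U3
    rwa [d3] at this

/-- The variational inequality with the classical second eigenvalue. -/
lemma mu_ineq {a b c : E2} (hcr : cr (b - a) (c - a) ≠ 0) {μ₂ : ℝ}
    (hμ₂ : IsLeast {μ : ℝ | ∃ u : E2 → ℝ, IsNeumannEigenfun a b c μ u} μ₂) :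
    ∀ f, Cl a b c f → MM a b c f = 0 → μ₂ * BB a b c f f ≤ AA a b c f f := by
  obtain ⟨ν, u, hu⟩ := exists_mini hcr
  have h1 : μ₂ ≤ ν := hμ₂.2 (hu.eigenfun hcr)
  intro f hf hm
  have h2 := hu.ineq f hf hm
  have h3 : 0 ≤ BB a b c f f := BB_nonneg _ _ _ _
  nlinarith

end

noncomputable section
open MeasureTheory Filter Topology

/-- `C¹` functions on the triangle minus vertices, vanishing off a compact subset. -/
structure CK (a b c : E2) (K : Set E2) (f : E2 → ℝ) : Prop where
  smooth : ContDiffOn ℝ 1 f (TriDom a b c)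
  compact : IsCompact K
  sub : K ⊆ TriDom a b c
  zero : ∀ p ∈ Tri a b c, p ∉ K → f p = 0

section
variable {a b c : E2} {K : Set E2} {f : E2 → ℝ}

lemma CK.dom_ev (_h : CK a b c K f) {p : E2} (hp : p ∈ TriDom a b c) : 𝓝[Tri a b c] p = 𝓝[TriDom a b c] p := by
  have h2 : IsClosed (Vtx a b c) := ((Set.toFinite {a, b, c} : Set.Finite _)).isClosed
  have h3 : (Vtx a b c)ᶜ ∈ 𝓝 p := h2.isOpen_compl.mem_nhds hp.2
  exact (nhdsWithin_inter_of_mem' (mem_nhdsWithin_of_mem_nhds h3)).symm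

lemma CK.cont (h : CK a b c K f) : ContinuousOn f (Tri a b c) := by
  intro p hp
  by_cases hK : p ∈ K
  · have h1 := h.smooth.continuousOn p (h.sub hK)
    unfold ContinuousWithinAt at h1 ⊢
    rwa [h.dom_ev (h.sub hK)]
  · have h1 : f =ᶠ[𝓝[Tri a b c] p] fun _ => 0 := by
      filter_upwards [self_mem_nhdsWithin, mem_nhdsWithin_of_mem_nhds (h.compact.isClosed.isOpen_compl.mem_nhds hK)] with q h1 h2
      exact h.zero q h1 h2
    exact (continuousWithinAt_const (b := (0:ℝ))).congr_of_eventuallyEq h1 (h.zero p hp hK)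

lemma CK.fderiv_eq (hcr : cr (b - a) (c - a) ≠ 0) {p : E2} (hp : p ∈ interior (Tri a b c)) :
    fderivWithin ℝ f (TriDom a b c) p = fderiv ℝ f p := by
  apply fderivWithin_of_mem_nhds
  exact Filter.mem_of_superset (isOpen_interior.mem_nhds hp) (IT_sub_dom hcr)

lemma CK.c1 (hcr : cr (b - a) (c - a) ≠ 0) (h : CK a b c K f) : ContDiffOn ℝ 1 f (interior (Tri a b c)) :=
  h.smooth.mono (IT_sub_dom hcr)

lemma CK.bdd (hcr : cr (b - a) (c - a) ≠ 0) (h : CK a b c K f) : ∃ M, ∀ p ∈ interior (Tri a b c), ‖fderiv ℝ f p‖ ≤ M := by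
  have h1 : ContinuousOn (fderivWithin ℝ f (TriDom a b c)) K :=
    (h.smooth.continuousOn_fderivWithin (Tri_uniq hcr) le_rfl).mono h.sub
  obtain ⟨M, hM⟩ := h.compact.exists_bound_of_continuousOn h1
  refine ⟨max M 0, fun p hp => ?_⟩
  by_cases hK : p ∈ K
  · rw [← CK.fderiv_eq hcr hp]; exact (hM p hK).trans (le_max_left _ _)
  · have h1 : f =ᶠ[𝓝 p] fun _ => 0 := by
      filter_upwards [isOpen_interior.mem_nhds hp, h.compact.isClosed.isOpen_compl.mem_nhds hK] with q h1 h2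
      exact h.zero q (interior_subset h1) h2
    rw [h1.fderiv_eq]; simp

lemma CK.cl (hcr : cr (b - a) (c - a) ≠ 0) (h : CK a b c K f) : Cl a b c f := ⟨h.cont, h.c1 hcr, h.bdd hcr⟩

lemma Cl.pd_int (h : Cl a b c f) (v : E2) : IntegrableOn (fun p => fderiv ℝ f p v) (interior (Tri a b c)) := by
  obtain ⟨M, hM⟩ := h.bd
  apply intOn_bdd
  · exact ((h.c1.continuousOn_fderiv_of_isOpen isOpen_interior le_rfl).clm_apply continuousOn_const)
  · exact ⟨M * ‖v‖, fun p hp => (ContinuousLinearMap.le_opNorm _ _).trans (by gcongr; exact hM p hp)⟩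

lemma CK.div (hcr : cr (b - a) (c - a) ≠ 0) {X0 X1 : E2 → ℝ} (h0 : CK a b c K X0) (h1 : CK a b c K X1) :
    cr (b - a) (c - a) * ∫ p in interior (Tri a b c), (fderiv ℝ X0 p e0 + fderiv ℝ X1 p e1) =
      |cr (b - a) (c - a)| * (fl a b X0 X1 + fl b c X0 X1 + fl c a X0 X1) := by
  have c0 := h0.cl hcr
  have c1 := h1.cl hcr
  exact div_tri hcr c0.cont c1.cont (c0.c1.differentiableOn one_ne_zero) (c1.c1.differentiableOn one_ne_zero) c0.pd_int c1.pd_int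

lemma fl_eq_zero {a b : E2} {X0 X1 : E2 → ℝ}
    (h : ∀ t ∈ Ioo (0:ℝ) 1, X0 (a + t • (b - a)) * (b - a) 1 - X1 (a + t • (b - a)) * (b - a) 0 = 0) : fl a b X0 X1 = 0 := by
  unfold fl
  apply intervalIntegral.integral_zero_ae
  have h1 : ∀ᵐ t : ℝ, t ≠ 1 := by simp [ae_iff]
  filter_upwards [h1] with t ht ht2
  rw [uIoc_of_le zero_le_one] at ht2
  exact h t ⟨ht2.1, lt_of_le_of_ne ht2.2 ht⟩

/-- Version in which all the boundary fluxes vanish. -/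
lemma CK.div_zero (hcr : cr (b - a) (c - a) ≠ 0) {X0 X1 : E2 → ℝ} (h0 : CK a b c K X0) (h1 : CK a b c K X1)
    (hf : fl a b X0 X1 = 0) (hK : ∀ p ∈ K, bar b c a p ≠ 0 ∧ bar c a b p ≠ 0) :
    ∫ p in interior (Tri a b c), (fderiv ℝ X0 p e0 + fderiv ℝ X1 p e1) = 0 := by
  have h := CK.div hcr h0 h1
  have z1 : fl b c X0 X1 = 0 := by
    apply fl_eq_zero
    intro t ht
    replace ht : t ∈ Icc (0:ℝ) 1 := ⟨ht.1.le, ht.2.le⟩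
    have hT : b + t • (c - b) ∈ Tri a b c := by rw [← Tri_perm]; exact seg_in_Tri ht
    have hn : b + t • (c - b) ∉ K := fun hk => (hK _ hk).1 (seg_bar b c a t)
    simp only [h0.zero _ hT hn, h1.zero _ hT hn]; ring
  have z2 : fl c a X0 X1 = 0 := by
    apply fl_eq_zero
    intro t ht
    replace ht : t ∈ Icc (0:ℝ) 1 := ⟨ht.1.le, ht.2.le⟩
    have hT : c + t • (a - c) ∈ Tri a b c := by rw [← Tri_perm, ← Tri_perm]; exact seg_in_Tri ht
    have hn : c + t • (a - c) ∉ K := fun hk => (hK _ hk).2 (seg_bar c a b t)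
    simp only [h0.zero _ hT hn, h1.zero _ hT hn]; ring
  rw [hf, z1, z2] at h
  simp only [add_zero, mul_zero] at h
  exact (mul_eq_zero.1 h).resolve_left hcr

end

/-- The standing assumptions on `ψ`, for the side `[a,b]`. -/
structure Psi (a b c : E2) (lam : ℝ) (ψ : E2 → ℝ) : Prop where
  hcr : cr (b - a) (c - a) ≠ 0
  cont : ContinuousOn ψ (Tri a b c)
  smooth : ContDiffOn ℝ (⊤ : ℕ∞) ψ (TriDom a b c)
  eqn : ∀ p ∈ interior (Tri a b c), lap ψ p = -lam * ψ p
  neu : NeumannOn (TriDom a b c) a b ψ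

section
variable {a b c : E2} {lam : ℝ} {ψ : E2 → ℝ}

/-- Partial derivatives of `ψ` up to the sides. -/
def pw (a b c : E2) (ψ : E2 → ℝ) (v p : E2) : ℝ := fderivWithin ℝ ψ (TriDom a b c) p v

lemma Psi.pw_smooth (h : Psi a b c lam ψ) (v : E2) : ContDiffOn ℝ 1 (pw a b c ψ v) (TriDom a b c) := by
  have h1 : ContDiffOn ℝ 1 (fderivWithin ℝ ψ (TriDom a b c)) (TriDom a b c) :=
    h.smooth.fderivWithin (Tri_uniq h.hcr) (by norm_cast)
  exact h1.clm_apply contDiffOn_const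

lemma Psi.pw_ev (h : Psi a b c lam ψ) (v : E2) {p : E2} (hp : p ∈ interior (Tri a b c)) :
    pw a b c ψ v =ᶠ[𝓝 p] fun q => fderiv ℝ ψ q v := by
  filter_upwards [isOpen_interior.mem_nhds hp] with q hq
  unfold pw
  rw [CK.fderiv_eq h.hcr hq]

lemma Psi.pw_dd (h : Psi a b c lam ψ) {p : E2} (hp : p ∈ interior (Tri a b c)) :
    fderiv ℝ (pw a b c ψ e0) p e0 + fderiv ℝ (pw a b c ψ e1) p e1 = -lam * ψ p := by
  rw [(h.pw_ev e0 hp).fderiv_eq, (h.pw_ev e1 hp).fderiv_eq, ← h.eqn p hp]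
  rfl

lemma Psi.pw_diff (h : Psi a b c lam ψ) (v : E2) {p : E2} (hp : p ∈ interior (Tri a b c)) :
    DifferentiableAt ℝ (pw a b c ψ v) p :=
  (((h.pw_smooth v).mono (IT_sub_dom h.hcr)).differentiableOn one_ne_zero p hp).differentiableAt (isOpen_interior.mem_nhds hp)

lemma Psi.diff (h : Psi a b c lam ψ) {p : E2} (hp : p ∈ interior (Tri a b c)) : ContDiffAt ℝ (⊤ : ℕ∞) ψ p :=
  (h.smooth.mono (IT_sub_dom h.hcr)).contDiffAt (isOpen_interior.mem_nhds hp)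

/-- Flux density of `∇ψ` across the Neumann side vanishes. -/
lemma Psi.flux (h : Psi a b c lam ψ) {t : ℝ} (ht : t ∈ Ioo (0:ℝ) 1) :
    pw a b c ψ e0 (a + t • (b - a)) * (b - a) 1 - pw a b c ψ e1 (a + t • (b - a)) * (b - a) 0 = 0 := by
  have hab : b - a ≠ 0 := by
    intro h0; apply h.hcr; rw [h0]; simp [cr]
  have hp : a + t • (b - a) ∈ segment ℝ a b := by
    rw [segment_eq_image']; exact ⟨t, ⟨ht.1.le, ht.2.le⟩, rfl⟩
  have h1 : a + t • (b - a) ≠ a := by simp [ht.1.ne', hab]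
  have h2 : a + t • (b - a) ≠ b := by
    intro h3
    have : (1 - t) • (b - a) = 0 := by
      rw [sub_smul, one_smul, sub_eq_zero, sub_eq_iff_eq_add, add_comm]; exact h3.symm
    rcases smul_eq_zero.1 this with h4 | h4
    · linarith [ht.2]
    · exact hab h4
  have h3 := h.neu _ hp h1 h2 ((b - a) 1 • e0 - (b - a) 0 • e1) (by
    rw [inner_eq_dt]; simp [dt]; ring)
  rw [map_sub, map_smul, map_smul, smul_eq_mul, smul_eq_mul] at h3
  unfold pw
  linarith

end

end

noncomputable section
open MeasureTheory Filter Topology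

section
variable {a b c : E2} {lam : ℝ} {ψ : E2 → ℝ}

/-- Interior unique continuation. -/
lemma Psi.uc_int (h : Psi a b c lam ψ) {U : Set E2} (hU : IsOpen U) (hne : (U ∩ interior (Tri a b c)).Nonempty)
    (hz : ∀ p ∈ U ∩ interior (Tri a b c), ψ p = 0) : ∀ p ∈ Tri a b c, ψ p = 0 := by
  set I := interior (Tri a b c) with hI
  have hIo : IsOpen I := isOpen_interior
  set Z := interior {p | p ∈ I → ψ p = 0} ∩ I with hZ
  have hZo : IsOpen Z := isOpen_interior.inter hIo
  have hconn : IsPreconnected I := (Tri_convex a b c).interior.isPreconnected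
  have hsub : I ⊆ Z := by
    apply hconn.subset_of_closure_inter_subset hZo
    · obtain ⟨p, hp⟩ := hne
      refine ⟨p, hp.2, ?_, hp.2⟩
      exact mem_interior.2 ⟨U, fun q hq hqI => hz q ⟨hq, hqI⟩, hU, hp.1⟩
    · rintro p ⟨hpc, hpI⟩
      obtain ⟨R, hR, hB⟩ := Metric.isOpen_iff.1 hIo p hpI
      obtain ⟨q, hqZ, hq⟩ := Metric.mem_closure_iff.1 hpc (R / 2) (by positivity)
      obtain ⟨ε, hε, hBq⟩ := Metric.isOpen_iff.1 hZo q hqZ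
      have hsubR : Metric.ball q (R / 2) ⊆ I := by
        refine Subset.trans (fun y hy => ?_) hB
        rw [Metric.mem_ball] at hy ⊢
        calc dist y p ≤ dist y q + dist q p := dist_triangle _ _ _
          _ < R := by rw [dist_comm q p]; linarith
      have := uc_ball (v := ψ) (x := q) (R := R / 2) (ν := lam) (ε := ε)
        (fun y hy => ((h.diff (hsubR hy)).of_le (by norm_cast)).contDiffWithinAt) (fun y hy => h.eqn y (hsubR hy)) hε
        (fun y hy => interior_subset (hBq hy).1 (hBq hy).2)
      exact ⟨mem_interior.2 ⟨Metric.ball q (R / 2), fun y hy _ => this y hy, Metric.isOpen_ball, hq⟩, hpI⟩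
  have h0 : ∀ p ∈ I, ψ p = 0 := fun p hp => interior_subset (hsub hp).1 hp
  intro p hp
  have hcl : p ∈ closure I := by rw [closure_IT h.hcr]; exact hp
  have hc : ContinuousWithinAt ψ I p := (h.cont p hp).mono interior_subset
  have ht : Tendsto ψ (𝓝[I] p) (𝓝 0) := by
    refine tendsto_const_nhds.congr' ?_
    filter_upwards [self_mem_nhdsWithin] with q hq
    exact (h0 q hq).symm
  haveI : (𝓝[I] p).NeBot := mem_closure_iff_nhdsWithin_neBot.1 hcl
  exact tendsto_nhds_unique hc ht

lemma Psi.weak (h : Psi a b c lam ψ) {o : E2} {r : ℝ}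
    (hb : ∀ p ∈ Metric.ball o r, 0 < bar b c a p ∧ 0 < bar c a b p)
    (hz : ∀ p ∈ Tri a b c, bar a b c p = 0 → p ∈ Metric.ball o r → ψ p = 0) :
    WeakSol (Metric.ball o r) (indicator (interior (Tri a b c)) ψ) lam := by
  intro k hk hkc hks
  have e : (fun y => indicator (interior (Tri a b c)) ψ y * (lap k y + lam * k y)) =
      indicator (interior (Tri a b c)) (fun y => ψ y * (lap k y + lam * k y)) := by
    funext y
    by_cases hy : y ∈ interior (Tri a b c) <;> simp [hy]
  rw [e, integral_indicator isOpen_interior.measurableSet]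
  set K := tsupport k ∩ Tri a b c with hK
  have hKc : IsCompact K := hkc.isCompact.inter_right (Tri_compact a b c).isClosed
  have hKd : K ⊆ TriDom a b c := by
    rintro p ⟨h1, h2⟩
    have h3 := hb p (hks h1)
    refine ⟨h2, ?_⟩
    rintro (rfl | rfl | rfl)
    · rw [bar_right c p b] at h3; exact lt_irrefl _ h3.2
    · rw [bar_left p c a] at h3; exact lt_irrefl _ h3.1
    · rw [bar_right b p a] at h3; exact lt_irrefl _ h3.1
  have hψ1 : ContDiffOn ℝ 1 ψ (TriDom a b c) := h.smooth.of_le (by norm_cast)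
  have hk0 : ∀ p, p ∉ tsupport k → k p = 0 := fun p hp => image_eq_zero_of_notMem_tsupport hp
  have hkd : ∀ (v : E2) p, p ∉ tsupport k → fderiv ℝ k p v = 0 := fun v p hp => by
    have h1 : k =ᶠ[𝓝 p] fun _ => 0 := notMem_tsupport_iff_eventuallyEq.1 hp
    rw [h1.fderiv_eq]; simp
  have hdk : ∀ v, ContDiff ℝ 1 (fun p => fderiv ℝ k p v) := fun v =>
    (hk.fderiv_right (m := 1) (by norm_cast)).clm_apply contDiff_const
  have hX : ∀ v, CK a b c K (fun p => ψ p * fderiv ℝ k p v - k p * pw a b c ψ v p) := fun v =>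
    { smooth := (hψ1.mul (hdk v).contDiffOn).sub ((hk.of_le (by norm_cast)).contDiffOn.mul (h.pw_smooth v))
      compact := hKc
      sub := hKd
      zero := fun p hp hpK => by
        have : p ∉ tsupport k := fun h1 => hpK ⟨h1, hp⟩
        simp only [hkd v p this, hk0 p this]; ring }
  have key := CK.div_zero h.hcr (hX e0) (hX e1) (by
    apply fl_eq_zero
    intro t ht
    have h1 := h.flux ht
    set p := a + t • (b - a) with hp
    have hpT : p ∈ Tri a b c := seg_in_Tri ⟨ht.1.le, ht.2.le⟩
    by_cases hpk : p ∈ tsupport k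
    · rw [hz p hpT (seg_bar a b c t) (hks hpk)]
      linear_combination -(k p) * h1
    · rw [hkd _ p hpk, hkd _ p hpk, hk0 p hpk]; ring) (fun p hp => by
      have := hb p (hks hp.1)
      exact ⟨this.1.ne', this.2.ne'⟩)
  rw [← key]
  apply setIntegral_congr_fun isOpen_interior.measurableSet
  intro p hp
  have hd : DifferentiableAt ℝ ψ p := (h.diff hp).differentiableAt (by simp)
  have hkdiff : DifferentiableAt ℝ k p := hk.differentiable (by simp) p
  have hkd1 : ∀ v, DifferentiableAt ℝ (fun p => fderiv ℝ k p v) p := fun v => (hdk v).differentiable one_ne_zero p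
  have hcomp : ∀ v, fderiv ℝ (fun p => ψ p * fderiv ℝ k p v - k p * pw a b c ψ v p) p v =
      ψ p * fderiv ℝ (fun p => fderiv ℝ k p v) p v - k p * fderiv ℝ (pw a b c ψ v) p v := by
    intro v
    have h1 := fderiv_mul_dir hd (hkd1 v) v
    have h2 := fderiv_mul_dir hkdiff (h.pw_diff v hp) v
    have h3 : pw a b c ψ v p = fderiv ℝ ψ p v := (h.pw_ev v hp).eq_of_nhds
    rw [fderiv_fun_sub (show DifferentiableAt ℝ (fun p => ψ p * fderiv ℝ k p v) p from hd.mul (hkd1 v))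
      (show DifferentiableAt ℝ (fun p => k p * pw a b c ψ v p) p from hkdiff.mul (h.pw_diff v hp)), _root_.sub_apply, h1, h2, h3]
    ring
  show ψ p * (lap k p + lam * k p) = _
  simp only [hcomp]
  have h4 := h.pw_dd hp
  unfold lap mixedDeriv
  linear_combination k p * h4

/-- Unique continuation from vanishing Cauchy data on part of the Neumann side. -/
lemma Psi.uc_side (h : Psi a b c lam ψ) {o : E2} {r : ℝ} (hr : 0 < r) (ho : o ∈ Tri a b c) (h1 : 0 < bar b c a o)
    (h2 : 0 < bar c a b o) (h3 : bar a b c o = 0)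
    (hz : ∀ p ∈ Tri a b c, bar a b c p = 0 → p ∈ Metric.ball o r → ψ p = 0) : ∀ p ∈ Tri a b c, ψ p = 0 := by
  have hopen : IsOpen {p | 0 < bar b c a p ∧ 0 < bar c a b p} :=
    (isOpen_lt continuous_const (bar_continuous _ _ _)).inter (isOpen_lt continuous_const (bar_continuous _ _ _))
  obtain ⟨r', hr', hB⟩ := Metric.isOpen_iff.1 hopen o ⟨h1, h2⟩
  set ρ := min r r' with hρ
  have hρ0 : 0 < ρ := lt_min hr hr'
  have hw := h.weak (o := o) (r := ρ) (fun p hp => hB (Metric.ball_subset_ball (min_le_right _ _) hp))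
    (fun p hp hp0 hpb => hz p hp hp0 (Metric.ball_subset_ball (min_le_left _ _) hpb))
  have hintg : Integrable (indicator (interior (Tri a b c)) ψ) volume :=
    (integrable_indicator_iff isOpen_interior.measurableSet).2 (intOn_cont h.cont)
  obtain ⟨g, hgs, hge, hga⟩ := weyl Metric.isOpen_ball hintg hw
  have hneg : IsOpen {p | bar a b c p < 0} := isOpen_lt (bar_continuous _ _ _) continuous_const
  have hn0 : ∀ p, bar a b c p < 0 → p ∉ interior (Tri a b c) := fun p hp hpI => by
    have := ((mem_interior_Tri h.hcr p).1 hpI).2.2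
    linarith
  have g0 : ∀ p ∈ Metric.ball o ρ ∩ {p | bar a b c p < 0}, g p = 0 := by
    apply ae_eq_cont (Metric.isOpen_ball.inter hneg) (hgs.continuousOn.mono inter_subset_left) continuousOn_const
    filter_upwards [hga] with p hp hp2
    rw [← hp hp2.1, indicator_of_notMem (hn0 p hp2.2)]
  have gψ : ∀ p ∈ Metric.ball o ρ ∩ interior (Tri a b c), g p = ψ p := by
    apply ae_eq_cont (Metric.isOpen_ball.inter isOpen_interior) (hgs.continuousOn.mono inter_subset_left)
      (h.cont.mono (inter_subset_right.trans interior_subset))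
    filter_upwards [hga] with p hp hp2
    rw [← hp hp2.1, indicator_of_mem hp2.2]
  -- a point on the other side
  have hx0 : ∃ x0, bar a b c x0 < 0 ∧ dist x0 o < ρ / 2 := by
    have hcont : Tendsto (fun s : ℝ => o - s • (c - a)) (𝓝[>] 0) (𝓝 o) := by
      have : Continuous (fun s : ℝ => o - s • (c - a)) := by fun_prop
      have h4 := this.tendsto 0
      simp only [zero_smul, sub_zero] at h4
      exact h4.mono_left nhdsWithin_le_nhds
    have h5 := hcont.eventually (Metric.ball_mem_nhds o (half_pos hρ0))
    obtain ⟨s, hs1, hs2⟩ := (h5.and self_mem_nhdsWithin).exists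
    refine ⟨o - s • (c - a), ?_, hs1⟩
    have : bar a b c (o - s • (c - a)) = bar a b c o - s := by
      unfold bar
      have hc := h.hcr
      field_simp
      simp [cr]; ring
    rw [this, h3]
    have : (0:ℝ) < s := hs2
    linarith
  obtain ⟨x0, hx1, hx2⟩ := hx0
  have hsubR : Metric.ball x0 (ρ / 2) ⊆ Metric.ball o ρ := by
    intro y hy
    rw [Metric.mem_ball] at hy ⊢
    linarith [dist_triangle y x0 o]
  have hx0m : x0 ∈ Metric.ball o ρ ∩ {p | bar a b c p < 0} := ⟨by rw [Metric.mem_ball]; linarith, hx1⟩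
  obtain ⟨ε, hε, hBε⟩ := Metric.isOpen_iff.1 (Metric.isOpen_ball.inter hneg) x0 hx0m
  have hzero := uc_ball (v := g) (x := x0) (R := ρ / 2) (ν := lam) (ε := ε) ((hgs.mono hsubR).of_le (by norm_cast))
    (fun p hp => hge p (hsubR hp)) hε (fun p hp => g0 p (hBε hp))
  apply h.uc_int (U := Metric.ball x0 (ρ / 2)) Metric.isOpen_ball
  · have hcl : o ∈ closure (interior (Tri a b c)) := by rw [closure_IT h.hcr]; exact ho
    exact mem_closure_iff.1 hcl _ Metric.isOpen_ball (by rw [Metric.mem_ball, dist_comm]; exact hx2)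
  · rintro p ⟨hp1, hp2⟩
    rw [← gψ p ⟨hsubR hp1, hp2⟩]
    exact hzero p hp1

end

end

noncomputable section
open MeasureTheory Filter Topology

/-- `φ` is a nonnegative nodal piece of `ψ` away from the two other sides. -/
structure Nod (a b c : E2) (ψ φ : E2 → ℝ) : Prop where
  cont : ContinuousOn φ (Tri a b c)
  nn : ∀ p ∈ Tri a b c, 0 ≤ φ p
  away : ∀ p ∈ Tri a b c, 0 < φ p → 0 < bar b c a p ∧ 0 < bar c a b p
  loc : ∀ p ∈ Tri a b c, 0 < φ p → ∀ᶠ q in 𝓝[Tri a b c] p, φ q = ψ q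
  pos : ∃ x ∈ Tri a b c, 0 < φ x

section
variable {a b c : E2} {lam : ℝ} {ψ : E2 → ℝ}

lemma Psi.exists_ne (h : Psi a b c lam ψ) (hnz : ∃ z ∈ Tri a b c, ψ z ≠ 0) {g0 g1 : E2} (h0 : g0 ∈ Tri a b c)
    (h1 : g1 ∈ Tri a b c) (hg0 : bar a b c g0 = 0) (hg1 : bar a b c g1 = 0) (hne : g0 ≠ g1) :
    ∃ x ∈ openSegment ℝ g0 g1, ψ x ≠ 0 := by
  by_contra hcon
  push Not at hcon
  have hB : bar b c a g0 ≠ bar b c a g1 := by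
    intro hE
    apply hne
    have s0 := bar_sum h.hcr g0
    have s1 := bar_sum h.hcr g1
    rw [bar_comb h.hcr g0, bar_comb h.hcr g1, hg0, hg1, hE, show bar c a b g0 = bar c a b g1 by linarith]
  set B0 := bar b c a g0
  set B1 := bar b c a g1
  have hd : B1 - B0 ≠ 0 := sub_ne_zero.2 hB.symm
  set T : E2 → ℝ := fun p => (bar b c a p - B0) / (B1 - B0) with hTdef
  have hTc : Continuous T := by
    have := bar_continuous b c a
    fun_prop
  have hrep : ∀ p, bar a b c p = 0 → p = (1 - T p) • g0 + T p • g1 := by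
    intro p hp
    have s0 := bar_sum h.hcr g0
    have s1 := bar_sum h.hcr g1
    have s2 := bar_sum h.hcr p
    have e : bar b c a p = B0 + T p * (B1 - B0) := by simp only [hTdef]; field_simp; ring
    have d0 := bar_comb h.hcr g0
    have d1 := bar_comb h.hcr g1
    have d2 := bar_comb h.hcr p
    have k0 : bar c a b g0 = 1 - B0 := by linarith
    have k1 : bar c a b g1 = 1 - B1 := by linarith
    have k2 : bar c a b p = 1 - (B0 + T p * (B1 - B0)) := by linarith
    rw [hg0, k0] at d0
    rw [hg1, k1] at d1
    rw [hp, k2, e] at d2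
    generalize T p = t at *
    calc p = _ := d2
      _ = (1 - t) • (B0 • a + (1 - B0) • b + (0:ℝ) • c) + t • (B1 • a + (1 - B1) • b + (0:ℝ) • c) := by module
      _ = _ := by rw [← d0, ← d1]
  set o : E2 := (1 / 2 : ℝ) • g0 + (1 / 2 : ℝ) • g1 with ho
  have hoT : o ∈ Tri a b c := Tri_convex a b c h0 h1 (by norm_num) (by norm_num) (by norm_num)
  have ho0 : bar a b c o = 0 := by rw [bar_affine a b c g0 g1 _ _ (by norm_num), hg0, hg1]; ring
  have hoB : bar b c a o = 1 / 2 * B0 + 1 / 2 * B1 := bar_affine b c a g0 g1 _ _ (by norm_num)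
  have hoC : bar c a b o = 1 / 2 * bar c a b g0 + 1 / 2 * bar c a b g1 := bar_affine c a b g0 g1 _ _ (by norm_num)
  have m0 := (mem_Tri h.hcr g0).1 h0
  have m1 := (mem_Tri h.hcr g1).1 h1
  have hTo : T o = 1 / 2 := by simp only [hTdef]; rw [hoB]; field_simp; ring
  have hopen : IsOpen {p | 0 < T p ∧ T p < 1} :=
    (isOpen_lt continuous_const hTc).inter (isOpen_lt hTc continuous_const)
  obtain ⟨r, hr, hball⟩ := Metric.isOpen_iff.1 hopen o ⟨by rw [hTo]; norm_num, by rw [hTo]; norm_num⟩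
  have s0 := bar_sum h.hcr g0
  have s1 := bar_sum h.hcr g1
  have hz := h.uc_side hr hoT (by
      rw [hoB]
      rcases lt_or_gt_of_ne hB with h5 | h5
      · linarith [m0.1]
      · linarith [m1.1]) (by
      rw [hoC]
      rcases lt_or_gt_of_ne hB with h5 | h5
      · linarith [m1.2.1, m0.2.1]
      · linarith [m1.2.1, m0.2.1]) ho0 (fun p hp hp0 hpb => by
      apply hcon
      have h5 := hball hpb
      exact ⟨1 - T p, T p, by linarith [h5.2], h5.1, by ring, (hrep p hp0).symm⟩)
  obtain ⟨z, hz1, hz2⟩ := hnz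
  exact hz2 (hz z hz1)

lemma exists_nod (hcr : cr (b - a) (c - a) ≠ 0) (hcont : ContinuousOn ψ (Tri a b c)) {γ : ℝ → E2}
    (hγc : ContinuousOn γ (Icc 0 1)) (hγT : ∀ t ∈ Icc (0:ℝ) 1, γ t ∈ Tri a b c)
    (hγ0 : bar a b c (γ 0) = 0) (hγ1 : bar a b c (γ 1) = 0) (hne : γ 0 ≠ γ 1)
    (hγz : ∀ t ∈ Icc (0:ℝ) 1, ψ (γ t) = 0) {x : E2} (hx : x ∈ openSegment ℝ (γ 0) (γ 1)) (hpos : 0 < ψ x) :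
    ∃ φ, Nod a b c ψ φ := by
  classical
  set N := {z | z ∈ Tri a b c ∧ 0 < ψ z} with hN
  have hxT : x ∈ Tri a b c := (Tri_convex a b c).openSegment_subset (hγT 0 (by simp)) (hγT 1 (by simp)) hx
  set D := {y | JoinedIn N x y} with hD
  have hDN : ∀ y ∈ D, y ∈ Tri a b c ∧ 0 < ψ y := fun y hy => by
    have h1 : JoinedIn N x y := hy
    exact h1.target_mem
  -- local structure
  have hloc : ∀ p ∈ Tri a b c, 0 < ψ p → ∀ᶠ q in 𝓝[Tri a b c] p, (0 < ψ q ∧ JoinedIn N p q) := by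
    intro p hp hpp
    have h1 : ∀ᶠ q in 𝓝[Tri a b c] p, 0 < ψ q := (hcont p hp).eventually (lt_mem_nhds hpp)
    obtain ⟨r, hr, hB⟩ := Metric.mem_nhdsWithin_iff.1 h1
    filter_upwards [mem_nhdsWithin_of_mem_nhds (Metric.ball_mem_nhds p hr), self_mem_nhdsWithin] with q h2 h3
    refine ⟨hB ⟨h2, h3⟩, JoinedIn.of_segment_subset ?_⟩
    have hc : Convex ℝ (Metric.ball p r ∩ Tri a b c) := (convex_ball p r).inter (Tri_convex a b c)
    have hs := hc.segment_subset ⟨Metric.mem_ball_self hr, hp⟩ ⟨h2, h3⟩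
    exact fun y hy => ⟨(hs hy).2, hB (hs hy)⟩
  refine ⟨fun p => if p ∈ D then ψ p else 0, ?_, ?_, ?_, ?_, ?_⟩
  · intro p hp
    rcases lt_or_ge 0 (ψ p) with h | h
    · by_cases hpD : p ∈ D
      · refine (hcont p hp).congr_of_eventuallyEq ?_ (by simp [hpD])
        filter_upwards [hloc p hp h] with q hq
        have : q ∈ D := JoinedIn.trans hpD hq.2
        simp [this]
      · refine (continuousWithinAt_const (b := (0:ℝ))).congr_of_eventuallyEq ?_ (by simp [hpD])
        filter_upwards [hloc p hp h] with q hq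
        have : q ∉ D := fun hqD => hpD (JoinedIn.trans hqD hq.2.symm)
        simp [this]
    · have hpD : p ∉ D := fun hpD => absurd (hDN p hpD).2 (not_lt.2 h)
      unfold ContinuousWithinAt
      simp only [hpD, if_false]
      have ht : Tendsto (fun q => max (ψ q) 0) (𝓝[Tri a b c] p) (𝓝 0) := by
        have := ((hcont p hp).max (continuousWithinAt_const (b := (0:ℝ))))
        unfold ContinuousWithinAt at this
        rwa [max_eq_right h] at this
      refine squeeze_zero (fun q => ?_) (fun q => ?_) ht
      · by_cases hq : q ∈ D
        · simp [hq, (hDN q hq).2.le]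
        · simp [hq]
      · by_cases hq : q ∈ D
        · simp [hq]
        · simp [hq]
  · intro p hp
    show 0 ≤ if p ∈ D then ψ p else 0
    split_ifs with h
    · exact (hDN p h).2.le
    · exact le_rfl
  · intro p hp hpp
    have hpD : p ∈ D := by
      by_contra h; simp [h] at hpp
    have key : ¬ (bar b c a p = 0 ∨ bar c a b p = 0) := by
      intro hbar
      obtain ⟨s, hs, t, ht, hst⟩ := crossing_tri hcr (γ := γ) (β := (JoinedIn.somePath hpD).extend) hγc
        ((JoinedIn.somePath hpD).continuous_extend.continuousOn) hγT
        (fun t ht => by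
          rw [Path.extend_apply _ ht]; exact (JoinedIn.somePath_mem hpD ⟨t, ht⟩).1)
        hγ0 hγ1 (by simpa using hx) hne (by simpa using hbar)
      have h1 := hγz s hs
      rw [hst, Path.extend_apply _ ht] at h1
      have h2 := (JoinedIn.somePath_mem hpD ⟨t, ht⟩).2
      linarith
    push Not at key
    have := (mem_Tri hcr p).1 hp
    exact ⟨lt_of_le_of_ne this.1 key.1.symm, lt_of_le_of_ne this.2.1 key.2.symm⟩
  · intro p hp hpp
    have hpD : p ∈ D := by
      by_contra h; simp [h] at hpp
    filter_upwards [hloc p hp (hDN p hpD).2] with q hq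
    have : q ∈ D := JoinedIn.trans hpD hq.2
    simp [this]
  · have : x ∈ D := JoinedIn.refl ⟨hxT, hpos⟩
    exact ⟨x, hxT, by simpa [this] using hpos⟩

lemma Psi.neg (h : Psi a b c lam ψ) : Psi a b c lam (fun p => - ψ p) := by
  refine ⟨h.hcr, h.cont.neg, h.smooth.neg, ?_, ?_⟩
  · intro p hp
    have e : lap (fun p => - ψ p) p = - lap ψ p := by
      unfold lap mixedDeriv
      simp only [fderiv_fun_neg, _root_.neg_apply]
      ring
    rw [e, h.eqn p hp]; ring
  · intro p hp h1 h2 v hv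
    have := h.neu p hp h1 h2 v hv
    have hu : UniqueDiffWithinAt ℝ (TriDom a b c) p := by
      obtain ⟨k1, k2, k3, k4⟩ := open_side h.hcr hp h1 h2
      refine Tri_uniq h.hcr p ⟨k1, ?_⟩
      rintro (rfl | rfl | rfl)
      · exact h1 rfl
      · exact h2 rfl
      · rw [bar_self h.hcr] at k4; exact one_ne_zero k4
    rw [fderivWithin_fun_neg hu, _root_.neg_apply, this, neg_zero]

/-- From a nodal arc to a nodal piece, up to sign. -/
lemma Psi.exists_piece (h : Psi a b c lam ψ) (hnz : ∃ z ∈ Tri a b c, ψ z ≠ 0) {γ : ℝ → E2}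
    (hγc : ContinuousOn γ (Icc 0 1)) (hγT : ∀ t ∈ Icc (0:ℝ) 1, γ t ∈ Tri a b c)
    (hγ0 : bar a b c (γ 0) = 0) (hγ1 : bar a b c (γ 1) = 0) (hne : γ 0 ≠ γ 1)
    (hγz : ∀ t ∈ Icc (0:ℝ) 1, ψ (γ t) = 0) : ∃ ψ' φ, Psi a b c lam ψ' ∧ Nod a b c ψ' φ := by
  obtain ⟨x, hx, hx0⟩ := h.exists_ne hnz (hγT 0 (by simp)) (hγT 1 (by simp)) hγ0 hγ1 hne
  rcases lt_or_gt_of_ne hx0 with h1 | h1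
  · obtain ⟨φ, hφ⟩ := exists_nod (ψ := fun p => - ψ p) h.hcr h.neg.cont hγc hγT hγ0 hγ1 hne
      (fun t ht => by simp [hγz t ht]) hx (by simpa using h1)
    exact ⟨_, φ, h.neg, hφ⟩
  · obtain ⟨φ, hφ⟩ := exists_nod h.hcr h.cont hγc hγT hγ0 hγ1 hne hγz hx h1
    exact ⟨_, φ, h, hφ⟩

end

end

noncomputable section
open MeasureTheory Filter Topology

/-- a cut-off profile -/
structure Prof (ε : ℝ) (κ : ℝ → ℝ) : Prop where
  cont : Continuous κ
  nn : ∀ t, 0 ≤ κ t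
  le : ∀ t, κ t ≤ 1
  lo : ∀ t ≤ ε, κ t = 0
  hi : ∀ t, 2 * ε ≤ t → κ t = 1

/-- its primitive -/
def prim (κ : ℝ → ℝ) (t : ℝ) : ℝ := ∫ s in (0:ℝ)..t, κ s

section
variable {ε : ℝ} {κ : ℝ → ℝ}

lemma Prof.sq (h : Prof ε κ) : Prof ε (fun t => κ t * κ t) :=
  ⟨h.cont.mul h.cont, fun t => mul_self_nonneg _, fun t => mul_le_one₀ (h.le t) (h.nn t) (h.le t),
    fun t ht => by simp [h.lo t ht], fun t ht => by simp [h.hi t ht]⟩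

lemma exists_prof (hε : 0 < ε) : ∃ κ, Prof ε κ := by
  refine ⟨fun t => max 0 (min 1 (t / ε - 1)), by fun_prop, fun t => le_max_left _ _, fun t => ?_, fun t ht => ?_, fun t ht => ?_⟩
  · exact max_le zero_le_one (min_le_left _ _)
  · apply max_eq_left
    refine (min_le_right _ _).trans ?_
    have : t / ε ≤ 1 := (div_le_one hε).2 ht
    linarith
  · have : 2 ≤ t / ε := (le_div_iff₀ hε).2 ht
    show max 0 (min 1 (t / ε - 1)) = 1
    rw [min_eq_left (by linarith)]; simp

lemma Prof.deriv (h : Prof ε κ) (t : ℝ) : HasDerivAt (prim κ) (κ t) t :=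
  intervalIntegral.integral_hasDerivAt_right (h.cont.intervalIntegrable _ _)
    h.cont.stronglyMeasurable.stronglyMeasurableAtFilter h.cont.continuousAt

lemma Prof.smooth (h : Prof ε κ) : ContDiff ℝ 1 (prim κ) := by
  rw [contDiff_one_iff_deriv]
  refine ⟨fun t => (h.deriv t).differentiableAt, ?_⟩
  have : _root_.deriv (prim κ) = κ := funext fun t => (h.deriv t).deriv
  rw [this]; exact h.cont

lemma Prof.prim_lo (h : Prof ε κ) (hε : 0 < ε) {t : ℝ} (ht : t ≤ ε) : prim κ t = 0 := by
  unfold prim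
  rw [intervalIntegral.integral_congr (g := fun _ => 0)]
  · simp
  · intro s hs
    have : s ≤ max 0 t := hs.2
    exact h.lo s (this.trans (max_le hε.le ht))

lemma Prof.prim_mono (h : Prof ε κ) : Monotone (prim κ) := by
  apply monotone_of_deriv_nonneg (fun t => (h.deriv t).differentiableAt)
  intro t; rw [(h.deriv t).deriv]; exact h.nn t

lemma Prof.prim_nn (h : Prof ε κ) (hε : 0 < ε) (t : ℝ) : 0 ≤ prim κ t := by
  rcases le_total t ε with h1 | h1
  · rw [h.prim_lo hε h1]
  · have := h.prim_mono h1
    rwa [h.prim_lo hε le_rfl] at this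

lemma Prof.prim_le (h : Prof ε κ) {t : ℝ} (ht : 0 ≤ t) : prim κ t ≤ t := by
  have hd : ∀ s, HasDerivAt (fun s => s - prim κ s) (1 - κ s) s := fun s => (hasDerivAt_id s).sub (h.deriv s)
  have hm : Monotone (fun s => s - prim κ s) := by
    apply monotone_of_deriv_nonneg (fun t => (hd t).differentiableAt)
    intro t; rw [(hd t).deriv]; linarith [h.le t]
  have := hm ht
  simp [prim] at this
  exact this

lemma Prof.prim_ge (h : Prof ε κ) (hε : 0 < ε) {t : ℝ} : t - 2 * ε ≤ prim κ t := by
  rcases le_total t (2 * ε) with h1 | h1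
  · linarith [h.prim_nn hε t]
  · have e : prim κ t = prim κ (2 * ε) + ∫ s in (2 * ε)..t, κ s := by
      unfold prim
      rw [intervalIntegral.integral_add_adjacent_intervals] <;> exact h.cont.intervalIntegrable _ _
    have e2 : ∫ s in (2 * ε)..t, κ s = t - 2 * ε := by
      rw [intervalIntegral.integral_congr (g := fun _ => 1)]
      · simp
      · intro s hs
        rw [uIcc_of_le h1] at hs
        exact h.hi s hs.1
    rw [e, e2]
    linarith [h.prim_nn hε (2 * ε)]

lemma Prof.sq_bd (h : Prof ε κ) (hε : 0 < ε) {t : ℝ} (ht : 0 ≤ t) :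
    t * prim (fun s => κ s * κ s) t ≤ prim κ t * prim κ t + 4 * ε * t := by
  have h1 := h.sq.prim_le ht
  have h2 := h.prim_ge hε (t := t)
  have h3 := h.prim_nn hε t
  have h4 : t * prim (fun s => κ s * κ s) t ≤ t * t := mul_le_mul_of_nonneg_left h1 ht
  rcases le_total t (2 * ε) with h5 | h5
  · nlinarith
  · nlinarith

end

section
variable {a b c : E2} {lam : ℝ} {ψ φ : E2 → ℝ} {ε : ℝ} {κ : ℝ → ℝ}

def KK (a b c : E2) (φ : E2 → ℝ) (ε : ℝ) : Set E2 := {p | p ∈ Tri a b c ∧ ε ≤ φ p}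

lemma Nod.K_compact (hn : Nod a b c ψ φ) : IsCompact (KK a b c φ ε) := by
  have h1 : IsClosed (Tri a b c ∩ φ ⁻¹' (Ici ε)) :=
    hn.cont.preimage_isClosed_of_isClosed (Tri_compact a b c).isClosed isClosed_Ici
  exact (Tri_compact a b c).of_isClosed_subset h1 inter_subset_left

lemma Nod.dom (hn : Nod a b c ψ φ) {p : E2} (hp : p ∈ Tri a b c) (hpp : 0 < φ p) : p ∈ TriDom a b c := by
  refine ⟨hp, ?_⟩
  have h3 := hn.away p hp hpp
  rintro (rfl | rfl | rfl)
  · rw [bar_right c p b] at h3; exact lt_irrefl _ h3.2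
  · rw [bar_left p c a] at h3; exact lt_irrefl _ h3.1
  · rw [bar_right b p a] at h3; exact lt_irrefl _ h3.1

lemma Nod.comp_smooth (hn : Nod a b c ψ φ) (h : Psi a b c lam ψ) (hε : 0 < ε) {H : ℝ → ℝ} (hH : ContDiff ℝ 1 H)
    (h0 : ∀ t ≤ ε, H t = 0) : ContDiffOn ℝ 1 (fun p => H (φ p)) (TriDom a b c) := by
  intro p hp
  have hsub : 𝓝[TriDom a b c] p ≤ 𝓝[Tri a b c] p := nhdsWithin_mono p inter_subset_left
  rcases (hn.nn p hp.1).lt_or_eq with h1 | h1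
  · have h2 : ContDiffWithinAt ℝ 1 (fun p => H (ψ p)) (TriDom a b c) p :=
      hH.contDiffAt.comp_contDiffWithinAt p ((h.smooth p hp).of_le (by norm_cast))
    have h3 := hn.loc p hp.1 h1
    refine h2.congr_of_eventuallyEq ?_ ?_
    · filter_upwards [hsub h3] with q hq
      rw [hq]
    · rw [h3.self_of_nhdsWithin hp.1]
  · have h3 : ∀ᶠ q in 𝓝[Tri a b c] p, φ q < ε := (hn.cont p hp.1).eventually (gt_mem_nhds (by rw [← h1]; exact hε))
    refine (contDiffWithinAt_const (c := (0:ℝ))).congr_of_eventuallyEq ?_ (h0 _ (by linarith))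
    filter_upwards [hsub h3] with q hq
    exact h0 _ hq.le

lemma Nod.comp_CK (hn : Nod a b c ψ φ) (h : Psi a b c lam ψ) (hε : 0 < ε) {H : ℝ → ℝ} (hH : ContDiff ℝ 1 H)
    (h0 : ∀ t ≤ ε, H t = 0) : CK a b c (KK a b c φ ε) (fun p => H (φ p)) where
  smooth := hn.comp_smooth h hε hH h0
  compact := hn.K_compact
  sub := fun p hp => hn.dom hp.1 (hε.trans_le hp.2)
  zero := fun p hp hpK => h0 _ (by
    by_contra h1
    exact hpK ⟨hp, (not_le.1 h1).le⟩)

/-- Truncation of the nodal piece, with its energy identity. -/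
lemma Nod.trunc (hn : Nod a b c ψ φ) (h : Psi a b c lam ψ) (hε : 0 < ε) : ∃ f W : E2 → ℝ, Cl a b c f ∧
    (∀ p ∈ Tri a b c, 0 ≤ f p ∧ φ p - 2 * ε ≤ f p ∧ f p ≤ φ p) ∧
    ContinuousOn W (Tri a b c) ∧ (∀ p ∈ Tri a b c, 0 ≤ W p ∧ W p ≤ f p * f p + 4 * ε * φ p) ∧
    AA a b c f f = lam * ∫ p in interior (Tri a b c), W p := by
  obtain ⟨κ, hκ⟩ := exists_prof hε
  set g := prim κ with hg
  set G := prim (fun s => κ s * κ s) with hG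
  have hf := hn.comp_CK h hε hκ.smooth (fun t ht => hκ.prim_lo hε ht)
  have hF := hn.comp_CK h hε hκ.sq.smooth (fun t ht => hκ.sq.prim_lo hε ht)
  refine ⟨fun p => g (φ p), fun p => φ p * G (φ p), hf.cl h.hcr, fun p hp => ⟨hκ.prim_nn hε _, hκ.prim_ge hε, hκ.prim_le (hn.nn p hp)⟩,
    hn.cont.mul hF.cont, fun p hp => ⟨mul_nonneg (hn.nn p hp) (hκ.sq.prim_nn hε _), hκ.sq_bd hε (hn.nn p hp)⟩, ?_⟩
  have hX : ∀ v, CK a b c (KK a b c φ ε) (fun p => G (φ p) * pw a b c ψ v p) := fun v =>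
    { smooth := hF.smooth.mul (h.pw_smooth v)
      compact := hF.compact
      sub := hF.sub
      zero := fun p hp hpK => by
        have := hF.zero p hp hpK
        show G (φ p) * _ = 0
        rw [hG, this, zero_mul] }
  have key := CK.div_zero h.hcr (hX e0) (hX e1) (by
    apply fl_eq_zero
    intro t ht
    have h1 := h.flux ht
    linear_combination (G (φ (a + t • (b - a)))) * h1) (fun p hp => by
      have := hn.away p hp.1 (hε.trans_le hp.2)
      exact ⟨this.1.ne', this.2.ne'⟩)
  have hpt : ∀ p ∈ interior (Tri a b c), gd (fun p => g (φ p)) (fun p => g (φ p)) p =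
      (fderiv ℝ (fun p => G (φ p) * pw a b c ψ e0 p) p e0 + fderiv ℝ (fun p => G (φ p) * pw a b c ψ e1 p) p e1)
        + lam * (φ p * G (φ p)) := by
    intro p hp
    have hpT := interior_subset hp
    have hnh : 𝓝[Tri a b c] p = 𝓝 p := nhdsWithin_eq_nhds.2 (mem_interior_iff_mem_nhds.1 hp)
    rcases (hn.nn p hpT).lt_or_eq with h1 | h1
    · have h3 : ∀ᶠ q in 𝓝 p, φ q = ψ q := hnh ▸ hn.loc p hpT h1
      have e1' : (fun p => g (φ p)) =ᶠ[𝓝 p] fun p => g (ψ p) := h3.mono fun q hq => by simp only [hq]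
      have e2' : ∀ v, (fun p => G (φ p) * pw a b c ψ v p) =ᶠ[𝓝 p] fun p => G (ψ p) * pw a b c ψ v p :=
        fun v => h3.mono fun q hq => by simp only [hq]
      have hd : HasFDerivAt ψ (fderiv ℝ ψ p) p := ((h.diff hp).differentiableAt (by simp)).hasFDerivAt
      have hdg : HasFDerivAt (fun p => g (ψ p)) (κ (ψ p) • fderiv ℝ ψ p) p := (hκ.deriv (ψ p)).comp_hasFDerivAt p hd
      have hdG : HasFDerivAt (fun p => G (ψ p)) ((κ (ψ p) * κ (ψ p)) • fderiv ℝ ψ p) p :=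
        (hκ.sq.deriv (ψ p)).comp_hasFDerivAt p hd
      have hm : ∀ v, fderiv ℝ (fun p => G (ψ p) * pw a b c ψ v p) p v =
          (κ (ψ p) * κ (ψ p)) * fderiv ℝ ψ p v * fderiv ℝ ψ p v + G (ψ p) * fderiv ℝ (pw a b c ψ v) p v := by
        intro v
        have h5 : pw a b c ψ v p = fderiv ℝ ψ p v := (h.pw_ev v hp).eq_of_nhds
        rw [fderiv_mul_dir hdG.differentiableAt (h.pw_diff v hp) v, hdG.fderiv, h5]
        simp only [_root_.smul_apply, smul_eq_mul]; ring
      unfold gd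
      rw [e1'.fderiv_eq, (e2' e0).fderiv_eq, (e2' e1).fderiv_eq, hdg.fderiv, hm, hm, h3.self_of_nhds]
      simp only [_root_.smul_apply, smul_eq_mul]
      have h6 := h.pw_dd hp
      linear_combination - G (ψ p) * h6
    · have h3 : ∀ᶠ q in 𝓝 p, φ q < ε := by
        have := (hn.cont p hpT).eventually (gt_mem_nhds (show φ p < ε by rw [← h1]; exact hε))
        rwa [hnh] at this
      have e1' : (fun p => g (φ p)) =ᶠ[𝓝 p] fun p => 0 := h3.mono fun q hq => hκ.prim_lo hε hq.le
      have e2' : ∀ v, (fun p => G (φ p) * pw a b c ψ v p) =ᶠ[𝓝 p] fun p => 0 :=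
        fun v => h3.mono fun q hq => by
          show G (φ q) * _ = 0
          rw [hG, hκ.sq.prim_lo hε hq.le, zero_mul]
      unfold gd
      rw [e1'.fderiv_eq, (e2' e0).fderiv_eq, (e2' e1).fderiv_eq, ← h1]
      simp
  unfold AA
  rw [setIntegral_congr_fun isOpen_interior.measurableSet hpt, integral_add, key, integral_const_mul, zero_add]
  · exact ((hX e0).cl h.hcr).pd_int e0 |>.add (((hX e1).cl h.hcr).pd_int e1)
  · exact (intOn_cont (hn.cont.mul hF.cont)).const_mul lam

end

end

noncomputable section
open MeasureTheory Filter Topology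

/-- a rotated sine and cosine pair of frequency `k` -/
structure TP (k : ℝ) (i j : ℝ → ℝ) : Prop where
  di : ∀ t, HasDerivAt i (k * j t) t
  dj : ∀ t, HasDerivAt j (-(k * i t)) t
  one : ∀ t, i t * i t + j t * j t = 1
  si : ContDiff ℝ 2 i
  sj : ContDiff ℝ 2 j

/-- ridge function -/
def rid (i : ℝ → ℝ) (τ : E2) (p : E2) : ℝ := i (dt p τ + 0)

section
variable {k : ℝ} {i j : ℝ → ℝ} {τ : E2}

lemma TP.mk' (k α β : ℝ) (h : α * α + β * β = 1) :
    TP k (fun t => α * Real.sin (k * t) + β * Real.cos (k * t)) (fun t => α * Real.cos (k * t) - β * Real.sin (k * t)) := by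
  have hk : ∀ t, HasDerivAt (fun t => k * t) k t := fun t => by simpa using (hasDerivAt_id t).const_mul k
  refine ⟨fun t => ?_, fun t => ?_, fun t => ?_, by fun_prop, by fun_prop⟩
  · have := (((hk t).sin).const_mul α).add (((hk t).cos).const_mul β)
    convert! this using 1; ring
  · have := (((hk t).cos).const_mul α).sub (((hk t).sin).const_mul β)
    convert! this using 1; ring
  · have := Real.sin_sq_add_cos_sq (k * t)
    linear_combination (α * α + β * β) * this + h

lemma rid_smooth {n : WithTop ℕ∞} (h : ContDiff ℝ n i) (τ : E2) : ContDiff ℝ n (rid i τ) := by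
  unfold rid dt
  exact h.comp (by fun_prop)

lemma TP.fi (h : TP k i j) (p w : E2) : fderiv ℝ (rid i τ) p w = k * rid j τ p * dt w τ := by
  have := (lap_ridge h.di (C2 := fun t => k * -(k * i t)) (fun t => (h.dj t).const_mul k) τ 0).1 p w
  exact this

lemma TP.fj (h : TP k i j) (p w : E2) : fderiv ℝ (rid j τ) p w = -(k * rid i τ p) * dt w τ := by
  have := (lap_ridge h.dj (C2 := fun t => -(k * (k * j t))) (fun t => ((h.di t).const_mul k).neg) τ 0).1 p w
  exact this

lemma TP.li (h : TP k i j) (hτ : dt τ τ = 1) (p : E2) : lap (rid i τ) p = -(k ^ 2) * rid i τ p := by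
  have := (lap_ridge h.di (C2 := fun t => k * -(k * i t)) (fun t => (h.dj t).const_mul k) τ 0).2 p
  refine this.trans ?_
  rw [hτ]; unfold rid; ring

lemma TP.lj (h : TP k i j) (hτ : dt τ τ = 1) (p : E2) : lap (rid j τ) p = -(k ^ 2) * rid j τ p := by
  have := (lap_ridge h.dj (C2 := fun t => -(k * (k * j t))) (fun t => ((h.di t).const_mul k).neg) τ 0).2 p
  refine this.trans ?_
  rw [hτ]; unfold rid; ring

lemma dt_e (τ : E2) : dt e0 τ = τ 0 ∧ dt e1 τ = τ 1 := by
  constructor <;> simp [dt]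

lemma TP.AAi (h : TP k i j) (hτ : dt τ τ = 1) (a b c : E2) : AA a b c (rid i τ) (rid i τ) = k ^ 2 * BB a b c (rid j τ) (rid j τ) := by
  unfold AA BB
  rw [← integral_const_mul]
  congr 1
  funext p
  unfold gd
  rw [h.fi, h.fi, (dt_e τ).1, (dt_e τ).2]
  unfold dt at hτ
  linear_combination k ^ 2 * rid j τ p ^ 2 * hτ

lemma TP.AAj (h : TP k i j) (hτ : dt τ τ = 1) (a b c : E2) : AA a b c (rid j τ) (rid j τ) = k ^ 2 * BB a b c (rid i τ) (rid i τ) := by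
  unfold AA BB
  rw [← integral_const_mul]
  congr 1
  funext p
  unfold gd
  rw [h.fj, h.fj, (dt_e τ).1, (dt_e τ).2]
  unfold dt at hτ
  linear_combination k ^ 2 * rid i τ p ^ 2 * hτ

lemma rid_Cl (a b c : E2) (h : ContDiff ℝ 2 i) : Cl a b c (rid i τ) :=
  Cl_smooth a b c (rid_smooth (h.of_le (by norm_num)) τ)

lemma fl_f_zero {a b : E2} {f : E2 → ℝ} {X0 X1 : E2 → ℝ} (h : ∀ t ∈ Icc (0:ℝ) 1, f (a + t • (b - a)) = 0) :
    fl a b (fun p => f p * X0 p) (fun p => f p * X1 p) = 0 := by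
  apply fl_eq_zero
  intro t ht
  rw [h t ⟨ht.1.le, ht.2.le⟩]; ring

/-- Green's formula against `J`, for functions vanishing on the two other sides. -/
lemma TP.green_j {a b c n : E2} {L κ : ℝ} (hS : SF a b c τ n L κ) (h : TP k i j) (hτ : dt τ τ = 1) {f : E2 → ℝ} (hf : Cl a b c f)
    (h1 : ∀ p ∈ Tri a b c, bar b c a p = 0 → f p = 0) (h2 : ∀ p ∈ Tri a b c, bar c a b p = 0 → f p = 0) :
    AA a b c f (rid j τ) = k ^ 2 * BB a b c f (rid j τ) := by
  have hg := green_tri hS.hcr hf (rid_smooth h.sj τ)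
  have z1 : ZF a b (rid j τ) := by
    intro t ht
    rw [h.fj, h.fj, (dt_e τ).1, (dt_e τ).2, hS.hb]
    simp; ring
  have z2 : fl b c (fun p => f p * fderiv ℝ (rid j τ) p e0) (fun p => f p * fderiv ℝ (rid j τ) p e1) = 0 :=
    fl_f_zero fun t ht => h1 _ (by rw [← Tri_perm]; exact seg_in_Tri ht) (seg_bar b c a t)
  have z3 : fl c a (fun p => f p * fderiv ℝ (rid j τ) p e0) (fun p => f p * fderiv ℝ (rid j τ) p e1) = 0 :=
    fl_f_zero fun t ht => h2 _ (by rw [← Tri_perm, ← Tri_perm]; exact seg_in_Tri ht) (seg_bar c a b t)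
  rw [fl_zero z1, z2, z3] at hg
  simp only [add_zero, mul_zero, mul_eq_zero, hS.hcr, false_or] at hg
  have e : ∫ p in interior (Tri a b c), f p * lap (rid j τ) p = -(k ^ 2) * BB a b c f (rid j τ) := by
    unfold BB
    rw [← integral_const_mul]
    congr 1
    funext p
    rw [h.lj hτ]; ring
  rw [e] at hg
  linarith

/-- no flux weighted by `t (1-t) J` through a segment forces the segment to be orthogonal to `τ`. -/
lemma TP.seg (h : TP k i j) (hk : 0 < k) {p q : E2} (hc : cr τ (q - p) ≠ 0) {f : E2 → ℝ}
    (hf : ∀ t ∈ Ioo (0:ℝ) 1, f (p + t • (q - p)) = t * (1 - t) * rid j τ (p + t • (q - p)))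
    (h0 : fl p q (fun p => f p * fderiv ℝ (rid i τ) p e0) (fun p => f p * fderiv ℝ (rid i τ) p e1) = 0) : dt (q - p) τ = 0 := by
  set F : ℝ → ℝ := fun t => t * (1 - t) * rid j τ (p + t • (q - p)) ^ 2 with hF
  have hJc : Continuous fun t : ℝ => rid j τ (p + t • (q - p)) :=
    (rid_smooth h.sj τ).continuous.comp (by fun_prop)
  have hFc : Continuous F := by fun_prop
  have e : fl p q (fun p => f p * fderiv ℝ (rid i τ) p e0) (fun p => f p * fderiv ℝ (rid i τ) p e1) =
      (k * cr τ (q - p)) * ∫ t in (0:ℝ)..1, F t := by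
    have e1' : fl p q (fun p => f p * fderiv ℝ (rid i τ) p e0) (fun p => f p * fderiv ℝ (rid i τ) p e1) =
      ∫ t in (0:ℝ)..1, (k * cr τ (q - p)) * F t := by
      unfold fl
      apply intervalIntegral.integral_congr_ae
      have h1 : ∀ᵐ t : ℝ, t ≠ 1 := by simp [ae_iff]
      filter_upwards [h1] with t ht ht2
      rw [uIoc_of_le zero_le_one] at ht2
      rw [hf t ⟨ht2.1, lt_of_le_of_ne ht2.2 ht⟩, h.fi, h.fi, (dt_e τ).1, (dt_e τ).2]
      simp only [hF, cr]; ring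
    rw [e1', intervalIntegral.integral_const_mul]
  rw [e] at h0
  have h1 : ∫ t in (0:ℝ)..1, F t = 0 := (mul_eq_zero.1 h0).resolve_left (mul_ne_zero hk.ne' hc)
  have hz : ∀ t ∈ Ioo (0:ℝ) 1, rid j τ (p + t • (q - p)) = 0 := by
    intro t ht
    by_contra hne
    have : 0 < ∫ t in (0:ℝ)..1, F t := by
      apply intervalIntegral.integral_pos zero_lt_one hFc.continuousOn
      · intro x hx
        have : 0 ≤ x * (1 - x) := mul_nonneg hx.1.le (by linarith [hx.2])
        exact mul_nonneg this (sq_nonneg _)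
      · refine ⟨t, ⟨ht.1.le, ht.2.le⟩, ?_⟩
        have : 0 < t * (1 - t) := mul_pos ht.1 (by linarith [ht.2])
        exact mul_pos this (by positivity)
    linarith
  have hd : HasDerivAt (fun t : ℝ => rid j τ (p + t • (q - p))) (-(k * rid i τ (p + (1/2:ℝ) • (q - p))) * dt (q - p) τ) (1/2) := by
    have hl : HasDerivAt (fun t : ℝ => p + t • (q - p)) (q - p) (1/2) := by
      simpa using ((hasDerivAt_id (1/2:ℝ)).smul_const (q - p)).const_add p
    have h2 := ((rid_smooth h.sj τ).differentiable (by simp) (p + (1/2:ℝ) • (q - p))).hasFDerivAt.comp_hasDerivAt (1/2:ℝ) hl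
    rw [h.fj] at h2
    exact h2
  have hd0 : HasDerivAt (fun t : ℝ => rid j τ (p + t • (q - p))) 0 (1/2) := by
    refine (hasDerivAt_const (1/2:ℝ) (0:ℝ)).congr_of_eventuallyEq ?_
    filter_upwards [isOpen_Ioo.mem_nhds (show (1/2:ℝ) ∈ Ioo (0:ℝ) 1 by norm_num)] with t ht
    exact hz t ht
  have hu := hd.unique hd0
  have hj := hz (1/2) (by norm_num)
  have ho := h.one (dt (p + (1/2:ℝ) • (q - p)) τ + 0)
  change rid i τ (p + (1/2:ℝ) • (q - p)) * rid i τ (p + (1/2:ℝ) • (q - p)) + rid j τ (p + (1/2:ℝ) • (q - p)) * rid j τ (p + (1/2:ℝ) • (q - p)) = 1 at ho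
  rcases mul_eq_zero.1 hu with h3 | h3
  · have h4 := (mul_eq_zero.1 (neg_eq_zero.1 h3)).resolve_left hk.ne'
    rw [hj, h4] at ho; norm_num at ho
  · exact h3

/-- If the Rayleigh bound is attained by `I`, then `I` solves the weak equation. -/
lemma weak_of_eq {a b c : E2} (hcr : cr (b - a) (c - a) ≠ 0) {lam : ℝ} {I : E2 → ℝ}
    (H : ∀ f, Cl a b c f → MM a b c f = 0 → lam * BB a b c f f ≤ AA a b c f f) (hI : Cl a b c I) (hM : MM a b c I = 0)
    (h0 : AA a b c I I = lam * BB a b c I I) {g : E2 → ℝ} (hg : Cl a b c g) : AA a b c g I = lam * BB a b c g I := by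
  obtain ⟨m, hm, hm0⟩ := center hcr hg
  set G : E2 → ℝ := fun p => 1 * g p + m * 1 with hG
  have hA : AA a b c G I = AA a b c g I := by
    unfold AA
    apply setIntegral_congr_fun isOpen_interior.measurableSet
    intro p hp
    have := fderiv_lin (hg.diffAt hp) ((one_Cl a b c).diffAt hp) 1 m
    show gd G I p = gd g I p
    unfold gd
    rw [hG, this]
    simp
  have hB : BB a b c G I = BB a b c g I := by
    have e : BB a b c G I = MM a b c (fun p => 1 * (g p * I p) + m * I p) := by
      unfold BB MM; congr 1; funext p; simp only [hG]; ring
    rw [e, MM_lin (hg.mul_int hI) hI.int, hM]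
    unfold BB MM; ring
  rw [← hA, ← hB]
  have key : ∀ t : ℝ, 0 ≤ t ^ 2 * (AA a b c G G - lam * BB a b c G G) + 2 * t * (AA a b c G I - lam * BB a b c G I) := by
    intro t
    have h1 := H _ (hm.lin hI t 1) (by rw [MM_lin hm.int hI.int, hM, hm0]; ring)
    rw [AA_lin hm hI, BB_lin hm hI, h0] at h1
    linarith
  set A := AA a b c G G - lam * BB a b c G G with hAd
  set B := AA a b c G I - lam * BB a b c G I with hBd
  have hA0 : 0 ≤ A := by
    have := H G hm hm0
    rw [hAd]; linarith
  by_contra hne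
  have hB0 : B ≠ 0 := fun h => hne (by rw [hBd] at h; linarith)
  have h2 := key (-(B / (A + 1)))
  have h3 : (-(B / (A + 1))) ^ 2 * A + 2 * (-(B / (A + 1))) * B = - (B ^ 2 * (A + 2) / (A + 1) ^ 2) := by
    field_simp; ring
  rw [h3] at h2
  have : 0 < B ^ 2 * (A + 2) / (A + 1) ^ 2 := by positivity
  linarith

/-- The key strictness. -/
lemma TP.strict {a b c n : E2} {L κ : ℝ} (hS : SF a b c τ n L κ) (h : TP k i j) (hk : 0 < k) (hτ : dt τ τ = 1)
    (H : ∀ f, Cl a b c f → MM a b c f = 0 → k ^ 2 * BB a b c f f ≤ AA a b c f f) (hM : MM a b c (rid i τ) = 0) :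
    k ^ 2 * BB a b c (rid i τ) (rid i τ) < AA a b c (rid i τ) (rid i τ) := by
  have hI : Cl a b c (rid i τ) := rid_Cl a b c h.si
  refine lt_of_le_of_ne (H _ hI hM) fun heq => ?_
  have hcr := hS.hcr
  have hL := hS.hL
  have bτ : b - a = L • τ := by rw [hS.hb]; simp
  -- total flux vanishes
  have hflux : ∀ f, ContDiff ℝ 1 f → fl a b (fun p => f p * fderiv ℝ (rid i τ) p e0) (fun p => f p * fderiv ℝ (rid i τ) p e1) +
      fl b c (fun p => f p * fderiv ℝ (rid i τ) p e0) (fun p => f p * fderiv ℝ (rid i τ) p e1) +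
      fl c a (fun p => f p * fderiv ℝ (rid i τ) p e0) (fun p => f p * fderiv ℝ (rid i τ) p e1) = 0 := by
    intro f hf
    have hfC := Cl_smooth a b c hf
    have hg := green_tri hcr hfC (rid_smooth h.si τ)
    have e : ∫ p in interior (Tri a b c), f p * lap (rid i τ) p = -(k ^ 2) * BB a b c f (rid i τ) := by
      unfold BB
      rw [← integral_const_mul]
      congr 1
      funext p
      rw [h.li hτ]; ring
    rw [e, weak_of_eq hcr H hI hM heq.symm hfC] at hg
    have : |cr (b - a) (c - a)| ≠ 0 := abs_ne_zero.2 hcr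
    have h5 := hg.symm
    rw [show cr (b - a) (c - a) * (k ^ 2 * BB a b c f (rid i τ) + -k ^ 2 * BB a b c f (rid i τ)) = 0 by ring] at h5
    exact (mul_eq_zero.1 h5).resolve_left this
  have hJs : ContDiff ℝ 1 (rid j τ) := rid_smooth (h.sj.of_le (by norm_num)) τ
  have hbs : ∀ x y z, ContDiff ℝ 1 (bar x y z) := fun x y z => (bar_contDiff x y z).of_le (by norm_cast)
  have hcrL : cr (b - a) (c - a) = L * cr τ (c - b) := by
    rw [bτ, show c - b = (c - a) - L • τ by rw [← bτ]; abel]; simp [cr]; ring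
  have hcrR : cr (b - a) (c - a) = - (L * cr τ (a - c)) := by
    rw [bτ]; simp [cr]; ring
  have z1 : dt (c - b) τ = 0 := by
    set f : E2 → ℝ := fun p => bar a b c p * bar c a b p * rid j τ p with hf
    have h1 := hflux f (((hbs _ _ _).mul (hbs _ _ _)).mul hJs)
    rw [fl_f_zero (a := a) (b := b) (f := f) (fun t ht => by simp [hf, seg_bar]), fl_f_zero (a := c) (b := a) (f := f) (fun t ht => by simp [hf, seg_bar]), add_zero, zero_add] at h1
    refine h.seg hk (p := b) (q := c) (f := f) (fun h0 => hcr (by rw [hcrL, h0, mul_zero])) (fun t ht => ?_) h1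
    have k1 : bar a b c (b + t • (c - b)) = t := by
      rw [show b + t • (c - b) = (1 - t) • b + t • c by module, bar_affine _ _ _ _ _ _ _ (by ring), bar_right, bar_self hcr]; ring
    have k2 : bar c a b (b + t • (c - b)) = 1 - t := by
      rw [show b + t • (c - b) = (1 - t) • b + t • c by module, bar_affine _ _ _ _ _ _ _ (by ring), bar_left, bar_self (cr_perm (cr_perm hcr))]; ring
    simp only [hf, k1, k2]
  have z2 : dt (a - c) τ = 0 := by
    set f : E2 → ℝ := fun p => bar a b c p * bar b c a p * rid j τ p with hf
    have h1 := hflux f (((hbs _ _ _).mul (hbs _ _ _)).mul hJs)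
    rw [fl_f_zero (a := a) (b := b) (f := f) (fun t ht => by simp [hf, seg_bar]), fl_f_zero (a := b) (b := c) (f := f) (fun t ht => by simp [hf, seg_bar]), zero_add, zero_add] at h1
    refine h.seg hk (p := c) (q := a) (f := f) (fun h0 => hcr (by rw [hcrR, h0, mul_zero, neg_zero])) (fun t ht => ?_) h1
    have k1 : bar a b c (c + t • (a - c)) = 1 - t := by
      rw [show c + t • (a - c) = (1 - t) • c + t • a by module, bar_affine _ _ _ _ _ _ _ (by ring), bar_left, bar_self hcr]; ring
    have k2 : bar b c a (c + t • (a - c)) = t := by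
      rw [show c + t • (a - c) = (1 - t) • c + t • a by module, bar_affine _ _ _ _ _ _ _ (by ring), bar_right, bar_self (cr_perm hcr)]; ring
    simp only [hf, k1, k2]; ring
  have : dt (b - a) τ = L := by
    rw [bτ]; unfold dt at hτ ⊢; simp; linear_combination L * hτ
  have h3 : dt (b - a) τ + dt (c - b) τ + dt (a - c) τ = 0 := by
    unfold dt; simp; ring
  rw [this, z1, z2] at h3
  linarith

lemma exists_TP (a b c τ : E2) (k : ℝ) : ∃ i j, TP k i j ∧ MM a b c (rid i τ) = 0 := by
  set S := MM a b c (rid (fun t => Real.sin (k * t)) τ) with hS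
  set C := MM a b c (rid (fun t => Real.cos (k * t)) τ) with hC
  have hex : ∃ α β : ℝ, α * α + β * β = 1 ∧ α * S + β * C = 0 := by
    by_cases h : S * S + C * C = 0
    · have h1 : S = 0 := by nlinarith [mul_self_nonneg S, mul_self_nonneg C]
      have h2 : C = 0 := by nlinarith [mul_self_nonneg S, mul_self_nonneg C]
      exact ⟨1, 0, by norm_num, by rw [h1, h2]; ring⟩
    · have hp : 0 < S * S + C * C := lt_of_le_of_ne (add_nonneg (mul_self_nonneg S) (mul_self_nonneg C)) (Ne.symm h)
      set r := Real.sqrt (S * S + C * C) with hr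
      have hr0 : 0 < r := Real.sqrt_pos.2 hp
      have hrr : r * r = S * S + C * C := Real.mul_self_sqrt hp.le
      refine ⟨C / r, -S / r, ?_, ?_⟩
      · field_simp; linarith
      · field_simp; ring
  obtain ⟨α, β, h1, h2⟩ := hex
  refine ⟨_, _, TP.mk' k α β h1, ?_⟩
  have i1 : Cl a b c (rid (fun t => Real.sin (k * t)) τ) := rid_Cl a b c (by fun_prop)
  have i2 : Cl a b c (rid (fun t => Real.cos (k * t)) τ) := rid_Cl a b c (by fun_prop)
  rw [← h2, hS, hC, ← MM_lin i1.int i2.int]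
  rfl

end

end

noncomputable section
open MeasureTheory Filter Topology

section
variable {a b c : E2} {lam μ : ℝ} {ψ φ : E2 → ℝ}

lemma Nod.MM_pos (hn : Nod a b c ψ φ) (hcr : cr (b - a) (c - a) ≠ 0) : 0 < MM a b c φ := by
  have hnn : 0 ≤ᵐ[volume.restrict (interior (Tri a b c))] φ := by
    filter_upwards [ae_restrict_mem isOpen_interior.measurableSet] with p hp
    exact hn.nn p (interior_subset hp)
  refine lt_of_le_of_ne (integral_nonneg_of_ae hnn) fun h0 => ?_
  have h1 := (integral_eq_zero_iff_of_nonneg_ae hnn (intOn_cont hn.cont)).1 h0.symm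
  have h2 : EqOn φ (fun _ => 0) (interior (Tri a b c)) :=
    Measure.eqOn_open_of_ae_eq h1 isOpen_interior (hn.cont.mono interior_subset) continuousOn_const
  have h3 : EqOn φ (fun _ => 0) (Tri a b c) :=
    h2.of_subset_closure hn.cont continuousOn_const interior_subset (closure_IT hcr).ge
  obtain ⟨x, hx, hpos⟩ := hn.pos
  have h4 : φ x = 0 := h3 hx
  linarith

lemma Nod.lam_pos (hn : Nod a b c ψ φ) (h : Psi a b c lam ψ) (hμ : 0 < μ)
    (H : ∀ f, Cl a b c f → MM a b c f = 0 → μ * BB a b c f f ≤ AA a b c f f) : 0 < lam := by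
  by_contra hneg
  obtain ⟨x, hx, hpos⟩ := hn.pos
  obtain ⟨f, W, hf, hfb, hW, hWb, hA⟩ := hn.trunc h (ε := φ x / 4) (by linarith)
  have hW0 : 0 ≤ ∫ p in interior (Tri a b c), W p :=
    setIntegral_nonneg isOpen_interior.measurableSet fun p hp => (hWb p (interior_subset hp)).1
  have hA0 : AA a b c f f = 0 := by
    refine le_antisymm ?_ (AA_nonneg a b c f)
    rw [hA]; exact mul_nonpos_of_nonpos_of_nonneg (not_lt.1 hneg) hW0
  obtain ⟨m, hm, hm0⟩ := center h.hcr hf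
  have h1 := H _ hm hm0
  rw [AA_lin hf (one_Cl a b c), hA0, AA_one, AA_one] at h1
  have hB : BB a b c (fun p => 1 * f p + m * 1) (fun p => 1 * f p + m * 1) = 0 := by
    have h2 := BB_nonneg a b c (fun p => 1 * f p + m * 1)
    refine le_antisymm ?_ h2
    by_contra h3
    have := mul_pos hμ (not_le.1 h3)
    linarith
  have h2 := BB_zero (hm.cont.mono interior_subset) (hm.mul_int hm) hB
  have h3 : EqOn (fun p => 1 * f p + m * 1) (fun _ => 0) (Tri a b c) :=
    EqOn.of_subset_closure h2 hm.cont continuousOn_const interior_subset (closure_IT h.hcr).ge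
  have hcT : c ∈ Tri a b c := subset_convexHull ℝ _ (by simp)
  have h4 : 1 * f x + m * 1 = 0 := h3 hx
  have h5 : 1 * f c + m * 1 = 0 := h3 hcT
  have h6 : ¬ 0 < φ c := fun h7 => by
    have := (hn.away c hcT h7).1
    rw [bar_right] at this; exact lt_irrefl _ this
  have h7 := hfb x hx
  have h8 := hfb c hcT
  linarith [h7.2.1, h8.1, h8.2.2]

theorem main_ineq (hn : Nod a b c ψ φ) (h : Psi a b c lam ψ) (hμ : 0 < μ)
    (H : ∀ f, Cl a b c f → MM a b c f = 0 → μ * BB a b c f f ≤ AA a b c f f) : μ < lam := by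
  by_contra hle
  have hl := hn.lam_pos h hμ H
  have hle' : lam ≤ μ := not_lt.1 hle
  set k := Real.sqrt lam with hk
  have hk0 : 0 < k := Real.sqrt_pos.2 hl
  have hk2 : k ^ 2 = lam := Real.sq_sqrt hl.le
  have H' : ∀ f, Cl a b c f → MM a b c f = 0 → lam * BB a b c f f ≤ AA a b c f f := fun f hf hm =>
    (mul_le_mul_of_nonneg_right hle' (BB_nonneg a b c f)).trans (H f hf hm)
  obtain ⟨τ, n, L, κ, hS⟩ := exists_SF h.hcr
  have hτ : dt τ τ = 1 := by
    have := hS.of.1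
    unfold dt; linarith
  obtain ⟨i, j, hT, hM⟩ := exists_TP a b c τ k
  have hst := hT.strict hS hk0 hτ (by rw [hk2]; exact H') hM
  have hAi := hT.AAi hτ a b c
  have hAj := hT.AAj hτ a b c
  have hJ : Cl a b c (rid j τ) := rid_Cl a b c hT.sj
  rw [hk2] at hst hAi hAj
  set BI := BB a b c (rid i τ) (rid i τ)
  set BJ := BB a b c (rid j τ) (rid j τ) with hBJ
  set MJ := MM a b c (rid j τ) with hMJ
  set δ := lam * BJ - lam * BI with hδ
  have hδ0 : 0 < δ := by linarith
  by_cases hJ0 : MJ = 0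
  · have := H' _ hJ hJ0
    linarith
  have hMφ := hn.MM_pos h.hcr
  set Mφ := MM a b c φ with hMφd
  have hV := vol_pos h.hcr
  set V := volume.real (interior (Tri a b c)) with hVd
  have hMJ2 : 0 < MJ ^ 2 := by positivity
  set ε := min (Mφ / (4 * V)) (Mφ * δ / (32 * lam * MJ ^ 2)) with hε
  have hε0 : 0 < ε := lt_min (by positivity) (by positivity)
  have hε1 : 2 * ε * V ≤ Mφ / 2 := by
    have : ε ≤ Mφ / (4 * V) := min_le_left _ _
    rw [le_div_iff₀ (by positivity)] at this
    linarith
  have hε2 : 32 * ε * lam * MJ ^ 2 ≤ Mφ * δ := by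
    have : ε ≤ Mφ * δ / (32 * lam * MJ ^ 2) := min_le_right _ _
    rw [le_div_iff₀ (by positivity)] at this
    linarith
  obtain ⟨f, W, hf, hfb, hW, hWb, hA⟩ := hn.trunc h hε0
  have hφz : ∀ p ∈ Tri a b c, (bar b c a p = 0 ∨ bar c a b p = 0) → f p = 0 := by
    intro p hp hb
    have h1 := hfb p hp
    by_contra hne
    have h2 : 0 < f p := lt_of_le_of_ne h1.1 (Ne.symm hne)
    have h3 := hn.away p hp (h2.trans_le h1.2.2)
    rcases hb with hb | hb <;> rw [hb] at h3
    · exact lt_irrefl _ h3.1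
    · exact lt_irrefl _ h3.2
  have hgj := hT.green_j hS hτ hf (fun p hp hb => hφz p hp (Or.inl hb)) (fun p hp hb => hφz p hp (Or.inr hb))
  rw [hk2] at hgj
  have hWi : ∫ p in interior (Tri a b c), W p ≤ BB a b c f f + 4 * ε * Mφ := by
    have e : BB a b c f f + 4 * ε * Mφ = MM a b c (fun p => 1 * (f p * f p) + 4 * ε * φ p) := by
      rw [MM_lin (hf.mul_int hf) (intOn_cont hn.cont), hMφd]
      unfold BB MM; ring
    rw [e]
    apply setIntegral_mono_on (intOn_cont hW) _ isOpen_interior.measurableSet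
    · intro p hp
      have := (hWb p (interior_subset hp)).2
      linarith
    · exact ((hf.mul_int hf).const_mul 1).add ((intOn_cont hn.cont).const_mul _)
  have hMf : Mφ / 2 ≤ MM a b c f := by
    have e : Mφ - 2 * ε * V = MM a b c (fun p => 1 * φ p + (-(2 * ε)) * 1) := by
      rw [MM_lin (intOn_cont hn.cont) (one_Cl a b c).int, MM_const]
      ring
    have h1 : MM a b c (fun p => 1 * φ p + (-(2 * ε)) * 1) ≤ MM a b c f := by
      apply setIntegral_mono_on _ hf.int isOpen_interior.measurableSet
      · intro p hp
        have := (hfb p (interior_subset hp)).2.1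
        linarith
      · exact ((intOn_cont hn.cont).const_mul 1).add ((one_Cl a b c).int.const_mul _)
    linarith
  set m := MM a b c f with hm
  set t := -(m / MJ) with ht
  have h1 := H' _ (hf.lin hJ 1 t) (by
    rw [MM_lin hf.int hJ.int, ← hm, ← hMJ, ht]; field_simp; ring)
  rw [AA_lin hf hJ, BB_lin hf hJ, hgj, hAj, hA] at h1
  have h2 : lam * ∫ p in interior (Tri a b c), W p ≤ lam * (BB a b c f f + 4 * ε * Mφ) :=
    mul_le_mul_of_nonneg_left hWi hl.le
  have h3 : t ^ 2 * δ ≤ 4 * ε * lam * Mφ := by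
    rw [hδ]; linarith
  have h4 : m ^ 2 * δ ≤ 4 * ε * lam * Mφ * MJ ^ 2 := by
    have e : m ^ 2 = t ^ 2 * MJ ^ 2 := by rw [ht]; field_simp
    rw [e]
    have := mul_le_mul_of_nonneg_right h3 hMJ2.le
    linarith
  have h5 : Mφ ^ 2 / 4 ≤ m ^ 2 := by nlinarith
  have h6 : Mφ ^ 2 / 4 * δ ≤ m ^ 2 * δ := mul_le_mul_of_nonneg_right h5 hδ0.le
  have h7 : 4 * ε * lam * Mφ * MJ ^ 2 ≤ Mφ ^ 2 * δ / 8 := by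
    have := mul_le_mul_of_nonneg_left hε2 hMφ.le
    nlinarith
  have h8 : 0 < Mφ ^ 2 * δ := by positivity
  linarith

/-- The main theorem for the side `[a,b]` of the triangle `a b c`. -/
theorem main_side (h : Psi a b c lam ψ) (hnz : ∃ z ∈ Tri a b c, ψ z ≠ 0) {γ : ℝ → E2}
    (hγc : ContinuousOn γ (Icc 0 1)) (hγT : ∀ t ∈ Icc (0:ℝ) 1, γ t ∈ Tri a b c)
    (hγ0 : γ 0 ∈ segment ℝ a b) (hγ1 : γ 1 ∈ segment ℝ a b) (hne : γ 0 ≠ γ 1)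
    (hγz : ∀ t ∈ Icc (0:ℝ) 1, ψ (γ t) = 0) (hμ : 0 < μ)
    (H : ∀ f, Cl a b c f → MM a b c f = 0 → μ * BB a b c f f ≤ AA a b c f f) : μ < lam := by
  have hseg : ∀ p ∈ segment ℝ a b, bar a b c p = 0 := by
    intro p hp
    rw [segment_eq_image'] at hp
    obtain ⟨t, _, rfl⟩ := hp
    exact seg_bar a b c t
  obtain ⟨ψ', φ, h', hn⟩ := h.exists_piece hnz hγc hγT (hseg _ hγ0) (hseg _ hγ1) hne hγz
  exact main_ineq hn h' hμ H

theorem main_perm {v₁ v₂ v₃ : E2} {A B : E2} (hcr : cr (v₂ - v₁) (v₃ - v₁) ≠ 0)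
    (hside : IsSide v₁ v₂ v₃ A B) {μ₂ : ℝ} (hμ : 0 < μ₂)
    (H : ∀ f, Cl v₁ v₂ v₃ f → MM v₁ v₂ v₃ f = 0 → μ₂ * BB v₁ v₂ v₃ f f ≤ AA v₁ v₂ v₃ f f)
    (hnz : ∃ z ∈ Tri v₁ v₂ v₃, ψ z ≠ 0)
    (hcont : ContinuousOn ψ (Tri v₁ v₂ v₃))
    (hsmooth : ContDiffOn ℝ (⊤ : ℕ∞) ψ (TriDom v₁ v₂ v₃))
    (heqn : ∀ p ∈ interior (Tri v₁ v₂ v₃), negLap ψ p = lam * ψ p)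
    (hneu : NeumannOn (TriDom v₁ v₂ v₃) A B ψ)
    (γ : ℝ → E2)
    (hγc : ContinuousOn γ (Set.Icc 0 1))
    (hγ0 : γ 0 ∈ segment ℝ A B) (hγ1 : γ 1 ∈ segment ℝ A B) (hγ01 : γ 0 ≠ γ 1)
    (hγT : ∀ t ∈ Set.Icc (0:ℝ) 1, γ t ∈ Tri v₁ v₂ v₃)
    (hγz : ∀ t ∈ Set.Icc (0:ℝ) 1, ψ (γ t) = 0) :
    μ₂ < lam := by
  have hlap : ∀ p ∈ interior (Tri v₁ v₂ v₃), lap ψ p = -lam * ψ p := fun p hp => by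
    have := heqn p hp
    rw [negLap_eq] at this; linarith
  rcases hside with ⟨rfl, rfl⟩ | ⟨rfl, rfl⟩ | ⟨rfl, rfl⟩
  · exact main_side ⟨hcr, hcont, hsmooth, hlap, hneu⟩ hnz hγc hγT hγ0 hγ1 hγ01 hγz hμ H
  · have e := Tri_perm v₁ A B
    have e' := TriDom_perm v₁ A B
    rw [← e] at hnz hcont hlap hγT
    rw [← e'] at hsmooth hneu
    refine main_side ⟨cr_perm hcr, hcont, hsmooth, hlap, hneu⟩ hnz hγc hγT hγ0 hγ1 hγ01 hγz hμ (fun f hf hm => ?_)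
    rw [AA_perm, BB_perm]
    rw [MM_perm] at hm
    exact H f hf.perm hm
  · have e : Tri B v₂ A = Tri A B v₂ := Tri_perm A B v₂
    have e' : TriDom B v₂ A = TriDom A B v₂ := TriDom_perm A B v₂
    rw [e] at hnz hcont hlap hγT
    rw [e'] at hsmooth hneu
    refine main_side ⟨cr_perm (cr_perm hcr), hcont, hsmooth, hlap, hneu⟩ hnz hγc hγT hγ0 hγ1 hγ01 hγz hμ (fun f hf hm => ?_)
    rw [← AA_perm, ← BB_perm]
    rw [← MM_perm] at hm
    exact H f hf.perm.perm hm

end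

end

/-- If an eigenfunction `ψ` on a triangle satisfies Neumann conditions along a side `e`
and its nodal set contains an injective arc with both (distinct) endpoints in `e`, then
its eigenvalue is strictly greater than the second Neumann eigenvalue of the
triangle. -/
theorem nodal_arc_with_endpoints_in_side
    (v₁ v₂ v₃ : E2) (hT : AffineIndependent ℝ ![v₁, v₂, v₃])
    (μ₂ : ℝ) (hμ₂ : IsLeast {μ : ℝ | ∃ u : E2 → ℝ, IsNeumannEigenfun v₁ v₂ v₃ μ u} μ₂)
    (a b : E2) (hside : IsSide v₁ v₂ v₃ a b)
    (ψ : E2 → ℝ) (lam : ℝ)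
    (hnz : ∃ z ∈ Tri v₁ v₂ v₃, ψ z ≠ 0)
    (hcont : ContinuousOn ψ (Tri v₁ v₂ v₃))
    (hsmooth : ContDiffOn ℝ (⊤ : ℕ∞) ψ (TriDom v₁ v₂ v₃))
    (heqn : ∀ p ∈ interior (Tri v₁ v₂ v₃), negLap ψ p = lam * ψ p)
    (hneu : NeumannOn (TriDom v₁ v₂ v₃) a b ψ)
    (γ : ℝ → E2)
    (hγc : ContinuousOn γ (Set.Icc 0 1)) (hγi : Set.InjOn γ (Set.Icc 0 1))
    (hγ0 : γ 0 ∈ segment ℝ a b) (hγ1 : γ 1 ∈ segment ℝ a b) (hγ01 : γ 0 ≠ γ 1)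
    (hγT : ∀ t ∈ Set.Icc (0:ℝ) 1, γ t ∈ Tri v₁ v₂ v₃)
    (hγz : ∀ t ∈ Set.Icc (0:ℝ) 1, ψ (γ t) = 0) :
    μ₂ < lam := by
  have hcr := cr_ne_of_affineIndependent hT
  obtain ⟨u, hu⟩ := hμ₂.1
  exact main_perm hcr hside hu.pos (mu_ineq hcr hμ₂) hnz hcont hsmooth heqn hneu γ hγc hγ0 hγ1 hγ01 hγT hγz

end
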